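/- For every n ≥ 7, the automorphism group of the commutator subgroup of the braid group B_n is isomorphic to the automorphism group of B_n itself: there is a group isomorphism MulAut ↥(commutator B_n) ≃* MulAut B_n. (Combined with Dyer–Grossman's theorem this recovers Orevkov's result that Aut [B_n,B_n] ≅ B_n/Z ⋊ ℤ/2ℤ.) -/

import Mathlib

/-- The braid relations on `n` strands, as elements of the free group on `Fin (n-1)`. -/
def braidRels (n : ℕ) : Set (FreeGroup (Fin (n - 1))) :=
  {r | ∃ i j : Fin (n - 1), 2 ≤ |(i : ℤ) - (j : ℤ)| ∧
      r = FreeGroup.of i * FreeGroup.of j * (FreeGroup.of j * FreeGroup.of i)⁻¹} ∪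
  {r | ∃ i j : Fin (n - 1), |(i : ℤ) - (j : ℤ)| = 1 ∧
      r = FreeGroup.of i * FreeGroup.of j * FreeGroup.of i *
        (FreeGroup.of j * FreeGroup.of i * FreeGroup.of j)⁻¹}

/-- The braid group on `n` strands. -/
abbrev B (n : ℕ) : Type := PresentedGroup (braidRels n)

/-- The standard generators of the braid group. -/
def σ {n : ℕ} (i : Fin (n - 1)) : B n := PresentedGroup.of i


namespace Braid
variable {n : ℕ}

/-- The generators of `B n` indexed by natural numbers, with value `1` out of range. -/
def s (i : ℕ) : B n := if h : i < n - 1 then σ ⟨i, h⟩ else 1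

lemma s_of_ge {i : ℕ} (h : n ≤ i + 1) : (s i : B n) = 1 := by
  unfold s; rw [dif_neg (by omega)]

lemma s_comm {i j : ℕ} (h : i + 2 ≤ j) : (s i : B n) * s j = s j * s i := by
  by_cases hj : j < n - 1
  · have hi : i < n - 1 := by omega
    unfold s; rw [dif_pos hi, dif_pos hj]
    rw [← mul_inv_eq_one]
    refine PresentedGroup.one_of_mem (rels := braidRels n)
      (x := FreeGroup.of ⟨i, hi⟩ * FreeGroup.of ⟨j, hj⟩ *
        (FreeGroup.of ⟨j, hj⟩ * FreeGroup.of ⟨i, hi⟩)⁻¹) (Or.inl ⟨⟨i, hi⟩, ⟨j, hj⟩, ?_, rfl⟩)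
    rw [abs_sub_comm]; refine le_trans ?_ (le_abs_self _); push_cast; omega
  · rw [s_of_ge (i := j) (by omega)]; simp

lemma s_comm' {i j : ℕ} (h : j + 2 ≤ i) : (s i : B n) * s j = s j * s i := (s_comm h).symm

lemma s_braid {i : ℕ} (h : i + 2 < n) :
    (s i : B n) * s (i + 1) * s i = s (i + 1) * s i * s (i + 1) := by
  have hi : i < n - 1 := by omega
  have hj : i + 1 < n - 1 := by omega
  unfold s; rw [dif_pos hi, dif_pos hj, ← mul_inv_eq_one]
  refine PresentedGroup.one_of_mem (rels := braidRels n)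
      (x := FreeGroup.of ⟨i, hi⟩ * FreeGroup.of ⟨i + 1, hj⟩ * FreeGroup.of ⟨i, hi⟩ *
        (FreeGroup.of ⟨i + 1, hj⟩ * FreeGroup.of ⟨i, hi⟩ * FreeGroup.of ⟨i + 1, hj⟩)⁻¹)
      (Or.inr ⟨⟨i, hi⟩, ⟨i + 1, hj⟩, ?_, rfl⟩)
  simp

/-- The universal property of `B n`. -/
def lift {G : Type*} [Group G] (g : ℕ → G)
    (h1 : ∀ i j, i + 2 ≤ j → j + 1 < n → g i * g j = g j * g i)
    (h2 : ∀ i, i + 2 < n → g i * g (i + 1) * g i = g (i + 1) * g i * g (i + 1)) : B n →* G :=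
  PresentedGroup.toGroup (rels := braidRels n) (f := fun i : Fin (n - 1) => g i) (by
    rintro r (⟨i, j, h, rfl⟩ | ⟨i, j, h, rfl⟩)
    · simp only [map_mul, map_inv, FreeGroup.lift_apply_of]
      rw [mul_inv_eq_one]
      rcases le_abs.mp h with h | h
      · exact (h1 j i (by omega) (by omega)).symm
      · exact h1 i j (by omega) (by omega)
    · simp only [map_mul, map_inv, FreeGroup.lift_apply_of]
      rw [mul_inv_eq_one]
      rcases eq_or_eq_neg_of_abs_eq h with h | h
      · have : (i : ℕ) = j + 1 := by omega
        rw [this]; exact (h2 j (by omega)).symm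
      · have : (j : ℕ) = i + 1 := by omega
        rw [this]; exact h2 i (by omega))

lemma lift_s {G : Type*} [Group G] (g : ℕ → G) (h1) (h2) {i : ℕ} (hi : i + 1 < n) :
    lift (n := n) g h1 h2 (s i) = g i := by
  unfold lift s; rw [dif_pos (by omega)]; exact PresentedGroup.toGroup.of (rels := braidRels n) (f := fun i : Fin (n - 1) => g i) _

lemma hom_ext {G : Type*} [Group G] {f g : B n →* G}
    (h : ∀ i, i + 1 < n → f (s i) = g (s i)) : f = g := by
  refine PresentedGroup.ext (rels := braidRels n) fun i => ?_
  have := h i (by omega)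
  unfold s at this; rw [dif_pos i.2] at this; exact this

/-- The subgroup generated by the first `k - 1` generators. -/
def Bk (n k : ℕ) : Subgroup (B n) := Subgroup.closure {x | ∃ i, i + 1 < k ∧ x = s i}

lemma Bk_top : Bk n n = ⊤ := by
  rw [eq_top_iff, ← PresentedGroup.closure_range_of]
  refine Subgroup.closure_mono ?_
  rintro _ ⟨i, rfl⟩
  refine ⟨i, by omega, ?_⟩
  unfold s; rw [dif_pos i.2]; rfl

lemma Bk_mono {k m : ℕ} (h : k ≤ m) : Bk n k ≤ Bk n m :=
  Subgroup.closure_mono (by rintro _ ⟨i, hi, rfl⟩; exact ⟨i, by omega, rfl⟩)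

lemma s_mem_Bk {i k : ℕ} (h : i + 1 < k) : s i ∈ Bk n k := Subgroup.subset_closure ⟨i, h, rfl⟩

lemma mem_Bk (β : B n) : β ∈ Bk n n := by rw [Bk_top]; trivial

@[elab_as_elim]
lemma induct {p : B n → Prop} (one : p 1) (s_mul : ∀ i β, i + 1 < n → p β → p (s i * β))
    (inv_mul : ∀ i β, i + 1 < n → p β → p ((s i)⁻¹ * β)) (β : B n) : p β := by
  have h := mem_Bk β
  unfold Bk at h
  induction h using Subgroup.closure_induction_left with
  | one => exact one
  | mul_left x hx y _ ih => obtain ⟨i, hi, rfl⟩ := hx; exact s_mul i _ hi ih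
  | inv_mul_cancel x hx y _ ih => obtain ⟨i, hi, rfl⟩ := hx; exact inv_mul i _ hi ih

/-- The exponent sum. -/
def expo : B n →* Multiplicative ℤ :=
  lift (fun _ => Multiplicative.ofAdd 1) (fun _ _ _ _ => rfl) (fun _ _ => rfl)

lemma expo_s {i : ℕ} (hi : i + 1 < n) : expo (s i : B n) = Multiplicative.ofAdd 1 :=
  lift_s _ _ _ hi

lemma commutator_eq : commutator (B n) = expo.ker := by
  apply le_antisymm
  · exact Abelianization.commutator_subset_ker _
  · intro β hβ
    have key : ∀ i, i + 1 < n → Abelianization.of (s i : B n) = Abelianization.of (s 0 : B n) := by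
      intro i
      induction i with
      | zero => intro _; rfl
      | succ i ih =>
        intro hi
        rw [← ih (by omega)]
        have := congrArg Abelianization.of (s_braid (n := n) (i := i) (by omega))
        simp only [map_mul] at this
        rw [mul_comm (Abelianization.of (s (i + 1) : B n)) (Abelianization.of (s i))] at this
        exact (mul_left_cancel this).symm
    have h2 : (Abelianization.of : B n →* _) =
        (zpowersHom _ (Abelianization.of (s 0 : B n))).comp expo := by
      apply hom_ext
      intro i hi
      simp [expo_s hi, key i hi]
    have h3 : Abelianization.of β = 1 := by
      rw [h2]; simp [MonoidHom.mem_ker.mp hβ]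
    exact (Abelianization.ker_of (B n)) ▸ (MonoidHom.mem_ker.mpr h3)

open Equiv


/-- The permutation of the strands. -/
def perm : B n →* Perm ℕ :=
  lift (fun i => swap i (i + 1)) (fun i j h _ => by
    apply Perm.Disjoint.commute
    rw [Perm.disjoint_iff_eq_or_eq]
    intro x
    simp only [swap_apply_def]
    grind) (fun i _ => by
    ext x
    simp only [Perm.mul_apply, swap_apply_def]
    grind)

lemma perm_s {i : ℕ} (hi : i + 1 < n) : perm (s i : B n) = swap i (i + 1) := lift_s _ _ _ hi

end Braid

namespace Braid
variable {n : ℕ}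

/-- The free group on countably many letters. -/
abbrev F := FreeGroup ℕ

/-- The letters of `F`. -/
abbrev y (i : ℕ) : F := FreeGroup.of i

def artFwd (i : ℕ) : F →* F := FreeGroup.lift fun m =>
  if m = i then y (i + 1) else if m = i + 1 then (y (i + 1))⁻¹ * y i * y (i + 1) else y m

def artBwd (i : ℕ) : F →* F := FreeGroup.lift fun m =>
  if m = i then y i * y (i + 1) * (y i)⁻¹ else if m = i + 1 then y i else y m

/-- The automorphism of `F` induced by a generator of the braid group. -/
def artGen (i : ℕ) : MulAut F :=
  MonoidHom.toMulEquiv (artFwd i) (artBwd i)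
    (by ext m; by_cases h : m = i <;> by_cases h' : m = i + 1 <;>
          simp_all [artFwd, artBwd, mul_assoc])
    (by ext m; by_cases h : m = i <;> by_cases h' : m = i + 1 <;>
          simp_all [artFwd, artBwd, mul_assoc])

lemma artGen_self (i : ℕ) : artGen i (y i) = y (i + 1) := by
  simp [artGen, artFwd]

lemma artGen_succ (i : ℕ) : artGen i (y (i + 1)) = (y (i + 1))⁻¹ * y i * y (i + 1) := by
  simp [artGen, artFwd]

lemma artGen_ne {i m : ℕ} (h : m ≠ i) (h' : m ≠ i + 1) : artGen i (y m) = y m := by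
  simp [artGen, artFwd, h, h']

lemma mulAut_ext {f g : MulAut F} (h : ∀ i, f (y i) = g (y i)) : f = g := by
  apply MulEquiv.toMonoidHom_injective
  ext i
  exact h i

/-- The Artin representation. -/
def art : B n →* MulAut F :=
  lift artGen (fun i j h _ => mulAut_ext fun m => by
      simp only [MulAut.mul_apply]
      by_cases h1 : m = i
      · subst h1; rw [artGen_ne (i := j) (by omega) (by omega), artGen_self,
          artGen_ne (by omega) (by omega)]
      by_cases h2 : m = i + 1
      · subst h2; rw [artGen_ne (i := j) (by omega) (by omega), artGen_succ]
        simp only [map_mul, map_inv]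
        rw [artGen_ne (by omega) (by omega), artGen_ne (by omega) (by omega)]
      rw [artGen_ne (i := i) h1 h2]
      by_cases h3 : m = j
      · subst h3; rw [artGen_self, artGen_ne (by omega) (by omega)]
      by_cases h4 : m = j + 1
      · subst h4; rw [artGen_succ]
        simp only [map_mul, map_inv]
        rw [artGen_ne (by omega) (by omega), artGen_ne (by omega) (by omega)]
      rw [artGen_ne h3 h4, artGen_ne h1 h2])
    (fun i _ => mulAut_ext fun m => by
      simp only [MulAut.mul_apply]
      by_cases h1 : m = i
      · subst h1
        rw [artGen_self, artGen_self, artGen_ne (i := m + 1) (by omega) (by omega), artGen_self,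
          artGen_self, artGen_ne (by omega) (by omega)]
      by_cases h2 : m = i + 1
      · subst h2
        rw [artGen_self, artGen_succ, artGen_ne (i := i) (by omega) (by omega), artGen_succ]
        simp only [map_mul, map_inv, artGen_self]
        rw [artGen_ne (i := i + 1) (m := i) (by omega) (by omega)]
        simp only [artGen_self]
        rw [artGen_ne (i := i) (m := i + 1 + 1) (by omega) (by omega)]
      by_cases h3 : m = i + 2
      · subst h3
        rw [artGen_ne (i := i) (by omega) (by omega)]
        rw [artGen_succ (i + 1)]
        simp only [map_mul, map_inv, artGen_succ, artGen_self]
        rw [artGen_ne (i := i) (m := i + 1 + 1) (by omega) (by omega)]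
        simp only [artGen_succ]
        rw [artGen_ne (i := i + 1) (m := i) (by omega) (by omega)]
        simp only [mul_assoc]; group
      rw [artGen_ne (i := i) h1 h2, artGen_ne (i := i + 1) h2 h3, artGen_ne (i := i) h1 h2,
        artGen_ne (i := i + 1) h2 h3])

lemma art_s {i : ℕ} (hi : i + 1 < n) : art (s i : B n) = artGen i := lift_s _ _ _ hi

section group
variable {G : Type*} [Group G] {a b c : G}

lemma braid_conj_sq (h : a * b * a = b * a * b) : a * (b * a ^ 2 * b⁻¹) * a⁻¹ = b ^ 2 := by
  rw [mul_inv_eq_iff_eq_mul, ← mul_assoc, mul_inv_eq_iff_eq_mul]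
  calc a * (b * a ^ 2) = (a * b * a) * a := by simp only [pow_two, mul_assoc]
    _ = b * (a * b * a) := by rw [h]; simp only [mul_assoc]; rw [← mul_assoc a b a, h]; simp only [mul_assoc]
    _ = b ^ 2 * a * b := by rw [h]; simp only [pow_two, mul_assoc]

lemma braid_conj (h : a * b * a = b * a * b) : a * b * a⁻¹ = b⁻¹ * a * b := by
  rw [mul_inv_eq_iff_eq_mul, mul_assoc, mul_assoc, eq_inv_mul_iff_mul_eq]
  simpa only [mul_assoc] using h.symm

end group

/-- The standard generators of the pure braid group; trivial for `k ≤ j`. -/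
def A (j : ℕ) : ℕ → B n
  | 0 => 1
  | k + 1 => if j = k then s k ^ 2 else s k * A j k * (s k)⁻¹

lemma A_self (k : ℕ) : (A k (k + 1) : B n) = s k ^ 2 := by simp [A]

lemma A_succ {j k : ℕ} (h : j ≠ k) : (A j (k + 1) : B n) = s k * A j k * (s k)⁻¹ := by
  simp [A, h]

lemma A_of_ge {j k : ℕ} (h : k ≤ j) : (A j k : B n) = 1 := by
  induction k with
  | zero => rfl
  | succ k ih => rw [A_succ (by omega), ih (by omega)]; simp

lemma A_mem_Bk {j k m : ℕ} (h : k < m) : A j k ∈ Bk n m := by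
  induction k with
  | zero => exact one_mem _
  | succ k ih =>
    have := s_mem_Bk (n := n) (i := k) (k := m) (by omega)
    unfold A; split_ifs
    · exact pow_mem this 2
    · exact mul_mem (mul_mem this (ih (by omega))) (inv_mem this)

lemma commute_s_Bk {m k : ℕ} (h : k ≤ m) {β : B n} (hβ : β ∈ Bk n k) : Commute (s m) β := by
  induction hβ using Subgroup.closure_induction with
  | mem x hx => obtain ⟨i, hi, rfl⟩ := hx; exact s_comm' (by omega)
  | one => exact Commute.one_right _
  | mul x y _ _ hx hy => exact hx.mul_right hy
  | inv x _ hx => exact hx.inv_right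

lemma commute_s_A {m j k : ℕ} (h : k < m) : Commute (s m : B n) (A j k) :=
  commute_s_Bk h (A_mem_Bk (by omega))

lemma s_A_self {i k : ℕ} (h : i + 1 < k) (hk : k < n) :
    (s i : B n) * A i k * (s i)⁻¹ = A (i + 1) k := by
  induction k, h using Nat.le_induction with
  | base =>
    rw [A_self, A_succ (by omega), A_self]
    exact braid_conj_sq (s_braid hk)
  | succ k hle ih =>
    rw [A_succ (by omega), A_succ (by omega), ← ih (by omega)]
    have : (s i : B n) * s k = s k * s i := s_comm (by omega)
    have h2 : (s k : B n)⁻¹ * (s i)⁻¹ = (s i)⁻¹ * (s k)⁻¹ := by rw [← mul_inv_rev, this, mul_inv_rev]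
    simp only [← mul_assoc, this]
    simp only [mul_assoc, h2]

lemma s_A_succ {i k : ℕ} (h : i + 1 < k) (hk : k < n) :
    (s i : B n) * A (i + 1) k * (s i)⁻¹ = (A (i + 1) k)⁻¹ * A i k * A (i + 1) k := by
  induction k, h using Nat.le_induction with
  | base =>
    rw [A_self, A_succ (by omega), A_self]
    have h := braid_conj (s_braid (n := n) (i := i) hk)
    calc _ = ((s i : B n) * s (i + 1) * (s i)⁻¹) ^ 2 := by simp [conj_pow]
      _ = _ := by rw [h]; simp only [pow_two]; group
  | succ k hle ih =>
    rw [A_succ (by omega), A_succ (by omega)]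
    have : (s i : B n) * s k = s k * s i := s_comm (by omega)
    have h2 : (s k : B n)⁻¹ * (s i)⁻¹ = (s i)⁻¹ * (s k)⁻¹ := by rw [← mul_inv_rev, this, mul_inv_rev]
    have h3 : s i * (s k * A (i + 1) k * (s k)⁻¹) * (s i)⁻¹ =
        s k * (s i * A (i + 1) k * (s i)⁻¹) * (s k : B n)⁻¹ := by
      simp only [← mul_assoc, this]
      simp only [mul_assoc, h2]
    rw [h3, ih (by omega)]; group

lemma s_A_ne {i j k : ℕ} (h : i + 1 < k) (hk : k < n) (h1 : j ≠ i) (h2 : j ≠ i + 1) :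
    Commute (s i : B n) (A j k) := by
  induction k, h using Nat.le_induction with
  | base =>
    by_cases hj : i + 2 ≤ j
    · rw [A_of_ge hj]; exact Commute.one_right _
    rw [A_succ (by omega), A_succ (by omega)]
    have hc : (s (i + 1) : B n) * A j i = A j i * s (i + 1) := commute_s_A (by omega)
    have hb := s_braid (n := n) (i := i) hk
    rw [Commute, SemiconjBy, ← mul_inv_eq_iff_eq_mul]
    calc _ = (s i * s (i + 1) * s i) * A j i * (s i * s (i + 1) * s i : B n)⁻¹ := by group
      _ = s (i + 1) * s i * (s (i + 1) * A j i * (s (i + 1))⁻¹) * (s (i + 1) * s i : B n)⁻¹ := by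
        rw [hb]; group
      _ = _ := by rw [hc]; group
  | succ k hle ih =>
    have hik : Commute (s i : B n) (s k) := s_comm (by omega)
    unfold A; split_ifs
    · exact hik.pow_right 2
    · exact (hik.mul_right (ih (by omega))).mul_right hik.inv_right

/-- The free group generated by the pure braids moving strand `k` around the previous ones. -/
def ι (k : ℕ) : F →* B n := FreeGroup.lift fun j => A j k

@[simp] lemma ι_y (k j : ℕ) : ι k (y j) = (A j k : B n) := by simp [ι]

lemma s_ι {i k : ℕ} (h : i + 1 < k) (hk : k < n) (x : F) :
    (s i : B n) * ι k x * (s i)⁻¹ = ι k (art (s i : B n) x) := by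
  have : (MulAut.conj (s i : B n)).toMonoidHom.comp (ι k) =
      (ι k).comp (art (s i : B n)).toMonoidHom := by
    ext j
    simp only [MonoidHom.comp_apply, MulEquiv.coe_toMonoidHom, MulAut.conj_apply]
    rw [art_s (by omega), ι_y]
    by_cases h1 : j = i
    · subst h1; rw [artGen_self, s_A_self h hk, ι_y]
    by_cases h2 : j = i + 1
    · subst h2; rw [artGen_succ, s_A_succ h hk]; simp
    rw [artGen_ne h1 h2, ι_y, (s_A_ne h hk h1 h2).eq]; simp
  exact DFunLike.congr_fun this x

lemma conj_ι {k : ℕ} (hk : k < n) {b : B n} (hb : b ∈ Bk n k) (x : F) :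
    b * ι k x * b⁻¹ = ι k (art b x) := by
  induction hb using Subgroup.closure_induction generalizing x with
  | mem b hb => obtain ⟨i, hi, rfl⟩ := hb; exact s_ι hi hk x
  | one => simp
  | mul a b _ _ ha hb =>
    rw [map_mul, MulAut.mul_apply, ← ha, ← hb]; group
  | inv b _ hb =>
    have := hb (art b⁻¹ x)
    rw [← MulAut.mul_apply, ← map_mul] at this
    simp only [mul_inv_cancel, map_one, MulAut.one_apply] at this
    rw [← this]; group

lemma ι_mem_Bk {k m : ℕ} (h : k < m) (x : F) : ι k x ∈ Bk n m := by
  induction x using FreeGroup.induction_on with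
  | C1 => simp
  | of j => rw [ι_y]; exact A_mem_Bk h
  | inv_of j _ => rw [map_inv, ι_y]; exact inv_mem (A_mem_Bk h)
  | mul x y hx hy => rw [map_mul]; exact mul_mem hx hy

end Braid

namespace Braid

section Keep
variable {L : Type*}

open Classical in
/-- The retraction of a free group killing the letters outside `p`. -/
noncomputable def keep (p : L → Prop) : FreeGroup L →* FreeGroup L :=
  FreeGroup.lift fun l => if p l then FreeGroup.of l else 1

lemma keep_of {p : L → Prop} {l : L} (h : p l) : keep p (FreeGroup.of l) = FreeGroup.of l := by
  simp [keep, h]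

lemma keep_of_not {p : L → Prop} {l : L} (h : ¬ p l) : keep p (FreeGroup.of l) = 1 := by
  simp [keep, h]

lemma keep_keep (p q : L → Prop) (w : FreeGroup L) :
    keep p (keep q w) = keep (fun l => p l ∧ q l) w := by
  rw [← MonoidHom.comp_apply]
  congr 1
  ext l
  by_cases hp : p l <;> by_cases hq : q l <;> simp [keep, hp, hq]

lemma keep_congr {p q : L → Prop} (h : ∀ l, p l ↔ q l) (w : FreeGroup L) :
    keep p w = keep q w := by
  rw [show p = q from funext fun l => propext (h l)]

lemma keep_of_imp {p q : L → Prop} (h : ∀ l, p l → q l) {w : FreeGroup L} (hw : keep p w = w) :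
    keep q w = w := by
  rw [← hw, keep_keep]
  exact keep_congr (fun l => ⟨fun h => h.2, fun h' => ⟨h l h', h'⟩⟩) w

lemma exists_support (w : FreeGroup L) : ∃ S : Finset L, keep (· ∈ S) w = w := by
  classical
  induction w using FreeGroup.induction_on with
  | C1 => exact ⟨∅, map_one _⟩
  | of l => exact ⟨{l}, keep_of (by simp)⟩
  | inv_of l _ => exact ⟨{l}, by rw [map_inv, keep_of (by simp)]⟩
  | mul x y hx hy =>
    obtain ⟨S, hS⟩ := hx
    obtain ⟨T, hT⟩ := hy
    refine ⟨S ∪ T, ?_⟩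
    rw [map_mul, keep_of_imp (by simp_all) hS, keep_of_imp (by simp_all) hT]

lemma exists_iterate (f : L → L) (hf : Function.Injective f) (S : Finset L) :
    ∃ r, 0 < r ∧ ∀ l ∈ S, f^[r] l ∈ S → f^[r] l = l := by
  classical
  let per : L → ℕ := fun l => if l ∈ Function.periodicPts f then Function.minimalPeriod f l else 1
  have hper : ∀ l, 0 < per l := fun l => by
    dsimp only [per]; split_ifs with h
    · exact Function.minimalPeriod_pos_of_mem_periodicPts h
    · exact one_pos
  let P := ∏ l ∈ S, per l
  have hP : 0 < P := Finset.prod_pos fun l _ => hper l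
  have hfin : (⋃ l ∈ {l ∈ S | l ∉ Function.periodicPts f}, {t : ℕ | f^[P * t] l ∈ S}).Finite := by
    refine Set.Finite.biUnion (Finset.finite_toSet {l ∈ S | l ∉ Function.periodicPts f}) ?_
    intro l hl
    have hl2 := (Finset.mem_filter.mp hl).2
    refine Set.Finite.preimage (f := fun t => f^[P * t] l) ?_ (Finset.finite_toSet S)
    have key : ∀ a b : ℕ, a < b → f^[P * a] l ≠ f^[P * b] l := by
      intro a b hab h
      obtain ⟨c, rfl⟩ := Nat.exists_eq_add_of_lt hab
      rw [show P * (a + c + 1) = P * a + P * (c + 1) by ring, Function.iterate_add_apply] at h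
      refine hl2 ⟨P * (c + 1), by positivity, ((hf.iterate _) h).symm⟩
    intro a _ b _ h
    rcases lt_trichotomy a b with hab | hab | hab
    · exact absurd h (key a b hab)
    · exact hab
    · exact absurd h.symm (key b a hab)
  obtain ⟨t, ht⟩ := (hfin.union (Set.finite_singleton 0)).infinite_compl.nonempty
  simp only [Set.mem_compl_iff, Set.mem_union, Set.mem_iUnion, not_or, not_exists,
    Set.mem_singleton_iff] at ht
  refine ⟨P * t, Nat.mul_pos hP (Nat.pos_of_ne_zero ht.2), fun l hl h => ?_⟩
  by_cases hp : l ∈ Function.periodicPts f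
  · have : Function.IsPeriodicPt f (P * t) l := by
      refine Function.IsPeriodicPt.mul_const ?_ t
      have h1 : Function.minimalPeriod f l ∣ P := by
        have := Finset.dvd_prod_of_mem per hl
        simpa [per, hp] using this
      exact Function.isPeriodicPt_iff_minimalPeriod_dvd.mpr h1
    exact this
  · exact absurd h (ht.1 l (Finset.mem_filter.mpr ⟨hl, hp⟩))

lemma keep_map {S : Finset L} {g : L → L} (h : ∀ l ∈ S, g l ∈ S → g l = l) {w : FreeGroup L}
    (hw : keep (· ∈ S) w = w) :
    keep (· ∈ S) (FreeGroup.map g w) = keep (fun l => l ∈ S ∧ g l = l) w := by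
  have : (keep (· ∈ S)).comp ((FreeGroup.map g).comp (keep (· ∈ S))) =
      keep (fun l => l ∈ S ∧ g l = l) := by
    ext l
    by_cases h1 : l ∈ S <;> by_cases h2 : g l ∈ S
    · have h3 := h l h1 h2
      simp [keep, h1, h3]
    · have : g l ≠ l := by intro h; rw [h] at h2; exact h2 h1
      simp [keep, h1, h2, this]
    · simp [keep, h1]
    · simp [keep, h1]
  rw [← this, MonoidHom.comp_apply, MonoidHom.comp_apply, hw]

lemma isConj_map_iterate {f : L → L} {w : FreeGroup L} (h : IsConj (FreeGroup.map f w) w) (r : ℕ) :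
    IsConj (FreeGroup.map (f^[r]) w) w := by
  induction r with
  | zero => simp only [Function.iterate_zero, FreeGroup.map.id]; exact IsConj.refl _
  | succ r ih =>
    have := (FreeGroup.map f).map_isConj ih
    rw [FreeGroup.map.comp, ← Function.iterate_succ'] at this
    exact this.trans h

lemma map_iterate {f : L → L} {w : FreeGroup L} (h : FreeGroup.map f w = w) (r : ℕ) :
    FreeGroup.map (f^[r]) w = w := by
  induction r with
  | zero => simp
  | succ r ih =>
    rw [Function.iterate_succ', ← FreeGroup.map.comp, ih, h]

/-- An element conjugate to its image under an injective relabelling is conjugate to an element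
involving periodic letters only. -/
lemma isConj_keep_periodic {f : L → L} (hf : Function.Injective f) {w : FreeGroup L}
    (h : IsConj (FreeGroup.map f w) w) :
    IsConj (keep (fun l => ∃ r, 0 < r ∧ f^[r] l = l) w) w := by
  obtain ⟨S, hS⟩ := exists_support w
  obtain ⟨r, hr, h2⟩ := exists_iterate f hf S
  have h3 := (keep (· ∈ S)).map_isConj (isConj_map_iterate h r)
  rw [hS, keep_map h2 hS] at h3
  have h4 := (keep (fun l => ∃ r, 0 < r ∧ f^[r] l = l)).map_isConj h3
  rw [keep_keep] at h4
  refine h4.symm.trans ?_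
  rwa [keep_congr (q := fun l => l ∈ S ∧ f^[r] l = l)]
  exact fun l => ⟨fun h => h.2, fun h => ⟨⟨r, hr, h.2⟩, h⟩⟩

lemma keep_periodic {f : L → L} (hf : Function.Injective f) {w : FreeGroup L}
    (h : FreeGroup.map f w = w) :
    keep (fun l => ∃ r, 0 < r ∧ f^[r] l = l) w = w := by
  obtain ⟨S, hS⟩ := exists_support w
  obtain ⟨r, hr, h2⟩ := exists_iterate f hf S
  have h3 := congrArg (keep (· ∈ S)) (map_iterate h r)
  rw [hS, keep_map h2 hS] at h3
  exact keep_of_imp (fun l hl => ⟨r, hr, hl.2⟩) h3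

lemma map_mem_closure_of_keep {G : Type*} [Group G] {p : L → Prop} {w : FreeGroup L}
    (hw : keep p w = w) (f : FreeGroup L →* G) (H : Subgroup G)
    (h : ∀ l, p l → f (FreeGroup.of l) ∈ H) : f w ∈ H := by
  rw [← hw]
  clear hw
  induction w using FreeGroup.induction_on with
  | C1 => simp
  | of l =>
    by_cases hp : p l
    · rw [keep_of hp]; exact h l hp
    · rw [keep_of_not hp, map_one]; exact one_mem _
  | inv_of l ih => rw [map_inv, map_inv]; exact inv_mem ih
  | mul x y hx hy => rw [map_mul, map_mul]; exact mul_mem hx hy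

end Keep

section Kurosh

/-- The translation action of `F` on the free group on the set `F`. -/
def trans : F →* MulAut (FreeGroup F) where
  toFun a := FreeGroup.freeGroupCongr (Equiv.mulLeft a)
  map_one' := by ext; simp
  map_mul' a b := by
    apply MulEquiv.toMonoidHom_injective
    ext l
    simp [mul_assoc]

lemma trans_apply (a : F) (w : FreeGroup F) : trans a w = FreeGroup.map (a * ·) w := rfl

/-- The decomposition of `F` as a semidirect product of the normal closure of the letter `b` and
the free group on the other letters. -/
def theta (b : ℕ) : F →* FreeGroup F ⋊[trans] F := FreeGroup.lift fun j =>
  if j = b then SemidirectProduct.inl (FreeGroup.of 1) else SemidirectProduct.inr (y j)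

/-- The part of an element in the normal closure of the letter `b`. -/
def W (b : ℕ) (e : F) : FreeGroup F := (theta b e).left

/-- The homomorphism giving back the normal closure of `b`. -/
def W' (b : ℕ) : FreeGroup F →* F := FreeGroup.lift fun g => g * y b * g⁻¹

lemma W'_of (b : ℕ) (g : F) : W' b (FreeGroup.of g) = g * y b * g⁻¹ := by simp [W']

/-- The retraction killing `b`. -/
noncomputable abbrev kill (b : ℕ) : F →* F := keep (· ≠ b)

lemma theta_right (b : ℕ) (e : F) : (theta b e).right = kill b e := by
  have : (SemidirectProduct.rightHom).comp (theta b) = kill b := by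
    ext j
    by_cases h : j = b <;> simp [theta, keep, h]
  rw [← this]; rfl

lemma W_one (b : ℕ) : W b 1 = 1 := by simp [W]

lemma W_mul (b : ℕ) (e f : F) : W b (e * f) = W b e * trans (kill b e) (W b f) := by
  simp [W, ← theta_right]

lemma W_inv (b : ℕ) (e : F) : W b e⁻¹ = trans (kill b e)⁻¹ (W b e)⁻¹ := by
  simp [W, ← theta_right]

lemma W_self (b : ℕ) : W b (y b) = FreeGroup.of 1 := by simp [W, theta]

lemma W_ne {b j : ℕ} (h : j ≠ b) : W b (y j) = 1 := by simp [W, theta, h]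

lemma W'_trans (b : ℕ) (a : F) (w : FreeGroup F) : W' b (trans a w) = a * W' b w * a⁻¹ := by
  have : (W' b).comp (trans a).toMonoidHom = (MulAut.conj a).toMonoidHom.comp (W' b) := by
    ext g
    simp [trans_apply, W'_of, mul_assoc]
  exact DFunLike.congr_fun this w

lemma W'_W (b : ℕ) (e : F) : W' b (W b e) * kill b e = e := by
  induction e using FreeGroup.induction_on with
  | C1 => simp [W_one]
  | of j =>
    by_cases h : j = b
    · subst h; rw [W_self, W'_of]; simp [keep]
    · rw [W_ne h]; simp [keep, h]
  | inv_of j _ =>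
    by_cases h : j = b
    · subst h; rw [W_inv, W'_trans, W_self, map_inv, W'_of]; simp [keep]
    · rw [W_inv, W'_trans, W_ne h]; simp [keep, h]
  | mul x z hx hz =>
    rw [W_mul, map_mul, map_mul, W'_trans]
    conv_rhs => rw [← hx, ← hz]
    group

lemma W_kill {b : ℕ} {c : F} (hc : kill b c = c) : W b c = 1 := by
  rw [← hc]
  clear hc
  induction c using FreeGroup.induction_on with
  | C1 => simp [W_one]
  | of j =>
    by_cases h : j = b
    · rw [keep_of_not (by simpa using h), W_one]
    · rw [keep_of (by simpa using h), W_ne h]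
  | inv_of j ih => rw [map_inv, W_inv, ih]; simp
  | mul x z hx hz => rw [map_mul, W_mul, hx, hz]; simp

/-- The homomorphism fixing `y b` and conjugating the other letters by `c`. -/
def tw (b : ℕ) (c : F) : F →* F := FreeGroup.lift fun j => if j = b then y b else c * y j * c⁻¹

lemma tw_self (b : ℕ) (c : F) : tw b c (y b) = y b := by simp [tw]

lemma tw_ne {b j : ℕ} (c : F) (h : j ≠ b) : tw b c (y j) = c * y j * c⁻¹ := by simp [tw, h]

lemma kill_tw {b : ℕ} {c : F} (hc : kill b c = c) (e : F) :
    kill b (tw b c e) = c * kill b e * c⁻¹ := by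
  have : (kill b).comp (tw b c) = (MulAut.conj c).toMonoidHom.comp (kill b) := by
    ext j
    by_cases h : j = b
    · subst h; simp [tw, keep]
    · simp only [MonoidHom.comp_apply, tw_ne c h, map_mul, map_inv, hc]; rfl
  exact DFunLike.congr_fun this e

lemma W_tw {b : ℕ} {c : F} (hc : kill b c = c) (e : F) :
    W b (tw b c e) = FreeGroup.map (fun g => c * g * c⁻¹) (W b e) := by
  have h0 : ∀ j, W b (tw b c (y j)) = FreeGroup.map (fun g => c * g * c⁻¹) (W b (y j)) := by
    intro j
    by_cases h : j = b
    · subst h; rw [tw_self, W_self]; simp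
    · rw [tw_ne c h, W_ne h, W_mul, W_mul, W_inv, W_kill hc, W_ne h]; simp
  have h1 : ∀ (a : F) (w : FreeGroup F), FreeGroup.map (fun g => c * g * c⁻¹) (trans a w) =
      trans (c * a * c⁻¹) (FreeGroup.map (fun g => c * g * c⁻¹) w) := by
    intro a w
    rw [trans_apply, trans_apply, FreeGroup.map.comp, FreeGroup.map.comp]
    congr 2
    ext g
    simp [mul_assoc]
  induction e using FreeGroup.induction_on with
  | C1 => simp [W_one]
  | of j => exact h0 j
  | inv_of j ih =>
    have : (c * kill b (FreeGroup.of j) * c⁻¹)⁻¹ = c * (kill b (FreeGroup.of j))⁻¹ * c⁻¹ := by group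
    rw [map_inv, W_inv, W_inv, h1, ih, kill_tw hc, this, map_inv (FreeGroup.map _)]
  | mul x z hx hz =>
    rw [map_mul, W_mul, W_mul, map_mul, hx, hz, h1, kill_tw hc]

lemma zpow_inj {c : F} (hc : c ≠ 1) {m : ℤ} (h : c ^ m = 1) : m = 0 := by
  by_contra hm
  exact hc ((IsMulTorsionFree.zpow_eq_one_iff_left hm).mp h)

lemma eq_kill_of_commute {b : ℕ} {c g : F} (hc : kill b c = c) (hc1 : c ≠ 1) (h : Commute c g) :
    kill b g = g := by
  have h2 : W b (c * g) = W b (g * c) := by rw [h.eq]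
  rw [W_mul, W_mul, W_kill hc, hc, map_one, mul_one, one_mul, trans_apply] at h2
  have h3 := keep_periodic (mul_right_injective c) h2
  have h4 : W b g = 1 := by
    rw [← h3]
    have := map_mem_closure_of_keep h3 (MonoidHom.id _) ⊥ (by
      rintro l ⟨r, hr, hl⟩
      rw [mul_left_iterate] at hl
      simp only [mul_eq_right] at hl
      exact absurd (zpow_inj hc1 (m := r) (by simpa using hl)) (by omega))
    rw [h3]; simpa using this
  have h5 := W'_W b g
  rw [h4] at h5
  simpa using h5

lemma keep_of_commute {p : ℕ → Prop} {c g : F} (hc : keep p c = c) (hc1 : c ≠ 1)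
    (h : Commute c g) : keep p g = g := by
  classical
  obtain ⟨S, hS⟩ := exists_support g
  have h1 : ∀ T : Finset ℕ, (∀ t ∈ T, ¬ p t) → keep (· ∉ T) g = g := by
    intro T
    induction T using Finset.induction_on with
    | empty => intro _; exact keep_of_imp (by simp) hS
    | insert t T ht ih =>
      intro hT
      have h2 := ih fun t ht => hT t (by simp [ht])
      have h3 : kill t g = g := eq_kill_of_commute
        (keep_of_imp (fun l hl => by rintro rfl; exact hT l (by simp) hl) hc) hc1 h
      rw [← h3, keep_keep] at h2
      refine keep_of_imp ?_ (h2.trans h3)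
      grind
  have h2 := h1 (S.filter (¬ p ·)) (by simp)
  rw [← hS, keep_keep] at h2
  refine keep_of_imp (p := fun l => l ∉ S.filter (¬ p ·) ∧ l ∈ S) ?_ ?_
  · intro l hl; grind
  · exact h2.trans hS

lemma mem_zpowers_of_keep {i : ℕ} {g : F} (h : keep (· = i) g = g) : g ∈ Subgroup.zpowers (y i) :=
  map_mem_closure_of_keep h (MonoidHom.id _) _ (by
    rintro l rfl; exact Subgroup.mem_zpowers _)

lemma mem_zpowers_of_commute {i : ℕ} {N : ℤ} (hN : N ≠ 0) {g : F} (h : Commute (y i ^ N) g) :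
    g ∈ Subgroup.zpowers (y i) := by
  apply mem_zpowers_of_keep
  refine keep_of_commute ?_ ?_ h
  · rw [map_zpow, keep_of (p := (· = i)) rfl]
  · intro h; exact hN (zpow_inj (FreeGroup.of_ne_one i) h)

/-- If `w` lies in the normal closure of `b` and is conjugate to its twist by a power of `x`, then
`w` is conjugate into the subgroup generated by `x` and `b`. -/
lemma exists_isConj_of_tw {b : ℕ} {x : F} (hx : kill b x = x)
    (hC : ∀ N : ℤ, N ≠ 0 → ∀ g, Commute (x ^ N) g → g ∈ Subgroup.zpowers x)
    {w e : F} (hw : kill b w = 1) {M : ℤ} (hM : M ≠ 0)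
    (h : e * tw b (x ^ M) w * e⁻¹ = w) :
    ∃ v ∈ Subgroup.closure {x, y b}, IsConj w v := by
  have hxM : kill b (x ^ M) = x ^ M := by rw [map_zpow, hx]
  set a := kill b e with ha
  let f : F → F := fun g => a * x ^ M * g * x ^ (-M)
  have hf : Function.Injective f := fun g g' h => by simpa [f] using h
  have h1 : IsConj (FreeGroup.map f (W b w)) (W b w) := by
    have := congrArg (W b) h
    rw [W_mul, W_mul, W_inv, map_mul, kill_tw hxM, hw, W_tw hxM] at this
    rw [isConj_iff]
    refine ⟨W b e, ?_⟩
    conv_rhs => rw [← this]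
    rw [trans_apply, FreeGroup.map.comp]
    congr 1
    · congr 3
      ext g
      simp [f, ← ha, mul_assoc]
    · rw [← MulAut.mul_apply, ← map_mul, ← map_inv]
      simp
  have h2 := isConj_keep_periodic hf h1
  have hw2 : W' b (W b w) = w := by simpa [hw] using W'_W b w
  have h3 := ((W' b).map_isConj h2).symm
  rw [hw2] at h3
  have hiter : ∀ (r : ℕ) g, f^[r] g = (a * x ^ M) ^ r * g * x ^ (-(M * r)) := by
    intro r g
    induction r with
    | zero => simp
    | succ r ih =>
      rw [Function.iterate_succ_apply', ih]
      simp only [f, pow_succ']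
      push_cast
      simp only [mul_add, neg_add, zpow_add]
      group
  by_cases hex : ∃ g, ∃ r, 0 < r ∧ f^[r] g = g
  · obtain ⟨g, r, hr, hg⟩ := hex
    let H := (Subgroup.closure {x, y b}).map (MulAut.conj g).toMonoidHom
    have h4 : W' b (keep (fun l => ∃ r, 0 < r ∧ f^[r] l = l) (W b w)) ∈ H := by
      refine map_mem_closure_of_keep (p := fun l => ∃ r, 0 < r ∧ f^[r] l = l) ?_ _ _ ?_
      · rw [keep_keep]; exact keep_congr (by simp) _
      · rintro g' ⟨r', hr', hg'⟩
        have e1 := (Function.IsPeriodicPt.mul_const (f := f) (x := g) (m := r) hg r')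
        have e2 := (Function.IsPeriodicPt.const_mul (f := f) (x := g') (m := r') hg' r)
        have e1 : f^[r * r'] g = g := e1
        have e2 : f^[r * r'] g' = g' := e2
        rw [hiter] at e1 e2
        have e3 : Commute (x ^ (M * (r * r' : ℕ))) (g⁻¹ * g') := by
          have e1' : (a * x ^ M) ^ (r * r') = g * x ^ (M * (r * r' : ℕ)) * g⁻¹ := by
            rw [zpow_neg] at e1
            rw [eq_mul_inv_iff_mul_eq, ← mul_inv_eq_iff_eq_mul]; exact e1
          rw [e1', zpow_neg, mul_inv_eq_iff_eq_mul] at e2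
          rw [Commute, SemiconjBy]
          rw [mul_assoc g⁻¹ g', ← e2]
          group
        have e4 := hC _ (mul_ne_zero hM (by positivity)) _ e3
        obtain ⟨j, hj⟩ := e4
        dsimp only at hj
        rw [W'_of]
        refine ⟨x ^ j * y b * (x ^ j)⁻¹, ?_, ?_⟩
        · have hx' : x ∈ Subgroup.closure {x, y b} := Subgroup.subset_closure (by simp)
          have hy' : y b ∈ Subgroup.closure {x, y b} := Subgroup.subset_closure (by simp)
          exact mul_mem (mul_mem (zpow_mem hx' _) hy') (inv_mem (zpow_mem hx' _))
        · simp only [MulEquiv.coe_toMonoidHom, MulAut.conj_apply, hj]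
          group
    obtain ⟨v, hv, hv2⟩ := h4
    refine ⟨v, hv, h3.trans ?_⟩
    rw [← hv2]
    exact (isConj_iff.mpr ⟨g, rfl⟩ : IsConj v _).symm
  · refine ⟨1, one_mem _, ?_⟩
    have : W' b (keep (fun l => ∃ r, 0 < r ∧ f^[r] l = l) (W b w)) = 1 := by
      have := map_mem_closure_of_keep (p := fun l => ∃ r, 0 < r ∧ f^[r] l = l)
        (w := keep (fun l => ∃ r, 0 < r ∧ f^[r] l = l) (W b w))
        (by rw [keep_keep]; exact keep_congr (by simp) _) (W' b) ⊥
        (fun l hl => absurd ⟨l, hl⟩ hex)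
      simpa using this
    rwa [this] at h3

lemma mem_closure_of_tw {b : ℕ} {x : F} (hx : kill b x = x)
    (hC : ∀ N : ℤ, N ≠ 0 → ∀ g, Commute (x ^ N) g → g ∈ Subgroup.zpowers x)
    {e : F} {M : ℤ} (hM : M ≠ 0) (h : tw b (x ^ M) e = e) :
    e ∈ Subgroup.closure {x, y b} := by
  have hxM : kill b (x ^ M) = x ^ M := by rw [map_zpow, hx]
  have hx' : x ∈ Subgroup.closure {x, y b} := Subgroup.subset_closure (by simp)
  have hy' : y b ∈ Subgroup.closure {x, y b} := Subgroup.subset_closure (by simp)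
  have h1 := congrArg (kill b) h
  rw [kill_tw hxM, mul_inv_eq_iff_eq_mul] at h1
  have h2 := congrArg (W b) h
  rw [W_tw hxM] at h2
  have hz : Subgroup.zpowers x ≤ Subgroup.closure {x, y b} := by simpa using hx'
  rw [← W'_W b e]
  refine mul_mem ?_ (hz (hC M hM _ h1))
  refine map_mem_closure_of_keep (keep_periodic (f := fun g => x ^ M * g * (x ^ M)⁻¹) ?_ h2) _ _ ?_
  · exact fun g g' h => by simpa using h
  · rintro g ⟨r, hr, hg⟩
    have hiter : ∀ (r : ℕ), (fun g => x ^ M * g * (x ^ M)⁻¹)^[r] g =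
        x ^ (M * r) * g * (x ^ (M * r))⁻¹ := by
      intro r
      induction r with
      | zero => simp
      | succ r ih =>
        rw [Function.iterate_succ_apply', ih]
        push_cast
        simp only [mul_add, zpow_add]
        group
    rw [hiter, mul_inv_eq_iff_eq_mul] at hg
    have := hz (hC _ (mul_ne_zero hM (by positivity)) _ hg)
    rw [W'_of]
    exact mul_mem (mul_mem this hy') (inv_mem this)

end Kurosh

end Braid

namespace Braid
variable {n : ℕ}

/-- The product of the generators from `k - 1` down to `j`. -/
def cs (j : ℕ) : ℕ → B n
  | 0 => 1
  | k + 1 => if j ≤ k then s k * cs j k else 1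

lemma cs_of_ge {j k : ℕ} (h : k ≤ j) : (cs j k : B n) = 1 := by
  cases k with
  | zero => rfl
  | succ k => simp [cs]; omega

lemma cs_succ {j k : ℕ} (h : j ≤ k) : (cs j (k + 1) : B n) = s k * cs j k := by simp [cs, h]

lemma cs_left {j k : ℕ} (h : j < k) : (cs j k : B n) = cs (j + 1) k * s j := by
  induction k with
  | zero => omega
  | succ k ih =>
    by_cases hj : j = k
    · subst hj; rw [cs_succ le_rfl, cs_of_ge le_rfl, cs_of_ge le_rfl]; simp
    · rw [cs_succ (by omega), cs_succ (by omega), ih (by omega), mul_assoc]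

lemma A_eq_cs {j k : ℕ} (h : j < k) :
    (A j k : B n) = cs (j + 1) k * s j ^ 2 * (cs (j + 1) k)⁻¹ := by
  induction k with
  | zero => omega
  | succ k ih =>
    by_cases hj : j = k
    · subst hj; rw [A_self, cs_of_ge le_rfl]; simp
    · rw [A_succ hj, cs_succ (by omega), ih (by omega)]; group

lemma cs_mem_Bk {j k m : ℕ} (h : k < m) : cs j k ∈ Bk n m := by
  induction k with
  | zero => exact one_mem _
  | succ k ih =>
    unfold cs; split_ifs
    · exact mul_mem (s_mem_Bk (by omega)) (ih (by omega))
    · exact one_mem _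

lemma commute_s_cs {i j k : ℕ} (h : i + 1 < j) : Commute (s i : B n) (cs j k) := by
  induction k with
  | zero => exact Commute.one_right _
  | succ k ih =>
    unfold cs; split_ifs
    · exact Commute.mul_right (s_comm (by omega)) ih
    · exact Commute.one_right _

lemma cs_mul_s {i j k : ℕ} (h : j ≤ i) (h2 : i + 1 < k) (hk : k < n) :
    (cs j k : B n) * s (i + 1) = s i * cs j k := by
  induction k, h2 using Nat.le_induction with
  | base =>
    rw [cs_succ (by omega), cs_succ (by omega)]
    have h1 : Commute (s (i + 1) : B n) (cs j i) :=
      commute_s_Bk (k := i + 1) (by omega) (cs_mem_Bk (by omega))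
    have h3 := s_braid (n := n) (i := i) hk
    calc s (i + 1) * (s i * cs j i) * s (i + 1)
        = s (i + 1) * s i * (cs j i * s (i + 1)) := by simp only [mul_assoc]
      _ = s (i + 1) * s i * s (i + 1) * cs j i := by rw [← h1.eq]; simp only [mul_assoc]
      _ = _ := by rw [← h3]; simp only [mul_assoc]
  | succ k hle ih =>
    rw [cs_succ (by omega), mul_assoc, ih (by omega), ← mul_assoc, ← mul_assoc,
      s_comm (show i + 2 ≤ k by omega)]

lemma coset_decomp {k : ℕ} (hk : k < n) {β : B n} (hβ : β ∈ Bk n (k + 1)) :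
    ∃ u, ∃ b ∈ Bk n k, ∃ j ≤ k, β = ι k u * b * cs j k := by
  unfold Bk at hβ
  induction hβ using Subgroup.closure_induction_right with
  | one => exact ⟨1, 1, one_mem _, k, le_rfl, by simp [cs_of_ge]⟩
  | mul_right β _ z hz ih =>
    obtain ⟨i, hi, rfl⟩ := hz
    obtain ⟨u, b, hb, j, hj, rfl⟩ := ih
    rcases lt_trichotomy (i + 1) j with h | h | h
    · refine ⟨u, b * s i, mul_mem hb (s_mem_Bk (by omega)), j, hj, ?_⟩
      rw [mul_assoc, ← (commute_s_cs h).eq]; simp only [mul_assoc]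
    · subst h
      refine ⟨u, b, hb, i, by omega, ?_⟩
      rw [cs_left (j := i) (by omega)]; simp only [mul_assoc]
    rcases eq_or_ne i j with rfl | hij
    · refine ⟨u * art b (y i), b, hb, i + 1, by omega, ?_⟩
      rw [map_mul, ← conj_ι hk hb, ι_y, A_eq_cs (by omega), cs_left (j := i) (by omega)]
      simp only [pow_two]; group
    · obtain ⟨i, rfl⟩ := Nat.exists_eq_succ_of_ne_zero (show i ≠ 0 by omega)
      refine ⟨u, b * s i, mul_mem hb (s_mem_Bk (by omega)), j, hj, ?_⟩
      rw [mul_assoc, cs_mul_s (by omega) (by omega) (by omega)]; simp only [mul_assoc]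
  | mul_inv_cancel β _ z hz ih =>
    obtain ⟨i, hi, rfl⟩ := hz
    obtain ⟨u, b, hb, j, hj, rfl⟩ := ih
    rcases lt_trichotomy (i + 1) j with h | h | h
    · refine ⟨u, b * (s i)⁻¹, mul_mem hb (inv_mem (s_mem_Bk (by omega))), j, hj, ?_⟩
      rw [mul_assoc, ← (commute_s_cs h).inv_left.eq]; simp only [mul_assoc]
    · subst h
      refine ⟨u * art b (y i)⁻¹, b, hb, i, by omega, ?_⟩
      rw [map_mul, ← conj_ι hk hb, map_inv, ι_y, A_eq_cs (by omega), cs_left (j := i) (by omega)]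
      simp only [pow_two]; group
    rcases eq_or_ne i j with rfl | hij
    · refine ⟨u, b, hb, i + 1, by omega, ?_⟩
      rw [cs_left (j := i) (by omega)]; group
    · obtain ⟨i, rfl⟩ := Nat.exists_eq_succ_of_ne_zero (show i ≠ 0 by omega)
      refine ⟨u, b * (s i)⁻¹, mul_mem hb (inv_mem (s_mem_Bk (by omega))), j, hj, ?_⟩
      rw [mul_inv_eq_iff_eq_mul, mul_assoc _ (cs j k), cs_mul_s (by omega) (by omega) (by omega)]
      group

open Equiv

lemma perm_Bk {k : ℕ} {b : B n} (hb : b ∈ Bk n k) {x : ℕ} (hx : k ≤ x) : perm b x = x := by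
  induction hb using Subgroup.closure_induction with
  | mem b hb =>
    obtain ⟨i, hi, rfl⟩ := hb
    by_cases h : i + 1 < n
    · rw [perm_s h, swap_apply_of_ne_of_ne] <;> omega
    · rw [s_of_ge (by omega)]; simp
  | one => simp
  | mul a b _ _ ha hb => rw [map_mul, Perm.mul_apply, hb, ha]
  | inv b _ hb => rw [map_inv, Perm.inv_eq_iff_eq, hb]

lemma perm_ge (β : B n) {x : ℕ} (hx : n ≤ x) : perm β x = x := perm_Bk (mem_Bk β) hx

lemma perm_cs {j k : ℕ} (h : j ≤ k) (hk : k < n) : perm (cs j k : B n) j = k := by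
  induction k with
  | zero => obtain rfl : j = 0 := by omega
            simp [cs]
  | succ k ih =>
    rcases Nat.lt_or_ge k j with h1 | h1
    · obtain rfl : j = k + 1 := by omega
      rw [cs_of_ge le_rfl]; simp
    · rw [cs_succ h1, map_mul, Perm.mul_apply, ih h1 (by omega), perm_s hk, swap_apply_left]

lemma perm_s_sq (i : ℕ) : perm (s i ^ 2 : B n) = 1 := by
  by_cases h : i + 1 < n
  · rw [map_pow, perm_s h, pow_two, swap_mul_self]
  · rw [s_of_ge (by omega)]; simp

/-- The pure braid group. -/
abbrev P (n : ℕ) : Subgroup (B n) := (perm : B n →* Perm ℕ).ker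

lemma mem_P {β : B n} : β ∈ P n ↔ perm β = 1 := MonoidHom.mem_ker

lemma A_mem_P (j k : ℕ) : A j k ∈ P n := by
  induction k with
  | zero => exact one_mem _
  | succ k ih =>
    unfold A; split_ifs
    · exact perm_s_sq k
    · exact (MonoidHom.normal_ker _).conj_mem _ ih _

lemma ι_mem_P (k : ℕ) (u : F) : ι k u ∈ P n := by
  have : (P n).comap (ι k) = ⊤ := by
    rw [eq_top_iff, ← FreeGroup.closure_range_of, Subgroup.closure_le]
    rintro _ ⟨j, rfl⟩
    simp only [Subgroup.coe_comap, Set.mem_preimage, SetLike.mem_coe]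
    rw [ι_y]; exact A_mem_P j k
  exact (this ▸ Subgroup.mem_top u : u ∈ (P n).comap (ι k))

lemma pure_decomp {k : ℕ} (hk : k < n) {β : B n} (hβ : β ∈ Bk n (k + 1)) (hp : β ∈ P n) :
    ∃ u, ∃ b ∈ Bk n k, b ∈ P n ∧ β = ι k u * b := by
  obtain ⟨u, b, hb, j, hj, rfl⟩ := coset_decomp hk hβ
  have h1 : perm (ι k u * b * cs j k : B n) j = j := by rw [mem_P.mp hp]; rfl
  rw [map_mul, map_mul, mem_P.mp (ι_mem_P k u), Perm.mul_apply, perm_cs hj hk, one_mul,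
    perm_Bk hb le_rfl] at h1
  subst h1
  rw [cs_of_ge le_rfl, mul_one] at hp ⊢
  exact ⟨u, b, hb, ((P n).mul_mem_cancel_left (ι_mem_P k u)).mp hp, rfl⟩

lemma conj_perm_inv {f : MulAut F} {π : Perm ℕ} (h : ∀ j, ∃ g, f (y j) = g * y (π j) * g⁻¹) (j : ℕ) :
    ∃ g, f⁻¹ (y j) = g * y (π⁻¹ j) * g⁻¹ := by
  obtain ⟨g, hg⟩ := h (π⁻¹ j)
  refine ⟨(f⁻¹ g)⁻¹, ?_⟩
  have : f⁻¹ (f (y (π⁻¹ j))) = f⁻¹ (g * y (π (π⁻¹ j)) * g⁻¹) := by rw [hg]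
  rw [MulAut.inv_apply_self, map_mul, map_mul, map_inv] at this
  rw [show π (π⁻¹ j) = j from π.apply_symm_apply j] at this
  rw [this]; group

lemma art_conj_perm (β : B n) (j : ℕ) : ∃ g, art β (y j) = g * y (perm β j) * g⁻¹ := by
  have key : ∀ i j, ∃ g, artGen i (y j) = g * y (swap i (i + 1) j) * g⁻¹ := by
    intro i j
    by_cases h1 : j = i
    · subst h1; exact ⟨1, by rw [artGen_self]; simp⟩
    by_cases h2 : j = i + 1
    · subst h2; exact ⟨(y (i + 1))⁻¹, by rw [artGen_succ]; simp⟩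
    · exact ⟨1, by rw [artGen_ne h1 h2, swap_apply_of_ne_of_ne h1 h2]; simp⟩
  induction β using induct generalizing j with
  | one => exact ⟨1, by simp⟩
  | s_mul i β hi ih =>
    obtain ⟨g, hg⟩ := ih j
    obtain ⟨g', hg'⟩ := key i (perm β j)
    refine ⟨artGen i g * g', ?_⟩
    rw [map_mul, map_mul, MulAut.mul_apply, Perm.mul_apply, hg, art_s hi, perm_s hi]
    rw [map_mul, map_mul, hg', map_inv]
    group
  | inv_mul i β hi ih =>
    obtain ⟨g, hg⟩ := ih j
    obtain ⟨g', hg'⟩ := conj_perm_inv (key i) (perm β j)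
    refine ⟨(artGen i)⁻¹ g * g', ?_⟩
    rw [map_mul, map_mul, MulAut.mul_apply, Perm.mul_apply, hg, map_inv, map_inv, art_s hi,
      perm_s hi]
    rw [map_mul, map_mul, hg', map_inv]
    group

/-- The exponent sum of the letter `i`. -/
def cnt (i : ℕ) : F →* Multiplicative ℤ :=
  FreeGroup.lift fun j => if j = i then Multiplicative.ofAdd 1 else 1

lemma cnt_y (i j : ℕ) : cnt i (y j) = if j = i then Multiplicative.ofAdd 1 else 1 := by simp [cnt]

lemma cnt_conj (i : ℕ) (g x : F) : cnt i (g * x * g⁻¹) = cnt i x := by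
  rw [map_mul, map_mul, map_inv, mul_comm, inv_mul_cancel_left]

lemma cnt_art (β : B n) (i : ℕ) (x : F) : cnt (perm β i) (art β x) = cnt i x := by
  have : (cnt (perm β i)).comp (art β).toMonoidHom = cnt i := by
    ext j
    obtain ⟨g, hg⟩ := art_conj_perm β j
    simp only [MonoidHom.comp_apply, MulEquiv.coe_toMonoidHom]
    rw [hg, cnt_conj, cnt_y, cnt_y]
    simp
  exact DFunLike.congr_fun this x

lemma perm_eq_one_of_art {β : B n} (h : art β = 1) : perm β = 1 := by
  ext i
  have := cnt_art β i (y i)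
  rw [h, MulAut.one_apply, cnt_y, cnt_y, if_pos rfl] at this
  split_ifs at this with h2
  · rw [← h2]; rfl
  · exact absurd this (by decide)

end Braid

namespace Braid
variable {n : ℕ}

/-- The retraction of `F` onto the free group on the first `k` letters. -/
noncomputable abbrev ret (k : ℕ) : F →* F := keep (· < k)

lemma ret_y {k j : ℕ} (h : j < k) : ret k (y j) = y j := keep_of (p := (· < k)) h

lemma ret_y_of_ge {k j : ℕ} (h : k ≤ j) : ret k (y j) = 1 :=
  keep_of_not (p := (· < k)) (by omega)

lemma ret_ret {k m : ℕ} (h : k ≤ m) (x : F) : ret k (ret m x) = ret k x := by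
  rw [keep_keep]; exact keep_congr (fun l => by omega) x

lemma art_fix {k : ℕ} {b : B n} (hb : b ∈ Bk n k) {j : ℕ} (hj : k ≤ j) : art b (y j) = y j := by
  induction hb using Subgroup.closure_induction with
  | mem b hb =>
    obtain ⟨i, hi, rfl⟩ := hb
    by_cases h : i + 1 < n
    · rw [art_s h, artGen_ne (by omega) (by omega)]
    · rw [s_of_ge (by omega)]; simp
  | one => simp
  | mul a b _ _ ha hb => rw [map_mul, MulAut.mul_apply, hb, ha]
  | inv b _ hb =>
    conv_lhs => rw [← hb, ← MulAut.mul_apply, ← map_mul, inv_mul_cancel]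
    simp

lemma ret_art {k : ℕ} {b : B n} (hb : b ∈ Bk n k) (x : F) :
    ret k (art b x) = art b (ret k x) := by
  induction hb using Subgroup.closure_induction generalizing x with
  | mem b hb =>
    obtain ⟨i, hi, rfl⟩ := hb
    by_cases h : i + 1 < n
    · have : (ret k).comp (art (s i : B n)).toMonoidHom =
          (art (s i : B n)).toMonoidHom.comp (ret k) := by
        ext j
        simp only [MonoidHom.comp_apply, MulEquiv.coe_toMonoidHom]
        rw [art_s h]
        by_cases h1 : j = i
        · subst h1; rw [artGen_self, ret_y hi, ret_y (by omega), artGen_self]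
        by_cases h2 : j = i + 1
        · subst h2
          rw [ret_y hi, artGen_succ]
          simp only [map_mul, map_inv, ret_y hi, ret_y (show i < k by omega)]
        rw [artGen_ne h1 h2]
        by_cases h3 : j < k
        · rw [ret_y h3, artGen_ne h1 h2]
        · rw [ret_y_of_ge (by omega), map_one]
      exact DFunLike.congr_fun this x
    · rw [s_of_ge (by omega)]; simp
  | one => simp
  | mul a b _ _ ha hb => rw [map_mul, MulAut.mul_apply, MulAut.mul_apply, ha, hb]
  | inv b _ hb =>
    have := hb (art b⁻¹ x)
    rw [← MulAut.mul_apply, ← map_mul, mul_inv_cancel, map_one, MulAut.one_apply] at this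
    rw [this, ← MulAut.mul_apply, ← map_mul, inv_mul_cancel, map_one, MulAut.one_apply]

/-- `β` acts on the letters before `k` trivially up to later letters, and conjugates `y k` by an
element restricting to `v⁻¹`. -/
def PushRel (k : ℕ) (β : B n) (v : F) : Prop :=
  (∀ x, ret k (art β x) = ret k x) ∧ ∃ g, art β (y k) = g * y k * g⁻¹ ∧ ret k g = v⁻¹

lemma PushRel.mul {k : ℕ} {β γ : B n} {v w : F} (h : PushRel k β v) (h' : PushRel k γ w) :
    PushRel k (β * γ) (v * w) := by
  obtain ⟨h1, g, h2, h3⟩ := h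
  obtain ⟨h1', g', h2', h3'⟩ := h'
  refine ⟨fun x => by rw [map_mul, MulAut.mul_apply, h1, h1'], art β g' * g, ?_, ?_⟩
  · rw [map_mul, MulAut.mul_apply, h2', map_mul, map_mul, h2, map_inv]; group
  · rw [map_mul, h1, h3, h3', mul_inv_rev]

lemma PushRel.inv {k : ℕ} {β : B n} {v : F} (h : PushRel k β v) : PushRel k β⁻¹ v⁻¹ := by
  obtain ⟨h1, g, h2, h3⟩ := h
  have e : ∀ x, art β⁻¹ (art β x) = x := fun x => by
    rw [← MulAut.mul_apply, ← map_mul, inv_mul_cancel, map_one, MulAut.one_apply]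
  have e' : ∀ x, art β (art β⁻¹ x) = x := fun x => by
    rw [← MulAut.mul_apply, ← map_mul, mul_inv_cancel, map_one, MulAut.one_apply]
  have h4 : ∀ x, ret k (art β⁻¹ x) = ret k x := fun x => by rw [← h1, e']
  refine ⟨h4, art β⁻¹ g⁻¹, ?_, ?_⟩
  · have := congrArg (art β⁻¹) h2
    rw [e, map_mul, map_mul, map_inv (art β⁻¹) g] at this
    rw [map_inv (art β⁻¹) g]
    conv_rhs => rw [this]
    group
  · rw [h4, map_inv, h3]

lemma PushRel.conj {k : ℕ} {β b : B n} {v : F} (hb : b ∈ Bk n k) (h : PushRel k β v) :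
    PushRel k (b * β * b⁻¹) (art b v) := by
  obtain ⟨h1, g, h2, h3⟩ := h
  have e' : ∀ x, art b (art b⁻¹ x) = x := fun x => by
    rw [← MulAut.mul_apply, ← map_mul, mul_inv_cancel, map_one, MulAut.one_apply]
  refine ⟨fun x => ?_, art b g, ?_, ?_⟩
  · simp only [map_mul, MulAut.mul_apply]
    rw [ret_art hb, h1, ← ret_art hb, e']
  · simp only [map_mul, MulAut.mul_apply]
    rw [art_fix (inv_mem hb) le_rfl, h2, map_mul, map_mul, map_inv, art_fix hb le_rfl]
  · rw [ret_art hb, h3, map_inv]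

lemma pushRel_A {j k : ℕ} (h : j < k) (hk : k < n) : PushRel k (A j k : B n) (y j) := by
  obtain ⟨d, rfl⟩ : ∃ d, k = j + d + 1 := ⟨k - j - 1, by omega⟩
  induction d generalizing j with
  | zero =>
    rw [Nat.add_zero] at hk ⊢
    have e : ∀ m, art (A j (j + 1) : B n) m = artGen j (artGen j m) := fun m => by
      rw [A_self, pow_two, map_mul, art_s hk]; rfl
    refine ⟨fun x => ?_, (y (j + 1))⁻¹ * (y j)⁻¹, ?_, ?_⟩
    · have : (ret (j + 1)).comp (art (A j (j + 1) : B n)).toMonoidHom = ret (j + 1) := by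
        ext i
        simp only [MonoidHom.comp_apply, MulEquiv.coe_toMonoidHom]
        rw [e]
        by_cases h1 : i = j
        · subst h1; rw [artGen_self, artGen_succ]; simp [ret_y_of_ge]
        by_cases h2 : i = j + 1
        · subst h2; rw [artGen_succ]
          simp only [map_mul, map_inv, artGen_self, artGen_succ]
          simp [ret_y_of_ge]
        rw [artGen_ne h1 h2, artGen_ne h1 h2]
      exact DFunLike.congr_fun this x
    · rw [e, artGen_succ]
      simp only [map_mul, map_inv, artGen_self, artGen_succ]
      group
    · rw [map_mul, map_inv, map_inv, ret_y_of_ge le_rfl, ret_y (by omega)]; simp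
  | succ d ih =>
    have h1 := ih (j := j + 1) (by omega) (by omega)
    rw [show j + 1 + d + 1 = j + (d + 1) + 1 by omega] at h1
    have h2 := h1.conj (inv_mem (s_mem_Bk (i := j) (by omega)))
    rw [← s_A_self (by omega) hk, map_inv, art_s (by omega)] at h2
    convert h2 using 1
    · group
    · rw [← artGen_self]; exact (MulAut.inv_apply_self _ _ _).symm

lemma pushRel_ι {k : ℕ} (hk : k < n) (u : F) : PushRel k (ι k u : B n) (ret k u) := by
  have h0 : ∀ j, PushRel k (ι k (y j) : B n) (ret k (y j)) := by
    intro j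
    rw [ι_y]
    by_cases h : j < k
    · rw [ret_y h]; exact pushRel_A h hk
    · rw [ret_y_of_ge (by omega), A_of_ge (by omega)]
      exact ⟨fun x => by simp, 1, by simp, by simp⟩
  induction u using FreeGroup.induction_on with
  | C1 => simpa using ⟨fun x => by simp, 1, by simp, by simp⟩
  | of j => exact h0 j
  | inv_of j h => rw [map_inv, map_inv]; exact h.inv
  | mul u v hu hv => rw [map_mul, map_mul]; exact hu.mul hv

lemma ret_art_ι {k m : ℕ} (hm : m < n) (h : k ≤ m) (u x : F) :
    ret k (art (ι m u : B n) x) = ret k x := by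
  rw [← ret_ret h, (pushRel_ι hm u).1, ret_ret h]

lemma ι_ret (k : ℕ) (u : F) : (ι k (ret k u) : B n) = ι k u := by
  have : (ι k).comp (ret k) = (ι k : F →* B n) := by
    ext j
    by_cases h : j < k
    · rw [MonoidHom.comp_apply, ret_y h]
    · rw [MonoidHom.comp_apply, ret_y_of_ge (by omega), ι_y, A_of_ge (by omega), map_one]
  exact DFunLike.congr_fun this u

lemma ret_eq_one_of_fix {k : ℕ} (hk : k < n) {u : F} (h : art (ι k u : B n) (y k) = y k) :
    ret k u = 1 := by
  obtain ⟨-, g, h2, h3⟩ := pushRel_ι hk u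
  rw [h, eq_mul_inv_iff_mul_eq] at h2
  have h4 : g ∈ Subgroup.zpowers (y k) :=
    mem_zpowers_of_commute (N := 1) one_ne_zero (by rw [zpow_one]; exact h2)
  obtain ⟨m, rfl⟩ := h4
  simp only [map_zpow, ret_y_of_ge le_rfl, one_zpow] at h3
  exact inv_eq_one.mp h3.symm

lemma ret_eq_one {k : ℕ} (hk : k < n) {u : F} (h : (ι k u : B n) = 1) : ret k u = 1 :=
  ret_eq_one_of_fix hk (by rw [h]; simp)

lemma ret_inj {k : ℕ} (hk : k < n) {u v : F} (h : (ι k u : B n) = ι k v) : ret k u = ret k v := by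
  have := ret_eq_one hk (u := u * v⁻¹) (by rw [map_mul, map_inv, h, mul_inv_cancel])
  rwa [map_mul, map_inv, mul_inv_eq_one] at this

lemma art_eq_one {k : ℕ} (hk : k ≤ n) {β : B n} (hβ : β ∈ Bk n k) (h : art β = 1) : β = 1 := by
  induction k generalizing β with
  | zero =>
    unfold Bk at hβ
    rw [show {x : B n | ∃ i, i + 1 < 0 ∧ x = s i} = ∅ by ext; simp] at hβ
    simpa using hβ
  | succ k ih =>
    obtain ⟨u, b, hb, hbP, rfl⟩ := pure_decomp hk hβ (perm_eq_one_of_art h)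
    have h1 : art (ι k u : B n) (y k) = y k := by
      rw [← art_fix hb le_rfl, ← MulAut.mul_apply, ← map_mul, h]
      rw [MulAut.one_apply, art_fix hb le_rfl]
    have h2 := ret_eq_one_of_fix hk h1
    rw [← ι_ret, h2, map_one, one_mul] at h ⊢
    exact ih (by omega) hb h

lemma art_injective : Function.Injective (art : B n →* MulAut F) := by
  rw [injective_iff_map_eq_one]
  exact fun β h => art_eq_one le_rfl (mem_Bk β) h

/-- The braids preserving the first `k` strands in a way allowing to forget the others. -/
def Hs (n k : ℕ) : Subgroup (B n) where
  carrier := {β | ∃ b ∈ Bk n k, ∀ x, ret k (art β x) = art b (ret k x)}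
  one_mem' := ⟨1, one_mem _, by simp⟩
  mul_mem' := by
    rintro β γ ⟨b, hb, h⟩ ⟨c, hc, h'⟩
    exact ⟨b * c, mul_mem hb hc, fun x => by
      rw [map_mul, map_mul, MulAut.mul_apply, MulAut.mul_apply, h, h']⟩
  inv_mem' := by
    rintro β ⟨b, hb, h⟩
    refine ⟨b⁻¹, inv_mem hb, fun x => ?_⟩
    have := h (art β⁻¹ x)
    rw [← MulAut.mul_apply, ← map_mul, mul_inv_cancel, map_one, MulAut.one_apply] at this
    rw [this, ← MulAut.mul_apply, ← map_mul, inv_mul_cancel, map_one, MulAut.one_apply]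

open Classical in
/-- The braid obtained by forgetting the strands from `k` on. -/
noncomputable def fg (k : ℕ) (β : B n) : B n :=
  if h : β ∈ Hs n k then h.choose else 1

lemma fg_mem_Bk (k : ℕ) (β : B n) : fg k β ∈ Bk n k := by
  unfold fg; split_ifs with h
  · exact h.choose_spec.1
  · exact one_mem _

lemma fg_spec {k : ℕ} {β : B n} (h : β ∈ Hs n k) (x : F) :
    ret k (art β x) = art (fg k β) (ret k x) := by
  unfold fg; rw [dif_pos h]; exact h.choose_spec.2 x

lemma fg_eq {k : ℕ} {β b : B n} (hb : b ∈ Bk n k)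
    (h : ∀ x, ret k (art β x) = art b (ret k x)) : fg k β = b := by
  have hβ : β ∈ Hs n k := ⟨b, hb, h⟩
  apply art_injective
  apply mulAut_ext
  intro j
  by_cases hj : j < k
  · have := fg_spec hβ (y j)
    rw [h, ret_y hj] at this
    exact this.symm
  · rw [art_fix (fg_mem_Bk k β) (by omega), art_fix hb (by omega)]

lemma Bk_le_Hs (k : ℕ) : Bk n k ≤ Hs n k := fun b hb => ⟨b, hb, ret_art hb⟩

lemma fg_of_mem {k : ℕ} {b : B n} (hb : b ∈ Bk n k) : fg k b = b := fg_eq hb (ret_art hb)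

lemma fg_one (k : ℕ) : fg k (1 : B n) = 1 := fg_of_mem (one_mem _)

lemma fg_top (β : B n) : fg n β = β := fg_of_mem (mem_Bk β)

lemma fg_mul {k : ℕ} {β γ : B n} (hβ : β ∈ Hs n k) (hγ : γ ∈ Hs n k) :
    fg k (β * γ) = fg k β * fg k γ :=
  fg_eq (mul_mem (fg_mem_Bk k β) (fg_mem_Bk k γ)) fun x => by
    rw [map_mul, map_mul, MulAut.mul_apply, MulAut.mul_apply, fg_spec hβ, fg_spec hγ]

lemma fg_inv {k : ℕ} {β : B n} (hβ : β ∈ Hs n k) : fg k β⁻¹ = (fg k β)⁻¹ := by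
  rw [eq_inv_iff_mul_eq_one, ← fg_mul (inv_mem hβ) hβ, inv_mul_cancel, fg_one]

lemma fg_zpow {k : ℕ} {β : B n} (hβ : β ∈ Hs n k) (m : ℤ) : fg k (β ^ m) = fg k β ^ m := by
  let f : Hs n k →* B n := ⟨⟨fun β => fg k β, fg_one k⟩, fun β γ => fg_mul β.2 γ.2⟩
  exact map_zpow f ⟨β, hβ⟩ m

lemma fg_ι {k m : ℕ} (hm : m < n) (h : k ≤ m) (u : F) : fg k (ι m u : B n) = 1 :=
  fg_eq (one_mem _) fun x => by rw [ret_art_ι hm h, map_one, MulAut.one_apply]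

lemma ι_mem_Hs {k m : ℕ} (hm : m < n) (h : k ≤ m) (u : F) : (ι m u : B n) ∈ Hs n k :=
  ⟨1, one_mem _, fun x => by rw [ret_art_ι hm h, map_one, MulAut.one_apply]⟩

lemma fg_conj {k : ℕ} {β d : B n} (hd : d ∈ Bk n k) (hβ : β ∈ Hs n k) :
    fg k (d * β * d⁻¹) = d * fg k β * d⁻¹ := by
  have h := Bk_le_Hs k hd
  rw [fg_mul (mul_mem h hβ) (inv_mem h), fg_mul h hβ, fg_inv h, fg_of_mem hd]

lemma P_le_Hs (k : ℕ) : P n ≤ Hs n k := by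
  rcases le_total n k with h | h
  · intro β _; exact Bk_le_Hs k (Bk_mono h (mem_Bk β))
  have key : ∀ d, k + d ≤ n → ∀ β ∈ Bk n (k + d), β ∈ P n → β ∈ Hs n k := by
    intro d
    induction d with
    | zero => intro _ β hβ _; exact Bk_le_Hs k hβ
    | succ d ih =>
      intro hd β hβ hp
      obtain ⟨u, b, hb, hbP, rfl⟩ := pure_decomp (k := k + d) (by omega) hβ hp
      exact mul_mem (ι_mem_Hs (by omega) (by omega) u) (ih (by omega) b hb hbP)
  obtain ⟨d, rfl⟩ := Nat.exists_eq_add_of_le h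
  exact fun β hβ => key d le_rfl β (mem_Bk β) hβ

lemma fg_fg {k m : ℕ} (h : k ≤ m) {β : B n} (hm : β ∈ Hs n m) (hk : fg m β ∈ Hs n k) :
    fg k (fg m β) = fg k β := by
  symm
  refine fg_eq (fg_mem_Bk _ _) fun x => ?_
  rw [← ret_ret h, fg_spec hm, fg_spec hk, ret_ret h]

lemma fg_mem_P {β : B n} (hβ : β ∈ P n) (k : ℕ) : fg k β ∈ P n := by
  rcases le_total n k with h | h
  · rw [fg_of_mem (Bk_mono h (mem_Bk β))]; exact hβ
  have key : ∀ d, k + d ≤ n → ∀ β ∈ Bk n (k + d), β ∈ P n → fg k β ∈ P n := by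
    intro d
    induction d with
    | zero => intro _ β hβ hp; rwa [fg_of_mem (by exact hβ)]
    | succ d ih =>
      intro hd β hβ hp
      obtain ⟨u, b, hb, hbP, rfl⟩ := pure_decomp (k := k + d) (by omega) hβ hp
      rw [fg_mul (ι_mem_Hs (by omega) (by omega) u) (P_le_Hs k hbP), fg_ι (by omega) (by omega),
        one_mul]
      exact ih (by omega) b hb hbP
  obtain ⟨d, rfl⟩ := Nat.exists_eq_add_of_le h
  exact key d le_rfl β (mem_Bk β) hβ

lemma fg_fg_P {k m : ℕ} (h : k ≤ m) {β : B n} (hβ : β ∈ P n) : fg k (fg m β) = fg k β :=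
  fg_fg h (P_le_Hs m hβ) (P_le_Hs k (fg_mem_P hβ m))

lemma fg_succ {k : ℕ} (hk : k < n) {β : B n} (hβ : β ∈ P n) :
    ∃ u, ret k u = u ∧ fg (k + 1) β = ι k u * fg k β := by
  obtain ⟨u, b, hb, hbP, h⟩ := pure_decomp hk (fg_mem_Bk (k + 1) β) (fg_mem_P hβ (k + 1))
  have h1 : fg k β = b := by
    rw [← fg_fg_P (Nat.le_succ k) hβ, h, fg_mul (ι_mem_Hs hk le_rfl u) (P_le_Hs k hbP),
      fg_ι hk le_rfl, one_mul, fg_of_mem hb]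
  exact ⟨ret k u, ret_ret le_rfl u, by rw [h, h1, ι_ret]⟩

end Braid

namespace Braid
open Equiv SemidirectProduct
variable {n : ℕ}

/-- The action of permutations on integer matrices. -/
def matAct : Perm ℕ →* MulAut (ℕ → ℕ → Multiplicative ℤ) where
  toFun π :=
    { toFun := fun f a b => f (π⁻¹ a) (π⁻¹ b)
      invFun := fun f a b => f (π a) (π b)
      left_inv := fun f => by ext; simp
      right_inv := fun f => by ext; simp
      map_mul' := fun f g => rfl }
  map_one' := rfl
  map_mul' := fun π ρ => rfl

/-- The indicator of the two ordered pairs made of `c` and `d`. -/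
def pairInd (c d a b : ℕ) : ℤ := if (a = c ∧ b = d) ∨ (a = d ∧ b = c) then 1 else 0

lemma pairInd_perm (π : Perm ℕ) (c d a b : ℕ) :
    pairInd c d (π⁻¹ a) (π⁻¹ b) = pairInd (π c) (π d) a b := by
  unfold pairInd
  simp only [Perm.inv_eq_iff_eq]

lemma pairInd_swap (c d a b : ℕ) : pairInd c d a b = pairInd d c a b := by
  unfold pairInd; grind

/-- The indicator of the two ordered pairs made of `i` and `i + 1`. -/
abbrev ind (i a b : ℕ) : ℤ := pairInd i (i + 1) a b

/-- Crossing numbers and permutation of a braid. -/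
def crossing : B n →* (ℕ → ℕ → Multiplicative ℤ) ⋊[matAct] Perm ℕ :=
  lift (fun i => ⟨fun a b => .ofAdd (ind i a b), swap i (i + 1)⟩)
    (fun i j h _ => by
      have hs : swap i (i + 1) * swap j (j + 1) = swap j (j + 1) * swap i (i + 1) := by
        have := congrArg perm (s_comm (n := j + 2) h)
        rwa [map_mul, map_mul, perm_s (by omega), perm_s (by omega)] at this
      refine SemidirectProduct.ext ?_ hs
      funext a b
      change Multiplicative.ofAdd (ind i a b + ind j ((swap i (i + 1))⁻¹ a) ((swap i (i + 1))⁻¹ b))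
        = Multiplicative.ofAdd (ind j a b + ind i ((swap j (j + 1))⁻¹ a) ((swap j (j + 1))⁻¹ b))
      congr 1
      unfold ind
      rw [pairInd_perm, pairInd_perm, swap_apply_of_ne_of_ne (by omega) (by omega),
        swap_apply_of_ne_of_ne (by omega) (by omega), swap_apply_of_ne_of_ne (by omega) (by omega),
        swap_apply_of_ne_of_ne (by omega) (by omega), add_comm])
    (fun i h => by
      have hs : swap i (i + 1) * swap (i + 1) (i + 1 + 1) * swap i (i + 1) =
          swap (i + 1) (i + 1 + 1) * swap i (i + 1) * swap (i + 1) (i + 1 + 1) := by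
        have := congrArg perm (s_braid h)
        rwa [map_mul, map_mul, map_mul, map_mul, perm_s (by omega), perm_s (by omega)] at this
      refine SemidirectProduct.ext ?_ hs
      funext a b
      change Multiplicative.ofAdd (ind i a b +
          ind (i + 1) ((swap i (i + 1))⁻¹ a) ((swap i (i + 1))⁻¹ b) +
          ind i ((swap i (i + 1) * swap (i + 1) (i + 1 + 1))⁻¹ a)
            ((swap i (i + 1) * swap (i + 1) (i + 1 + 1))⁻¹ b))
        = Multiplicative.ofAdd (ind (i + 1) a b +
          ind i ((swap (i + 1) (i + 1 + 1))⁻¹ a) ((swap (i + 1) (i + 1 + 1))⁻¹ b) +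
          ind (i + 1) ((swap (i + 1) (i + 1 + 1) * swap i (i + 1))⁻¹ a)
            ((swap (i + 1) (i + 1 + 1) * swap i (i + 1))⁻¹ b))
      congr 1
      unfold ind
      rw [pairInd_perm, pairInd_perm, pairInd_perm, pairInd_perm]
      simp only [Perm.mul_apply, swap_apply_left, swap_apply_right]
      rw [swap_apply_of_ne_of_ne (a := i) (x := i + 1 + 1) (by omega) (by omega),
        swap_apply_of_ne_of_ne (b := i + 1 + 1) (x := i) (by omega) (by omega)]
      simp only [swap_apply_left, swap_apply_right]
      ring)

lemma crossing_right (β : B n) : (crossing β).right = perm β := by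
  have : rightHom.comp crossing = (perm : B n →* Perm ℕ) :=
    hom_ext fun i hi => by
      rw [MonoidHom.comp_apply, perm_s hi, crossing, lift_s _ _ _ hi]; rfl
  exact DFunLike.congr_fun this β

/-- The signed number of crossings between the strands ending at `a` and `b`. -/
def lk (β : B n) (a b : ℕ) : ℤ := ((crossing β).left a b).toAdd

lemma lk_one (a b : ℕ) : lk (1 : B n) a b = 0 := by simp [lk]

lemma lk_mul (β γ : B n) (a b : ℕ) :
    lk (β * γ) a b = lk β a b + lk γ ((perm β)⁻¹ a) ((perm β)⁻¹ b) := by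
  unfold lk
  rw [map_mul, mul_left, crossing_right]; rfl

lemma lk_s {i : ℕ} (hi : i + 1 < n) (a b : ℕ) : lk (s i : B n) a b = ind i a b := by
  unfold lk crossing
  rw [lift_s _ _ _ hi]; rfl

lemma lk_inv (β : B n) (a b : ℕ) : lk β⁻¹ a b = - lk β (perm β a) (perm β b) := by
  have := lk_mul β⁻¹ β a b
  rw [inv_mul_cancel, lk_one, map_inv, inv_inv] at this
  linarith

lemma lk_mul_P {β : B n} (hβ : β ∈ P n) (γ : B n) (a b : ℕ) :
    lk (β * γ) a b = lk β a b + lk γ a b := by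
  rw [lk_mul, mem_P.1 hβ]; rfl

lemma lk_inv_P {β : B n} (hβ : β ∈ P n) (a b : ℕ) : lk β⁻¹ a b = - lk β a b := by
  rw [lk_inv, mem_P.1 hβ]; rfl

lemma lk_zpow_P {β : B n} (hβ : β ∈ P n) (m : ℤ) (a b : ℕ) : lk (β ^ m) a b = m * lk β a b := by
  let f : P n →* Multiplicative ℤ :=
    ⟨⟨fun γ => .ofAdd (lk γ.1 a b), congrArg Multiplicative.ofAdd (lk_one a b)⟩,
      fun γ δ => congrArg Multiplicative.ofAdd (lk_mul_P γ.2 δ.1 a b)⟩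
  have := map_zpow f ⟨β, hβ⟩ m
  have h2 := congrArg Multiplicative.toAdd this
  rw [toAdd_zpow, smul_eq_mul] at h2
  exact h2

lemma lk_conj {β : B n} (hβ : β ∈ P n) (g : B n) (a b : ℕ) :
    lk (g * β * g⁻¹) a b = lk β ((perm g)⁻¹ a) ((perm g)⁻¹ b) := by
  rw [lk_mul, lk_mul, lk_inv, map_mul, mem_P.1 hβ, mul_one]
  simp

lemma lk_comm (β : B n) (a b : ℕ) : lk β a b = lk β b a := by
  have h : ∀ i a b, ind i a b = ind i b a := fun i a b => by unfold ind pairInd; grind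
  induction β using induct generalizing a b with
  | one => rw [lk_one, lk_one]
  | s_mul i β hi ih => rw [lk_mul, lk_mul, lk_s hi, lk_s hi, h, ih]
  | inv_mul i β hi ih => rw [lk_mul, lk_mul, lk_inv, lk_inv, lk_s hi, lk_s hi, h, ih]

lemma lk_self (β : B n) (a : ℕ) : lk β a a = 0 := by
  have h : ∀ i a, ind i a a = 0 := fun i a => by unfold ind pairInd; grind
  induction β using induct generalizing a with
  | one => rw [lk_one]
  | s_mul i β hi ih => rw [lk_mul, lk_s hi, h, ih, add_zero]
  | inv_mul i β hi ih => rw [lk_mul, lk_inv, lk_s hi, h, ih]; rfl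

lemma lk_Bk {k : ℕ} {β : B n} (hβ : β ∈ Bk n k) {a : ℕ} (h : k ≤ a) (b : ℕ) : lk β a b = 0 := by
  induction hβ using Subgroup.closure_induction generalizing b with
  | mem β hβ =>
    obtain ⟨i, hi, rfl⟩ := hβ
    by_cases hn : i + 1 < n
    · rw [lk_s hn]; unfold ind pairInd; grind
    · rw [s_of_ge (by omega), lk_one]
  | one => exact lk_one _ _
  | mul β γ hβ _ h1 h2 =>
    have := perm_Bk (inv_mem hβ) h
    rw [map_inv] at this
    rw [lk_mul, this, h1, h2, add_zero]
  | inv β hβ h1 => rw [lk_inv, perm_Bk hβ h, h1, neg_zero]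

/-- The exponent sum as an integer. -/
def ee (β : B n) : ℤ := (expo β).toAdd

lemma ee_one : ee (1 : B n) = 0 := by simp [ee]
lemma ee_mul (β γ : B n) : ee (β * γ) = ee β + ee γ := by simp [ee]
lemma ee_inv (β : B n) : ee β⁻¹ = - ee β := by simp [ee]
lemma ee_zpow (β : B n) (m : ℤ) : ee (β ^ m) = m * ee β := by simp [ee]
lemma ee_pow (β : B n) (m : ℕ) : ee (β ^ m) = m * ee β := by simp [ee]
lemma ee_s {i : ℕ} (hi : i + 1 < n) : ee (s i : B n) = 1 := by simp [ee, expo_s hi]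
lemma ee_conj (g β : B n) : ee (g * β * g⁻¹) = ee β := by rw [ee_mul, ee_mul, ee_inv]; ring

lemma mem_comm {β : B n} : β ∈ commutator (B n) ↔ ee β = 0 := by
  rw [commutator_eq, MonoidHom.mem_ker]; rfl

lemma sum_perm (β : B n) (f : ℕ → ℤ) :
    ∑ a ∈ Finset.range n, f (perm β a) = ∑ a ∈ Finset.range n, f a := by
  have hm : ∀ γ : B n, ∀ a, a < n → perm γ a < n := fun γ a ha => by
    by_contra! h
    have := perm_ge γ h
    have := (perm γ).injective this
    omega
  refine Finset.sum_bij (fun a _ => perm β a) (fun a ha => by simpa using hm β a (by simpa using ha))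
    (fun a _ b _ h => (perm β).injective h) (fun b hb => ⟨(perm β)⁻¹ b, ?_, by simp⟩) (fun _ _ => rfl)
  have := hm β⁻¹ b (by simpa using hb)
  rw [map_inv] at this
  simpa using this

lemma sum_lk (β : B n) :
    ∑ a ∈ Finset.range n, ∑ b ∈ Finset.range n, lk β a b = 2 * ee β := by
  have hmul : ∀ β γ : B n, ∑ a ∈ Finset.range n, ∑ b ∈ Finset.range n, lk (β * γ) a b =
      ∑ a ∈ Finset.range n, ∑ b ∈ Finset.range n, lk β a b +
      ∑ a ∈ Finset.range n, ∑ b ∈ Finset.range n, lk γ a b := by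
    intro β γ
    simp only [lk_mul, Finset.sum_add_distrib]
    congr 1
    rw [← map_inv, ← sum_perm β⁻¹ (fun a => ∑ b ∈ Finset.range n, lk γ a b)]
    refine Finset.sum_congr rfl fun a _ => ?_
    rw [← sum_perm β⁻¹ (fun b => lk γ _ b)]
  let f : B n →* Multiplicative ℤ :=
    ⟨⟨fun β => .ofAdd (∑ a ∈ Finset.range n, ∑ b ∈ Finset.range n, lk β a b), by simp [lk_one]⟩,
      fun β γ => congrArg Multiplicative.ofAdd (hmul β γ)⟩
  have : f = (zpowGroupHom 2).comp expo := hom_ext fun i hi => by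
    rw [MonoidHom.comp_apply, expo_s hi]
    change Multiplicative.ofAdd (∑ a ∈ Finset.range n, ∑ b ∈ Finset.range n, lk (s i) a b) = _
    have h1 : ∀ a b, ind i a b = (if a = i then if b = i + 1 then 1 else 0 else 0) +
        if a = i + 1 then if b = i then 1 else 0 else 0 := fun a b => by unfold ind pairInd; grind
    simp only [lk_s hi, h1, Finset.sum_add_distrib]
    have e1 : ∀ (c d : ℕ), c < n → d < n → ∑ a ∈ Finset.range n, ∑ b ∈ Finset.range n,
        (if a = c then if b = d then (1 : ℤ) else 0 else 0) = 1 := by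
      intro c d hc hd
      rw [Finset.sum_eq_single c, Finset.sum_eq_single d]
      all_goals simp +contextual [hc, hd]
    rw [e1 _ _ (by omega) hi, e1 _ _ hi (by omega)]
    rfl
  have h2 := congrArg Multiplicative.toAdd (DFunLike.congr_fun this β)
  rw [MonoidHom.comp_apply, zpowGroupHom_apply, toAdd_zpow, smul_eq_mul] at h2
  exact h2

lemma perm_cs_left {i j k : ℕ} (h : i < j) (hk : k < n) : perm (cs j k : B n) i = i := by
  induction k with
  | zero => simp [cs]
  | succ k ih =>
    by_cases hj : j ≤ k
    · rw [cs_succ hj, map_mul, Perm.mul_apply, ih (by omega), perm_s (by omega),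
        swap_apply_of_ne_of_ne (by omega) (by omega)]
    · rw [cs_of_ge (by omega)]; simp

lemma lk_A {j k : ℕ} (h : j < k) (hk : k < n) (a b : ℕ) :
    lk (A j k : B n) a b = if (a = j ∧ b = k) ∨ (a = k ∧ b = j) then 2 else 0 := by
  rw [A_eq_cs h, lk_conj (mem_P.2 (perm_s_sq _)), pow_two, lk_mul, lk_s (by omega),
    lk_s (by omega), perm_s (by omega), swap_inv]
  have h1 : (perm (cs (j + 1) k : B n)) j = j := perm_cs_left (by omega) hk
  have h2 : (perm (cs (j + 1) k : B n)) (j + 1) = k := perm_cs (by omega) hk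
  generalize perm (cs (j + 1) k : B n) = π at *
  have h3 : ∀ c d, ind j (swap j (j + 1) c) (swap j (j + 1) d) = ind j c d := fun c d => by
    unfold ind
    rw [← swap_inv, pairInd_perm, swap_apply_left, swap_apply_right, pairInd_swap]
  rw [h3]
  unfold ind
  rw [pairInd_perm, h1, h2]
  unfold pairInd
  grind

lemma lk_ι {j k : ℕ} (h : j < k) (hk : k < n) (u : F) :
    lk (ι k u : B n) j k = 2 * (cnt j u).toAdd := by
  let f : F →* Multiplicative ℤ :=
    ⟨⟨fun u => .ofAdd (lk (ι k u : B n) j k), by rw [map_one, lk_one]; rfl⟩,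
      fun u v => congrArg Multiplicative.ofAdd (by
        rw [map_mul, lk_mul_P (ι_mem_P k u)] :
          lk (ι k (u * v) : B n) j k = lk (ι k u : B n) j k + lk (ι k v : B n) j k)⟩
  have : f = (zpowGroupHom 2).comp (cnt j) := by
    ext i
    change lk (ι k (y i) : B n) j k = ((cnt j (y i)) ^ (2 : ℤ)).toAdd
    rw [ι_y, cnt_y]
    by_cases hi : i < k
    · rw [lk_A hi hk]; split_ifs <;> first | rfl | omega
    · rw [A_of_ge (by omega), lk_one, if_neg (by omega)]; rfl
  have h2 := congrArg Multiplicative.toAdd (DFunLike.congr_fun this u)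
  rw [MonoidHom.comp_apply, zpowGroupHom_apply, toAdd_zpow, smul_eq_mul] at h2
  exact h2

lemma lk_ι_of_ne {a b k : ℕ} (ha : a ≠ k) (hb : b ≠ k) (hk : k < n) (u : F) :
    lk (ι k u : B n) a b = 0 := by
  induction u using FreeGroup.induction_on with
  | C1 => rw [map_one, lk_one]
  | of i =>
    change lk (ι k (y i) : B n) a b = 0
    rw [ι_y]
    by_cases hi : i < k
    · rw [lk_A hi hk, if_neg (by omega)]
    · rw [A_of_ge (by omega), lk_one]
  | inv_of i h => rw [map_inv, lk_inv_P (ι_mem_P _ _), h, neg_zero]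
  | mul u v hu hv => rw [map_mul, lk_mul_P (ι_mem_P _ _), hu, hv, add_zero]

lemma lk_fg {k : ℕ} {β : B n} (hβ : β ∈ P n) {a b : ℕ} (ha : a < k) (hb : b < k) :
    lk (fg k β) a b = lk β a b := by
  rcases le_total n k with h | h
  · rw [fg_of_mem (Bk_mono h (mem_Bk β))]
  induction h using Nat.decreasingInduction with
  | self => rw [fg_top]
  | of_succ k hk ih =>
    rw [← ih (by omega) (by omega)]
    obtain ⟨u, -, h⟩ := fg_succ hk hβ
    rw [h, lk_mul_P (ι_mem_P _ _), lk_ι_of_ne (by omega) (by omega) hk, zero_add]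

end Braid

namespace Braid
variable {n : ℕ}

/-- The product of the first `m` letters. -/
def X : ℕ → F
  | 0 => 1
  | m + 1 => X m * y m

lemma X_zero : X 0 = 1 := rfl

lemma X_succ (m : ℕ) : X (m + 1) = X m * y m := rfl

lemma hom_eq_of_keep {G : Type*} [Group G] {f g : F →* G} {p : ℕ → Prop} {x : F}
    (hx : keep p x = x) (h : ∀ j, p j → f (y j) = g (y j)) : f x = g x :=
  map_mem_closure_of_keep hx ((f.prod g)) (MonoidHom.eqLocus (MonoidHom.fst G G) (MonoidHom.snd G G)) h

lemma ret_X {k m : ℕ} (h : m ≤ k) : ret k (X m) = X m := by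
  induction m with
  | zero => rw [X_zero, map_one]
  | succ m ih => rw [X_succ, map_mul, ih (by omega), ret_y h]

lemma cnt_X (i m : ℕ) : cnt i (X m) = if i < m then Multiplicative.ofAdd 1 else 1 := by
  induction m with
  | zero => simp [X]
  | succ m ih =>
    rw [X_succ, map_mul, ih, cnt_y]
    split_ifs <;> first | omega | simp

/-- The automorphism of `F` multiplying the first letter by the following ones. -/
noncomputable def shear (c : F) (hc : kill 0 c = c) : F ≃* F := by
  let f (c : F) : F →* F := FreeGroup.lift fun j => if j = 0 then y 0 * c else y j
  have hf : ∀ d c : F, kill 0 c = c → f d c = c := fun d c hc =>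
    hom_eq_of_keep (g := MonoidHom.id F) hc fun j hj => by simp [f, hj]
  have key : ∀ c : F, kill 0 c = c → (f c).comp (f c⁻¹) = MonoidHom.id F := fun c hc => by
    ext j
    by_cases h : j = 0
    · subst h
      change f c (f c⁻¹ (y 0)) = y 0
      have h1 : ∀ d, f d (y 0) = y 0 * d := fun d => by simp [f]
      rw [h1, map_mul, h1, map_inv, hf c c hc, mul_inv_cancel_right]
    · simp [f, h]
  exact MonoidHom.toMulEquiv (f c) (f c⁻¹) (by
    have := key c⁻¹ (by rw [map_inv, hc])
    rwa [inv_inv] at this) (key c hc)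

lemma shear_y (c : F) (hc : kill 0 c = c) : shear c hc (y 0) = y 0 * c := by
  simp [shear]

lemma mem_zpowers_X {m : ℕ} (hm : 0 < m) {N : ℤ} (hN : N ≠ 0) {g : F} (h : Commute (X m ^ N) g) :
    g ∈ Subgroup.zpowers (X m) := by
  have h1 : ∀ m, 0 < m → ∃ c, kill 0 c = c ∧ X m = y 0 * c := by
    intro m hm
    induction m, hm using Nat.le_induction with
    | base => exact ⟨1, map_one _, by simp [X]⟩
    | succ m hm ih =>
      obtain ⟨c, hc, h⟩ := ih
      have : kill 0 (y m) = y m := keep_of (p := (· ≠ 0)) (by omega)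
      exact ⟨c * y m, by rw [map_mul, hc, this], by rw [X_succ, h, mul_assoc]⟩
  obtain ⟨c, hc, hX⟩ := h1 m hm
  rw [hX, ← shear_y c hc] at h ⊢
  have h2 := h.map (shear c hc).symm
  rw [map_zpow, MulEquiv.symm_apply_apply] at h2
  obtain ⟨a, ha⟩ := mem_zpowers_of_commute hN h2
  refine ⟨a, ?_⟩
  have := congrArg (shear c hc) ha
  simpa using this

lemma art_X {k : ℕ} (hk : k ≤ n) {b : B n} (hb : b ∈ Bk n k) : art b (X k) = X k := by
  induction hb using Subgroup.closure_induction with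
  | mem b hb =>
    obtain ⟨i, hi, rfl⟩ := hb
    induction k, hi using Nat.le_induction with
    | base =>
      have h0 : art (s i : B n) (X i) = X i := by
        refine hom_eq_of_keep (f := (art (s i : B n)).toMonoidHom) (g := MonoidHom.id F)
          (p := (· < i)) (ret_X le_rfl) fun j hj => ?_
        change art (s i) (y j) = y j
        rw [art_s (by omega), artGen_ne (by omega) (by omega)]
      rw [X_succ, X_succ, map_mul, map_mul, h0, art_s (by omega), artGen_self, artGen_succ]
      group
    | succ k hi ih =>
      rw [X_succ, map_mul, ih (by omega), art_fix (s_mem_Bk hi) le_rfl]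
  | one => simp
  | mul a b _ _ ha hb => rw [map_mul, MulAut.mul_apply, hb, ha]
  | inv b _ hb => rw [map_inv, MulAut.inv_apply, MulEquiv.symm_apply_eq, hb]

lemma commute_ι_X {k : ℕ} (hk : k < n) {b : B n} (hb : b ∈ Bk n k) : Commute b (ι k (X k)) := by
  have := conj_ι hk hb (X k)
  rw [art_X hk.le hb] at this
  exact mul_inv_eq_iff_eq_mul.1 this

/-- The full twist on the first `k` strands. -/
def D : ℕ → B n
  | 0 => 1
  | k + 1 => D k * ι k (X k)

lemma D_succ (k : ℕ) : (D (k + 1) : B n) = D k * ι k (X k) := rfl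

lemma D_one : (D 1 : B n) = 1 := by rw [D_succ, X_zero, map_one]; simp [D]

lemma D_mem_Bk (k : ℕ) : (D k : B n) ∈ Bk n k := by
  induction k with
  | zero => exact one_mem _
  | succ k ih => exact mul_mem (Bk_mono (by omega) ih) (ι_mem_Bk (by omega) _)

lemma D_mem_P (k : ℕ) : (D k : B n) ∈ P n := by
  induction k with
  | zero => exact one_mem _
  | succ k ih => exact mul_mem ih (ι_mem_P _ _)

lemma ι_succ_conj {k : ℕ} {u : F} (hu : ret k u = u) :
    (ι (k + 1) u : B n) = s k * ι k u * (s k)⁻¹ :=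
  hom_eq_of_keep (f := (ι (k + 1) : F →* B n))
    (g := (MulAut.conj (s k : B n)).toMonoidHom.comp (ι k)) hu fun j hj => by
    change (ι (k + 1) (y j) : B n) = s k * ι k (y j) * (s k)⁻¹
    rw [ι_y, ι_y, A_succ (by omega)]

lemma commute_D {k : ℕ} (hk : k ≤ n) {b : B n} (hb : b ∈ Bk n k) : Commute (D k) b := by
  induction k generalizing b with
  | zero => exact Commute.one_left _
  | succ k ih =>
    induction hb using Subgroup.closure_induction with
    | one => exact Commute.one_right _
    | mul a b _ _ ha hb => exact ha.mul_right hb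
    | inv b _ hb => exact hb.inv_right
    | mem b hb =>
      obtain ⟨i, hi, rfl⟩ := hb
      by_cases h : i + 1 < k
      · have := s_mem_Bk (n := n) h
        exact (ih (by omega) this).mul_left (commute_ι_X hk this).symm
      · obtain rfl : k = i + 1 := by omega
        have h1 : Commute (D i : B n) (s i) := (commute_s_Bk le_rfl (D_mem_Bk i)).symm
        have h2 : (ι (i + 1) (X (i + 1)) : B n) = s i * ι i (X i) * s i := by
          rw [X_succ, map_mul, ι_succ_conj (ret_X le_rfl), ι_y, A_self]; group
        have h3 : Commute (ι i (X i) : B n) (ι (i + 1) (X (i + 1))) :=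
          commute_ι_X hk (ι_mem_Bk (by omega) _)
        rw [D_succ, D_succ, mul_assoc]
        refine h1.mul_left ?_
        rw [h2] at h3 ⊢
        generalize (ι i (X i) : B n) = x at *
        generalize (s i : B n) = s at *
        have h4 : x * (s * x * s) = s * x * s * x := h3
        change x * (s * x * s) * s = s * (x * (s * x * s))
        conv_lhs => rw [h4]
        simp only [mul_assoc]

lemma commute_D_top (b : B n) : Commute (D n) b := commute_D le_rfl (mem_Bk b)

lemma D_zpow_succ {k : ℕ} (hk : k < n) (c : ℤ) :
    (D (k + 1) : B n) ^ c = D k ^ c * ι k (X k ^ c) := by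
  rw [D_succ, (commute_ι_X hk (D_mem_Bk k)).mul_zpow, map_zpow]

lemma conj_D {k : ℕ} (hk : k < n) (N : ℤ) (u : F) :
    (D k : B n) ^ N * ι k u * (D k ^ N)⁻¹ = ι k ((X k ^ N)⁻¹ * u * X k ^ N) := by
  have h1 := ((commute_D (n := n) hk (ι_mem_Bk (Nat.lt_succ_self k) u)).zpow_left N).eq
  have h2 := ((commute_ι_X hk (D_mem_Bk k)).zpow_right N).zpow_left N
  rw [D_zpow_succ hk] at h1
  simp only [map_mul, map_inv, map_zpow] at h1 ⊢
  have h2 : (D k : B n) ^ N * ι k (X k) ^ N = ι k (X k) ^ N * D k ^ N := h2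
  rw [mul_inv_eq_iff_eq_mul, mul_assoc, mul_assoc, eq_inv_mul_iff_mul_eq, ← mul_assoc, ← h2, h1,
    h2]

lemma art_D {r : ℕ} (hr : r < n) (N : ℤ) {j : ℕ} (hj : j < r) :
    art ((D r : B n) ^ N) (y j) = (X r ^ N)⁻¹ * y j * X r ^ N := by
  have h1 := conj_D hr N (y j)
  have hm : (D r : B n) ^ N ∈ Bk n r := zpow_mem (D_mem_Bk r) N
  rw [conj_ι hr hm] at h1
  have h2 := ret_inj hr h1
  rw [ret_art hm] at h2
  simpa [ret_y hj, ret_X le_rfl] using h2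

lemma conj_D_succ {r : ℕ} (hr : r + 1 < n) (N : ℤ) (u : F) :
    (D r : B n) ^ N * ι (r + 1) u * (D r ^ N)⁻¹ = ι (r + 1) (tw r (X r ^ (-N)) u) := by
  have hm : (D r : B n) ^ N ∈ Bk n r := zpow_mem (D_mem_Bk r) N
  rw [conj_ι hr (Bk_mono (by omega) hm)]
  have : (ι (r + 1) : F →* B n).comp (art ((D r : B n) ^ N)).toMonoidHom =
      (ι (r + 1)).comp (tw r (X r ^ (-N))) := by
    ext j
    change (ι (r + 1) (art ((D r : B n) ^ N) (y j)) : B n) = ι (r + 1) (tw r (X r ^ (-N)) (y j))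
    rcases lt_trichotomy j r with h | rfl | h
    · rw [art_D (by omega) N h, tw_ne _ (by omega)]; simp
    · rw [art_fix hm le_rfl, tw_self]
    · rw [art_fix hm h.le, tw_ne _ (by omega)]
      rw [map_mul, map_mul, ι_y, A_of_ge (by omega)]; simp
  exact DFunLike.congr_fun this u

lemma fg_D {m k : ℕ} (h : m ≤ k) (hk : k ≤ n) : fg m (D k : B n) = D m := by
  induction k, h using Nat.le_induction with
  | base => exact fg_of_mem (D_mem_Bk m)
  | succ k h ih =>
    rw [D_succ, fg_mul (P_le_Hs m (D_mem_P k)) (ι_mem_Hs hk h _), ih (by omega), fg_ι hk h, mul_one]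

lemma lk_D {i j m : ℕ} (hij : i < j) (hj : j < m) (hm : m ≤ n) : lk (D m : B n) i j = 2 := by
  induction m with
  | zero => omega
  | succ m ih =>
    rw [D_succ, lk_mul_P (D_mem_P m)]
    by_cases h : j = m
    · subst h
      rw [lk_comm, lk_Bk (D_mem_Bk j) le_rfl, lk_ι hij hm, cnt_X, if_pos hij]; rfl
    · rw [ih (by omega) (by omega), lk_ι_of_ne (by omega) h hm]; rfl

lemma ee_A {j k : ℕ} (h : j < k) (hk : k < n) : ee (A j k : B n) = 2 := by
  rw [A_eq_cs h, ee_conj, ee_pow, ee_s (by omega)]; rfl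

lemma ee_D {m : ℕ} (hm : m ≤ n) : (ee (D m : B n)) = m * (m - 1) := by
  induction m with
  | zero => simp [D, ee_one]
  | succ m ih =>
    have : ∀ r, r ≤ m → ee (ι m (X r) : B n) = 2 * r := by
      intro r hr
      induction r with
      | zero => rw [X_zero, map_one, ee_one]; rfl
      | succ r ihr => rw [X_succ, map_mul, ee_mul, ihr (by omega), ι_y, ee_A hr hm]; push_cast; ring
    rw [D_succ, ee_mul, ih (by omega), this m le_rfl]; push_cast; ring

lemma ee_D_ne_zero (hn : 2 ≤ n) : ee (D n : B n) ≠ 0 := by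
  rw [ee_D le_rfl]
  have : (2 : ℤ) ≤ n := by exact_mod_cast hn
  exact mul_ne_zero (by omega) (by omega)

lemma Bk_le_one {k : ℕ} (h : k ≤ 1) {β : B n} (hβ : β ∈ Bk n k) : β = 1 := by
  rw [← Subgroup.mem_bot]
  refine (Subgroup.closure_le _).2 ?_ hβ
  rintro _ ⟨i, hi, -⟩; omega

/-- A pure braid commuting with nontrivial powers of the standard generators is a power of the
full twist. -/
lemma mem_zpowers_D {m : ℕ} (hm : m ≤ n) {N : ℤ} (hN : N ≠ 0) {g : B n} (hg : g ∈ Bk n m)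
    (hP : g ∈ P n) (h : ∀ i j, i < j → j < m → Commute (A i j ^ N) g) :
    g ∈ Subgroup.zpowers (D m : B n) := by
  induction m generalizing g with
  | zero => rw [Bk_le_one (by omega) hg]; exact one_mem _
  | succ k ih =>
    obtain ⟨u, b, hb, hbP, rfl⟩ := pure_decomp hm hg hP
    have hfg : fg k (ι k u * b) = b := by
      rw [fg_mul (ι_mem_Hs hm le_rfl u) (Bk_le_Hs k hb), fg_ι hm le_rfl, one_mul, fg_of_mem hb]
    obtain ⟨c, rfl⟩ := ih (by omega) hb hbP fun i j hij hj => by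
      have h1 : (A i j ^ N : B n) ∈ Bk n k := zpow_mem (A_mem_Bk hj) N
      have h2 := congrArg (fg k) (h i j hij (by omega)).eq
      have h3 : (ι k u * b : B n) ∈ Hs n k := P_le_Hs k hP
      rwa [fg_mul (Bk_le_Hs k h1) h3, fg_mul h3 (Bk_le_Hs k h1), hfg, fg_of_mem h1] at h2
    have e : ∃ v, ret k v = v ∧ ι k u * (D k : B n) ^ c = ι k v * D (k + 1) ^ c := by
      refine ⟨ret k (u * (X k ^ c)⁻¹), ret_ret le_rfl _, ?_⟩
      rw [ι_ret, D_zpow_succ hm, map_mul, map_inv, mul_assoc]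
      congr 1
      have h2 := ((commute_ι_X hm (D_mem_Bk k)).zpow_right c).zpow_left c
      rw [map_zpow]
      have h2 : (D k : B n) ^ c * ι k (X k) ^ c = ι k (X k) ^ c * D k ^ c := h2
      rw [h2, inv_mul_cancel_left]
    obtain ⟨v, hv, e⟩ := e
    change ι k u * (D k : B n) ^ c ∈ _
    have h' : ∀ i j, i < j → j < k + 1 → Commute (A i j ^ N) (ι k u * (D k : B n) ^ c) := h
    rw [e] at h' ⊢
    refine mul_mem ?_ (zpow_mem (Subgroup.mem_zpowers _) c)
    have hc : ∀ j, j < k → Commute (y j ^ N) v := fun j hj => by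
      have h1 := (h' j k hj (by omega))
      have h2 := (commute_D hm (A_mem_Bk (n := n) (j := j) (Nat.lt_succ_self k))).zpow_left c
      have h3 : Commute (A j k ^ N) (ι k v : B n) := by
        have := h1.mul_right ((h2.symm.zpow_left N).inv_right)
        rwa [mul_inv_cancel_right] at this
      rw [← ι_y, ← map_zpow] at h3
      have h4 : (ι k (y j ^ N * v) : B n) = ι k (v * y j ^ N) := by
        rw [map_mul, map_mul]; exact h3
      have h5 := ret_inj hm h4
      rwa [map_mul, map_mul, map_zpow, ret_y hj, hv] at h5
    rcases Nat.lt_or_ge k 2 with hk | hk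
    · rcases Nat.lt_or_ge k 1 with hk1 | hk1
      · obtain rfl : k = 0 := by omega
        have h1 := Bk_le_one le_rfl (ι_mem_Bk (n := n) Nat.zero_lt_one v)
        rw [zero_add, D_one]
        exact ⟨0, by simpa using h1.symm⟩
      · obtain rfl : k = 1 := by omega
        obtain ⟨a, rfl⟩ := mem_zpowers_of_commute hN (hc 0 (by omega))
        refine ⟨a, ?_⟩
        change (D (1 + 1) : B n) ^ a = ι 1 (y 0 ^ a)
        rw [D_zpow_succ hm, D_one, one_zpow, one_mul]
        simp [X]
    · obtain ⟨a, ha⟩ := mem_zpowers_of_commute hN (hc 0 (by omega))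
      obtain ⟨a', ha'⟩ := mem_zpowers_of_commute hN (hc 1 (by omega))
      have ha : y 0 ^ a = v := ha
      have ha' : y 1 ^ a' = v := ha'
      have h1 := congrArg (cnt 0) (ha.trans ha'.symm)
      rw [map_zpow, map_zpow, cnt_y, cnt_y, if_pos rfl, if_neg (by omega), one_zpow,
        ← ofAdd_zsmul] at h1
      have : a = 0 := by simpa using h1
      rw [← ha, this, zpow_zero, map_one]
      exact one_mem _

lemma P_le_of_A {H : Subgroup (B n)} (h : ∀ j k, j < k → k < n → A j k ∈ H) : P n ≤ H := by
  have key : ∀ m, m ≤ n → ∀ β ∈ Bk n m, β ∈ P n → β ∈ H := by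
    intro m hm
    induction m with
    | zero => intro β hβ _; rw [Bk_le_one (by omega) hβ]; exact one_mem _
    | succ k ih =>
      intro β hβ hP
      obtain ⟨u, b, hb, hbP, rfl⟩ := pure_decomp hm hβ hP
      refine mul_mem ?_ (ih (by omega) b hb hbP)
      rw [← ι_ret]
      refine map_mem_closure_of_keep (p := (· < k)) (ret_ret le_rfl u) (ι k) H fun j hj => ?_
      change ι k (y j) ∈ H
      rw [ι_y]; exact h j k hj hm
  exact fun β hβ => key n le_rfl β (mem_Bk β) hβ

end Braid

namespace Braid
variable {n : ℕ}

/-- The homomorphism killing the first `a` letters and shifting the other ones down. -/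
def Q (a : ℕ) : F →* F := FreeGroup.lift fun j => if j < a then 1 else y (j - a)

lemma Q_lt {a j : ℕ} (h : j < a) : Q a (y j) = 1 := by simp [Q, h]

lemma Q_ge {a j : ℕ} (h : a ≤ j) : Q a (y j) = y (j - a) := by simp [Q, not_lt.2 h]

lemma Q_zero (u : F) : Q 0 u = u := by
  have : Q 0 = MonoidHom.id F := by ext j; exact Q_ge (Nat.zero_le j)
  rw [this]; rfl

lemma Q_Q (a b : ℕ) (u : F) : Q a (Q b u) = Q (b + a) u := by
  have : (Q a).comp (Q b) = Q (b + a) := by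
    ext j
    change Q a (Q b (y j)) = Q (b + a) (y j)
    by_cases h : j < b
    · rw [Q_lt h, Q_lt (by omega), map_one]
    · rw [Q_ge (by omega)]
      by_cases h' : j - b < a
      · rw [Q_lt h', Q_lt (by omega)]
      · rw [Q_ge (by omega), Q_ge (by omega)]; congr 1; omega
  exact DFunLike.congr_fun this u

lemma Q_X {a m : ℕ} (h : m ≤ a) : Q a (X m) = 1 := by
  induction m with
  | zero => rw [X_zero, map_one]
  | succ m ih => rw [X_succ, map_mul, ih (by omega), Q_lt h, mul_one]

/-- The embedding of the free group on two letters with image generated by `X r` and `y r`. -/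
def η (r : ℕ) : F →* F := FreeGroup.lift fun j => if j = 0 then X r else if j = 1 then y r else 1

lemma η_zero (r : ℕ) : η r (y 0) = X r := by simp [η]

lemma η_one (r : ℕ) : η r (y 1) = y r := by simp [η]

lemma η_Q {a : ℕ} {v : F} (hv : v ∈ Subgroup.closure {X (a + 1), y (a + 1)}) :
    η (a + 1) (Q a v) = v := by
  induction hv using Subgroup.closure_induction with
  | mem v hv =>
    rcases hv with rfl | rfl
    · rw [X_succ, map_mul, Q_X le_rfl, Q_ge le_rfl, one_mul, Nat.sub_self, η_zero, X_succ]
    · rw [Q_ge (by omega), Nat.add_sub_cancel_left, η_one]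
  | one => simp
  | mul u v _ _ hu hv => rw [map_mul, map_mul, hu, hv]
  | inv u _ hu => rw [map_inv, map_inv, hu]

lemma X_mem_closure (r : ℕ) : X r ∈ Subgroup.closure {X r, y r} :=
  Subgroup.subset_closure (by simp)

lemma y_mem_closure (r : ℕ) : y r ∈ Subgroup.closure {X r, y r} :=
  Subgroup.subset_closure (by simp)

lemma isConj_of_Q {a : ℕ} {w v t : F} (hv : v ∈ Subgroup.closure {X (a + 1), y (a + 1)})
    (h : IsConj w v) (ht : t ∈ Subgroup.closure {X (a + 1), y (a + 1)})
    (h2 : IsConj (Q a w) (Q a t)) : IsConj w t := by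
  have h3 := ((Q a).map_isConj h.symm).trans h2
  have h4 := (η (a + 1)).map_isConj h3
  rw [η_Q hv, η_Q ht] at h4
  exact h.trans h4

lemma eq_one_of_Q {a c : ℕ} {v : F} (hv : v ∈ Subgroup.closure {X (a + 1), y (a + 1)})
    (hc : c ≤ a) (h : Q c v = 1) : v = 1 := by
  obtain ⟨d, rfl⟩ := Nat.exists_eq_add_of_le hc
  rw [← η_Q hv, ← Q_Q, h, map_one, map_one]

lemma kill_of_ret {r : ℕ} {x : F} (h : ret r x = x) : kill r x = x :=
  keep_of_imp (fun l (h : l < r) => by omega) h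

/-- The braid moving the first strand to the last position. -/
def sh : B n := cs 0 (n - 1)

lemma sh_s {i : ℕ} (h : i + 2 < n) : (sh : B n) * s (i + 1) * sh⁻¹ = s i := by
  rw [mul_inv_eq_iff_eq_mul]
  exact cs_mul_s (Nat.zero_le i) (by omega) (by omega)

lemma sh_A {j k : ℕ} (h : k + 1 < n) : (sh : B n) * A (j + 1) (k + 1) * sh⁻¹ = A j k := by
  induction k with
  | zero => rw [A_of_ge (by omega), A_of_ge (by omega)]; group
  | succ k ih =>
    by_cases hjk : j = k
    · subst hjk
      rw [A_self, A_self, ← sh_s h, conj_pow]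
    · rw [A_succ (by omega), A_succ hjk, ← ih (by omega), ← sh_s h]; group

lemma sh_cs {j k : ℕ} (h : k + 1 < n) : (sh : B n) * cs (j + 1) (k + 1) * sh⁻¹ = cs j k := by
  induction k with
  | zero => rw [cs_of_ge (by omega), cs_of_ge (by omega)]; group
  | succ k ih =>
    by_cases hjk : j ≤ k
    · rw [cs_succ (by omega), cs_succ hjk, ← ih (by omega), ← sh_s h]; group
    · rw [cs_of_ge (by omega), cs_of_ge (by omega)]; group

lemma sh_A_zero {k : ℕ} (h : k + 1 < n) :
    (sh : B n) * A 0 (k + 1) * sh⁻¹ = ι (n - 1) (art (cs 0 k : B n) (y 0)) := by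
  have h0 : (sh : B n) * s 0 ^ 2 * sh⁻¹ = A 0 (n - 1) := by
    rw [A_eq_cs (by omega), sh, cs_left (by omega)]; group
  have hc : (cs 0 k : B n) ∈ Bk n (n - 1) := cs_mem_Bk (by omega)
  rw [A_eq_cs (by omega), ← conj_ι (by omega) hc, ι_y, ← h0, ← sh_cs h]
  group

lemma conj_mem_P (g : B n) {β : B n} (h : β ∈ P n) : g * β * g⁻¹ ∈ P n :=
  Subgroup.Normal.conj_mem (MonoidHom.normal_ker _) β h g

lemma fg_mul_P {β γ : B n} (hβ : β ∈ P n) (hγ : γ ∈ P n) (k : ℕ) :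
    fg k (β * γ) = fg k β * fg k γ := fg_mul (P_le_Hs k hβ) (P_le_Hs k hγ)

lemma fg_inv_P {β : B n} (hβ : β ∈ P n) (k : ℕ) : fg k β⁻¹ = (fg k β)⁻¹ := fg_inv (P_le_Hs k hβ)

lemma fg_conj_P {g β : B n} (hg : g ∈ P n) (hβ : β ∈ P n) (k : ℕ) :
    fg k (g * β * g⁻¹) = fg k g * fg k β * (fg k g)⁻¹ := by
  rw [fg_mul_P (mul_mem hg hβ) (inv_mem hg), fg_mul_P hg hβ, fg_inv_P hg]

lemma conj_mul (g β γ : B n) : g * (β * γ) * g⁻¹ = (g * β * g⁻¹) * (g * γ * g⁻¹) := by group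

lemma fg_sh_ι {k m : ℕ} (hm : m + 1 ≤ n) (hk : k + 1 < n) (u : F) :
    fg m (sh * ι (k + 1) u * sh⁻¹ : B n) = fg m (ι k (Q 1 u)) := by
  induction u using FreeGroup.induction_on with
  | C1 => simp
  | of j =>
    change fg m (sh * ι (k + 1) (y j) * sh⁻¹ : B n) = fg m (ι k (Q 1 (y j)))
    cases j with
    | zero =>
      rw [ι_y, sh_A_zero hk, fg_ι (by omega) (by omega), Q_lt (by omega), map_one, fg_one]
    | succ j => rw [ι_y, sh_A hk, Q_ge (by omega), ι_y]; rfl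
  | inv_of j h =>
    rw [map_inv, map_inv, map_inv, ← conj_inv, fg_inv_P (conj_mem_P _ (ι_mem_P _ _)), h,
      ← fg_inv_P (ι_mem_P _ _)]
  | mul u v hu hv =>
    rw [map_mul, map_mul, map_mul, conj_mul, fg_mul_P (conj_mem_P _ (ι_mem_P _ _))
      (conj_mem_P _ (ι_mem_P _ _)), hu, hv, fg_mul_P (ι_mem_P _ _) (ι_mem_P _ _)]

lemma fg_sh {k : ℕ} (hk : k + 1 ≤ n) {β : B n} (hβ : β ∈ P n) :
    fg k (sh * fg (k + 1) β * sh⁻¹) = fg k (sh * β * sh⁻¹) := by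
  have key : ∀ d, k + 1 + d ≤ n →
      fg k (sh * fg (k + 1 + d) β * sh⁻¹) = fg k (sh * fg (k + 1) β * sh⁻¹) := by
    intro d
    induction d with
    | zero => intro _; rfl
    | succ d ih =>
      intro hd
      rw [← ih (by omega)]
      obtain ⟨u, -, h⟩ := fg_succ (k := k + 1 + d) (by omega) hβ
      rw [← add_assoc, h, conj_mul, fg_mul_P (conj_mem_P _ (ι_mem_P _ _))
        (conj_mem_P _ (fg_mem_P hβ _)), show k + 1 + d = k + d + 1 by omega,
        fg_sh_ι hk (by omega), fg_ι (by omega) (by omega), one_mul]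
  have := key (n - (k + 1)) (by omega)
  rw [show k + 1 + (n - (k + 1)) = n by omega, fg_top] at this
  exact this.symm

lemma conj_pow_succ (g β : B n) (r : ℕ) :
    g ^ (r + 1) * β * (g ^ (r + 1))⁻¹ = g * (g ^ r * β * (g ^ r)⁻¹) * g⁻¹ := by
  rw [pow_succ']; group

lemma fg_sh_pow {a r : ℕ} (h : a + r ≤ n) {β : B n} (hβ : β ∈ P n) :
    fg a (sh ^ r * fg (a + r) β * (sh ^ r)⁻¹) = fg a (sh ^ r * β * (sh ^ r)⁻¹) := by
  induction r generalizing a with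
  | zero => simpa using fg_fg_P le_rfl hβ
  | succ r ih =>
    rw [conj_pow_succ, conj_pow_succ, ← fg_sh (by omega) (conj_mem_P _ hβ),
      ← fg_sh (by omega) (conj_mem_P _ (fg_mem_P hβ _)), ← ih (by omega),
      show a + (r + 1) = a + 1 + r by omega]

lemma fg_sh_pow_ι {a r : ℕ} (h : a + r < n) (u : F) :
    fg (a + 1) (sh ^ r * ι (a + r) u * (sh ^ r)⁻¹ : B n) = ι a (Q r u) := by
  induction r generalizing a with
  | zero => simpa [Q_zero] using fg_of_mem (ι_mem_Bk (by omega) u)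
  | succ r ih =>
    rw [conj_pow_succ, ← fg_sh (by omega) (conj_mem_P _ (ι_mem_P _ _)),
      show a + (r + 1) = a + 1 + r by omega, ih (by omega), fg_sh_ι (by omega) (by omega), Q_Q,
      fg_of_mem (ι_mem_Bk (by omega) _)]

/-- Conjugation by `s r` and forgetting strand `r + 1` kills the letter `r` of a push. -/
lemma fg_s_ι {r : ℕ} (h : r + 1 < n) (u : F) :
    fg (r + 1) ((s r)⁻¹ * ι (r + 1) u * s r : B n) = ι r (kill r u) := by
  have hc : ∀ v, ((s r)⁻¹ * v * s r : B n) = (s r)⁻¹ * v * (s r)⁻¹⁻¹ := fun v => by rw [inv_inv]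
  rw [hc]
  induction u using FreeGroup.induction_on with
  | C1 => simpa using fg_one _
  | of j =>
    change fg (r + 1) ((s r)⁻¹ * ι (r + 1) (y j) * (s r)⁻¹⁻¹ : B n) = ι r (kill r (y j))
    rcases lt_trichotomy j r with hj | rfl | hj
    · rw [ι_y, A_succ (by omega), show kill r (y j) = y j from keep_of (p := (· ≠ r)) (by omega),
        ι_y, ← fg_of_mem (A_mem_Bk (n := n) (j := j) (Nat.lt_succ_self r))]
      congr 1; simp only [inv_inv]
      rw [fg_of_mem (A_mem_Bk (Nat.lt_succ_self r))]; group
    · rw [show kill j (y j) = 1 from keep_of_not (p := (· ≠ j)) (by omega), map_one]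
      have : ((s j)⁻¹ * ι (j + 1) (y j) * (s j)⁻¹⁻¹ : B n) = ι (j + 1) (y j) := by
        rw [ι_y, A_self]; group
      rw [this, fg_ι h le_rfl]
    · rw [ι_y, A_of_ge (by omega), show kill r (y j) = y j from keep_of (p := (· ≠ r)) (by omega),
        ι_y, A_of_ge (by omega), mul_one, mul_inv_cancel, fg_one]
  | inv_of j hj =>
    rw [map_inv, ← conj_inv, fg_inv_P (conj_mem_P _ (ι_mem_P _ _)), hj, map_inv, map_inv]
  | mul u v hu hv =>
    rw [map_mul, conj_mul, fg_mul_P (conj_mem_P _ (ι_mem_P _ _))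
      (conj_mem_P _ (ι_mem_P _ _)), hu, hv, map_mul, map_mul]

end Braid

namespace Braid
variable {n : ℕ}

/-- The pure braids with zero exponent sum. -/
def J (n : ℕ) : Subgroup (B n) := P n ⊓ expo.ker

lemma mem_J {β : B n} : β ∈ J n ↔ β ∈ P n ∧ ee β = 0 := Iff.rfl

lemma conj_mem_J (g : B n) {β : B n} (h : β ∈ J n) : g * β * g⁻¹ ∈ J n :=
  mem_J.2 ⟨conj_mem_P g h.1, by rw [ee_conj]; exact h.2⟩

/-- A surjective endomorphism of the commutator subgroup, compatible with permutations and extended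
arbitrarily to the braid group. -/
structure Auto (φ : B n → B n) : Prop where
  map_mul : ∀ {a b}, ee a = 0 → ee b = 0 → φ (a * b) = φ a * φ b
  ee_map : ∀ {a}, ee a = 0 → ee (φ a) = 0
  surj : ∀ {b}, ee b = 0 → ∃ a, ee a = 0 ∧ φ a = b
  perm_map : ∀ {a}, ee a = 0 → perm (φ a) = perm a

/-- A surjective endomorphism of the commutator subgroup compatible with permutations and linking
numbers, extended arbitrarily to the braid group. -/
structure Nice (φ : B n → B n) : Prop extends Auto φ where
  lk_map : ∀ {a}, a ∈ J n → ∀ i j, lk (φ a) i j = lk a i j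

lemma ee_conj_inv (c a : B n) : ee (c⁻¹ * a * c) = ee a := by rw [ee_mul, ee_mul, ee_inv]; ring

namespace Auto
variable {φ : B n → B n} (hφ : Auto φ)
include hφ

lemma map_one : φ 1 = 1 := by
  have := hφ.map_mul (a := 1) (b := 1) ee_one ee_one
  rwa [mul_one, left_eq_mul] at this

lemma map_inv {a : B n} (ha : ee a = 0) : φ a⁻¹ = (φ a)⁻¹ := by
  rw [eq_inv_iff_mul_eq_one, ← hφ.map_mul (by rw [ee_inv, ha]; rfl) ha, inv_mul_cancel, hφ.map_one]

lemma map_conj {a b : B n} (ha : ee a = 0) (hb : ee b = 0) :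
    φ (a * b * a⁻¹) = φ a * φ b * (φ a)⁻¹ := by
  rw [hφ.map_mul (by rw [ee_mul, ha, hb]; rfl) (by rw [ee_inv, ha]; rfl), hφ.map_mul ha hb,
    hφ.map_inv ha]

lemma map_commute {a b : B n} (ha : ee a = 0) (hb : ee b = 0) (h : Commute a b) :
    Commute (φ a) (φ b) := by
  have := hφ.map_mul ha hb
  rw [h.eq, hφ.map_mul hb ha] at this
  exact this.symm

lemma map_mem_P {a : B n} (ha : a ∈ J n) : φ a ∈ P n := by
  rw [mem_P, hφ.perm_map ha.2]; exact ha.1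

lemma conj (c : B n) : Auto fun a => c * φ (c⁻¹ * a * c) * c⁻¹ where
  map_mul {a b} ha hb := by
    rw [show c⁻¹ * (a * b) * c = (c⁻¹ * a * c) * (c⁻¹ * b * c) by group,
      hφ.map_mul (by rw [ee_conj_inv, ha]) (by rw [ee_conj_inv, hb])]
    group
  ee_map {a} ha := by rw [ee_conj, hφ.ee_map (by rw [ee_conj_inv, ha])]
  surj {b} hb := by
    obtain ⟨a, ha, h⟩ := hφ.surj (b := c⁻¹ * b * c) (by rw [ee_conj_inv, hb])
    refine ⟨c * a * c⁻¹, by rw [ee_conj, ha], ?_⟩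
    rw [show c⁻¹ * (c * a * c⁻¹) * c = a by group, h]; group
  perm_map {a} ha := by
    rw [_root_.map_mul, _root_.map_mul, hφ.perm_map (by rw [ee_conj_inv, ha])]
    simp only [_root_.map_mul, _root_.map_inv]
    group

lemma conj_left {g : B n} (hg : g ∈ P n) : Auto fun a => g⁻¹ * φ a * g where
  map_mul {a b} ha hb := by rw [hφ.map_mul ha hb]; group
  ee_map {a} ha := by rw [ee_conj_inv, hφ.ee_map ha]
  surj {b} hb := by
    obtain ⟨a, ha, h⟩ := hφ.surj (b := g * b * g⁻¹) (by rw [ee_conj, hb])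
    exact ⟨a, ha, by rw [h]; group⟩
  perm_map {a} ha := by
    rw [_root_.map_mul, _root_.map_mul, _root_.map_inv, mem_P.1 hg, hφ.perm_map ha]; simp

end Auto

namespace Nice
variable {φ : B n → B n} (hφ : Nice φ)
include hφ

lemma conj (c : B n) : Nice fun a => c * φ (c⁻¹ * a * c) * c⁻¹ where
  toAuto := hφ.toAuto.conj c
  lk_map {a} ha i j := by
    have h : c⁻¹ * a * c ∈ J n := by simpa using conj_mem_J c⁻¹ ha
    rw [lk_conj (hφ.map_mem_P h), hφ.lk_map h, ← lk_conj h.1]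
    congr 1; group

lemma conj_left {g : B n} (hg : g ∈ P n) : Nice fun a => g⁻¹ * φ a * g where
  toAuto := hφ.toAuto.conj_left hg
  lk_map {a} ha i j := by
    have := lk_conj (hφ.map_mem_P ha) g⁻¹ i j
    rw [inv_inv, _root_.map_inv, inv_inv, mem_P.1 hg] at this
    rw [this, ← hφ.lk_map ha]; rfl

end Nice

/-- The commutator map induces an inner automorphism on the first `k` strands. -/
def Inn (φ : B n → B n) (k : ℕ) : Prop :=
  ∃ g ∈ P n, ∀ h ∈ J n, fg k (φ h) = fg k (g * h * g⁻¹)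

lemma Inn.of_conj {φ : B n → B n} (hφ : Nice φ) {g : B n} (hg : g ∈ P n) {k : ℕ}
    (h : Inn (fun a => g⁻¹ * φ a * g) k) : Inn φ k := by
  obtain ⟨d, hd, h⟩ := h
  refine ⟨g * d, mul_mem hg hd, fun a ha => ?_⟩
  have h1 := h a ha
  have h2 : φ a = g * (g⁻¹ * φ a * g) * g⁻¹ := by group
  have h3 : g * d * a * (g * d)⁻¹ = g * (d * a * d⁻¹) * g⁻¹ := by group
  have h4 := hφ.map_mem_P ha
  rw [h2, h3, fg_conj_P hg (mul_mem (mul_mem (inv_mem hg) h4) hg),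
    fg_conj_P hg (conj_mem_P d ha.1), h1]

/-- A power of a braid corrected by a central element to have exponent sum zero. -/
def tl (β : B n) : B n := β ^ ee (D n : B n) * D n ^ (-ee β)

lemma ee_tl (β : B n) : ee (tl β) = 0 := by rw [tl, ee_mul, ee_zpow, ee_zpow]; ring

lemma tl_mem {β : B n} (h : β ∈ P n) : tl β ∈ J n :=
  mem_J.2 ⟨mul_mem (zpow_mem h _) (zpow_mem (D_mem_P n) _), ee_tl β⟩

lemma fg_zpow_P {β : B n} (h : β ∈ P n) (k : ℕ) (m : ℤ) : fg k (β ^ m) = fg k β ^ m :=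
  fg_zpow (P_le_Hs k h) m

lemma fg_tl {β : B n} (h : β ∈ P n) {k : ℕ} (hk : k ≤ n) :
    fg k (tl β) = fg k β ^ ee (D n : B n) * D k ^ (-ee β) := by
  rw [tl, fg_mul_P (zpow_mem h _) (zpow_mem (D_mem_P n) _), fg_zpow_P h, fg_zpow_P (D_mem_P n),
    fg_D hk le_rfl]

lemma commute_tl {β γ : B n} (h : Commute β γ) : Commute (tl β) γ :=
  (h.zpow_left _).mul_left ((commute_D_top γ).zpow_left _)

lemma commute_tl_tl {β γ : B n} (h : Commute β γ) : Commute (tl β) (tl γ) :=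
  commute_tl (commute_tl h.symm).symm

lemma isConj_art_of_ι {k : ℕ} (hk : k < n) {g : B n} (hg : g ∈ Bk n (k + 1)) (hP : g ∈ P n)
    {w t : F} (hw : ret k w = w) (ht : ret k t = t) (h : (ι k w : B n) = g * ι k t * g⁻¹) :
    ∃ b ∈ Bk n k, b ∈ P n ∧ IsConj w (art b t) := by
  obtain ⟨u, b, hb, hbP, rfl⟩ := pure_decomp hk hg hP
  refine ⟨b, hb, hbP, ?_⟩
  have h1 : (ι k w : B n) = ι k (u * art b t * u⁻¹) := by
    rw [h, map_mul, map_mul, ← conj_ι hk hb, map_inv]; group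
  have h2 := ret_inj hk h1
  rw [hw, map_mul, map_mul, ret_art hb, ht, map_inv] at h2
  rw [h2]
  exact (isConj_iff.2 ⟨ret k u, rfl⟩).symm

/-- If a map is inner on three strands, so are its shifts. -/
lemma isConj_Q {φ : B n → B n} (hφ : Nice φ) (h3 : ∀ φ : B n → B n, Nice φ → Inn φ 3) {a : ℕ}
    (ha : a + 2 < n) {h : B n} (hJ : h ∈ J n) {m : ℤ} {w t : F}
    (ht : fg (a + 3) h = ι (a + 2) t * D (a + 3) ^ m)
    (hw : fg (a + 3) (φ h) = ι (a + 2) w * D (a + 3) ^ m)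
    (hrw : ret (a + 2) w = w) (hrt : ret (a + 2) t = t) :
    ∃ b ∈ Bk n 2, b ∈ P n ∧ IsConj (Q a w) (art b (Q a t)) := by
  have h3n : 3 ≤ n := by omega
  obtain ⟨g, hg, hgh⟩ := h3 _ (hφ.conj (sh ^ a))
  have h1 := hgh (sh ^ a * h * (sh ^ a)⁻¹) (conj_mem_J _ hJ)
  have e0 : (sh ^ a)⁻¹ * (sh ^ a * h * (sh ^ a)⁻¹) * sh ^ a = h := by group
  simp only [e0] at h1
  have key : ∀ β ∈ P n, ∀ v, fg (a + 3) β = ι (a + 2) v * D (a + 3) ^ m →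
      fg 3 (sh ^ a * β * (sh ^ a)⁻¹) = ι 2 (Q a v) * D 3 ^ m := by
    intro β hβ v hv
    have hD : fg (3 + a) (D n ^ m : B n) = D (a + 3) ^ m := by
      rw [fg_zpow_P (D_mem_P n), fg_D (by omega) le_rfl, add_comm]
    rw [← fg_sh_pow (by omega) hβ, show 3 + a = a + 3 by omega, hv, conj_mul,
      fg_mul_P (conj_mem_P _ (ι_mem_P _ _)) (conj_mem_P _ (zpow_mem (D_mem_P _) _)), ← hD,
      fg_sh_pow (by omega) (zpow_mem (D_mem_P _) _), show a + 2 = 2 + a by omega,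
      fg_sh_pow_ι (by omega), ← ((commute_D_top (sh ^ a)).zpow_left m).eq, mul_inv_cancel_right,
      fg_zpow_P (D_mem_P n), fg_D h3n le_rfl]
  rw [key _ (hφ.map_mem_P hJ) w hw, fg_conj_P hg (conj_mem_P _ hJ.1), key _ hJ.1 t ht] at h1
  have hc := ((commute_D h3n (fg_mem_Bk 3 g)).zpow_left m)
  have h2 : (ι 2 (Q a w) : B n) = fg 3 g * ι 2 (Q a t) * (fg 3 g)⁻¹ := by
    have := hc.inv_right.eq
    rw [mul_assoc, mul_assoc, this] at h1
    rw [← mul_assoc, ← mul_assoc, mul_left_inj] at h1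
    exact h1
  have hr : ∀ v, ret (a + 2) v = v → ret 2 (Q a v) = Q a v := fun v hv =>
    hom_eq_of_keep (f := (ret 2).comp (Q a)) (g := Q a) hv fun j hj => by
      change ret 2 (Q a (y j)) = Q a (y j)
      rcases Nat.lt_or_ge j a with h | h
      · rw [Q_lt h, map_one]
      · rw [Q_ge h, ret_y (by omega)]
  exact isConj_art_of_ι (by omega) (fg_mem_Bk 3 g) (fg_mem_P hg 3) (hr w hrw) (hr t hrt) h2

lemma exists_push {φ : B n → B n} (hφ : Nice φ) {k : ℕ} (hk : k < n) {h : B n} (hJ : h ∈ J n)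
    (h0 : fg k (φ h) = fg k h) :
    ∃ u, ret k u = u ∧ (∀ j < k, cnt j u = 1) ∧ fg (k + 1) (φ h) = ι k u * fg (k + 1) h := by
  have hP := hφ.map_mem_P hJ
  obtain ⟨u, hu, e1⟩ := fg_succ hk hJ.1
  obtain ⟨v, hv, e2⟩ := fg_succ hk hP
  have e : fg (k + 1) (φ h) = ι k (v * u⁻¹) * fg (k + 1) h := by
    rw [e2, e1, h0, map_mul, map_inv]; group
  refine ⟨v * u⁻¹, by rw [map_mul, map_inv, hu, hv], fun j hj => ?_, e⟩
  have h1 : lk (fg (k + 1) (φ h)) j k = lk (ι k (v * u⁻¹) * fg (k + 1) h) j k := by rw [e]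
  rw [lk_fg hP (by omega) (by omega), lk_mul_P (ι_mem_P _ _), lk_fg hJ.1 (by omega) (by omega),
    hφ.lk_map hJ, lk_ι hj hk] at h1
  exact Multiplicative.toAdd.injective (by rw [toAdd_one]; omega)

end Braid

namespace Braid
variable {n : ℕ}

lemma tw_ret {r : ℕ} (M : ℤ) {w : F} (hw : ret (r + 1) w = w) :
    ret (r + 1) (tw r (X r ^ M) w) = tw r (X r ^ M) w :=
  hom_eq_of_keep (f := (ret (r + 1)).comp (tw r (X r ^ M))) (g := tw r (X r ^ M)) hw fun j hj => by
    change ret (r + 1) (tw r (X r ^ M) (y j)) = tw r (X r ^ M) (y j)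
    by_cases h : j = r
    · subst h; rw [tw_self, ret_y (by omega)]
    · rw [tw_ne _ h, map_mul, map_mul, map_inv, map_zpow, ret_X (by omega), ret_y hj]

lemma tw_of_commute {r : ℕ} (hr : r + 1 < n) {e w : F} {M : ℤ} (he : ret (r + 1) e = e)
    (hw : ret (r + 1) w = w) (h : Commute (ι (r + 1) e * D r ^ M : B n) (ι (r + 1) w)) :
    e * tw r (X r ^ (-M)) w * e⁻¹ = w := by
  have h1 : (ι (r + 1) (e * tw r (X r ^ (-M)) w * e⁻¹) : B n) = ι (r + 1) w := by
    rw [map_mul, map_mul, ← conj_D_succ hr, map_inv]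
    have := h.eq
    rw [mul_assoc] at this
    calc _ = (ι (r + 1) e * (D r ^ M * ι (r + 1) w)) * ((D r ^ M)⁻¹ * (ι (r + 1) e)⁻¹) := by group
      _ = _ := by rw [this]; group
  have h2 := ret_inj hr h1
  rwa [map_mul, map_mul, map_inv, he, hw, tw_ret _ hw] at h2

lemma kill_X (r : ℕ) : kill r (X r) = X r := kill_of_ret (ret_X le_rfl)

lemma commute_D_ι {r : ℕ} (hr : r + 1 < n) {c : F} (hc : c ∈ Subgroup.closure {X r, y r}) :
    Commute (D r : B n) (ι (r + 1) c) := by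
  induction hc using Subgroup.closure_induction with
  | mem v hv =>
    have hs : Commute (s r : B n) (D r) := commute_s_Bk le_rfl (D_mem_Bk r)
    rcases hv with rfl | rfl
    · rw [ι_succ_conj (ret_X le_rfl)]
      exact (hs.symm.mul_right (commute_ι_X (by omega) (D_mem_Bk r))).mul_right hs.symm.inv_right
    · rw [ι_y, A_self]
      exact hs.symm.pow_right 2
  | one => rw [map_one]; exact Commute.one_right _
  | mul v w _ _ h1 h2 => rw [map_mul]; exact h1.mul_right h2
  | inv v _ h => rw [map_inv]; exact h.inv_right

lemma η_mem_closure (r : ℕ) (u : F) : η r u ∈ Subgroup.closure {X r, y r} := by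
  induction u using FreeGroup.induction_on with
  | C1 => rw [map_one]; exact one_mem _
  | of j =>
    change η r (y j) ∈ _
    rcases j with _ | _ | j
    · rw [η_zero]; exact X_mem_closure r
    · rw [zero_add, η_one]; exact y_mem_closure r
    · rw [show η r (y (j + 1 + 1)) = 1 by simp [η]]; exact one_mem _
  | inv_of j h => rw [map_inv]; exact inv_mem h
  | mul v w h1 h2 => rw [map_mul]; exact mul_mem h1 h2

lemma kill_of_ret_s {r : ℕ} (hr : r + 1 < n) {w : F} (hw : ret (r + 1) w = w)
    (h : (ι r (kill r w) : B n) = 1) : kill r w = 1 := by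
  have h1 := ret_eq_one (by omega) h
  rw [← h1, ← hw, ret, ret, kill, keep_keep, keep_keep]
  exact keep_congr (fun l => by omega) w

lemma commute_cancel {k : ℕ} (hk : k ≤ n) {β γ : B n} (hβ : β ∈ Bk n k) {m : ℤ}
    (h : Commute β (γ * D k ^ m)) : Commute β γ := by
  have := h.mul_right ((commute_D hk hβ).symm.zpow_right m).inv_right
  rwa [mul_inv_cancel_right] at this

lemma commute_fg {k : ℕ} {β γ : B n} (hβ : β ∈ P n) (hγ : γ ∈ P n) (h : Commute β γ) :
    Commute (fg k β) (fg k γ) := by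
  rw [Commute, SemiconjBy, ← fg_mul_P hβ hγ, h.eq, fg_mul_P hγ hβ]

lemma cnt_eq_one_of_zpow {v : F} {j : ℕ} (hv : cnt j v = Multiplicative.ofAdd 1) {c : ℤ}
    (h : cnt j (v ^ c) = 1) : c = 0 := by
  rw [map_zpow, hv, ← ofAdd_zsmul, ofAdd_eq_one] at h
  simpa using h

/-- The map agrees with the identity on the first `k` strands. -/
def Fix (φ : B n → B n) (k : ℕ) : Prop := ∀ h ∈ J n, fg k (φ h) = fg k h

lemma Fix.conj_ι {φ : B n → B n} (hφ : Nice φ) {k : ℕ} (hk : k < n) (h0 : Fix φ k) (c : F) :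
    Fix (fun h => (ι k c)⁻¹ * φ h * ι k c) k := fun h hJ => by
  have := fg_conj_P (inv_mem (ι_mem_P k c)) (hφ.map_mem_P hJ) k
  rw [inv_inv] at this
  rw [this, fg_inv_P (ι_mem_P _ _), fg_ι hk le_rfl, h0 h hJ]; group

lemma fg_tl_D {k : ℕ} (hk : k < n) : fg (k + 1) (tl (D k : B n)) =
    ι k (X k ^ (-ee (D n : B n))) * D (k + 1) ^ (ee (D n : B n) - ee (D k : B n)) := by
  rw [fg_tl (D_mem_P _) (by omega), fg_of_mem (Bk_mono (by omega) (D_mem_Bk _)), sub_eq_add_neg,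
    zpow_add, ← mul_assoc]
  congr 1
  have hc := commute_D hk (ι_mem_Bk (n := n) (show k < k + 1 by omega) (X k ^ (-ee (D n : B n))))
  rw [← (hc.zpow_left _).eq, D_zpow_succ hk, mul_assoc, ← map_mul, ← zpow_add, add_neg_cancel,
    zpow_zero, map_one, mul_one]

section
variable {φ : B n → B n} (hφ : Nice φ) {a : ℕ} (ha : a + 2 < n)
include hφ ha

lemma kill_push (hI : ∀ φ : B n → B n, Nice φ → Inn φ (a + 2)) {w : F}
    (hw : ret (a + 2) w = w)
    (h : fg (a + 3) (φ (tl (s (a + 1) ^ 2))) = ι (a + 2) w * D (a + 3) ^ (-2 : ℤ)) :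
    kill (a + 1) w = 1 := by
  obtain ⟨g, hg, hgh⟩ := hI _ (hφ.conj (s (a + 1))⁻¹)
  have hP : (s (a + 1) ^ 2 : B n) ∈ P n := perm_s_sq _
  have h1 := hgh _ (tl_mem hP)
  have hc : Commute (tl (s (a + 1) ^ 2) : B n) (s (a + 1)) :=
    commute_tl ((Commute.refl _).pow_left 2)
  have e0 : (s (a + 1) : B n)⁻¹⁻¹ * tl (s (a + 1) ^ 2) * (s (a + 1))⁻¹ = tl (s (a + 1) ^ 2) := by
    rw [inv_inv, ← hc.eq, mul_inv_cancel_right]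
  simp only [e0] at h1
  have hs : (s (a + 1) : B n)⁻¹ ∈ Bk n (a + 3) := inv_mem (s_mem_Bk (by omega))
  have hφP := hφ.map_mem_P (tl_mem hP)
  rw [← fg_fg_P (show a + 2 ≤ a + 3 by omega) (conj_mem_P _ hφP), fg_conj hs (P_le_Hs _ hφP), h,
    conj_mul, fg_mul_P (conj_mem_P _ (ι_mem_P _ _))
      (conj_mem_P _ (zpow_mem (D_mem_P _) _)), inv_inv, fg_s_ι (by omega)] at h1
  have hD : ((s (a + 1))⁻¹ * D (a + 3) ^ (-2 : ℤ) * s (a + 1) : B n) = D (a + 3) ^ (-2 : ℤ) := by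
    rw [← ((commute_D (by omega) hs).zpow_left (-2)).eq, inv_mul_cancel_right]
  have hfs : fg (a + 2) (s (a + 1) ^ 2 : B n) = 1 := by
    rw [← A_self, ← ι_y, fg_ι ha le_rfl]
  have hD2 : fg (a + 2) (D (a + 3) ^ (-2 : ℤ) : B n) = D (a + 2) ^ (-2 : ℤ) := by
    rw [fg_zpow_P (D_mem_P _), fg_D (by omega) (by omega)]
  rw [hD, hD2, fg_conj_P hg (tl_mem hP).1, fg_tl hP (by omega), hfs, one_zpow, one_mul, ee_pow,
    ee_s (by omega), ← ((commute_D (by omega) (fg_mem_Bk (a + 2) g)).zpow_left _).eq,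
    mul_inv_cancel_right] at h1
  refine kill_of_ret_s ha hw ?_
  simpa using h1

lemma exists_fix_ξ (h3 : ∀ φ : B n → B n, Nice φ → Inn φ 3)
    (hI : ∀ φ : B n → B n, Nice φ → Inn φ (a + 2)) (h0 : Fix φ (a + 2)) :
    ∃ c, fg (a + 3) ((ι (a + 2) c)⁻¹ * φ (tl (s (a + 1) ^ 2)) * ι (a + 2) c) =
      ι (a + 2) (y (a + 1) ^ ee (D n : B n)) * D (a + 3) ^ (-2 : ℤ) := by
  have hP : (s (a + 1) ^ 2 : B n) ∈ P n := perm_s_sq _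
  have hφP := hφ.map_mem_P (tl_mem hP)
  have hM := ee_D_ne_zero (n := n) (by omega)
  have hy : ret (a + 2) (y (a + 1) ^ ee (D n : B n)) = y (a + 1) ^ ee (D n : B n) := by
    rw [map_zpow, ret_y (by omega)]
  have ht : fg (a + 3) (tl (s (a + 1) ^ 2) : B n) =
      ι (a + 2) (y (a + 1) ^ ee (D n : B n)) * D (a + 3) ^ (-2 : ℤ) := by
    rw [fg_tl hP (by omega), fg_of_mem (pow_mem (s_mem_Bk (by omega)) 2), ee_pow,
      ee_s (by omega), map_zpow, ι_y, A_self]; rfl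
  obtain ⟨u, hu, -, e⟩ := exists_push hφ ha (tl_mem hP) (h0 _ (tl_mem hP))
  obtain ⟨w, hw⟩ : ∃ w, w = u * y (a + 1) ^ ee (D n : B n) := ⟨_, rfl⟩
  have hwr : ret (a + 2) w = w := by rw [hw, map_mul, hu, hy]
  rw [ht, ← mul_assoc, ← map_mul, ← hw] at e
  have hk := kill_push hφ ha hI hwr e
  have hδ := D_mem_P (n := n) (a + 1)
  obtain ⟨v, hv, -, e'⟩ := exists_push hφ ha (tl_mem hδ) (h0 _ (tl_mem hδ))
  rw [fg_tl hδ (by omega), fg_of_mem (Bk_mono (by omega) (D_mem_Bk _)), ← mul_assoc] at e'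
  have hc := commute_fg (k := a + 3) (hφ.map_mem_P (tl_mem hδ)) hφP
    (hφ.map_commute (ee_tl _) (ee_tl _) (commute_tl_tl
      ((commute_s_Bk le_rfl (D_mem_Bk (a + 1))).symm.pow_right 2)))
  have hm := fg_mem_Bk (a + 3) (φ (tl (D (a + 1) : B n)))
  rw [e] at hc
  have hc2 := commute_cancel (by omega) hm hc
  rw [e'] at hc2
  have hc3 := tw_of_commute ha hv hwr (commute_cancel (by omega) (ι_mem_Bk (by omega) _) hc2.symm).symm
  obtain ⟨x, hx, hwx⟩ := exists_isConj_of_tw (kill_X _)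
    (fun N hN g => mem_zpowers_X (by omega) hN) hk (neg_ne_zero.2 hM) hc3
  obtain ⟨b, -, hb, hcb⟩ := isConj_Q hφ h3 ha (tl_mem hP) ht e hwr hy
  have hty : y (a + 1) ^ ee (D n : B n) ∈ Subgroup.closure {X (a + 1), y (a + 1)} :=
    zpow_mem (y_mem_closure _) _
  have h5 : IsConj (art b (Q a (y (a + 1) ^ ee (D n : B n)))) (Q a (y (a + 1) ^ ee (D n : B n))) := by
    rw [map_zpow, Q_ge (by omega), map_zpow]
    obtain ⟨g, hg⟩ := art_conj_perm b (a + 1 - a)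
    rw [hg, mem_P.1 hb, conj_zpow]
    exact (isConj_iff.2 ⟨g, rfl⟩).symm
  obtain ⟨c, hc⟩ := isConj_iff.1 (isConj_of_Q hx hwx hty (hcb.trans h5))
  refine ⟨c⁻¹, ?_⟩
  have := fg_conj_P (ι_mem_P (a + 2) c) hφP (a + 3)
  have hιc := ι_mem_Bk (n := n) (show a + 2 < a + 3 by omega) c
  rw [map_inv, inv_inv, this, e, fg_of_mem hιc, conj_mul,
    ← ((commute_D (by omega) hιc).zpow_left _).eq, mul_inv_cancel_right, ← map_inv, ← map_mul,
    ← map_mul, hc]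

lemma fix_δ (h0 : Fix φ (a + 2))
    (hξ : fg (a + 3) (φ (tl (s (a + 1) ^ 2))) =
      ι (a + 2) (y (a + 1) ^ ee (D n : B n)) * D (a + 3) ^ (-2 : ℤ)) :
    fg (a + 3) (φ (tl (D (a + 1)))) = fg (a + 3) (tl (D (a + 1))) := by
  have hM := ee_D_ne_zero (n := n) (by omega)
  have hδ := D_mem_P (n := n) (a + 1)
  have hP : (s (a + 1) ^ 2 : B n) ∈ P n := perm_s_sq _
  have hy : ret (a + 2) (y (a + 1) ^ ee (D n : B n)) = y (a + 1) ^ ee (D n : B n) := by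
    rw [map_zpow, ret_y (by omega)]
  obtain ⟨v, hv, hcv, e'⟩ := exists_push hφ ha (tl_mem hδ) (h0 _ (tl_mem hδ))
  suffices v = 1 by rw [e', this, map_one, one_mul]
  rw [fg_tl hδ (by omega), fg_of_mem (Bk_mono (by omega) (D_mem_Bk _)), ← mul_assoc] at e'
  have hc := commute_fg (k := a + 3) (hφ.map_mem_P (tl_mem hδ)) (hφ.map_mem_P (tl_mem hP))
    (hφ.map_commute (ee_tl _) (ee_tl _) (commute_tl_tl
      ((commute_s_Bk le_rfl (D_mem_Bk (a + 1))).symm.pow_right 2)))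
  have hm := fg_mem_Bk (a + 3) (φ (tl (D (a + 1) : B n)))
  rw [hξ] at hc
  have hc2 := commute_cancel (by omega) hm hc
  rw [e'] at hc2
  have hc3 := tw_of_commute ha hv hy (commute_cancel (by omega) (ι_mem_Bk (by omega) _) hc2.symm).symm
  rw [map_zpow, tw_self, mul_inv_eq_iff_eq_mul] at hc3
  obtain ⟨c, rfl⟩ := mem_zpowers_of_commute hM (show Commute _ _ from hc3.symm)
  have := hcv (a + 1) (by omega)
  change cnt (a + 1) (y (a + 1) ^ c) = 1 at this
  rw [cnt_eq_one_of_zpow (by simp [cnt_y]) this]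
  exact zpow_zero _

lemma exists_fix_ζ (h3 : ∀ φ : B n → B n, Nice φ → Inn φ 3) (h0 : Fix φ (a + 2))
    (hδ : fg (a + 3) (φ (tl (D (a + 1)))) = fg (a + 3) (tl (D (a + 1)))) :
    ∃ c ∈ Subgroup.closure {X (a + 1), y (a + 1)},
      fg (a + 3) ((ι (a + 2) c)⁻¹ * φ (tl (D (a + 2))) * ι (a + 2) c) =
      fg (a + 3) (tl (D (a + 2))) := by
  have hM := ee_D_ne_zero (n := n) (by omega)
  have hP := D_mem_P (n := n) (a + 2)
  have hδP := D_mem_P (n := n) (a + 1)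
  have hφP := hφ.map_mem_P (tl_mem hP)
  have hX : ret (a + 2) (X (a + 2) ^ (-ee (D n : B n))) = X (a + 2) ^ (-ee (D n : B n)) := by
    rw [map_zpow, ret_X le_rfl]
  have ht := fg_tl_D ha
  obtain ⟨u, hu, -, e⟩ := exists_push hφ ha (tl_mem hP) (h0 _ (tl_mem hP))
  obtain ⟨w, hw⟩ : ∃ w, w = u * X (a + 2) ^ (-ee (D n : B n)) := ⟨_, rfl⟩
  have hwr : ret (a + 2) w = w := by rw [hw, map_mul, hu, hX]
  rw [ht, ← mul_assoc, ← map_mul, ← hw] at e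
  rw [fg_tl hδP (by omega), fg_of_mem (Bk_mono (by omega) (D_mem_Bk _))] at hδ
  have hc := commute_fg (k := a + 3) (hφ.map_mem_P (tl_mem hδP)) hφP
    (hφ.map_commute (ee_tl _) (ee_tl _) (commute_tl_tl
      (commute_D (by omega) (Bk_mono (by omega) (D_mem_Bk (a + 1)))).symm))
  have hm := fg_mem_Bk (a + 3) (φ (tl (D (a + 1) : B n)))
  rw [e] at hc
  have hc2 := commute_cancel (by omega) hm hc
  rw [hδ] at hc2
  have hc4 := commute_cancel (by omega) (ι_mem_Bk (by omega) _) hc2.symm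
  have hc3 := tw_of_commute ha (e := 1) (map_one _) hwr (by rw [map_one, one_mul]; exact hc4.symm)
  rw [one_mul, inv_one, mul_one] at hc3
  have hwc := mem_closure_of_tw (kill_X _) (fun N hN g => mem_zpowers_X (by omega) hN)
    (neg_ne_zero.2 hM) hc3
  obtain ⟨b, hb, -, hcb⟩ := isConj_Q hφ h3 ha (tl_mem hP) ht e hwr hX
  have hQ : Q a (X (a + 2)) = X 2 := by
    rw [X_succ, X_succ, map_mul, map_mul, Q_X le_rfl, Q_ge le_rfl, Q_ge (by omega), X_succ, X_succ,
      X_zero]; simp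
  rw [map_zpow (Q a), hQ, map_zpow, art_X (by omega) hb] at hcb
  obtain ⟨c, hc⟩ := isConj_iff.1 hcb
  have hηX : η (a + 1) (X 2) = X (a + 2) := by
    rw [X_succ, X_succ, X_zero, one_mul, map_mul, η_zero, η_one, ← X_succ]
  have hc5 := congrArg (η (a + 1)) hc
  rw [map_mul, map_mul, map_inv, η_Q hwc, map_zpow, hηX] at hc5
  refine ⟨(η (a + 1) c)⁻¹, inv_mem (η_mem_closure _ _), ?_⟩
  have := fg_conj_P (ι_mem_P (a + 2) (η (a + 1) c)) hφP (a + 3)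
  have hιc := ι_mem_Bk (n := n) (show a + 2 < a + 3 by omega) (η (a + 1) c)
  rw [map_inv, inv_inv, this, e, fg_of_mem hιc, conj_mul,
    ← ((commute_D (by omega) hιc).zpow_left _).eq, mul_inv_cancel_right, ← map_inv, ← map_mul,
    ← map_mul, hc5, ht]

end

end Braid

namespace Braid
variable {n : ℕ}
open Equiv

lemma commute_X_of_commute_D {k : ℕ} (hk : k < n) {u : F} (hu : ret k u = u) {M : ℤ}
    (h : Commute (D k ^ M : B n) (ι k u)) : Commute (X k ^ M) u := by
  have h1 := conj_D hk M u
  rw [h.eq, mul_inv_cancel_right] at h1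
  have h2 := ret_inj hk h1
  rw [map_mul, map_mul, map_inv, map_zpow, ret_X le_rfl, hu, mul_assoc, eq_inv_mul_iff_mul_eq] at h2
  exact h2

/-- The centralizer of powers of the band generators and of a full twist on `r` strands. -/
lemma exists_eq_D_mul {r : ℕ} (h0 : 0 < r) (hr : r < n) {M : ℤ} (hM : M ≠ 0) {g : B n}
    (hg : g ∈ Bk n (r + 1)) (hP : g ∈ P n)
    (hA : ∀ i j, i < j → j < r → Commute (A i j ^ M) g) (hD : Commute (D r ^ M) g) :
    ∃ c d : ℤ, g = D (r + 1) ^ c * D r ^ d := by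
  obtain ⟨u, b, hb, hbP, rfl⟩ := pure_decomp hr hg hP
  obtain ⟨d, rfl⟩ := mem_zpowers_D hr.le hM hb hbP fun i j hij hj => by
    have := commute_fg (k := r) (zpow_mem (A_mem_P i j) M) hP (hA i j hij hj)
    rwa [fg_mul_P (ι_mem_P _ _) hbP, fg_ι hr le_rfl, one_mul, fg_of_mem hb,
      fg_of_mem (zpow_mem (A_mem_Bk hj) M)] at this
  change Commute (D r ^ M) (ι r u * D r ^ d) at hD
  change ∃ c d', (ι r u * D r ^ d : B n) = D (r + 1) ^ c * D r ^ d'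
  have h1 := hD.mul_right (((Commute.refl (D r : B n)).zpow_zpow M d).inv_right)
  rw [mul_inv_cancel_right, ← ι_ret] at h1
  obtain ⟨c, hc⟩ := mem_zpowers_X h0 hM (commute_X_of_commute_D hr (ret_ret le_rfl u) h1)
  change X r ^ c = ret r u at hc
  refine ⟨c, d - c, ?_⟩
  have h2 : Commute (D r : B n) (ι r (X r)) := commute_ι_X hr (D_mem_Bk r)
  rw [D_zpow_succ hr, ← ι_ret, ← hc, map_zpow, (h2.zpow_zpow c c).eq, mul_assoc, ← zpow_add]
  congr 2; ring

lemma Q_one_X (j : ℕ) : Q 1 (X (j + 1)) = X j := by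
  induction j with
  | zero => exact Q_X le_rfl
  | succ j ih => rw [X_succ, map_mul, ih, Q_ge (by omega)]; rfl

lemma fg_sh_D {m j : ℕ} (hm : m + 1 ≤ n) (hj : j ≤ m) :
    fg m (sh * D (j + 1) * sh⁻¹ : B n) = D j := by
  induction j with
  | zero => rw [D_one, mul_one, mul_inv_cancel, fg_one]; rfl
  | succ j ih =>
    rw [D_succ, conj_mul, fg_mul_P (conj_mem_P _ (D_mem_P _)) (conj_mem_P _ (ι_mem_P _ _)),
      ih (by omega), fg_sh_ι hm (by omega), Q_one_X, fg_of_mem (ι_mem_Bk (by omega) _), D_succ]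

lemma conj_tl (g β : B n) : g * tl β * g⁻¹ = tl (g * β * g⁻¹) := by
  rw [tl, tl, conj_mul, ee_conj, conj_zpow, ← ((commute_D_top g).zpow_left _).eq,
    mul_inv_cancel_right]

lemma exists_pow_mem_P (β : B n) : ∃ m : ℕ, 0 < m ∧ β ^ m ∈ P n := by
  have h : ∀ x, x < n ↔ perm β x < n := fun x => by
    refine ⟨fun hx => ?_, fun hx => ?_⟩
    · by_contra! h
      have := (perm β).injective (perm_ge β h); omega
    · by_contra! h
      rw [perm_ge β h] at hx; omega
  have h2 := Perm.ofSubtype_subtypePerm (f := perm β) (p := (· < n)) (fun x => (h x).symm)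
    (fun x hx => by by_contra! h; exact hx (perm_ge β h))
  generalize (perm β).subtypePerm (p := (· < n)) (fun x => (h x).symm) = π at h2
  refine ⟨_, orderOf_pos π, mem_P.2 ?_⟩
  rw [map_pow, ← h2, ← map_pow, pow_orderOf_eq_one, map_one]

lemma commute_A_Bk {i j k : ℕ} (h : k ≤ i) {β : B n} (hβ : β ∈ Bk n k) : Commute (A i j) β := by
  induction j with
  | zero => rw [A_of_ge (Nat.zero_le i)]; exact Commute.one_left _
  | succ j ih =>
    rcases Nat.lt_trichotomy j i with h1 | rfl | h1
    · rw [A_of_ge (by omega)]; exact Commute.one_left _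
    · rw [A_self]; exact (commute_s_Bk h hβ).pow_left 2
    · rw [A_succ (by omega)]
      have := commute_s_Bk (show k ≤ j by omega) hβ
      exact (this.mul_left ih).mul_left this.inv_left

lemma exists_conj_A {i r j : ℕ} (hi : i ≤ r) (hr : r < j) (hj : j < n) :
    ∃ b ∈ Bk n (r + 1), A i j = b * A r j * b⁻¹ := by
  induction hi using Nat.decreasingInduction with
  | self => exact ⟨1, one_mem _, by group⟩
  | of_succ i hi ih =>
    obtain ⟨b, hb, h⟩ := ih
    refine ⟨(s i)⁻¹ * b, mul_mem (inv_mem (s_mem_Bk (by omega))) hb, ?_⟩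
    rw [← s_A_self (by omega) hj] at h
    calc _ = (s i)⁻¹ * (s i * A i j * (s i)⁻¹) * s i := by group
      _ = _ := by rw [h]; group

section
variable {φ : B n → B n} (hφ : Nice φ)
include hφ

lemma fix_of_commute_D {k : ℕ} (hk0 : 0 < k) (hk : k < n) (h0 : Fix φ k)
    (hζ : fg (k + 1) (φ (tl (D k))) = fg (k + 1) (tl (D k))) {h : B n} (hJ : h ∈ J n)
    (hc : Commute h (D k)) : fg (k + 1) (φ h) = fg (k + 1) h := by
  have hM := ee_D_ne_zero (n := n) (by omega)
  have hP := D_mem_P (n := n) k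
  obtain ⟨u, hu, hcu, e⟩ := exists_push hφ hk hJ (h0 h hJ)
  suffices u = 1 by rw [e, this, map_one, one_mul]
  have hfg : fg (k + 1) (tl (D k) : B n) = D k ^ ee (D n : B n) * D (k + 1) ^ (-ee (D k : B n)) := by
    rw [fg_tl hP (by omega), fg_of_mem (Bk_mono (by omega) (D_mem_Bk _))]
  have h1 := commute_fg (k := k + 1) (hφ.map_mem_P hJ) (hφ.map_mem_P (tl_mem hP))
    (hφ.map_commute hJ.2 (ee_tl _) (commute_tl hc.symm).symm)
  have h2 := commute_fg (k := k + 1) hJ.1 (tl_mem hP).1 (commute_tl hc.symm).symm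
  rw [hζ, hfg] at h1
  rw [hfg] at h2
  have h3 := commute_cancel (by omega) (fg_mem_Bk _ _) h1
  have h4 := commute_cancel (by omega) (fg_mem_Bk _ _) h2
  rw [e] at h3
  have h5 := h3.mul_left h4.inv_left
  rw [mul_inv_cancel_right] at h5
  obtain ⟨c, rfl⟩ := mem_zpowers_X hk0 hM (commute_X_of_commute_D hk hu h5.symm)
  have := hcu 0 hk0
  change cnt 0 (X k ^ c) = 1 at this
  rw [cnt_eq_one_of_zpow (by simp [cnt_X, hk0]) this]
  exact zpow_zero _

/-- Normalization on the strands `1, …, k`. -/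
lemma exists_fix_sh {r : ℕ} (hr0 : 0 < r) (hr : r + 1 < n) (hI : ∀ φ : B n → B n, Nice φ → Inn φ (r + 1))
    (h0 : Fix φ (r + 1))
    (hζ : fg (r + 2) (φ (tl (D (r + 1)))) = fg (r + 2) (tl (D (r + 1)))) :
    ∃ d : ℤ, ∀ h ∈ J n, fg (r + 1) (sh * ((D (r + 1) ^ d)⁻¹ * φ h * D (r + 1) ^ d) * sh⁻¹) =
      fg (r + 1) (sh * h * sh⁻¹) := by
  have hM := ee_D_ne_zero (n := n) (by omega)
  obtain ⟨g, hg, hgh⟩ := hI _ (hφ.conj sh)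
  have H : ∀ h ∈ J n, fg (r + 1) (sh * φ h * sh⁻¹) =
      fg (r + 1) g * fg (r + 1) (sh * h * sh⁻¹) * (fg (r + 1) g)⁻¹ := fun h hJ => by
    rw [← fg_conj_P hg (conj_mem_P _ hJ.1), ← hgh _ (conj_mem_J sh hJ)]
    simp only
    congr 5; group
  have hc : ∀ h ∈ J n, Commute h (D (r + 1)) → Commute (fg (r + 1) (sh * h * sh⁻¹)) (fg (r + 1) g) := by
    intro h hJ hcom
    have h1 := H h hJ
    have h2 := fix_of_commute_D hφ (by omega) hr h0 hζ hJ hcom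
    rw [← fg_sh (by omega) (hφ.map_mem_P hJ), h2, fg_sh (by omega) hJ.1,
      eq_mul_inv_iff_mul_eq] at h1
    exact h1
  have hgk := fg_mem_Bk (r + 1) g
  have hcD : ∀ (β : B n) (m : ℤ), Commute (β * D (r + 1) ^ m) (fg (r + 1) g) →
      Commute β (fg (r + 1) g) := fun β m h =>
    (commute_cancel (by omega) hgk h.symm).symm
  obtain ⟨c, d, hcd⟩ := exists_eq_D_mul hr0 (by omega) hM hgk (fg_mem_P hg _)
    (fun i j hij hj => by
      have h1 := hc _ (tl_mem (A_mem_P (i + 1) (j + 1)))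
        (commute_tl (commute_D (by omega) (A_mem_Bk (by omega))).symm)
      rw [conj_tl, sh_A (by omega), fg_tl (A_mem_P _ _) (by omega),
        fg_of_mem (A_mem_Bk (by omega))] at h1
      exact hcD _ _ h1)
    (by
      have h1 := hc _ (tl_mem (D_mem_P (r + 1))) (commute_tl (Commute.refl _))
      rw [conj_tl, fg_tl (conj_mem_P _ (D_mem_P _)) (by omega), fg_sh_D (by omega) (by omega)] at h1
      exact hcD _ _ h1)
  refine ⟨d, fun h hJ => ?_⟩
  have hG : ((D (r + 1) : B n) ^ d)⁻¹ ∈ P n := inv_mem (zpow_mem (D_mem_P _) _)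
  have hfG : fg (r + 1) (sh * ((D (r + 1) : B n) ^ d)⁻¹ * sh⁻¹) = (D r ^ d)⁻¹ := by
    rw [← zpow_neg, ← conj_zpow, fg_zpow_P (conj_mem_P _ (D_mem_P _)),
      fg_sh_D (by omega) (by omega), zpow_neg]
  have e1 : sh * ((D (r + 1) ^ d)⁻¹ * φ h * D (r + 1) ^ d) * sh⁻¹ =
      (sh * (D (r + 1) ^ d)⁻¹ * sh⁻¹) * (sh * φ h * sh⁻¹) * (sh * (D (r + 1) ^ d)⁻¹ * sh⁻¹)⁻¹ := by
    group
  rw [e1, fg_conj_P (conj_mem_P _ hG) (conj_mem_P _ (hφ.map_mem_P hJ)), hfG, H h hJ, hcd]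
  have hk := ((commute_D (by omega) (fg_mem_Bk (r + 1) (sh * h * sh⁻¹ : B n))).zpow_left c)
  have hk2 := ((commute_D (n := n) (k := r + 1) (by omega) (Bk_mono (by omega) (D_mem_Bk r))).zpow_zpow c d)
  rw [hk2.eq, mul_inv_rev]
  calc _ = (D (r + 1) ^ c * fg (r + 1) (sh * h * sh⁻¹)) * (D (r + 1) ^ c)⁻¹ := by group
    _ = _ := by rw [hk.eq]; group

lemma fix_of_commute_D' {a : ℕ} (ha1 : 1 ≤ a) (ha : a + 2 < n) (h0 : Fix φ (a + 2))
    (hδ : fg (a + 3) (φ (tl (D (a + 1)))) = fg (a + 3) (tl (D (a + 1))))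
    (hsh : ∀ h ∈ J n, fg (a + 2) (sh * φ h * sh⁻¹) = fg (a + 2) (sh * h * sh⁻¹)) {h : B n}
    (hJ : h ∈ J n) (hc : Commute h (D (a + 1))) : fg (a + 3) (φ h) = fg (a + 3) h := by
  have hM := ee_D_ne_zero (n := n) (by omega)
  have hP := D_mem_P (n := n) (a + 1)
  obtain ⟨u, hu, -, e⟩ := exists_push hφ ha hJ (h0 h hJ)
  suffices u = 1 by rw [e, this, map_one, one_mul]
  have hfg : fg (a + 3) (tl (D (a + 1)) : B n) =
      D (a + 1) ^ ee (D n : B n) * D (a + 3) ^ (-ee (D (a + 1) : B n)) := by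
    rw [fg_tl hP (by omega), fg_of_mem (Bk_mono (by omega) (D_mem_Bk _))]
  have h1 := commute_fg (k := a + 3) (hφ.map_mem_P hJ) (hφ.map_mem_P (tl_mem hP))
    (hφ.map_commute hJ.2 (ee_tl _) (commute_tl hc.symm).symm)
  have h2 := commute_fg (k := a + 3) hJ.1 (tl_mem hP).1 (commute_tl hc.symm).symm
  rw [hδ, hfg] at h1
  rw [hfg] at h2
  have h3 := commute_cancel (by omega) (fg_mem_Bk _ _) h1
  have h4 := commute_cancel (by omega) (fg_mem_Bk _ _) h2
  rw [e] at h3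
  have h5 := h3.mul_left h4.inv_left
  rw [mul_inv_cancel_right] at h5
  have h6 := tw_of_commute ha (e := 1) (map_one _) hu (by rw [map_one, one_mul]; exact h5.symm)
  rw [one_mul, inv_one, mul_one] at h6
  have hcl := mem_closure_of_tw (kill_X _) (fun N hN g => mem_zpowers_X (by omega) hN)
    (neg_ne_zero.2 hM) h6
  refine eq_one_of_Q hcl ha1 ?_
  have h7 := hsh h hJ
  rw [← fg_sh (by omega) (hφ.map_mem_P hJ), e, conj_mul,
    fg_mul_P (conj_mem_P _ (ι_mem_P _ _)) (conj_mem_P _ (fg_mem_P hJ.1 _)), fg_sh (by omega) hJ.1,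
    mul_eq_right, fg_sh_ι (by omega) (by omega), fg_of_mem (ι_mem_Bk (by omega) _)] at h7
  rw [← ret_eq_one (by omega) h7]
  exact (hom_eq_of_keep (f := (ret (a + 1)).comp (Q 1)) (g := Q 1) hu fun j hj => by
    change ret (a + 1) (Q 1 (y j)) = Q 1 (y j)
    rcases Nat.lt_or_ge j 1 with h | h
    · rw [Q_lt h, map_one]
    · rw [Q_ge h, ret_y (by omega)]).symm

end
end Braid

namespace Braid
variable {n : ℕ}

section
variable {φ : B n → B n} (hφ : Nice φ)
include hφ

/-- The defect of equivariance of a map normalizing the permutations. -/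
lemma defect_mem_P {d : B n} (hd : ee d = 0) : d⁻¹ * φ d ∈ P n := by
  rw [mem_P, map_mul, map_inv, hφ.perm_map hd, inv_mul_cancel]

lemma fg_defect_eq_one {k : ℕ} (hk0 : 2 ≤ k) (hk : k < n)
    (hE : ∀ h ∈ J n, Commute h (D k) → fg (k + 1) (φ h) = fg (k + 1) h)
    {d : B n} (hd : d ∈ Bk n k) (hd0 : ee d = 0) : fg (k + 1) (d⁻¹ * φ d) = 1 := by
  have hM := ee_D_ne_zero (n := n) (by omega)
  have hkk : Bk n k ≤ Bk n (k + 1) := Bk_mono (by omega)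
  have key : ∀ d ∈ Bk n k, ee d = 0 →
      ∃ a b : ℤ, fg (k + 1) (d⁻¹ * φ d) = D (k + 1) ^ a * D k ^ b := by
    intro d hd hd0
    have hc : ∀ h ∈ J n, Commute h (D k) →
        Commute (fg (k + 1) h) (fg (k + 1) (d⁻¹ * φ d)) := by
      intro h hJ hcom
      have h1 := hE (d * h * d⁻¹) (conj_mem_J d hJ) (by
        have := (commute_D hk.le hd).symm
        exact (this.mul_left hcom).mul_left this.inv_left)
      rw [hφ.map_conj hd0 hJ.2, fg_conj (hkk hd) (P_le_Hs _ hJ.1), show φ d * φ h * (φ d)⁻¹ =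
        d * ((d⁻¹ * φ d) * φ h * (d⁻¹ * φ d)⁻¹) * d⁻¹ by group,
        fg_conj (hkk hd) (P_le_Hs _ (mul_mem (mul_mem (defect_mem_P hφ hd0) (hφ.map_mem_P hJ))
          (inv_mem (defect_mem_P hφ hd0)))), mul_left_inj, mul_right_inj,
        fg_conj_P (defect_mem_P hφ hd0) (hφ.map_mem_P hJ), hE h hJ hcom,
        mul_inv_eq_iff_eq_mul] at h1
      exact h1.symm
    have hmem := fg_mem_Bk (k + 1) (d⁻¹ * φ d)
    refine exists_eq_D_mul (by omega) hk hM hmem (fg_mem_P (defect_mem_P hφ hd0) _)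
      (fun i j hij hj => ?_) ?_
    · have h1 := hc _ (tl_mem (A_mem_P i j)) (commute_tl (commute_D hk.le (A_mem_Bk hj)).symm)
      rw [fg_tl (A_mem_P _ _) (by omega), fg_of_mem (A_mem_Bk (by omega))] at h1
      exact (commute_cancel (by omega) hmem h1.symm).symm
    · have h1 := hc _ (tl_mem (D_mem_P k)) (commute_tl (Commute.refl _))
      rw [fg_tl (D_mem_P _) (by omega), fg_of_mem (hkk (D_mem_Bk _))] at h1
      exact (commute_cancel (by omega) hmem h1.symm).symm
  have hpow : ∀ m : ℕ, fg (k + 1) ((d ^ m)⁻¹ * φ (d ^ m)) = fg (k + 1) (d⁻¹ * φ d) ^ m := by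
    intro m
    induction m with
    | zero => rw [pow_zero, hφ.map_one, inv_one, mul_one, fg_one, pow_zero]
    | succ m ih =>
      have hdm : ee (d ^ m) = 0 := by rw [ee_pow, hd0, mul_zero]
      obtain ⟨a, b, hab⟩ := key (d ^ m) (pow_mem hd m) hdm
      have hdi : d⁻¹ ∈ Bk n k := inv_mem hd
      have e1 : (d ^ (m + 1))⁻¹ * φ (d ^ (m + 1)) =
          d⁻¹ * ((d ^ m)⁻¹ * φ (d ^ m)) * d⁻¹⁻¹ * (d⁻¹ * φ d) := by
        rw [pow_succ, hφ.map_mul hdm hd0]; group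
      rw [e1, fg_mul_P (conj_mem_P _ (defect_mem_P hφ hdm)) (defect_mem_P hφ hd0),
        fg_conj (hkk hdi) (P_le_Hs _ (defect_mem_P hφ hdm)), pow_succ, ← ih]
      congr 1
      rw [hab, mul_inv_eq_iff_eq_mul]
      exact (((commute_D (by omega) (hkk hdi)).zpow_left a).mul_left
        ((commute_D hk.le hdi).zpow_left b)).eq.symm
  obtain ⟨a, b, hab⟩ := key d hd hd0
  obtain ⟨m, hm, hmP⟩ := exists_pow_mem_P d
  have hmJ : d ^ m ∈ J n := mem_J.2 ⟨hmP, by rw [ee_pow, hd0, mul_zero]⟩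
  have hl : ∀ i j, i < k + 1 → j < k + 1 → lk (fg (k + 1) (d⁻¹ * φ d)) i j = 0 := by
    intro i j hi hj
    have h1 : lk (fg (k + 1) ((d ^ m)⁻¹ * φ (d ^ m))) i j = 0 := by
      rw [lk_fg (defect_mem_P hφ hmJ.2) hi hj, lk_mul_P (inv_mem hmP), lk_inv_P hmP, hφ.lk_map hmJ]
      ring
    rw [hpow, ← zpow_natCast, lk_zpow_P (fg_mem_P (defect_mem_P hφ hd0) _)] at h1
    rcases mul_eq_zero.1 h1 with h | h
    · omega
    · exact h
  have h1 := hl 0 k (by omega) (by omega)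
  have h2 := hl 0 1 (by omega) (by omega)
  rw [hab, lk_mul_P (zpow_mem (D_mem_P _) _), lk_zpow_P (D_mem_P _), lk_zpow_P (D_mem_P _)] at h1 h2
  rw [lk_D (by omega) (by omega) (by omega), lk_comm, lk_Bk (D_mem_Bk k) le_rfl] at h1
  rw [lk_D (by omega) (by omega) (by omega), lk_D (by omega) (by omega) (by omega)] at h2
  have ha : a = 0 := by omega
  have hb : b = 0 := by omega
  rw [hab, ha, hb]; simp

lemma fix_succ {a : ℕ} (ha1 : 1 ≤ a) (ha : a + 2 < n)
    (hζ : ∀ h ∈ J n, Commute h (D (a + 2)) → fg (a + 3) (φ h) = fg (a + 3) h)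
    (hδ : ∀ h ∈ J n, Commute h (D (a + 1)) → fg (a + 3) (φ h) = fg (a + 3) h) :
    Fix φ (a + 3) := by
  have hdef : ∀ d ∈ Bk n (a + 2), ee d = 0 → fg (a + 3) (d⁻¹ * φ d) = 1 := fun d hd h0 =>
    fg_defect_eq_one hφ (by omega) ha hζ hd h0
  have hEmul : ∀ g h, g ∈ J n → h ∈ J n → fg (a + 3) (φ g) = fg (a + 3) g →
      fg (a + 3) (φ h) = fg (a + 3) h → fg (a + 3) (φ (g * h)) = fg (a + 3) (g * h) := by
    intro g h hg hh eg eh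
    rw [hφ.map_mul hg.2 hh.2, fg_mul_P (hφ.map_mem_P hg) (hφ.map_mem_P hh), eg, eh,
      fg_mul_P hg.1 hh.1]
  have hEinv : ∀ g, g ∈ J n → fg (a + 3) (φ g) = fg (a + 3) g →
      fg (a + 3) (φ g⁻¹) = fg (a + 3) g⁻¹ := by
    intro g hg eg
    rw [hφ.map_inv hg.2, fg_inv_P (hφ.map_mem_P hg), eg, fg_inv_P hg.1]
  have hEconj : ∀ d ∈ Bk n (a + 2), ee d = 0 → ∀ h ∈ J n, fg (a + 3) (φ h) = fg (a + 3) h →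
      fg (a + 3) (φ (d * h * d⁻¹)) = fg (a + 3) (d * h * d⁻¹) := by
    intro d hd hd0 h hJ eh
    have hd' : d ∈ Bk n (a + 3) := Bk_mono (by omega) hd
    rw [hφ.map_conj hd0 hJ.2, fg_conj hd' (P_le_Hs _ hJ.1), show φ d * φ h * (φ d)⁻¹ =
        d * ((d⁻¹ * φ d) * φ h * (d⁻¹ * φ d)⁻¹) * d⁻¹ by group,
        fg_conj hd' (P_le_Hs _ (mul_mem (mul_mem (defect_mem_P hφ hd0) (hφ.map_mem_P hJ))
          (inv_mem (defect_mem_P hφ hd0)))),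
        fg_conj_P (defect_mem_P hφ hd0) (hφ.map_mem_P hJ), hdef d hd hd0, eh]
    group
  obtain ⟨c, hc⟩ : ∃ c : B n, c = s 0 ^ 2 := ⟨_, rfl⟩
  have hcP : c ∈ P n := by rw [hc]; exact perm_s_sq _
  have hce : ee c = 2 := by rw [hc, ee_pow, ee_s (by omega)]; rfl
  have hcr : c ∈ Bk n (a + 1) := by rw [hc]; exact pow_mem (s_mem_Bk (by omega)) 2
  have hck : c ∈ Bk n (a + 2) := Bk_mono (by omega) hcr
  let E : B n → Prop := fun β => β ∈ J n ∧ fg (a + 3) (φ β) = fg (a + 3) β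
  have Emul : ∀ {g h}, E g → E h → E (g * h) := fun hg hh =>
    ⟨mul_mem hg.1 hh.1, hEmul _ _ hg.1 hh.1 hg.2 hh.2⟩
  have Einv : ∀ {g}, E g → E g⁻¹ := fun hg => ⟨inv_mem hg.1, hEinv _ hg.1 hg.2⟩
  have Eζ : ∀ {h}, h ∈ J n → Commute h (D (a + 2)) → E h := fun hJ h => ⟨hJ, hζ _ hJ h⟩
  let H : Subgroup (B n) :=
    { carrier := {β | β ∈ P n ∧ ∃ t : ℤ, ee β = 2 * t ∧
        ∀ m : ℤ, E (c ^ m * (β * c ^ (-t)) * (c ^ m)⁻¹)}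
      one_mem' := ⟨one_mem _, 0, ee_one, fun m => by
        rw [neg_zero, zpow_zero, mul_one, mul_one, mul_inv_cancel]
        exact ⟨one_mem _, by rw [hφ.map_one]⟩⟩
      mul_mem' := by
        rintro β γ ⟨hβ, t, ht, h1⟩ ⟨hγ, t', ht', h2⟩
        refine ⟨mul_mem hβ hγ, t + t', by rw [ee_mul, ht, ht']; ring, fun m => ?_⟩
        have := Emul (h1 m) (h2 (m + t))
        convert this using 1
        rw [neg_add_rev, zpow_add, zpow_add]
        group
      inv_mem' := by
        rintro β ⟨hβ, t, ht, h1⟩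
        refine ⟨inv_mem hβ, -t, by rw [ee_inv, ht]; ring, fun m => ?_⟩
        convert Einv (h1 (m - t)) using 1
        group }
  have hcJ : ∀ {β}, β ∈ P n → ee β = 2 → β * c ^ (-1 : ℤ) ∈ J n := fun hβ he =>
    mem_J.2 ⟨mul_mem hβ (zpow_mem hcP _), by rw [ee_mul, ee_zpow, hce, he]; rfl⟩
  have hcD := (commute_D ha.le hck).symm
  have hH : P n ≤ H := by
    refine P_le_of_A fun i j hij hj => ?_
    refine ⟨A_mem_P i j, 1, by rw [ee_A hij hj]; rfl, fun m => ?_⟩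
    have hAJ := hcJ (A_mem_P i j) (ee_A hij hj)
    by_cases hcase : Commute (A i j : B n) (D (a + 2))
    · refine Eζ (conj_mem_J _ hAJ) ?_
      exact ((hcD.zpow_left m).mul_left (hcase.mul_left (hcD.zpow_left _))).mul_left
        (hcD.zpow_left m).inv_left
    have h1 : i ≤ a + 1 := by
      by_contra! h
      exact hcase (commute_A_Bk (by omega) (D_mem_Bk _))
    have h2 : a + 1 < j := by
      by_contra! h
      exact hcase (commute_D ha.le (A_mem_Bk (by omega))).symm
    obtain ⟨b, hb, hbA⟩ := exists_conj_A h1 h2 hj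
    have hR : Commute (A (a + 1) j : B n) c := commute_A_Bk le_rfl hcr
    have hRs : Commute (A (a + 1) j : B n) (s 0) := commute_A_Bk le_rfl (s_mem_Bk (by omega))
    have hR0 : E (A (a + 1) j * c ^ (-1 : ℤ)) := by
      refine ⟨hcJ (A_mem_P _ _) (ee_A h2 hj), hδ _ (hcJ (A_mem_P _ _) (ee_A h2 hj)) ?_⟩
      exact (commute_A_Bk le_rfl (D_mem_Bk _)).mul_left
        ((commute_D (by omega) hcr).symm.zpow_left _)
    obtain ⟨g, hg⟩ : ∃ g, g = c ^ m * b := ⟨_, rfl⟩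
    have hgk : g ∈ Bk n (a + 2) := by rw [hg]; exact mul_mem (zpow_mem hck m) hb
    obtain ⟨d, hd⟩ : ∃ d, d = g * s 0 ^ (-ee g) := ⟨_, rfl⟩
    have hdk : d ∈ Bk n (a + 2) := by
      rw [hd]; exact mul_mem hgk (zpow_mem (s_mem_Bk (by omega)) _)
    have hd0 : ee d = 0 := by rw [hd, ee_mul, ee_zpow, ee_s (by omega)]; ring
    have hE1 : E (d * (A (a + 1) j * c ^ (-1 : ℤ)) * d⁻¹) :=
      ⟨conj_mem_J _ hR0.1, hEconj d hdk hd0 _ hR0.1 hR0.2⟩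
    have hE2 : E (g * c * g⁻¹ * c⁻¹) := by
      refine Eζ (mem_J.2 ⟨mul_mem (conj_mem_P _ hcP) (inv_mem hcP), by
        rw [ee_mul, ee_conj, ee_inv]; ring⟩) ?_
      have := (commute_D ha.le hgk).symm
      exact ((this.mul_left hcD).mul_left this.inv_left).mul_left hcD.inv_left
    convert Emul hE1 hE2 using 1
    have hsc : Commute (s 0 ^ (-ee g)) (A (a + 1) j * c ^ (-1 : ℤ)) := by
      refine (hRs.symm.zpow_left _).mul_right ?_
      rw [hc]; exact (((Commute.refl (s 0 : B n)).pow_right 2).zpow_right _).zpow_left _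
    rw [hd, show g * s 0 ^ (-ee g) * (A (a + 1) j * c ^ (-1 : ℤ)) * (g * s 0 ^ (-ee g))⁻¹ =
      g * (s 0 ^ (-ee g) * (A (a + 1) j * c ^ (-1 : ℤ))) * (s 0 ^ (-ee g))⁻¹ * g⁻¹ by group, hsc.eq,
      hbA, hg]
    group
  intro h hJ
  obtain ⟨-, t, ht, h1⟩ := hH hJ.1
  have h2 : ee h = 0 := hJ.2
  have ht0 : t = 0 := by omega
  subst ht0
  simpa using (h1 0).2

end

lemma Fix.inn {φ : B n → B n} {k : ℕ} (h : Fix φ k) : Inn φ k :=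
  ⟨1, one_mem _, fun a ha => by rw [h a ha]; simp⟩

lemma commute_conj {g β : B n} (h : Commute g β) : g⁻¹ * β * g = β := by
  rw [mul_assoc, ← h.eq, inv_mul_cancel_left]

lemma inn_of_δζ {a : ℕ} (ha1 : 1 ≤ a) (ha : a + 2 < n)
    (hI : ∀ φ : B n → B n, Nice φ → Inn φ (a + 2)) {φ : B n → B n} (hφ : Nice φ)
    (h0 : Fix φ (a + 2)) (hδ : fg (a + 3) (φ (tl (D (a + 1)))) = fg (a + 3) (tl (D (a + 1))))
    (hζ : fg (a + 3) (φ (tl (D (a + 2)))) = fg (a + 3) (tl (D (a + 2)))) : Inn φ (a + 3) := by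
  obtain ⟨d, hd⟩ := exists_fix_sh hφ (by omega) ha hI h0 hζ
  have hG : (D (a + 2) ^ d : B n) ∈ P n := zpow_mem (D_mem_P _) _
  have hGk : (D (a + 2) ^ d : B n) ∈ Bk n (a + 2) := zpow_mem (D_mem_Bk _) _
  refine Inn.of_conj hφ hG ?_
  have hfg : ∀ h ∈ J n, ∀ k, a + 2 ≤ k →
      fg k ((D (a + 2) ^ d)⁻¹ * φ h * D (a + 2) ^ d) =
        (D (a + 2) ^ d)⁻¹ * fg k (φ h) * D (a + 2) ^ d := by
    intro h hJ k hk
    have := fg_conj (inv_mem (Bk_mono hk hGk)) (P_le_Hs k (hφ.map_mem_P hJ))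
    rwa [inv_inv] at this
  have hφ' := hφ.conj_left hG
  have h0' : Fix (fun h => (D (a + 2) ^ d)⁻¹ * φ h * D (a + 2) ^ d) (a + 2) := fun h hJ => by
    simp only
    rw [hfg h hJ _ le_rfl, h0 h hJ]
    exact commute_conj ((commute_D ha.le (fg_mem_Bk _ _)).zpow_left _)
  have hfix : ∀ {h}, h ∈ J n → Commute h (D (a + 2)) → fg (a + 3) (φ h) = fg (a + 3) h →
      fg (a + 3) ((D (a + 2) ^ d)⁻¹ * φ h * D (a + 2) ^ d) = fg (a + 3) h := by
    intro h hJ hc he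
    rw [hfg h hJ _ (by omega), he]
    have := commute_fg (k := a + 3) hJ.1 (D_mem_P _) hc
    rw [fg_of_mem (Bk_mono (by omega) (D_mem_Bk _))] at this
    exact commute_conj (this.symm.zpow_left _)
  have hδ' := hfix (tl_mem (D_mem_P _))
    (commute_tl (commute_D (by omega) (Bk_mono (by omega) (D_mem_Bk (a + 1)))).symm) hδ
  have hζ' := hfix (tl_mem (D_mem_P _)) (commute_tl (Commute.refl _)) hζ
  exact (fix_succ hφ' ha1 ha (fun h hJ hc => fix_of_commute_D hφ' (by omega) ha h0' hζ' hJ hc)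
    fun h hJ hc => fix_of_commute_D' hφ' ha1 ha h0' hδ' hd hJ hc).inn

lemma inn_of_δ {a : ℕ} (ha1 : 1 ≤ a) (ha : a + 2 < n) (h3 : ∀ φ : B n → B n, Nice φ → Inn φ 3)
    (hI : ∀ φ : B n → B n, Nice φ → Inn φ (a + 2)) {φ : B n → B n} (hφ : Nice φ)
    (h0 : Fix φ (a + 2)) (hδ : fg (a + 3) (φ (tl (D (a + 1)))) = fg (a + 3) (tl (D (a + 1)))) :
    Inn φ (a + 3) := by
  obtain ⟨c, hc, hζ⟩ := exists_fix_ζ hφ ha h3 h0 hδ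
  refine Inn.of_conj hφ (ι_mem_P (a + 2) c)
    (inn_of_δζ ha1 ha hI (hφ.conj_left (ι_mem_P (a + 2) c)) (Fix.conj_ι hφ ha h0 c) ?_ hζ)
  have hιc := ι_mem_Bk (n := n) (show a + 2 < a + 3 by omega) c
  have h1 := fg_conj (inv_mem hιc) (P_le_Hs _ (hφ.map_mem_P (tl_mem (D_mem_P (a + 1)))))
  rw [inv_inv] at h1
  rw [h1, hδ, fg_tl (D_mem_P _) (by omega), fg_of_mem (Bk_mono (by omega) (D_mem_Bk _))]
  exact commute_conj (((commute_D_ι ha hc).symm.zpow_right _).mul_right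
    ((commute_D (by omega) hιc).symm.zpow_right _))

lemma inn_of_fix {a : ℕ} (ha1 : 1 ≤ a) (ha : a + 2 < n) (h3 : ∀ φ : B n → B n, Nice φ → Inn φ 3)
    (hI : ∀ φ : B n → B n, Nice φ → Inn φ (a + 2)) {φ : B n → B n} (hφ : Nice φ)
    (h0 : Fix φ (a + 2)) : Inn φ (a + 3) := by
  obtain ⟨c, hc⟩ := exists_fix_ξ hφ ha h3 hI h0
  have hφ' := hφ.conj_left (ι_mem_P (a + 2) c)
  have h0' := Fix.conj_ι hφ ha h0 c
  exact Inn.of_conj hφ (ι_mem_P (a + 2) c) (inn_of_δ ha1 ha h3 hI hφ' h0' (fix_δ hφ' ha h0' hc))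

lemma fix_conj_of_inn {φ : B n → B n} (hφ : Nice φ) {k : ℕ} {g : B n} (hg : g ∈ P n)
    (h : ∀ h ∈ J n, fg k (φ h) = fg k (g * h * g⁻¹)) : Fix (fun h => g⁻¹ * φ h * g) k :=
  fun a ha => by
    have := fg_conj_P (inv_mem hg) (hφ.map_mem_P ha) k
    rw [inv_inv] at this
    rw [this, h a ha, fg_conj_P hg ha.1, fg_inv_P hg]; group

lemma inn_step {a : ℕ} (ha1 : 1 ≤ a) (ha : a + 2 < n) (h3 : ∀ φ : B n → B n, Nice φ → Inn φ 3)
    (hI : ∀ φ : B n → B n, Nice φ → Inn φ (a + 2)) {φ : B n → B n} (hφ : Nice φ) :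
    Inn φ (a + 3) := by
  obtain ⟨g, hg, hgh⟩ := hI φ hφ
  exact Inn.of_conj hφ hg (inn_of_fix ha1 ha h3 hI (hφ.conj_left hg) (fix_conj_of_inn hφ hg hgh))

lemma inn_top (hn : 3 ≤ n) (h3 : ∀ φ : B n → B n, Nice φ → Inn φ 3) :
    ∀ φ : B n → B n, Nice φ → Inn φ n := by
  have : ∀ a, a + 3 ≤ n → ∀ φ : B n → B n, Nice φ → Inn φ (a + 3) := by
    intro a
    induction a with
    | zero => exact fun _ => h3
    | succ a ih => exact fun h φ hφ => inn_step (by omega) (by omega) h3 (ih (by omega)) hφ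
  obtain ⟨a, rfl⟩ := Nat.exists_eq_add_of_le' hn
  exact this a le_rfl

/-- A map satisfying the normalizations is conjugation by a pure braid. -/
theorem Nice.exists_conj (hn : 3 ≤ n) (h3 : ∀ φ : B n → B n, Nice φ → Inn φ 3) {φ : B n → B n}
    (hφ : Nice φ) : ∃ g, ∀ d, ee d = 0 → φ d = g * d * g⁻¹ := by
  have hM := ee_D_ne_zero (n := n) (by omega)
  obtain ⟨g, hg, hgh⟩ := inn_top hn h3 φ hφ
  have hfix := fix_conj_of_inn hφ hg hgh
  have hψ := hφ.conj_left hg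
  obtain ⟨ψ, hψe⟩ : ∃ ψ, ψ = fun h => g⁻¹ * φ h * g := ⟨_, rfl⟩
  rw [← hψe] at hfix hψ
  have hE : ∀ h ∈ J n, ψ h = h := fun h hJ => by simpa only [fg_top] using hfix h hJ
  suffices H : ∀ d, ee d = 0 → d⁻¹ * ψ d = 1 by
    refine ⟨g, fun d hd => ?_⟩
    have := H d hd
    rw [hψe, inv_mul_eq_one] at this
    simp only at this
    calc φ d = g * (g⁻¹ * φ d * g) * g⁻¹ := by group
      _ = g * d * g⁻¹ := by rw [← this]
  have key : ∀ d : B n, ee d = 0 → ∃ a : ℤ, d⁻¹ * ψ d = D n ^ a := by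
    intro d hd
    have hc : ∀ h ∈ J n, Commute h (d⁻¹ * ψ d) := by
      intro h hJ
      have h1 := hE (d * h * d⁻¹) (conj_mem_J d hJ)
      rw [hψ.map_conj hd hJ.2, hE h hJ] at h1
      have h2 := congrArg (fun x => d⁻¹ * x * ψ d) h1
      simp only [mul_assoc, inv_mul_cancel_left, inv_mul_cancel, mul_one] at h2
      rw [Commute, SemiconjBy, ← h2]; group
    obtain ⟨a, ha⟩ := mem_zpowers_D le_rfl hM (mem_Bk _) (defect_mem_P hψ hd) fun i j hij hj => by
      have h1 := (hc _ (tl_mem (A_mem_P i j))).symm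
      exact (commute_cancel le_rfl (mem_Bk _) h1).symm
    exact ⟨a, ha.symm⟩
  have hpow : ∀ (d : B n) (m : ℕ), ee d = 0 → (d ^ m)⁻¹ * ψ (d ^ m) = (d⁻¹ * ψ d) ^ m := by
    intro d m hd
    induction m with
    | zero => rw [pow_zero, hψ.map_one, inv_one, mul_one, pow_zero]
    | succ m ih =>
      have hdm : ee (d ^ m) = 0 := by rw [ee_pow, hd, mul_zero]
      obtain ⟨a, ha⟩ := key (d ^ m) hdm
      rw [pow_succ (d⁻¹ * ψ d), ← ih, ha]
      calc _ = d⁻¹ * ((d ^ m)⁻¹ * ψ (d ^ m)) * ψ d := by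
            rw [pow_succ, hψ.map_mul hdm hd]; group
        _ = _ := by rw [ha, ← mul_assoc, ((commute_D_top d⁻¹).zpow_left a).eq]
  intro d hd
  obtain ⟨a, ha⟩ := key d hd
  obtain ⟨m, hm, hmP⟩ := exists_pow_mem_P d
  have hmJ : d ^ m ∈ J n := mem_J.2 ⟨hmP, by rw [ee_pow, hd, mul_zero]⟩
  have h1 := hpow d m hd
  rw [hE _ hmJ, inv_mul_cancel, ha, ← zpow_natCast, ← zpow_mul] at h1
  have h2 := congrArg ee h1
  rw [ee_one, ee_zpow] at h2
  have h3 : a * m = 0 := by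
    rcases mul_eq_zero.1 h2.symm with h | h
    · exact h
    · exact absurd h hM
  have h4 : a = 0 := by
    rcases mul_eq_zero.1 h3 with h | h
    · exact h
    · omega
  rw [ha, h4, zpow_zero]

end Braid

namespace Braid
variable {n : ℕ}
open Equiv MatrixGroups

/-- The image of the first generator of the three strand braid group in `SL(2, ℤ)`. -/
def matU : SL(2, ℤ) := ⟨!![1, 1; 0, 1], by simp [Matrix.det_fin_two_of]⟩

/-- The image of the second generator of the three strand braid group in `SL(2, ℤ)`. -/
def matL : SL(2, ℤ) := ⟨!![1, 0; -1, 1], by simp [Matrix.det_fin_two_of]⟩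

/-- The reduced Burau representation of `B 3` at `-1`. -/
def burau : B 3 →* SL(2, ℤ) :=
  lift (fun i => if i = 0 then matU else matL) (fun i j _ _ => by omega) (fun i _ => by
    obtain rfl : i = 0 := by omega
    decide)

lemma burau_s_zero : burau (s 0) = matU := lift_s _ _ _ (by omega)

lemma burau_s_one : burau (s 1) = matL := lift_s _ _ _ (by omega)

lemma burau_surjective : Function.Surjective burau := by
  rw [← MonoidHom.range_eq_top, eq_top_iff, ← SpecialLinearGroup.SL2Z_generators,
    Subgroup.closure_le]
  rintro _ (rfl | rfl)
  · exact ⟨(s 0 * s 1 * s 0)⁻¹, by rw [map_inv, map_mul, map_mul, burau_s_zero, burau_s_one]; decide⟩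
  · exact ⟨s 0, burau_s_zero⟩

/-- Reduction of integer matrices modulo two. -/
def red : SL(2, ℤ) →* SL(2, ZMod 2) := Matrix.SpecialLinearGroup.map (Int.castRingHom (ZMod 2))

lemma red_matU : red matU = ⟨!![1, 1; 0, 1], by simp [Matrix.det_fin_two_of]⟩ := by
  ext i j; fin_cases i <;> fin_cases j <;> rfl

lemma red_matL : red matL = ⟨!![1, 0; 1, 1], by simp [Matrix.det_fin_two_of]⟩ := by
  ext i j; fin_cases i <;> fin_cases j <;> rfl

lemma red_of_mem_P {b : B 3} (h : b ∈ P 3) : red (burau b) = 1 := by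
  have hU : red (burau (s 0 ^ 2)) = 1 := by
    rw [map_pow, map_pow, burau_s_zero, red_matU]; decide
  have hL : red (burau (s 1 ^ 2)) = 1 := by
    rw [map_pow, map_pow, burau_s_one, red_matL]; decide
  refine P_le_of_A (H := (red.comp burau).ker) (fun j k hj hk => ?_) h
  rw [MonoidHom.mem_ker, MonoidHom.comp_apply]
  have : (j = 0 ∧ k = 1) ∨ (j = 1 ∧ k = 2) ∨ (j = 0 ∧ k = 2) := by omega
  rcases this with ⟨rfl, rfl⟩ | ⟨rfl, rfl⟩ | ⟨rfl, rfl⟩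
  · rw [A_self, hU]
  · rw [A_self, hL]
  · rw [A_succ (by omega), A_self, map_mul, map_mul, map_mul, map_mul, hU, map_inv, map_inv]; simp

lemma mem_P_of_red {b : B 3} (h : red (burau b) = 1) : b ∈ P 3 := by
  obtain ⟨u, c, hc, k, hk, rfl⟩ := coset_decomp (n := 3) (k := 2) (by omega) (mem_Bk b)
  obtain ⟨v, d, hd, j, hj, rfl⟩ := coset_decomp (n := 3) (k := 1) (by omega) hc
  obtain rfl := Bk_le_one le_rfl hd
  rw [map_mul, map_mul, map_mul, map_mul, red_of_mem_P (ι_mem_P _ _), map_mul, map_mul, map_mul,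
    map_mul, red_of_mem_P (ι_mem_P _ _), map_one, map_one, one_mul, one_mul, one_mul] at h
  refine mul_mem (mul_mem (ι_mem_P _ _) (mul_mem (mul_mem (ι_mem_P _ _) (one_mem _)) ?_)) ?_ <;>
  · interval_cases j <;> interval_cases k <;>
      simp only [cs, le_refl, if_true, mul_one, map_one, map_mul, burau_s_zero, burau_s_one,
        red_matU, red_matL, one_mem, Nat.not_succ_le_self, if_false, zero_le,
        Nat.not_ofNat_le_one] at h ⊢ <;>
      exact absurd h (by decide)

/-- The free subgroup of `P 3` generated by the squares of the generators. -/
def sanov : FreeGroup (Fin 2) →* B 3 := FreeGroup.lift ![s 0 ^ 2, s 1 ^ 2]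

lemma smul_apply_zero (M N : SL(2, ℤ)) :
    (M • N) 0 0 = M 0 0 * N 0 0 + M 0 1 * N 1 0 ∧ (M • N) 1 0 = M 1 0 * N 0 0 + M 1 1 * N 1 0 := by
  simp [smul_eq_mul, Matrix.mul_apply, Fin.sum_univ_two]

lemma col_ne_zero (M : SL(2, ℤ)) : M 0 0 ≠ 0 ∨ M 1 0 ≠ 0 := by
  by_contra! h
  have := M.det_coe
  rw [Matrix.det_fin_two, h.1, h.2] at this
  simp at this

/-- Attracting regions for the ping-pong action on first columns. -/
def pingX (i : Fin 2) : Set SL(2, ℤ) := {M | if i = 0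
  then (0 ≤ M 1 0 ∧ M 1 0 ≤ M 0 0) ∨ (M 0 0 ≤ M 1 0 ∧ M 1 0 ≤ 0)
  else (0 ≤ - M 0 0 ∧ - M 0 0 ≤ M 1 0) ∨ (M 1 0 ≤ - M 0 0 ∧ - M 0 0 ≤ 0)}

/-- Repelling regions for the ping-pong action on first columns. -/
def pingY (i : Fin 2) : Set SL(2, ℤ) := {M | if i = 0
  then (0 < - M 1 0 ∧ - M 1 0 < M 0 0) ∨ (0 < M 1 0 ∧ M 1 0 < - M 0 0)
  else (0 < M 0 0 ∧ M 0 0 < M 1 0) ∨ (M 1 0 < M 0 0 ∧ M 0 0 < 0)}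

lemma mem_pingX_zero {M : SL(2, ℤ)} : M ∈ pingX 0 ↔
    (0 ≤ M 1 0 ∧ M 1 0 ≤ M 0 0) ∨ (M 0 0 ≤ M 1 0 ∧ M 1 0 ≤ 0) := Iff.rfl

lemma mem_pingX_one {M : SL(2, ℤ)} : M ∈ pingX 1 ↔
    (0 ≤ - M 0 0 ∧ - M 0 0 ≤ M 1 0) ∨ (M 1 0 ≤ - M 0 0 ∧ - M 0 0 ≤ 0) := Iff.rfl

lemma mem_pingY_zero {M : SL(2, ℤ)} : M ∈ pingY 0 ↔
    (0 < - M 1 0 ∧ - M 1 0 < M 0 0) ∨ (0 < M 1 0 ∧ M 1 0 < - M 0 0) := Iff.rfl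

lemma mem_pingY_one {M : SL(2, ℤ)} : M ∈ pingY 1 ↔
    (0 < M 0 0 ∧ M 0 0 < M 1 0) ∨ (M 1 0 < M 0 0 ∧ M 0 0 < 0) := Iff.rfl

lemma burau_sanov_injective : Function.Injective (burau.comp sanov) := by
  have hcomp : burau.comp sanov = FreeGroup.lift ![matU ^ 2, matL ^ 2] := by
    ext1 i
    fin_cases i <;> simp [sanov, burau_s_zero, burau_s_one]
  have hU : ∀ M : SL(2, ℤ), (matU ^ 2 • M) 0 0 = M 0 0 + 2 * M 1 0 ∧
      (matU ^ 2 • M) 1 0 = M 1 0 := fun M => by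
    have := smul_apply_zero (matU ^ 2) M
    obtain ⟨h1, h2, h3, h4⟩ : (matU ^ 2 : SL(2, ℤ)) 0 0 = 1 ∧ (matU ^ 2 : SL(2, ℤ)) 0 1 = 2 ∧
      (matU ^ 2 : SL(2, ℤ)) 1 0 = 0 ∧ (matU ^ 2 : SL(2, ℤ)) 1 1 = 1 := by decide
    rw [h1, h2, h3, h4] at this
    simpa using this
  have hU' : ∀ M : SL(2, ℤ), ((matU ^ 2)⁻¹ • M) 0 0 = M 0 0 - 2 * M 1 0 ∧
      ((matU ^ 2)⁻¹ • M) 1 0 = M 1 0 := fun M => by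
    have := smul_apply_zero (matU ^ 2)⁻¹ M
    obtain ⟨h1, h2, h3, h4⟩ : ((matU ^ 2)⁻¹ : SL(2, ℤ)) 0 0 = 1 ∧ ((matU ^ 2)⁻¹ : SL(2, ℤ)) 0 1 = -2 ∧
      ((matU ^ 2)⁻¹ : SL(2, ℤ)) 1 0 = 0 ∧ ((matU ^ 2)⁻¹ : SL(2, ℤ)) 1 1 = 1 := by decide
    rw [h1, h2, h3, h4] at this
    simpa [sub_eq_add_neg] using this
  have hL : ∀ M : SL(2, ℤ), (matL ^ 2 • M) 0 0 = M 0 0 ∧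
      (matL ^ 2 • M) 1 0 = - 2 * M 0 0 + M 1 0 := fun M => by
    have := smul_apply_zero (matL ^ 2) M
    obtain ⟨h1, h2, h3, h4⟩ : (matL ^ 2 : SL(2, ℤ)) 0 0 = 1 ∧ (matL ^ 2 : SL(2, ℤ)) 0 1 = 0 ∧
      (matL ^ 2 : SL(2, ℤ)) 1 0 = -2 ∧ (matL ^ 2 : SL(2, ℤ)) 1 1 = 1 := by decide
    rw [h1, h2, h3, h4] at this
    simpa using this
  have hL' : ∀ M : SL(2, ℤ), ((matL ^ 2)⁻¹ • M) 0 0 = M 0 0 ∧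
      ((matL ^ 2)⁻¹ • M) 1 0 = 2 * M 0 0 + M 1 0 := fun M => by
    have := smul_apply_zero (matL ^ 2)⁻¹ M
    obtain ⟨h1, h2, h3, h4⟩ : ((matL ^ 2)⁻¹ : SL(2, ℤ)) 0 0 = 1 ∧ ((matL ^ 2)⁻¹ : SL(2, ℤ)) 0 1 = 0 ∧
      ((matL ^ 2)⁻¹ : SL(2, ℤ)) 1 0 = 2 ∧ ((matL ^ 2)⁻¹ : SL(2, ℤ)) 1 1 = 1 := by decide
    rw [h1, h2, h3, h4] at this
    simpa using this
  rw [hcomp]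
  refine FreeGroup.injective_lift_of_ping_pong _ pingX pingY ?_ ?_ ?_ ?_ ?_ ?_
  · intro i
    fin_cases i
    · exact ⟨1, by simp [pingX]⟩
    · exact ⟨ModularGroup.S, by simp [pingX]⟩
  · intro i j hij
    refine Set.disjoint_left.2 fun M hi hj => ?_
    have := col_ne_zero M
    fin_cases i <;> fin_cases j <;> simp [pingX] at hij hi hj <;> omega
  · intro i j hij
    refine Set.disjoint_left.2 fun M hi hj => ?_
    have := col_ne_zero M
    fin_cases i <;> fin_cases j <;> simp [pingY] at hij hi hj <;> omega
  · intro i j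
    refine Set.disjoint_left.2 fun M hi hj => ?_
    have := col_ne_zero M
    fin_cases i <;> fin_cases j <;> simp [pingX, pingY] at hi hj <;> omega
  · rintro i _ ⟨M, hM, rfl⟩
    have := col_ne_zero M
    fin_cases i
    · have := hU M
      change ¬ M ∈ pingY 0 at hM
      change matU ^ 2 • M ∈ pingX 0
      rw [mem_pingY_zero] at hM
      rw [mem_pingX_zero]
      omega
    · have := hL M
      change ¬ M ∈ pingY 1 at hM
      change matL ^ 2 • M ∈ pingX 1
      rw [mem_pingY_one] at hM
      rw [mem_pingX_one]
      omega
  · rintro i _ ⟨M, hM, rfl⟩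
    have := col_ne_zero M
    fin_cases i
    · have := hU' M
      change ¬ M ∈ pingX 0 at hM
      change (matU ^ 2)⁻¹ • M ∈ pingY 0
      rw [mem_pingX_zero] at hM
      rw [mem_pingY_zero]
      omega
    · have := hL' M
      change ¬ M ∈ pingX 1 at hM
      change (matL ^ 2)⁻¹ • M ∈ pingY 1
      rw [mem_pingX_one] at hM
      rw [mem_pingY_one]
      omega

lemma D_three : (D 3 : B 3) = A 0 1 * (A 0 2 * A 1 2) := by
  rw [D_succ, D_succ, D_one]
  simp [X, ι_y]

lemma burau_D : burau (D 3) = -1 := by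
  rw [D_three, A_succ (j := 0) (k := 1) (by omega), A_self, A_self]
  simp only [map_mul, map_pow, map_inv, burau_s_zero, burau_s_one]
  decide

lemma exists_eq_sanov {b : B 3} (hb : b ∈ P 3) : ∃ w k, b = sanov w * D 3 ^ (k : ℤ) := by
  let f := MonoidHom.noncommCoprod sanov (zpowersHom _ (D 3 : B 3)) fun w k =>
    ((commute_D_top (sanov w)).zpow_left k.toAdd).symm
  have h0 : A 0 1 ∈ f.range := ⟨(FreeGroup.of 0, 1), by simp [f, sanov, A_self]⟩
  have h1 : A 1 2 ∈ f.range := ⟨(FreeGroup.of 1, 1), by simp [f, sanov, A_self]⟩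
  have h2 : D 3 ∈ f.range := ⟨(1, .ofAdd 1), (one_mul _).trans (zpow_one (D 3 : B 3))⟩
  obtain ⟨⟨w, k⟩, rfl⟩ := P_le_of_A (H := f.range) (fun j k hj hk => by
    have : (j = 0 ∧ k = 1) ∨ (j = 1 ∧ k = 2) ∨ (j = 0 ∧ k = 2) := by omega
    rcases this with ⟨rfl, rfl⟩ | ⟨rfl, rfl⟩ | ⟨rfl, rfl⟩
    · exact h0
    · exact h1
    · have h := mul_mem (mul_mem (inv_mem h0) h2) (inv_mem h1)
      rw [D_three] at h
      convert h using 1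
      group) hb
  exact ⟨w, k.toAdd, rfl⟩

lemma mem_zpowers_D_of_burau {b : B 3} (hb : b ∈ P 3) (h : burau b = 1 ∨ burau b = -1) :
    ∃ k : ℤ, b = D 3 ^ k := by
  obtain ⟨w, k, rfl⟩ := exists_eq_sanov hb
  have hs : burau (sanov w) ^ 2 = 1 := by
    have h1 : burau (sanov w * D 3 ^ k) ^ 2 = 1 := by rcases h with h | h <;> rw [h] <;> simp
    rwa [map_mul, map_zpow, burau_D, ((Commute.neg_one_right _).zpow_right k).mul_pow,
      ← zpow_natCast ((-1 : SL(2, ℤ)) ^ k), ← zpow_mul, mul_comm, zpow_mul, zpow_natCast, neg_one_sq,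
      one_zpow, mul_one] at h1
  have hw : w ^ 2 = 1 := burau_sanov_injective (by
    rw [map_pow, map_one]; exact hs)
  have hw1 : w = 1 := by simpa using hw
  exact ⟨k, by rw [hw1, map_one, one_mul]⟩

end Braid

namespace Braid
variable {n : ℕ}
open Equiv MatrixGroups

lemma exists_lo (β : B n) : ∃ b : B 3, art b = art (fg 3 β) := by
  have h := fg_mem_Bk 3 β
  generalize fg 3 β = c at h ⊢
  unfold Bk at h
  induction h using Subgroup.closure_induction with
  | mem x hx =>
    obtain ⟨i, hi, rfl⟩ := hx
    by_cases h : i + 1 < n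
    · exact ⟨s i, by rw [art_s hi, art_s h]⟩
    · exact ⟨1, by rw [s_of_ge (by omega), map_one, map_one]⟩
  | one => exact ⟨1, by rw [map_one, map_one]⟩
  | mul x y _ _ hx hy =>
    obtain ⟨a, ha⟩ := hx
    obtain ⟨b, hb⟩ := hy
    exact ⟨a * b, by rw [map_mul, map_mul, ha, hb]⟩
  | inv x _ hx =>
    obtain ⟨a, ha⟩ := hx
    exact ⟨a⁻¹, by rw [map_inv, map_inv, ha]⟩

/-- The three strand braid obtained by forgetting all but the first three strands. -/
noncomputable def lo (β : B n) : B 3 := (exists_lo β).choose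

lemma art_lo (β : B n) : art (lo β) = art (fg 3 β) := (exists_lo β).choose_spec

lemma lo_eq {β : B n} {b : B 3} (h : art b = art (fg 3 β)) : lo β = b :=
  art_injective (by rw [art_lo, h])

lemma lo_inj {β γ : B n} (h : lo β = lo γ) : fg 3 β = fg 3 γ :=
  art_injective (by rw [← art_lo, h, art_lo])

lemma lo_mul {β γ : B n} (hβ : β ∈ Hs n 3) (hγ : γ ∈ Hs n 3) : lo (β * γ) = lo β * lo γ :=
  lo_eq (by rw [map_mul, art_lo, art_lo, fg_mul hβ hγ, map_mul])

lemma lo_one : lo (1 : B n) = 1 := lo_eq (by rw [fg_one, map_one, map_one])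

lemma lo_inv {β : B n} (hβ : β ∈ Hs n 3) : lo β⁻¹ = (lo β)⁻¹ :=
  lo_eq (by rw [map_inv, art_lo, fg_inv hβ, map_inv])

lemma lo_s_of_lt {i : ℕ} (h : i < 2) (hn : 3 ≤ n) : lo (s i : B n) = s i :=
  lo_eq (by rw [fg_of_mem (s_mem_Bk (by omega)), art_s (by omega), art_s (by omega)])

lemma perm_eq_of_art {m : ℕ} {b : B m} {c : B n} (h : art b = art c) (j : ℕ) :
    perm b j = perm c j := by
  obtain ⟨g, hg⟩ := art_conj_perm b j
  obtain ⟨g', hg'⟩ := art_conj_perm c j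
  rw [h, hg'] at hg
  have := congrArg (cnt (perm b j)) hg
  by_contra hne
  rw [cnt_conj, cnt_conj, cnt_y, cnt_y, if_pos rfl, if_neg (Ne.symm hne)] at this
  exact absurd this (by decide)

lemma perm_lo (β : B n) : perm (lo β) = perm (fg 3 β) :=
  Equiv.ext fun j => perm_eq_of_art (art_lo β) j

lemma lo_mem_P {β : B n} (hβ : β ∈ P n) : lo β ∈ P 3 := by
  rw [mem_P, perm_lo]; exact fg_mem_P hβ 3

lemma fg_s_of_ge {i : ℕ} (h : 3 ≤ i) : (s i : B n) ∈ Hs n 3 ∧ fg 3 (s i : B n) = 1 := by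
  have key : ∀ x, ret 3 (art (s i : B n) x) = art (1 : B n) (ret 3 x) := by
    intro x
    rw [map_one, MulAut.one_apply]
    by_cases hi : i + 1 < n
    · rw [art_s hi]
      have : (ret 3).comp (artGen i).toMonoidHom = ret 3 := by
        ext m
        change ret 3 (artGen i (y m)) = ret 3 (y m)
        by_cases h1 : m = i
        · subst h1
          rw [artGen_self, ret_y_of_ge h, ret_y_of_ge (by omega)]
        · by_cases h2 : m = i + 1
          · subst h2; rw [artGen_succ, map_mul, map_mul, map_inv, ret_y_of_ge h, ret_y_of_ge (by omega)]; simp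
          · rw [artGen_ne h1 h2]
      exact DFunLike.congr_fun this x
    · rw [s_of_ge (by omega), map_one, MulAut.one_apply]
  exact ⟨⟨1, one_mem _, key⟩, fg_eq (one_mem _) key⟩

lemma s_mem_Hs {i : ℕ} (h : i ≠ 2) : (s i : B n) ∈ Hs n 3 := by
  by_cases hi : 3 ≤ i
  · exact (fg_s_of_ge hi).1
  · exact Bk_le_Hs 3 (s_mem_Bk (by omega))

lemma lo_s_of_ge {i : ℕ} (h : 3 ≤ i) : lo (s i : B n) = 1 :=
  lo_eq (by rw [(fg_s_of_ge h).2, map_one, map_one])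

lemma lo_A {k j : ℕ} (h : 3 ≤ k) (hk : k < n) : lo (A j k : B n) = 1 :=
  lo_eq (by rw [← ι_y, fg_ι hk h, map_one, map_one])

/-- The braids of exponent sum zero preserving the first three strands. -/
def St (n : ℕ) : Subgroup (B n) := Hs n 3 ⊓ expo.ker

lemma mem_St {β : B n} : β ∈ St n ↔ β ∈ Hs n 3 ∧ ee β = 0 := Iff.rfl

lemma Auto.map_mem_Hs {φ : B n → B n} (hφ : Auto φ) {d : B n} (hd : d ∈ St n) :
    φ d ∈ Hs n 3 := by
  have : φ d * d⁻¹ ∈ P n := by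
    rw [mem_P, _root_.map_mul, _root_.map_inv, hφ.perm_map hd.2, mul_inv_cancel]
  have h := mul_mem (P_le_Hs 3 this) hd.1
  rwa [inv_mul_cancel_right] at h

/-- The action of `φ` on the stabilizer of the first three strands, as integer matrices. -/
noncomputable def tr (φ : B n → B n) (d : B n) : SL(2, ℤ) := burau (lo (φ d))

namespace Auto
variable {φ : B n → B n} (hφ : Auto φ)
include hφ

lemma tr_mul {a b : B n} (ha : a ∈ St n) (hb : b ∈ St n) : tr φ (a * b) = tr φ a * tr φ b := by
  unfold tr
  rw [hφ.map_mul ha.2 hb.2, lo_mul (hφ.map_mem_Hs ha) (hφ.map_mem_Hs hb), _root_.map_mul]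

lemma tr_inv {a : B n} (ha : a ∈ St n) : tr φ a⁻¹ = (tr φ a)⁻¹ := by
  unfold tr
  rw [hφ.map_inv ha.2, lo_inv (hφ.map_mem_Hs ha), _root_.map_inv]

lemma tr_conj {a b : B n} (ha : a ∈ St n) (hb : b ∈ St n) :
    tr φ (a * b * a⁻¹) = tr φ a * tr φ b * (tr φ a)⁻¹ := by
  rw [hφ.tr_mul (mul_mem ha hb) (inv_mem ha), hφ.tr_mul ha hb, hφ.tr_inv ha]

lemma tr_commute {a b : B n} (ha : a ∈ St n) (hb : b ∈ St n) (h : Commute a b) :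
    Commute (tr φ a) (tr φ b) := by
  rw [Commute, SemiconjBy, ← hφ.tr_mul ha hb, h.eq, hφ.tr_mul hb ha]

lemma red_tr {d : B n} (hd : d ∈ St n) : red (tr φ d) = red (burau (lo d)) := by
  have : φ d * d⁻¹ ∈ P n := by
    rw [mem_P, _root_.map_mul, _root_.map_inv, hφ.perm_map hd.2, mul_inv_cancel]
  unfold tr
  rw [← inv_mul_cancel_right (φ d) d, lo_mul (P_le_Hs 3 this) hd.1, _root_.map_mul, _root_.map_mul,
    red_of_mem_P (lo_mem_P this), one_mul]

end Auto

/-- The quotient of two generators. -/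
def q (i j : ℕ) : B n := s i * (s j)⁻¹

lemma q_mem_St {i j : ℕ} (hi : i ≠ 2) (hj : j ≠ 2) (hi' : i + 1 < n) (hj' : j + 1 < n) :
    (q i j : B n) ∈ St n :=
  mem_St.2 ⟨mul_mem (s_mem_Hs hi) (inv_mem (s_mem_Hs hj)), by
    rw [q, ee_mul, ee_inv, ee_s hi', ee_s hj']; rfl⟩

end Braid

namespace Braid
open MatrixGroups

/-- A matrix of `SL(2, ℤ)` acting trivially on the projective line. -/
def Sc (M : SL(2, ℤ)) : Prop := M = 1 ∨ M = -1

lemma sl_ext {M N : SL(2, ℤ)} (h1 : M 0 0 = N 0 0) (h2 : M 0 1 = N 0 1) (h3 : M 1 0 = N 1 0)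
    (h4 : M 1 1 = N 1 1) : M = N := by
  ext i j; fin_cases i <;> fin_cases j <;> assumption

lemma sl_mul (M N : SL(2, ℤ)) :
    (M * N) 0 0 = M 0 0 * N 0 0 + M 0 1 * N 1 0 ∧ (M * N) 0 1 = M 0 0 * N 0 1 + M 0 1 * N 1 1 ∧
    (M * N) 1 0 = M 1 0 * N 0 0 + M 1 1 * N 1 0 ∧ (M * N) 1 1 = M 1 0 * N 0 1 + M 1 1 * N 1 1 := by
  simp [Matrix.mul_apply, Fin.sum_univ_two]

lemma sl_one : (1 : SL(2, ℤ)) 0 0 = 1 ∧ (1 : SL(2, ℤ)) 0 1 = 0 ∧ (1 : SL(2, ℤ)) 1 0 = 0 ∧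
    (1 : SL(2, ℤ)) 1 1 = 1 := by decide

lemma sl_neg (M : SL(2, ℤ)) : (-M) 0 0 = -M 0 0 ∧ (-M) 0 1 = -M 0 1 ∧ (-M) 1 0 = -M 1 0 ∧
    (-M) 1 1 = -M 1 1 := by simp

lemma sl_det (M : SL(2, ℤ)) : M 0 0 * M 1 1 - M 0 1 * M 1 0 = 1 := by
  rw [← Matrix.det_fin_two, M.det_coe]

lemma sl_commute_iff {M N : SL(2, ℤ)} : Commute M N ↔ M 0 1 * N 1 0 = N 0 1 * M 1 0 ∧
    M 0 1 * (N 0 0 - N 1 1) = N 0 1 * (M 0 0 - M 1 1) ∧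
    M 1 0 * (N 0 0 - N 1 1) = N 1 0 * (M 0 0 - M 1 1) := by
  obtain ⟨h1, h2, h3, h4⟩ := sl_mul M N
  obtain ⟨k1, k2, k3, k4⟩ := sl_mul N M
  constructor
  · intro h
    rw [h.eq] at h1 h2 h3 h4
    refine ⟨by linarith, by linarith, by linarith⟩
  · rintro ⟨e1, e2, e3⟩
    apply sl_ext <;> linarith

lemma sc_iff {M : SL(2, ℤ)} : Sc M ↔ M 0 1 = 0 ∧ M 1 0 = 0 ∧ M 0 0 = M 1 1 := by
  obtain ⟨o1, o2, o3, o4⟩ := sl_one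
  obtain ⟨n1, n2, n3, n4⟩ := sl_neg 1
  constructor
  · rintro (rfl | rfl)
    · exact ⟨o2, o3, by rw [o1, o4]⟩
    · rw [n1, n2, n3, n4, o1, o2, o3, o4]; decide
  · rintro ⟨h1, h2, h3⟩
    have := sl_det M
    rw [h1, h2, h3, mul_zero, sub_zero] at this
    rcases Int.eq_one_or_neg_one_of_mul_eq_one this with h | h
    · left; apply sl_ext <;> linarith
    · right; apply sl_ext <;> linarith

lemma sc_of_diag {M : SL(2, ℤ)} (h1 : M 0 1 = 0) (h2 : M 1 0 = 0) : Sc M := by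
  refine sc_iff.2 ⟨h1, h2, ?_⟩
  have := sl_det M
  rw [h1, zero_mul, sub_zero] at this
  rcases Int.mul_eq_one_iff_eq_one_or_neg_one.1 this with ⟨h, h'⟩ | ⟨h, h'⟩ <;> rw [h, h']

lemma Sc.one : Sc 1 := Or.inl rfl

lemma Sc.mul {M N : SL(2, ℤ)} (hM : Sc M) (hN : Sc N) : Sc (M * N) := by
  rcases hM with rfl | rfl <;> rcases hN with rfl | rfl <;> simp [Sc]

lemma Sc.inv {M : SL(2, ℤ)} (hM : Sc M) : Sc M⁻¹ := by
  rcases hM with rfl | rfl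
  · exact Or.inl inv_one
  · exact Or.inr (by decide)

lemma Sc.commute {M : SL(2, ℤ)} (hM : Sc M) (N : SL(2, ℤ)) : Commute M N := by
  rcases hM with rfl | rfl
  · exact Commute.one_left N
  · exact (Commute.neg_one_left N)

lemma commute_of_not_sc {X Y Z : SL(2, ℤ)} (hZ : ¬ Sc Z) (hX : Commute Z X) (hY : Commute Z Y) :
    Commute X Y := by
  rw [sl_commute_iff] at hX hY ⊢
  obtain ⟨x1, x2, x3⟩ := hX
  obtain ⟨y1, y2, y3⟩ := hY
  by_cases hb : Z 0 1 = 0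
  · by_cases hc : Z 1 0 = 0
    · exact absurd (sc_of_diag hb hc) hZ
    · refine ⟨mul_left_cancel₀ hc ?_, mul_left_cancel₀ hc ?_, mul_left_cancel₀ hc ?_⟩ <;> grind
  · refine ⟨mul_left_cancel₀ hb ?_, mul_left_cancel₀ hb ?_, mul_left_cancel₀ hb ?_⟩ <;> grind

lemma red_apply (M : SL(2, ℤ)) (i j : Fin 2) : red M i j = (M i j : ZMod 2) := rfl

lemma red_eq_one {M : SL(2, ℤ)} (h : red M = 1) :
    ∃ a b c d : ℤ, M 0 0 = 2 * a + 1 ∧ M 0 1 = 2 * b ∧ M 1 0 = 2 * c ∧ M 1 1 = 2 * d + 1 := by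
  have h1 : ((M 0 0 - 1 : ℤ) : ZMod 2) = 0 := by
    push_cast; rw [← red_apply, h]; decide
  have h2 : ((M 0 1 : ℤ) : ZMod 2) = 0 := by rw [← red_apply, h]; decide
  have h3 : ((M 1 0 : ℤ) : ZMod 2) = 0 := by rw [← red_apply, h]; decide
  have h4 : ((M 1 1 - 1 : ℤ) : ZMod 2) = 0 := by
    push_cast; rw [← red_apply, h]; decide
  rw [ZMod.intCast_zmod_eq_zero_iff_dvd] at h1 h2 h3 h4
  obtain ⟨a, ha⟩ := h1
  obtain ⟨b, hb⟩ := h2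
  obtain ⟨c, hc⟩ := h3
  obtain ⟨d, hd⟩ := h4
  push_cast at ha hb hc hd
  exact ⟨a, b, c, d, by linarith, hb, hc, by linarith⟩

lemma sc_of_cube {M : SL(2, ℤ)} (hr : red M = 1) (h : Sc (M ^ 3)) : Sc M := by
  obtain ⟨a, b, c, d, h1, h2, h3, h4⟩ := red_eq_one hr
  obtain ⟨m1, m2, m3, m4⟩ := sl_mul M M
  obtain ⟨l1, l2, l3, l4⟩ := sl_mul (M * M) M
  obtain ⟨e1, e2, -⟩ := sc_iff.1 h
  rw [pow_succ, pow_two] at e1 e2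
  rw [l2, m1, m2] at e1
  rw [l3, m3, m4] at e2
  have hd := sl_det M
  have ht : (M 0 0 + M 1 1) ^ 2 - 1 ≠ 0 := by
    intro h0
    rw [h1, h4] at h0
    have : 4 * (a + d + 1) ^ 2 = 1 := by linarith
    omega
  refine sc_of_diag (mul_left_cancel₀ ht ?_) (mul_left_cancel₀ ht ?_) <;> grind

end Braid

namespace Braid
variable {n : ℕ}
open MatrixGroups

lemma commute_s {i j : ℕ} (h : i + 2 ≤ j ∨ j + 2 ≤ i) : Commute (s i : B n) (s j) :=
  h.elim s_comm s_comm'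

lemma commute_q {i j k l : ℕ} (h1 : Commute (s i : B n) (s k)) (h2 : Commute (s i : B n) (s l))
    (h3 : Commute (s j : B n) (s k)) (h4 : Commute (s j : B n) (s l)) :
    Commute (q i j : B n) (q k l) :=
  ((h1.mul_right h2.inv_right).mul_left (h3.mul_right h4.inv_right).inv_left)

lemma commute_s_q {i k l : ℕ} (h1 : Commute (s i : B n) (s k)) (h2 : Commute (s i : B n) (s l)) :
    Commute (s i : B n) (q k l) := h1.mul_right h2.inv_right

lemma braid_mul_right {G : Type*} [Group G] {a b z : G} (h : a * b * a = b * a * b)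
    (ha : Commute z a) (hb : Commute z b) :
    a * z * (b * z) * (a * z) = b * z * (a * z) * (b * z) := by
  have key : ∀ x y : G, Commute z x → Commute z y → x * z * (y * z) * (x * z) = x * y * x * z ^ 3 :=
    fun x y hx hy => by
      calc x * z * (y * z) * (x * z) = x * (z * y) * (z * x) * z := by group
        _ = x * y * (z * (x * z)) * z := by rw [hy.eq, hx.eq]; simp only [mul_assoc]
        _ = x * y * x * z ^ 3 := by rw [← hx.eq, ← mul_assoc z, ← pow_two, (hx.pow_left 2).eq]; group
  rw [key a b ha hb, key b a hb ha, h]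

lemma braid_conj_ratio {G : Type*} [Group G] {a b : G} (h : a * b * a = b * a * b) :
    a * (a ^ 2 * b⁻¹ * a⁻¹) * a⁻¹ = a ^ 2 * b⁻¹ * a⁻¹ * (a * b⁻¹)⁻¹ := by
  calc a * (a ^ 2 * b⁻¹ * a⁻¹) * a⁻¹ = a ^ 2 * (a * b * a⁻¹)⁻¹ * a⁻¹ := by group
    _ = a ^ 2 * b⁻¹ * a⁻¹ * (a * b⁻¹)⁻¹ := by rw [braid_conj h]; group

lemma conj_pow_three {G : Type*} [Group G] {a c d : G} (h1 : a * c * a⁻¹ = d)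
    (h2 : a * d * a⁻¹ = d * c⁻¹) (h : Commute c d) : a ^ 3 * c * (a ^ 3)⁻¹ = c⁻¹ := by
  have e : a * (d * c⁻¹) * a⁻¹ = a * d * a⁻¹ * (a * c * a⁻¹)⁻¹ := by simp [mul_assoc]
  calc a ^ 3 * c * (a ^ 3)⁻¹ = a * (a * (a * c * a⁻¹) * a⁻¹) * a⁻¹ := by simp [pow_succ, mul_assoc]
    _ = c⁻¹ := by rw [h1, h2, e, h1, h2, h.inv_left.symm.eq, mul_inv_cancel_right]

lemma q_braid (h : 3 ≤ n) : (q 0 3 * q 1 3 * q 0 3 : B n) = q 1 3 * q 0 3 * q 1 3 :=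
  braid_mul_right (s_braid (i := 0) (by omega)) (commute_s (by omega)).inv_left
    (commute_s (by omega)).inv_left

section
variable {φ : B n → B n} (hφ : Auto φ) (hn : 7 ≤ n)
include hφ hn

lemma tr_braid : tr φ (q 0 3) * tr φ (q 1 3) * tr φ (q 0 3)
    = tr φ (q 1 3) * tr φ (q 0 3) * tr φ (q 1 3) := by
  have h0 : (q 0 3 : B n) ∈ St n := q_mem_St (by omega) (by omega) (by omega) (by omega)
  have h1 : (q 1 3 : B n) ∈ St n := q_mem_St (by omega) (by omega) (by omega) (by omega)
  rw [← hφ.tr_mul h0 h1, ← hφ.tr_mul (mul_mem h0 h1) h0, q_braid (by omega),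
    ← hφ.tr_mul h1 h0, ← hφ.tr_mul (mul_mem h1 h0) h1]

lemma red_tr_zero : red (tr φ (q 0 3)) = red matU := by
  rw [hφ.red_tr (q_mem_St (by omega) (by omega) (by omega) (by omega)), q,
    lo_mul (s_mem_Hs (by omega)) (inv_mem (s_mem_Hs (by omega))), lo_inv (s_mem_Hs (by omega)),
    lo_s_of_lt (by omega) (by omega), lo_s_of_ge (by omega), inv_one, mul_one, burau_s_zero]

lemma red_tr_one : red (tr φ (q 1 3)) = red matL := by
  rw [hφ.red_tr (q_mem_St (by omega) (by omega) (by omega) (by omega)), q,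
    lo_mul (s_mem_Hs (by omega)) (inv_mem (s_mem_Hs (by omega))), lo_inv (s_mem_Hs (by omega)),
    lo_s_of_lt (by omega) (by omega), lo_s_of_ge (by omega), inv_one, mul_one, burau_s_one]

lemma not_commute_tr : ¬ Commute (tr φ (q 0 3)) (tr φ (q 1 3)) := by
  intro h
  have := h.map red
  rw [red_tr_zero hφ hn, red_tr_one hφ hn, red_matU, red_matL] at this
  exact absurd this.eq (by decide)

lemma sc_of_commute {z : B n} (hz : z ∈ St n) (h0 : Commute z (q 0 3)) (h1 : Commute z (q 1 3)) :
    Sc (tr φ z) := by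
  by_contra h
  exact not_commute_tr hφ hn (commute_of_not_sc h
    (hφ.tr_commute hz (q_mem_St (by omega) (by omega) (by omega) (by omega)) h0)
    (hφ.tr_commute hz (q_mem_St (by omega) (by omega) (by omega) (by omega)) h1))

lemma sc_tr_far {i : ℕ} (h : 5 ≤ i) (hi : i + 1 < n) : Sc (tr φ (q i 3)) :=
  sc_of_commute hφ hn (q_mem_St (by omega) (by omega) (by omega) (by omega))
    (commute_q (commute_s (by omega)) (commute_s (by omega)) (commute_s (by omega)) (.refl _))
    (commute_q (commute_s (by omega)) (commute_s (by omega)) (commute_s (by omega)) (.refl _))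

lemma red_tr_q34 : red (tr φ (q 3 4)) = 1 := by
  rw [hφ.red_tr (q_mem_St (by omega) (by omega) (by omega) (by omega)), q,
    lo_mul (s_mem_Hs (by omega)) (inv_mem (s_mem_Hs (by omega))), lo_inv (s_mem_Hs (by omega)),
    lo_s_of_ge (by omega), lo_s_of_ge (by omega), inv_one, mul_one, map_one, map_one]

lemma sc_tr_q34 : Sc (tr φ (q 3 4)) := by
  have h30 : (q 3 0 : B n) ∈ St n := q_mem_St (by omega) (by omega) (by omega) (by omega)
  have h34 : (q 3 4 : B n) ∈ St n := q_mem_St (by omega) (by omega) (by omega) (by omega)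
  have h10 : (q 1 0 : B n) ∈ St n := q_mem_St (by omega) (by omega) (by omega) (by omega)
  have h03 : (q 0 3 : B n) ∈ St n := q_mem_St (by omega) (by omega) (by omega) (by omega)
  have h13 : (q 1 3 : B n) ∈ St n := q_mem_St (by omega) (by omega) (by omega) (by omega)
  have c3 : Commute (s 3 : B n) (q 1 0) := commute_s_q (commute_s (by omega)) (commute_s (by omega))
  have c4 : Commute (s 4 : B n) (q 1 0) := commute_s_q (commute_s (by omega)) (commute_s (by omega))
  have d3 : Commute (s 0 : B n) (s 3) := commute_s (by omega)
  have d4 : Commute (s 0 : B n) (s 4) := commute_s (by omega)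
  have conj30 : ∀ x : B n, Commute (s 0) x → q 3 0 * x * (q 3 0)⁻¹ = s 3 * x * (s 3)⁻¹ :=
    fun x hx => by
      rw [q, mul_assoc (s 3), hx.inv_left.eq]; group
  have br := s_braid (n := n) (i := 3) (by omega)
  set x := (s 3 : B n) with hx
  set z := (s 4 : B n) with hz
  have hq34 : (q 3 4 : B n) = x * z⁻¹ := rfl
  have e1 : q 3 0 * q 3 4 * (q 3 0)⁻¹ = x ^ 2 * z⁻¹ * x⁻¹ := by
    rw [hq34, conj30 _ (d3.mul_right d4.inv_right)]; simp [pow_succ, mul_assoc]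
  have e2 : (q 3 0 : B n) * (q 3 0 * q 3 4 * (q 3 0)⁻¹) * (q 3 0)⁻¹
      = q 3 0 * q 3 4 * (q 3 0)⁻¹ * (q 3 4)⁻¹ := by
    rw [e1, conj30 _ (((d3.pow_right 2).mul_right d4.inv_right).mul_right d3.inv_right), hq34]
    exact braid_conj_ratio br
  set α := tr φ (q 3 0) with hα
  set γ := tr φ (q 3 4) with hγ
  have hαr : red (α ^ 2) = 1 := by
    have : α = (tr φ (q 0 3))⁻¹ := by rw [hα, ← hφ.tr_inv h03]; simp [q]
    rw [this, map_pow, map_inv, red_tr_zero hφ hn, red_matU]; decide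
  set γ' := α * γ * α⁻¹ with hγ'
  have t1 : tr φ (q 3 0 * q 3 4 * (q 3 0)⁻¹) = γ' := hφ.tr_conj h30 h34
  have h34' := mul_mem (mul_mem h30 h34) (inv_mem h30)
  have t2 : α * γ' * α⁻¹ = γ' * γ⁻¹ := by
    rw [← t1, ← hφ.tr_conj h30 h34', e2, hφ.tr_mul h34' (inv_mem h34), hφ.tr_inv h34]
  have hu : ¬ Sc (tr φ (q 1 0)) := by
    intro h
    have : tr φ (q 1 3) = tr φ (q 1 0) * tr φ (q 0 3) := by
      rw [← hφ.tr_mul h10 h03]; simp [q]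
    apply not_commute_tr hφ hn
    rw [this]
    exact (h.commute _).symm.mul_right (.refl _)
  have hcomm : Commute γ γ' := by
    rw [← t1]
    refine commute_of_not_sc hu (hφ.tr_commute h10 h34 ?_) (hφ.tr_commute h10 h34' ?_)
    · exact (c3.mul_left c4.inv_left).symm
    · rw [e1]
      exact (((c3.pow_left 2).mul_left c4.inv_left).mul_left c3.inv_left).symm
  have h6 : Commute (α ^ 6) γ := by
    have h3 := conj_pow_three hγ'.symm t2 hcomm
    have : α ^ 6 * γ * (α ^ 6)⁻¹ = γ := by
      calc α ^ 6 * γ * (α ^ 6)⁻¹ = α ^ 3 * (α ^ 3 * γ * (α ^ 3)⁻¹) * (α ^ 3)⁻¹ := by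
            rw [pow_add α 3 3]; simp only [mul_inv_rev, mul_assoc]
        _ = γ := by rw [h3, ← conj_inv, h3, inv_inv]
    exact mul_inv_eq_iff_eq_mul.1 this
  by_cases hsc : Sc (α ^ 6)
  · have h2 : Sc (α ^ 2) := sc_of_cube hαr (by rwa [← pow_mul])
    have e3 : γ' * γ⁻¹ = γ := by
      rw [← t2, hγ']
      calc α * (α * γ * α⁻¹) * α⁻¹ = α ^ 2 * γ * (α ^ 2)⁻¹ := by simp [pow_two, mul_assoc]
        _ = γ := by rw [(h2.commute γ).eq, mul_inv_cancel_right]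
    have e4 : γ' = γ ^ 2 := by rw [pow_two]; exact mul_inv_eq_iff_eq_mul.1 e3
    refine sc_of_cube (red_tr_q34 hφ hn) (Or.inl ?_)
    rw [e3, e4, ← conj_pow, ← hγ', e4, ← pow_mul] at t2
    exact mul_right_cancel (b := γ) (by rw [← pow_succ, t2, one_mul])
  · have : Commute α γ := commute_of_not_sc hsc (.pow_self α 6) h6
    have e3 : γ' = γ := by rw [hγ', this.eq, mul_inv_cancel_right]
    rw [e3, mul_inv_cancel, this.eq, mul_inv_cancel_right] at t2
    exact Or.inl t2

end
end Braid

namespace Braid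
variable {n : ℕ}
open MatrixGroups

lemma s_braid' {i : ℕ} (h : i + 2 < n) :
    (s (i + 1) : B n) * s i * s (i + 1) = s i * s (i + 1) * s i := (s_braid h).symm

/-- The pure braid linking the third and fourth strands, with exponent sum corrected to zero. -/
def link : B n := s 2 ^ 2 * (s 5 ^ 2)⁻¹

lemma link_mem_St (hn : 7 ≤ n) : (link : B n) ∈ St n :=
  mem_St.2 ⟨mul_mem (P_le_Hs 3 (by rw [← A_self]; exact A_mem_P _ _))
    (inv_mem (pow_mem (s_mem_Hs (by omega)) 2)), by
    rw [link, ee_mul, ee_inv, ee_pow, ee_pow, ee_s (by omega), ee_s (by omega)]; rfl⟩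

lemma conj_link {i : ℕ} (hi : i = 1 ∨ i = 3) :
    (q i 5 * link * (q i 5)⁻¹ : B n) = s i * s 2 ^ 2 * (s i)⁻¹ * (s 5 ^ 2)⁻¹ := by
  have h5 : Commute (s 5 : B n) (s 2) := commute_s (by omega)
  have hi5 : Commute (s 5 : B n) (s i) := commute_s (by omega)
  have h : Commute (s 5 : B n) link := (h5.pow_right 2).mul_right (.inv_right (.self_pow _ 2))
  calc (q i 5 * link * (q i 5)⁻¹ : B n)
      = s i * ((s 5)⁻¹ * link) * s 5 * (s i)⁻¹ := by simp only [q]; group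
    _ = s i * s 2 ^ 2 * (s 5 ^ 2)⁻¹ * (s i)⁻¹ := by
        rw [h.inv_left.eq, ← mul_assoc, inv_mul_cancel_right, link, ← mul_assoc]
    _ = _ := by rw [mul_assoc, ((hi5.pow_left 2).inv_inv).eq, ← mul_assoc]

lemma conj_s_two (hn : 7 ≤ n) {i : ℕ} (hi : i = 1 ∨ i = 3) :
    (s i * s 2 ^ 2 * (s i)⁻¹ : B n) = (s 2)⁻¹ * s i ^ 2 * s 2 := by
  have h : (s i * s 2 * (s i)⁻¹ : B n) = (s 2)⁻¹ * s i * s 2 := by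
    rcases hi with rfl | rfl
    · exact braid_conj (s_braid (i := 1) (by omega))
    · exact braid_conj (s_braid' (i := 2) (by omega))
  rw [← conj_pow, h]; simp [pow_two, mul_assoc]

lemma commute_conj_link (hn : 7 ≤ n) :
    Commute (q 3 5 * link * (q 3 5)⁻¹ : B n) (q 1 5 * link * (q 1 5)⁻¹) := by
  rw [conj_link (.inl rfl), conj_link (.inr rfl)]
  have h2 : Commute (s 5 : B n) (s 2) := commute_s (by omega)
  have h1 : Commute (s 5 : B n) (s 1) := commute_s (by omega)
  have h3 : Commute (s 5 : B n) (s 3) := commute_s (by omega)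
  have h13 : Commute (s 3 : B n) (s 1) := commute_s (by omega)
  have k1 := (((h1.mul_right (h2.pow_right 2)).mul_right h1.inv_right).pow_left 2).inv_left
  have k3 := (((h3.mul_right (h2.pow_right 2)).mul_right h3.inv_right).pow_left 2).inv_left
  refine Commute.mul_left (Commute.mul_right ?_ k3.symm) (k1.mul_right (.refl _))
  rw [conj_s_two hn (.inl rfl), conj_s_two hn (.inr rfl)]
  simpa only [inv_inv] using (Commute.conj_iff (s 2 : B n)⁻¹).2 (h13.pow_pow 2 2)

section
variable {φ : B n → B n} (hφ : Auto φ) (hn : 7 ≤ n)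
include hφ hn

lemma sc_tr_q53 : Sc (tr φ (q 5 3)) := sc_tr_far hφ hn (by omega) (by omega)

lemma sc_tr_link : Sc (tr φ link) := by
  have h03 : (q 0 3 : B n) ∈ St n := q_mem_St (by omega) (by omega) (by omega) (by omega)
  have h13 : (q 1 3 : B n) ∈ St n := q_mem_St (by omega) (by omega) (by omega) (by omega)
  have h05 : (q 0 5 : B n) ∈ St n := q_mem_St (by omega) (by omega) (by omega) (by omega)
  have h15 : (q 1 5 : B n) ∈ St n := q_mem_St (by omega) (by omega) (by omega) (by omega)
  have h35 : (q 3 5 : B n) ∈ St n := q_mem_St (by omega) (by omega) (by omega) (by omega)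
  have h53 : (q 5 3 : B n) ∈ St n := q_mem_St (by omega) (by omega) (by omega) (by omega)
  have hl : (link : B n) ∈ St n := link_mem_St hn
  have s53 := sc_tr_q53 hφ hn
  have s35 : Sc (tr φ (q 3 5)) := by
    rw [show (q 3 5 : B n) = (q 5 3)⁻¹ by simp [q], hφ.tr_inv h53]; exact s53.inv
  have e0 : tr φ (q 0 3) = tr φ (q 0 5) * tr φ (q 5 3) := by
    rw [← hφ.tr_mul h05 h53]; simp [q]
  have e1 : tr φ (q 1 5) = tr φ (q 1 3) * tr φ (q 3 5) := by
    rw [← hφ.tr_mul h13 h35]; simp [q]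
  by_contra hsc
  have c0 : Commute (tr φ link) (tr φ (q 0 3)) := by
    rw [e0]
    refine .mul_right (hφ.tr_commute hl h05 ?_) (s53.commute _).symm
    exact (commute_s_q (commute_s (by omega)) (commute_s (by omega)) |>.pow_left 2).mul_left
      ((commute_s_q (commute_s (by omega)) (.refl _)).pow_left 2).inv_left
  have ex : tr φ (q 3 5 * link * (q 3 5)⁻¹) = tr φ link := by
    rw [hφ.tr_conj h35 hl, (s35.commute _).eq, mul_inv_cancel_right]
  have ey : tr φ (q 1 5 * link * (q 1 5)⁻¹) = tr φ (q 1 3) * tr φ link * (tr φ (q 1 3))⁻¹ := by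
    rw [hφ.tr_conj h15 hl, e1, mul_assoc _ (tr φ (q 3 5)), (s35.commute _).eq]; group
  have c1 := hφ.tr_commute (mul_mem (mul_mem h35 hl) (inv_mem h35))
    (mul_mem (mul_mem h15 hl) (inv_mem h15)) (commute_conj_link hn)
  rw [ex, ey] at c1
  have c2 := commute_of_not_sc hsc c0 c1
  have hb := tr_braid hφ hn
  have hnc := not_commute_tr hφ hn
  set α := tr φ (q 0 3)
  set β := tr φ (q 1 3)
  have hsc' : ¬ Sc (β * tr φ link * β⁻¹) := fun h => hsc <| by
    have := h.commute β
    have e : β * tr φ link * β⁻¹ = tr φ link := by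
      have h2 := this.eq
      rw [inv_mul_cancel_right] at h2
      exact (mul_left_cancel h2).symm
    rwa [e] at h
  have c3 := commute_of_not_sc hsc' c2.symm ((Commute.conj_iff β).2 c0)
  rw [braid_conj hb.symm] at c3
  apply hnc
  have := (Commute.conj_iff α).2 c3
  simpa [mul_assoc] using this

end

/-- The subgroup of the stabilizer of the first three strands generated by braids sent by every `tr φ`
to a controlled matrix. -/
def D0 (n : ℕ) : Subgroup (B n) :=
  Subgroup.closure ({q 0 3, q 1 3, link} ∪ {x | ∃ i, 4 ≤ i ∧ i + 1 < n ∧ x = q i 3})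

lemma D0_le_St (hn : 7 ≤ n) : D0 n ≤ St n := by
  rw [D0, Subgroup.closure_le]
  rintro x ((rfl | rfl | rfl) | ⟨i, h, hi, rfl⟩)
  · exact q_mem_St (by omega) (by omega) (by omega) (by omega)
  · exact q_mem_St (by omega) (by omega) (by omega) (by omega)
  · exact link_mem_St hn
  · exact q_mem_St (by omega) (by omega) (by omega) (by omega)

lemma q_mem_D0 {i : ℕ} (hi : i ≠ 2) (hi' : i + 1 < n) : (q i 3 : B n) ∈ D0 n := by
  by_cases h0 : i = 0
  · subst h0; exact Subgroup.subset_closure (by simp)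
  by_cases h1 : i = 1
  · subst h1; exact Subgroup.subset_closure (by simp)
  by_cases h3 : i = 3
  · subst h3; rw [q, mul_inv_cancel]; exact one_mem _
  exact Subgroup.subset_closure (.inr ⟨i, by omega, hi', rfl⟩)

lemma link_mem_D0 : (link : B n) ∈ D0 n := Subgroup.subset_closure (by simp)

lemma q_mem_D0' {i j : ℕ} (hi : i ≠ 2) (hi' : i + 1 < n) (hj : j ≠ 2) (hj' : j + 1 < n) :
    (q i j : B n) ∈ D0 n := by
  have := mul_mem (q_mem_D0 hi hi') (inv_mem (q_mem_D0 hj hj'))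
  simpa [q] using this

lemma s_conj_D0 (hn : 7 ≤ n) {x : B n} (hx : x ∈ D0 n) : s 3 * x * (s 3)⁻¹ ∈ D0 n ∧
    (s 3)⁻¹ * x * s 3 ∈ D0 n := by
  have key : ∀ (x c : B n), Commute c x → s 3 * c⁻¹ ∈ D0 n → x ∈ D0 n → Commute c (s 3) →
      s 3 * x * (s 3)⁻¹ ∈ D0 n ∧ (s 3)⁻¹ * x * s 3 ∈ D0 n := by
    intro x c hc h1 h2 h3
    have e1 : s 3 * c⁻¹ * x * (s 3 * c⁻¹)⁻¹ = s 3 * x * (s 3)⁻¹ := by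
      rw [mul_assoc (s 3), hc.inv_left.eq]; group
    have e2 : (s 3 * c⁻¹)⁻¹ * x * (s 3 * c⁻¹) = (s 3)⁻¹ * x * s 3 := by
      rw [← h3.inv_left.eq]
      simp only [mul_inv_rev, inv_inv]
      rw [mul_assoc (s 3)⁻¹, hc.eq]; group
    exact ⟨e1 ▸ mul_mem (mul_mem h1 h2) (inv_mem h1), e2 ▸ mul_mem (mul_mem (inv_mem h1) h2) h1⟩
  unfold D0 at hx
  induction hx using Subgroup.closure_induction with
  | mem x hx =>
    have hmem : x ∈ D0 n := Subgroup.subset_closure hx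
    rcases hx with (rfl | rfl | rfl) | ⟨i, h, hi, rfl⟩
    · exact key _ (s 5) (commute_s_q (commute_s (by omega)) (commute_s (by omega)))
        (q_mem_D0' (i := 3) (j := 5) (by omega) (by omega) (by omega) (by omega)) hmem
        (commute_s (by omega))
    · exact key _ (s 5) (commute_s_q (commute_s (by omega)) (commute_s (by omega)))
        (q_mem_D0' (i := 3) (j := 5) (by omega) (by omega) (by omega) (by omega)) hmem
        (commute_s (by omega))
    · exact key _ (s 5) ((Commute.pow_right (commute_s (by omega)) 2).mul_right
        (.inv_right (.self_pow _ 2)))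
        (q_mem_D0' (i := 3) (j := 5) (by omega) (by omega) (by omega) (by omega)) hmem
        (commute_s (by omega))
    · exact key _ (s 0) (commute_s_q (commute_s (by omega)) (commute_s (by omega)))
        (q_mem_D0' (i := 3) (j := 0) (by omega) (by omega) (by omega) (by omega)) hmem
        (commute_s (by omega))
  | one => simp [one_mem]
  | mul x y _ _ hx hy =>
    refine ⟨?_, ?_⟩
    · rw [conj_mul]; exact mul_mem hx.1 hy.1
    · have := mul_mem hx.2 hy.2
      convert this using 1; group
  | inv x _ hx =>
    refine ⟨?_, ?_⟩
    · rw [← conj_inv]; exact inv_mem hx.1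
    · have := inv_mem hx.2
      convert this using 1; group

end Braid

namespace Braid
open MatrixGroups

lemma sl_inv (M : SL(2, ℤ)) : M⁻¹ 0 0 = M 1 1 ∧ M⁻¹ 0 1 = -M 0 1 ∧ M⁻¹ 1 0 = -M 1 0 ∧
    M⁻¹ 1 1 = M 0 0 := by
  rw [Matrix.SpecialLinearGroup.SL2_inv_expl]; simp

section braided
variable {A B : SL(2, ℤ)} (hb : A * B * A = B * A * B)
include hb

lemma mul_pow_three_of_braid : (A * B) ^ 3 = (A * B * A) ^ 2 := by
  calc (A * B) ^ 3 = A * B * A * (B * A * B) := by simp [pow_succ, mul_assoc]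
    _ = (A * B * A) ^ 2 := by rw [← hb, pow_two]

lemma trace_eq_of_braid : A 0 0 + A 1 1 = B 0 0 + B 1 1 := by
  have h : (A * B) * A = B * (A * B) := by rw [hb, mul_assoc]
  have e : B = A * B * A * (A * B)⁻¹ := by rw [h, mul_inv_cancel_right]
  have hd := sl_det (A * B)
  obtain ⟨m1, -, -, m4⟩ := sl_mul (A * B * A) (A * B)⁻¹
  obtain ⟨l1, l2, l3, l4⟩ := sl_mul (A * B) A
  obtain ⟨i1, i2, i3, i4⟩ := sl_inv (A * B)
  rw [← e] at m1 m4
  rw [m1, m4, l1, l2, l3, l4, i1, i2, i3, i4]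
  linear_combination (- A 0 0 - A 1 1) * hd

lemma garside_mul_left : A * B * A * A = B * (A * B * A) := by rw [hb]; simp only [mul_assoc] at hb ⊢; rw [hb]

lemma garside_mul_right : A * B * A * B = A * (A * B * A) := by
  rw [mul_assoc, mul_assoc, ← mul_assoc B, ← hb]

variable (hnc : ¬ Commute A B)
include hnc

lemma sc_mul_pow_three : Sc ((A * B) ^ 3) := by
  have h1 := garside_mul_left hb
  have h2 := garside_mul_right hb
  by_contra hsc
  apply hnc
  refine commute_of_not_sc hsc ?_ ?_ <;> rw [mul_pow_three_of_braid hb] <;>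
    generalize A * B * A = X at h1 h2 <;> rw [Commute, SemiconjBy, pow_two, mul_assoc]
  · rw [h1, ← mul_assoc, h2, mul_assoc]
  · rw [h2, ← mul_assoc, h1, mul_assoc]

lemma trace_mul_eq_one : (A * B) 0 0 + (A * B) 1 1 = 1 := by
  have hsc := sc_mul_pow_three hb hnc
  have hC : ¬ Sc (A * B) := fun h => hnc <| by
    have h2 := (h.commute A).eq
    rw [mul_assoc] at h2
    exact (mul_left_cancel h2).symm
  have hX : ¬ Sc (A * B * A) := fun h => hnc <| by
    have h1 := (h.commute A).eq
    rw [garside_mul_left hb] at h1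
    rw [mul_right_cancel h1]
  have h2 := mul_pow_three_of_braid hb
  have h3 : (A * B) ^ 3 = -1 := by
    rw [h2] at hsc ⊢
    generalize A * B * A = X at *
    obtain ⟨m1, m2, m3, m4⟩ := sl_mul X X
    obtain ⟨e1, e2, -⟩ := sc_iff.1 hsc
    obtain ⟨o1, o2, o3, o4⟩ := sl_one
    obtain ⟨n1, n2, n3, n4⟩ := sl_neg 1
    rw [pow_two] at *
    have ht : X 0 0 + X 1 1 = 0 := by
      by_contra ht
      refine hX (sc_of_diag (mul_left_cancel₀ ht ?_) (mul_left_cancel₀ ht ?_)) <;> linarith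
    have hd := sl_det X
    have h5 : X 1 1 = - X 0 0 := by linarith
    rw [h5] at hd
    apply sl_ext
    · linarith
    · rw [e1, n2, o2, neg_zero]
    · rw [e2, n3, o3, neg_zero]
    · rw [m4, n4, o4, h5]; linarith
  generalize A * B = X at *
  have hd := sl_det X
  obtain ⟨m1, m2, m3, m4⟩ := sl_mul X X
  obtain ⟨l1, l2, l3, l4⟩ := sl_mul (X * X) X
  obtain ⟨o1, o2, o3, o4⟩ := sl_one
  obtain ⟨n1, n2, n3, n4⟩ := sl_neg 1
  rw [pow_succ, pow_two] at h3
  rw [h3, n1, o1, m1, m2] at l1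
  rw [h3, n2, o2, m1, m2] at l2
  rw [h3, n3, o3, m3, m4] at l3
  have ht : (X 0 0 + X 1 1) ^ 2 - 1 = 0 := by
    by_contra ht
    refine hC (sc_of_diag (mul_left_cancel₀ ht ?_) (mul_left_cancel₀ ht ?_)) <;> grind
  grind

end braided

lemma int_eq_mul_sq_of_isCoprime {x y z : ℤ} (hc : IsCoprime y z) (h : x ^ 2 + y * z = 0) :
    ∃ ε p q : ℤ, (ε = 1 ∨ ε = -1) ∧ x = - ε * p * q ∧ y = ε * p ^ 2 ∧ z = - ε * q ^ 2 := by
  obtain ⟨p, hp⟩ := Int.sq_of_isCoprime (a := y) (b := -z) (c := x) hc.neg_right (by linarith)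
  obtain ⟨q, hq⟩ := Int.sq_of_isCoprime (a := -z) (b := y) (c := x) hc.symm.neg_left (by linarith)
  have hz : z = - q ^ 2 ∨ z = q ^ 2 := by
    rcases hq with hq | hq
    · left; linarith
    · right; linarith
  have key : y * z = - (p * q) ^ 2 → x = p * q ∨ x = - (p * q) := fun h' => by
    rw [h'] at h; exact sq_eq_sq_iff_eq_or_eq_neg.1 (by linarith)
  have key' : y * z = (p * q) ^ 2 → x = 0 ∧ (p = 0 ∨ q = 0) := fun h' => by
    rw [h'] at h
    have h1 := sq_nonneg x
    have h2 := sq_nonneg (p * q)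
    exact ⟨pow_eq_zero_iff (n := 2) (by omega) |>.1 (by linarith), mul_eq_zero.1
      (pow_eq_zero_iff (n := 2) (by omega) |>.1 (by linarith))⟩
  rcases hp with rfl | rfl <;> rcases hz with rfl | rfl
  · rcases key (by ring) with rfl | rfl
    · exact ⟨1, p, -q, .inl rfl, by ring, by ring, by ring⟩
    · exact ⟨1, p, q, .inl rfl, by ring, by ring, by ring⟩
  · obtain ⟨rfl, rfl | rfl⟩ := key' (by ring)
    · exact ⟨-1, 0, q, .inr rfl, by ring, by ring, by ring⟩
    · exact ⟨1, p, 0, .inl rfl, by ring, by ring, by ring⟩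
  · obtain ⟨rfl, rfl | rfl⟩ := key' (by ring)
    · exact ⟨1, 0, q, .inl rfl, by ring, by ring, by ring⟩
    · exact ⟨-1, p, 0, .inr rfl, by ring, by ring, by ring⟩
  · rcases key (by ring) with rfl | rfl
    · exact ⟨-1, p, q, .inr rfl, by ring, by ring, by ring⟩
    · exact ⟨-1, p, -q, .inr rfl, by ring, by ring, by ring⟩

lemma exists_unipotent_vector {A : SL(2, ℤ)} (hA : A 0 0 + A 1 1 = 2) {x y z : ℤ}
    (h : 2 * ((A 0 0 - 1) * x) + A 0 1 * z + A 1 0 * y = -1) :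
    ∃ ε p q : ℤ, (ε = 1 ∨ ε = -1) ∧ A 0 0 = 1 - ε * p * q ∧ A 0 1 = ε * p ^ 2 ∧
      A 1 0 = - ε * q ^ 2 ∧ A 1 1 = 1 + ε * p * q := by
  have hd := sl_det A
  have h11 : A 1 1 = 2 - A 0 0 := by linarith
  rw [h11] at hd
  have h0 : (A 0 0 - 1) ^ 2 + A 0 1 * A 1 0 = 0 := by linarith
  have hc : IsCoprime (A 0 1) (A 1 0) := by
    rw [Int.isCoprime_iff_gcd_eq_one]
    set g := Int.gcd (A 0 1) (A 1 0)
    have h1 : (g : ℤ) ∣ A 0 1 := Int.gcd_dvd_left ..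
    have h2 : (g : ℤ) ∣ A 1 0 := Int.gcd_dvd_right ..
    have h3 : (g : ℤ) ^ 2 ∣ (A 0 0 - 1) ^ 2 := by
      rw [eq_neg_of_add_eq_zero_left h0, dvd_neg, pow_two]; exact mul_dvd_mul h1 h2
    have h4 : (g : ℤ) ∣ A 0 0 - 1 := (Int.pow_dvd_pow_iff (by omega)).1 h3
    have h5 : (g : ℤ) ∣ -1 := by
      rw [← h]
      exact dvd_add (dvd_add ((h4.mul_right x).mul_left 2) (h1.mul_right z)) (h2.mul_right y)
    have := Int.natAbs_dvd_natAbs.2 h5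
    simpa using this
  obtain ⟨ε, p, q, hε, e1, e2, e3⟩ := int_eq_mul_sq_of_isCoprime hc h0
  exact ⟨ε, p, q, hε, by linarith, e2, e3, by linarith⟩

lemma matU_apply : matU 0 0 = 1 ∧ matU 0 1 = 1 ∧ matU 1 0 = 0 ∧ matU 1 1 = 1 := by decide

lemma matL_apply : matL 0 0 = 1 ∧ matL 0 1 = 0 ∧ matL 1 0 = -1 ∧ matL 1 1 = 1 := by decide

/-- Two braided noncommuting matrices of trace two are simultaneously conjugate to the standard ones
or to their inverses. -/
lemma exists_conj_of_trace_two {A B : SL(2, ℤ)} (hA : A 0 0 + A 1 1 = 2) (hB : B 0 0 + B 1 1 = 2)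
    (hAB : (A * B) 0 0 + (A * B) 1 1 = 1) :
    ∃ X : SL(2, ℤ), (A * X = X * matU ∧ B * X = X * matL) ∨
      (A * X = X * matU⁻¹ ∧ B * X = X * matL⁻¹) := by
  obtain ⟨m1, -, -, m4⟩ := sl_mul A B
  rw [m1, m4] at hAB
  have hA' : A 1 1 = 2 - A 0 0 := by linarith
  have hB' : B 1 1 = 2 - B 0 0 := by linarith
  obtain ⟨ε, p, q, hε, a1, a2, a3, a4⟩ := exists_unipotent_vector (x := B 0 0 - 1) (y := B 0 1)
    (z := B 1 0) hA (by rw [hA', hB'] at hAB; linarith)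
  obtain ⟨δ, r, t, hδ, b1, b2, b3, b4⟩ := exists_unipotent_vector (x := A 0 0 - 1) (y := A 0 1)
    (z := A 1 0) hB (by rw [hA', hB'] at hAB; linarith)
  rw [a1, a2, a3, a4, b1, b2, b3, b4] at hAB
  have hε2 : ε * ε = 1 := by rcases hε with rfl | rfl <;> rfl
  have h : (ε * δ) * (p * t - q * r) ^ 2 = 1 := by linarith
  have hεδ : ε = δ := by
    have h0 := sq_nonneg (p * t - q * r)
    rcases hε with rfl | rfl <;> rcases hδ with rfl | rfl <;> first | rfl | (exfalso; linarith)
  subst hεδ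
  rw [hε2, one_mul] at h
  obtain ⟨u1, u2, u3, u4⟩ := matU_apply
  obtain ⟨l1, l2, l3, l4⟩ := matL_apply
  obtain ⟨u1', u2', u3', u4'⟩ := sl_inv matU
  obtain ⟨l1', l2', l3', l4'⟩ := sl_inv matL
  have key : ∀ r t : ℤ, p * t - r * q = 1 → B 0 0 = 1 - ε * r * t → B 0 1 = ε * r ^ 2 →
      B 1 0 = - ε * t ^ 2 → B 1 1 = 1 + ε * r * t → ∃ X : SL(2, ℤ),
      (A * X = X * matU ∧ B * X = X * matL) ∨ (A * X = X * matU⁻¹ ∧ B * X = X * matL⁻¹) := by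
    intro r t hd b1 b2 b3 b4
    refine ⟨⟨!![p, r; q, t], by rw [Matrix.det_fin_two_of, hd]⟩, ?_⟩
    set X : SL(2, ℤ) := ⟨!![p, r; q, t], by rw [Matrix.det_fin_two_of, hd]⟩
    have x1 : X 0 0 = p := rfl
    have x2 : X 0 1 = r := rfl
    have x3 : X 1 0 = q := rfl
    have x4 : X 1 1 = t := rfl
    clear_value X
    have hd' : p * t = 1 + r * q := by linarith
    rcases hε with rfl | rfl
    · left
      constructor
      all_goals
        apply sl_ext <;> simp only [sl_mul, x1, x2, x3, x4, a1, a2, a3, a4, b1, b2, b3, b4, u1, u2,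
          u3, u4, l1, l2, l3, l4] <;> grind
    · right
      constructor
      all_goals
        apply sl_ext <;> simp only [sl_mul, x1, x2, x3, x4, a1, a2, a3, a4, b1, b2, b3, b4, u1, u2,
          u3, u4, l1, l2, l3, l4, u1', u2', u3', u4', l1', l2', l3', l4'] <;> grind
  rcases sq_eq_one_iff.1 h with h | h
  · exact key r t (by linarith) b1 b2 b3 b4
  · exact key (-r) (-t) (by linarith) (by rw [b1]; ring) (by rw [b2]; ring) (by rw [b3]; ring)
      (by rw [b4]; ring)

section finite
variable {R : Type*} [CommRing R]

lemma sl2_mul_apply (M N : SL(2, R)) :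
    (M * N) 0 0 = M 0 0 * N 0 0 + M 0 1 * N 1 0 ∧ (M * N) 0 1 = M 0 0 * N 0 1 + M 0 1 * N 1 1 ∧
    (M * N) 1 0 = M 1 0 * N 0 0 + M 1 1 * N 1 0 ∧ (M * N) 1 1 = M 1 0 * N 0 1 + M 1 1 * N 1 1 := by
  simp [Matrix.mul_apply, Fin.sum_univ_two]

lemma sl2_trace_mul_comm (M N : SL(2, R)) :
    (M * N) 0 0 + (M * N) 1 1 = (N * M) 0 0 + (N * M) 1 1 := by
  obtain ⟨h1, -, -, h4⟩ := sl2_mul_apply M N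
  obtain ⟨k1, -, -, k4⟩ := sl2_mul_apply N M
  rw [h1, h4, k1, k4]; ring

lemma sl2_sq_of_trace_eq_zero {M : SL(2, R)} (h : M 0 0 + M 1 1 = 0) : M * M = -1 := by
  obtain ⟨h1, h2, h3, h4⟩ := sl2_mul_apply M M
  have hd : M 0 0 * M 1 1 - M 0 1 * M 1 0 = 1 := by rw [← Matrix.det_fin_two, M.det_coe]
  ext i j; fin_cases i <;> fin_cases j
  · simp only [Fin.zero_eta, h1]; simp; linear_combination M 0 0 * h - hd
  · simp only [Fin.zero_eta, Fin.mk_one, h2]; simp; linear_combination M 0 1 * h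
  · simp only [Fin.zero_eta, Fin.mk_one, h3]; simp; linear_combination M 1 0 * h
  · simp only [Fin.mk_one, h4]; simp; linear_combination M 1 1 * h - hd

lemma eq_or_neg_of_mem_closure {G : Type*} [Group G] [HasDistribNeg G] {a b x : G}
    (ha : a * a = -1) (hb : b * b = -1) (h : a * b * a = b * a * b)
    (hx : x ∈ Subgroup.closure {a, b, -1}) :
    ∃ w ∈ ({1, a, b, a * b, b * a, a * b * a} : Set G), x = w ∨ x = -w := by
  have hn : ∀ x : G, (∃ w ∈ ({1, a, b, a * b, b * a, a * b * a} : Set G), x = w ∨ x = -w) →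
      ∃ w ∈ ({1, a, b, a * b, b * a, a * b * a} : Set G), -x = w ∨ -x = -w := by
    rintro x ⟨w, hw, rfl | rfl⟩
    · exact ⟨_, hw, .inr rfl⟩
    · exact ⟨_, hw, .inl (neg_neg w)⟩
  have hmul : ∀ c : G, (∀ w ∈ ({1, a, b, a * b, b * a, a * b * a} : Set G),
      ∃ w' ∈ ({1, a, b, a * b, b * a, a * b * a} : Set G), w * c = w' ∨ w * c = -w') →
      ∀ x : G, (∃ w ∈ ({1, a, b, a * b, b * a, a * b * a} : Set G), x = w ∨ x = -w) →
      ∃ w ∈ ({1, a, b, a * b, b * a, a * b * a} : Set G), x * c = w ∨ x * c = -w := by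
    rintro c hc x ⟨w, hw, rfl | rfl⟩
    · exact hc _ hw
    · rw [neg_mul]; exact hn _ (hc _ hw)
  have hma := hmul a <| by
    rintro w (rfl | rfl | rfl | rfl | rfl | rfl)
    · exact ⟨a, by simp, by simp⟩
    · exact ⟨1, by simp, .inr ha⟩
    · exact ⟨w * a, by simp, by simp⟩
    · exact ⟨a * b * a, by simp, by simp⟩
    · exact ⟨b, by simp, by simp [mul_assoc, ha]⟩
    · exact ⟨a * b, by simp, by simp [mul_assoc, ha]⟩
  have hmb := hmul b <| by
    rintro w (rfl | rfl | rfl | rfl | rfl | rfl)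
    · exact ⟨b, by simp, by simp⟩
    · exact ⟨w * b, by simp, by simp⟩
    · exact ⟨1, by simp, .inr hb⟩
    · exact ⟨a, by simp, by simp [mul_assoc, hb]⟩
    · exact ⟨a * b * a, by simp, .inl h.symm⟩
    · refine ⟨b * a, by simp, .inr ?_⟩
      rw [mul_assoc, mul_assoc, ← mul_assoc b, ← h, mul_assoc a b, ← mul_assoc a a, ha, neg_mul,
        one_mul]
  have hia : a⁻¹ = -a := inv_eq_of_mul_eq_one_right (by rw [mul_neg, ha, neg_neg])
  have hib : b⁻¹ = -b := inv_eq_of_mul_eq_one_right (by rw [mul_neg, hb, neg_neg])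
  induction hx using Subgroup.closure_induction_right with
  | one => exact ⟨1, by simp, .inl rfl⟩
  | mul_right x _ y hy ih =>
    rcases hy with rfl | rfl | rfl
    · exact hma x ih
    · exact hmb x ih
    · rw [mul_neg, mul_one]; exact hn x ih
  | mul_inv_cancel x _ y hy ih =>
    rcases hy with rfl | rfl | rfl
    · rw [hia, mul_neg]; exact hn _ (hma x ih)
    · rw [hib, mul_neg]; exact hn _ (hmb x ih)
    · rw [inv_neg, inv_one, mul_neg, mul_one]; exact hn x ih

lemma sl2_trace_of_mem_closure {a b x : SL(2, R)} (ha : a 0 0 + a 1 1 = 0) (hb : b 0 0 + b 1 1 = 0)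
    (hab : (a * b) 0 0 + (a * b) 1 1 = 1) (h : a * b * a = b * a * b)
    (hx : x ∈ Subgroup.closure {a, b, -1}) :
    x = 1 ∨ x = -1 ∨ x 0 0 + x 1 1 = 0 ∨ x 0 0 + x 1 1 = 1 ∨ x 0 0 + x 1 1 = -1 := by
  have ha2 := sl2_sq_of_trace_eq_zero ha
  obtain ⟨w, hw, hx⟩ := eq_or_neg_of_mem_closure ha2 (sl2_sq_of_trace_eq_zero hb) h hx
  have key : w = 1 ∨ w 0 0 + w 1 1 = 0 ∨ w 0 0 + w 1 1 = 1 := by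
    rcases hw with rfl | rfl | rfl | rfl | rfl | rfl
    · exact .inl rfl
    · exact .inr (.inl ha)
    · exact .inr (.inl hb)
    · exact .inr (.inr hab)
    · exact .inr (.inr (by rw [sl2_trace_mul_comm, hab]))
    · refine .inr (.inl ?_)
      rw [sl2_trace_mul_comm, ← mul_assoc, ha2, neg_mul, one_mul]
      simp; linear_combination -hb
  have hneg : (-w) 0 0 + (-w) 1 1 = - (w 0 0 + w 1 1) := by simp; ring
  rcases hx with rfl | rfl
  · tauto
  · rw [hneg]
    rcases key with rfl | h | h
    · exact .inr (.inl rfl)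
    · rw [h]; simp
    · rw [h]; simp

end finite

lemma trace_eq_two_of_mem_closure {A B : SL(2, ℤ)} {t : ℤ} (hA : A 0 0 + A 1 1 = t)
    (hB : B 0 0 + B 1 1 = t) (hAB : (A * B) 0 0 + (A * B) 1 1 = 1) (hb : A * B * A = B * A * B)
    (ht : (2 : ℤ) ∣ t) (hU : matU ∈ Subgroup.closure {A, B, -1}) : t = 2 ∨ t = -2 := by
  let f : SL(2, ℤ) →* SL(2, ZMod t.natAbs) :=
    Matrix.SpecialLinearGroup.map (Int.castRingHom (ZMod t.natAbs))
  have hf : ∀ M i j, f M i j = (M i j : ZMod t.natAbs) := fun M i j => rfl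
  have hcast : ∀ x : ℤ, (x : ZMod t.natAbs) = 0 → t ∣ x := fun x hx => by
    rw [ZMod.intCast_zmod_eq_zero_iff_dvd, Int.natAbs_dvd] at hx; exact hx
  have h0 : ((t : ℤ) : ZMod t.natAbs) = 0 := by
    rw [ZMod.intCast_zmod_eq_zero_iff_dvd, Int.natAbs_dvd]
  have hfU : f matU ∈ Subgroup.closure {f A, f B, -1} := by
    have := Subgroup.mem_map_of_mem f hU
    rw [MonoidHom.map_closure, Set.image_insert_eq, Set.image_insert_eq, Set.image_singleton] at this
    convert this
    ext i j; fin_cases i <;> fin_cases j <;> simp [hf]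
  obtain ⟨u1, u2, u3, u4⟩ := matU_apply
  have hodd : ¬ t ∣ 1 := fun h => by have := ht.trans h; omega
  have h3 : ¬ t ∣ 3 := fun h => by have := ht.trans h; omega
  rcases sl2_trace_of_mem_closure (a := f A) (b := f B) (x := f matU)
    (by rw [hf, hf, ← Int.cast_add, hA, h0]) (by rw [hf, hf, ← Int.cast_add, hB, h0])
    (by rw [← map_mul, hf, hf, ← Int.cast_add, hAB, Int.cast_one])
    (by rw [← map_mul, ← map_mul, hb, map_mul, map_mul]) hfU with h | h | h | h | h
  · have := hf matU 0 1
    rw [h, u2] at this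
    exact absurd (hcast 1 (by rw [← this]; simp)) hodd
  · have := hf matU 0 1
    rw [h, u2] at this
    exact absurd (hcast 1 (by rw [← this]; simp)) hodd
  · rw [hf, hf, u1, u4] at h
    have := hcast 2 (by rw [← h]; norm_num)
    have h1 := Int.le_of_dvd (by norm_num) this
    have h2 := Int.le_of_dvd (by norm_num) (neg_dvd.2 this)
    obtain ⟨k, rfl⟩ := ht
    have : k ≠ 0 := by rintro rfl; simp at this
    omega
  · rw [hf, hf, u1, u4] at h
    exact absurd (hcast 1 (by push_cast at h ⊢; linear_combination h)) hodd
  · rw [hf, hf, u1, u4] at h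
    exact absurd (hcast 3 (by push_cast at h ⊢; linear_combination h)) h3

end Braid

namespace Braid
variable {n : ℕ}
open MatrixGroups

lemma s_zpow_conj_D0 (hn : 7 ≤ n) {x : B n} (hx : x ∈ D0 n) (k : ℤ) :
    s 3 ^ k * x * s 3 ^ (-k) ∈ D0 n := by
  induction k with
  | zero => simpa
  | succ k ih =>
    have := (s_conj_D0 hn ih).1
    convert this using 1
    rw [add_comm, zpow_add, neg_add, add_comm (-1), zpow_add]; simp [mul_assoc]
  | pred k ih =>
    have := (s_conj_D0 hn ih).2
    convert this using 1
    rw [sub_eq_add_neg, add_comm, zpow_add, neg_add, add_comm (- -1), zpow_add]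
    simp [mul_assoc]

/-- The subgroup generated by `D0` and `s 3`. -/
def D0s (hn : 7 ≤ n) : Subgroup (B n) where
  carrier := {β | β * s 3 ^ (-ee β) ∈ D0 n}
  one_mem' := by simp [ee_one, one_mem]
  mul_mem' {a b} ha hb := by
    have := mul_mem ha (s_zpow_conj_D0 hn hb (ee a))
    rw [Set.mem_ofPred_eq, ee_mul, neg_add, add_comm, zpow_add]
    convert this using 1
    simp [mul_assoc]
  inv_mem' {a} ha := by
    have := s_zpow_conj_D0 hn (inv_mem ha) (-ee a)
    rw [Set.mem_ofPred_eq, ee_inv]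
    convert this using 1
    simp

lemma mem_D0s {hn : 7 ≤ n} {β : B n} : β ∈ D0s hn ↔ β * s 3 ^ (-ee β) ∈ D0 n := Iff.rfl

lemma s_mem_D0s (hn : 7 ≤ n) {i : ℕ} (hi : i ≠ 2) (hi' : i + 1 < n) : s i ∈ D0s hn := by
  rw [mem_D0s, ee_s hi', zpow_neg_one]; exact q_mem_D0 hi hi'

lemma s_sq_mem_D0s (hn : 7 ≤ n) : s 2 ^ 2 ∈ D0s hn := by
  rw [mem_D0s, ee_pow, ee_s (by omega)]
  have := mul_mem (link_mem_D0 (n := n)) (pow_mem (q_mem_D0 (n := n) (i := 5) (by omega) (by omega)) 2)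
  convert this using 1
  rw [link, q, ((commute_s (by omega) : Commute (s 5 : B n) (s 3)).inv_right).mul_pow]
  simp [mul_assoc, zpow_neg]

lemma A_mem_D0s (hn : 7 ≤ n) (k : ℕ) : ∀ j < k, k < n → A j k ∈ D0s hn := by
  have h3 : (A 2 3 : B n) = s 2 ^ 2 := A_self 2
  have conj : ∀ x i, x ∈ D0s hn → i ≠ 2 → i + 1 < n → s i * x * (s i)⁻¹ ∈ D0s hn := fun x i hx h h' =>
    mul_mem (mul_mem (s_mem_D0s hn h h') hx) (inv_mem (s_mem_D0s hn h h'))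
  have back : ∀ i, i ≠ 2 → i + 1 < 3 → A (i + 1) 3 ∈ D0s hn → A i 3 ∈ D0s hn := by
    intro i h h' hx
    rw [← s_A_self (by omega) (by omega)] at hx
    have hs := s_mem_D0s hn h (by omega)
    simpa [mul_assoc] using mul_mem (mul_mem (inv_mem hs) hx) hs
  have h23 : A 2 3 ∈ D0s hn := h3 ▸ s_sq_mem_D0s hn
  have h13 := back 1 (by omega) (by omega) h23
  have h03 := back 0 (by omega) (by omega) h13
  induction k with
  | zero => intro j h; omega
  | succ k ih =>
    intro j hj hk
    by_cases h : j = k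
    · subst h
      rw [A_self]
      by_cases h2 : j = 2
      · subst h2; exact s_sq_mem_D0s hn
      · exact pow_mem (s_mem_D0s hn h2 (by omega)) 2
    · by_cases h2 : k = 2
      · subst h2
        interval_cases j
        · exact h03
        · exact h13
        · exact h23
      · rw [A_succ h]
        exact conj _ _ (ih j (by omega) (by omega)) h2 (by omega)

lemma J_le_D0 (hn : 7 ≤ n) : J n ≤ D0 n := by
  intro x hx
  obtain ⟨h1, h2⟩ := mem_J.1 hx
  have := P_le_of_A (fun j k h h' => A_mem_D0s hn k j h h') h1
  rw [mem_D0s, h2] at this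
  simpa using this

end Braid

namespace Braid
variable {n : ℕ}
open MatrixGroups

lemma auto_id : Auto (id : B n → B n) where
  map_mul _ _ := rfl
  ee_map h := h
  surj {b} h := ⟨b, h, rfl⟩
  perm_map _ := rfl

lemma tr_id_zero (hn : 7 ≤ n) : tr id (q 0 3 : B n) = matU := by
  rw [tr, id, q, lo_mul (s_mem_Hs (by omega)) (inv_mem (s_mem_Hs (by omega))),
    lo_inv (s_mem_Hs (by omega)), lo_s_of_lt (by omega) (by omega), lo_s_of_ge (by omega), inv_one,
    mul_one, burau_s_zero]

lemma tr_id_one (hn : 7 ≤ n) : tr id (q 1 3 : B n) = matL := by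
  rw [tr, id, q, lo_mul (s_mem_Hs (by omega)) (inv_mem (s_mem_Hs (by omega))),
    lo_inv (s_mem_Hs (by omega)), lo_s_of_lt (by omega) (by omega), lo_s_of_ge (by omega), inv_one,
    mul_one, burau_s_one]

lemma tr_id_link (hn : 7 ≤ n) : tr id (link : B n) = 1 := by
  have h5 : (s 5 : B n) ∈ Hs n 3 := s_mem_Hs (by omega)
  rw [tr, id, link, ← A_self, lo_mul (P_le_Hs 3 (A_mem_P _ _)) (inv_mem (pow_mem h5 2)),
    lo_inv (pow_mem h5 2), lo_A (by omega) (by omega), pow_two, lo_mul h5 h5,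
    lo_s_of_ge (by omega)]
  simp

lemma tr_id_far {i : ℕ} (hi : 3 ≤ i) : tr id (q i 3 : B n) = 1 := by
  rw [tr, id, q, lo_mul (s_mem_Hs (by omega)) (inv_mem (s_mem_Hs (by omega))),
    lo_inv (s_mem_Hs (by omega)), lo_s_of_ge hi, lo_s_of_ge (by omega)]
  simp

lemma sc_tr_of_four_le {φ : B n → B n} (hφ : Auto φ) (hn : 7 ≤ n) {i : ℕ} (h : 4 ≤ i)
    (hi : i + 1 < n) : Sc (tr φ (q i 3)) := by
  by_cases h4 : i = 4
  · subst h4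
    have := (sc_tr_q34 hφ hn).inv
    rw [← hφ.tr_inv (q_mem_St (by omega) (by omega) (by omega) (by omega))] at this
    simpa [q] using this
  · exact sc_tr_far hφ hn (by omega) hi

lemma tr_induction {φ : B n → B n} (hφ : Auto φ) (hn : 7 ≤ n) {R : SL(2, ℤ) → SL(2, ℤ) → Prop}
    (hm : ∀ {a b c d}, R a b → R c d → R (a * c) (b * d)) (hi : ∀ {a b}, R a b → R a⁻¹ b⁻¹)
    (h0 : R (tr φ (q 0 3)) matU) (h1 : R (tr φ (q 1 3)) matL) (hs : ∀ {x}, Sc x → R x 1)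
    {d : B n} (hd : d ∈ D0 n) : R (tr φ d) (tr id d) := by
  have hle := D0_le_St hn
  have hid : Auto (id : B n → B n) := auto_id
  unfold D0 at hd
  induction hd using Subgroup.closure_induction with
  | mem x hx =>
    rcases hx with (rfl | rfl | rfl) | ⟨i, h, hi, rfl⟩
    · rwa [tr_id_zero hn]
    · rwa [tr_id_one hn]
    · rw [tr_id_link hn]; exact hs (sc_tr_link hφ hn)
    · rw [tr_id_far (by omega)]; exact hs (sc_tr_of_four_le hφ hn h hi)
  | one =>
    have e : ∀ φ : B n → B n, Auto φ → tr φ 1 = 1 := fun φ h => by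
      rw [tr, h.map_one, lo_one, map_one]
    rw [e φ hφ, e id hid]; exact hs .one
  | mul x y hx hy h h' =>
    rw [hφ.tr_mul (hle hx) (hle hy), hid.tr_mul (hle hx) (hle hy)]; exact hm h h'
  | inv x hx h => rw [hφ.tr_inv (hle hx), hid.tr_inv (hle hx)]; exact hi h

lemma matU_mem_closure {φ : B n → B n} (hφ : Auto φ) (hn : 7 ≤ n) :
    matU ∈ Subgroup.closure {tr φ (q 0 3), tr φ (q 1 3), -1} := by
  have hq : (q 0 3 : B n) ∈ St n := q_mem_St (by omega) (by omega) (by omega) (by omega)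
  obtain ⟨d, hd, e⟩ := hφ.surj hq.2
  have hD : d ∈ D0 n := by
    have : d * (q 0 3)⁻¹ ∈ J n := mem_J.2 ⟨by
      rw [mem_P, map_mul, ← hφ.perm_map hd, e, map_inv, mul_inv_cancel], by
      rw [ee_mul, ee_inv, hd, show ee (q 0 3 : B n) = 0 from hq.2]; rfl⟩
    have := mul_mem (J_le_D0 hn this) (q_mem_D0 (i := 0) (by omega) (by omega))
    rwa [inv_mul_cancel_right] at this
  have := tr_induction hφ hn (R := fun a _ => a ∈ Subgroup.closure {tr φ (q 0 3), tr φ (q 1 3), -1})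
    (fun h h' => mul_mem h h') (fun h => inv_mem h) (Subgroup.subset_closure (by simp))
    (Subgroup.subset_closure (by simp)) (fun {x} hx => ?_) hD
  · rwa [show tr φ d = matU by rw [tr, e]; exact tr_id_zero hn] at this
  · rcases hx with rfl | rfl
    · exact one_mem _
    · exact Subgroup.subset_closure (by simp)

lemma trace_tr {φ : B n → B n} (hφ : Auto φ) (hn : 7 ≤ n) :
    tr φ (q 0 3) 0 0 + tr φ (q 0 3) 1 1 = 2 ∨ tr φ (q 0 3) 0 0 + tr φ (q 0 3) 1 1 = -2 := by
  refine trace_eq_two_of_mem_closure rfl (trace_eq_of_braid (tr_braid hφ hn)).symm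
    (trace_mul_eq_one (tr_braid hφ hn) (not_commute_tr hφ hn)) (tr_braid hφ hn) ?_
    (matU_mem_closure hφ hn)
  have : ((tr φ (q 0 3) 0 0 + tr φ (q 0 3) 1 1 : ℤ) : ZMod 2) = 0 := by
    push_cast
    rw [← red_apply, ← red_apply, red_tr_zero hφ hn, red_matU]; decide
  exact_mod_cast (ZMod.intCast_zmod_eq_zero_iff_dvd _ 2).1 this

lemma exists_conj_tr {φ : B n → B n} (hφ : Auto φ) (hn : 7 ≤ n) : ∃ X : SL(2, ℤ),
    (Sc (tr φ (q 0 3) * (X * matU * X⁻¹)⁻¹) ∧ Sc (tr φ (q 1 3) * (X * matL * X⁻¹)⁻¹)) ∨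
    (Sc (tr φ (q 0 3) * (X * matU⁻¹ * X⁻¹)⁻¹) ∧ Sc (tr φ (q 1 3) * (X * matL⁻¹ * X⁻¹)⁻¹)) := by
  have hAB := trace_mul_eq_one (tr_braid hφ hn) (not_commute_tr hφ hn)
  have htB := trace_eq_of_braid (tr_braid hφ hn)
  have htA := trace_tr hφ hn
  generalize tr φ (q 0 3) = A, tr φ (q 1 3) = C at *
  have pos : ∀ {A X M : SL(2, ℤ)}, A * X = X * M → Sc (A * (X * M * X⁻¹)⁻¹) := by
    intro A X M h; left; rw [← h]; group
  have neg : ∀ {A X M : SL(2, ℤ)}, -A * X = X * M → Sc (A * (X * M * X⁻¹)⁻¹) := by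
    intro A X M h; right; rw [← h]; simp
  have ng : ∀ (M : SL(2, ℤ)) i j, (-M) i j = -(M i j) := fun M i j => rfl
  rcases htA with h | h
  · obtain ⟨X, ⟨h1, h2⟩ | ⟨h1, h2⟩⟩ := exists_conj_of_trace_two h (htB ▸ h) hAB
    · exact ⟨X, .inl ⟨pos h1, pos h2⟩⟩
    · exact ⟨X, .inr ⟨pos h1, pos h2⟩⟩
  · obtain ⟨X, ⟨h1, h2⟩ | ⟨h1, h2⟩⟩ := exists_conj_of_trace_two (A := -A) (B := -C)
      (by rw [ng, ng]; omega) (by rw [ng, ng]; omega) (by rw [neg_mul_neg]; exact hAB)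
    · exact ⟨X, .inl ⟨neg h1, neg h2⟩⟩
    · exact ⟨X, .inr ⟨neg h1, neg h2⟩⟩

end Braid

namespace Braid
variable {n : ℕ}
open MatrixGroups

/-- The mirror automorphism, inverting every generator. -/
def mirror : B n →* B n :=
  lift (fun i => (s i)⁻¹) (fun i j h _ => by rw [← mul_inv_rev, ← mul_inv_rev, s_comm h])
    (fun i h => by
      rw [← mul_inv_rev, ← mul_inv_rev, ← mul_inv_rev, ← mul_inv_rev, ← mul_assoc, ← mul_assoc,
        s_braid h])

lemma mirror_s {i : ℕ} (hi : i + 1 < n) : mirror (s i : B n) = (s i)⁻¹ := lift_s _ _ _ hi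

lemma mirror_mirror (β : B n) : mirror (mirror β) = β := by
  have : (mirror : B n →* B n).comp mirror = MonoidHom.id _ := hom_ext fun i hi => by
    rw [MonoidHom.comp_apply, mirror_s hi, map_inv, mirror_s hi, inv_inv, MonoidHom.id_apply]
  exact DFunLike.congr_fun this β

lemma perm_mirror (β : B n) : perm (mirror β) = perm β := by
  have : (perm : B n →* _).comp mirror = perm := hom_ext fun i hi => by
    rw [MonoidHom.comp_apply, mirror_s hi, map_inv, perm_s hi, Equiv.swap_inv]
  exact DFunLike.congr_fun this β

lemma ee_mirror (β : B n) : ee (mirror β) = -ee β := by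
  have : (expo : B n →* _).comp mirror = expo⁻¹ := hom_ext fun i hi => by
    rw [MonoidHom.comp_apply, mirror_s hi, map_inv, expo_s hi, MonoidHom.inv_apply, expo_s hi]
  exact congrArg Multiplicative.toAdd (DFunLike.congr_fun this β)

lemma Auto.mirror {φ : B n → B n} (hφ : Auto φ) : Auto fun a => φ (mirror a) where
  map_mul {a b} ha hb := by
    rw [_root_.map_mul, hφ.map_mul (by rw [ee_mirror, ha]; rfl) (by rw [ee_mirror, hb]; rfl)]
  ee_map {a} ha := hφ.ee_map (by rw [ee_mirror, ha]; rfl)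
  surj {b} hb := by
    obtain ⟨a, ha, rfl⟩ := hφ.surj hb
    exact ⟨Braid.mirror a, by rw [ee_mirror, ha]; rfl, by rw [mirror_mirror]⟩
  perm_map {a} ha := by rw [hφ.perm_map (by rw [ee_mirror, ha]; rfl), perm_mirror]

/-- The inclusion of the braid group on three strands. -/
def inc (hn : 3 ≤ n) : B 3 →* B n :=
  lift s (fun _ _ h _ => s_comm h) (fun _ h => s_braid (by omega))

lemma inc_s (hn : 3 ≤ n) {i : ℕ} (hi : i + 1 < 3) : inc hn (s i) = s i := lift_s _ _ _ hi

lemma inc_mem_Bk (hn : 3 ≤ n) (b : B 3) : inc hn b ∈ Bk n 3 := by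
  induction b using induct with
  | one => rw [map_one]; exact one_mem _
  | s_mul i β hi h => rw [map_mul, inc_s hn hi]; exact mul_mem (s_mem_Bk hi) h
  | inv_mul i β hi h => rw [map_mul, map_inv, inc_s hn hi]; exact mul_mem (inv_mem (s_mem_Bk hi)) h

lemma lo_inc (hn : 3 ≤ n) (b : B 3) : lo (inc hn b) = b := by
  have hH : ∀ b : B 3, inc hn b ∈ Hs n 3 := fun b => Bk_le_Hs 3 (inc_mem_Bk hn b)
  have hs : ∀ i, i + 1 < 3 → inc hn (s i) ∈ Hs n 3 := fun i _ => hH _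
  induction b using induct with
  | one => rw [map_one, lo_one]
  | s_mul i β hi h =>
    rw [map_mul, lo_mul (hH _) (hH _), h, inc_s hn hi, lo_s_of_lt (by omega) hn]
  | inv_mul i β hi h =>
    rw [map_mul, lo_mul (hH _) (hH _), h, map_inv, lo_inv (hH _), inc_s hn hi,
      lo_s_of_lt (by omega) hn]

lemma inc_mem_P (hn : 3 ≤ n) {b : B 3} (hb : b ∈ P 3) : inc hn b ∈ P n := by
  have := perm_lo (inc hn b)
  rw [lo_inc, fg_of_mem (inc_mem_Bk hn b)] at this
  rw [mem_P, ← this]; exact hb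

lemma inc_D (hn : 3 ≤ n) : inc hn (D 3) = D 3 := by
  have h : ∀ m, (D 3 : B m) = A 0 1 * (A 0 2 * A 1 2) := fun m => by
    rw [D_succ, D_succ, D_one]; simp [X, ι_y]
  have h2 : ∀ m, (A 0 2 : B m) = s 1 * A 0 1 * (s 1)⁻¹ := fun m => A_succ (by omega)
  rw [h, h, h2, h2, A_self, A_self, A_self, A_self]
  simp only [map_mul, map_pow, map_inv, inc_s hn (i := 0) (by omega), inc_s hn (i := 1) (by omega)]

lemma Sc.inv_mul {a u : SL(2, ℤ)} (h : Sc (a * u⁻¹)) : Sc (a⁻¹ * u) := by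
  have h2 := h.inv
  rw [mul_inv_rev, inv_inv] at h2
  have := (h2.commute u).eq
  rw [mul_assoc, mul_right_inj] at this
  rwa [this]

/-- After an inner correction, `φ` acts on the first three strands up to central full twists. -/
def Good (φ : B n → B n) : Prop :=
  ∃ g ∈ P n, ∀ h ∈ J n, ∃ k : ℤ, fg 3 (φ h) = D 3 ^ k * fg 3 (g * h * g⁻¹)

lemma good_of_conj {φ : B n → B n} (hφ : Auto φ) (hn : 7 ≤ n) {Y : SL(2, ℤ)}
    (h0 : Sc (tr φ (q 0 3) * (Y * matU * Y⁻¹)⁻¹)) (h1 : Sc (tr φ (q 1 3) * (Y * matL * Y⁻¹)⁻¹)) :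
    Good φ := by
  have hsc : ∀ {d}, d ∈ D0 n → Sc (tr φ d * (Y * tr id d * Y⁻¹)⁻¹) := fun {d} hd => by
    refine tr_induction hφ hn (R := fun a b => Sc (a * (Y * b * Y⁻¹)⁻¹)) (fun {a b c d} h h' => ?_)
      (fun {a b} h => ?_) h0 h1 (fun {x} hx => ?_) hd
    · have := h.mul h'
      rw [mul_assoc, ← (h'.commute _).eq] at this
      convert this using 1
      group
    · have := h.inv_mul
      convert this using 1
      group
    · simpa using hx
  have hred : ∀ {x : SL(2, ℤ)}, Sc x → red x = 1 := by
    rintro x (rfl | rfl)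
    · exact map_one _
    · decide
  have hY : red Y = 1 := by
    have e0 := hred h0
    have e1 := hred h1
    rw [map_mul, red_tr_zero hφ hn, map_inv, mul_inv_eq_one, map_mul, map_mul, map_inv,
      eq_mul_inv_iff_mul_eq, red_matU] at e0
    rw [map_mul, red_tr_one hφ hn, map_inv, mul_inv_eq_one, map_mul, map_mul, map_inv,
      eq_mul_inv_iff_mul_eq, red_matL] at e1
    generalize red Y = Z at e0 e1
    revert Z
    decide
  obtain ⟨b, rfl⟩ := burau_surjective Y
  have hb : b ∈ P 3 := mem_P_of_red hY
  have h3 : 3 ≤ n := by omega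
  refine ⟨inc h3 b, inc_mem_P h3 hb, fun h hh => ?_⟩
  have hg := inc_mem_P h3 hb
  have hP : h ∈ P n := hh.1
  have hφP := hφ.map_mem_P hh
  have hgP := conj_mem_P (inc h3 b) hP
  have hH : ∀ {x : B n}, x ∈ P n → x ∈ Hs n 3 := fun hx => P_le_Hs 3 hx
  have e : lo (inc h3 b * h * (inc h3 b)⁻¹) = b * lo h * b⁻¹ := by
    rw [lo_mul (mul_mem (hH hg) (hH hP)) (inv_mem (hH hg)), lo_mul (hH hg) (hH hP), lo_inv (hH hg),
      lo_inc]
  obtain ⟨k, hk⟩ := mem_zpowers_D_of_burau (b := lo (φ h) * (lo (inc h3 b * h * (inc h3 b)⁻¹))⁻¹)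
    (mul_mem (lo_mem_P hφP) (inv_mem (lo_mem_P hgP))) (by
      have := hsc (J_le_D0 hn hh)
      rw [e]
      simpa [tr, Sc] using this)
  have hD : (D 3 : B n) ∈ Hs n 3 := hH (D_mem_P 3)
  have hDk : lo (D 3 ^ k : B n) = D 3 ^ k := by
    rw [← inc_D h3, ← map_zpow, lo_inc]
  refine ⟨k, ?_⟩
  rw [mul_inv_eq_iff_eq_mul, ← hDk, ← lo_mul (zpow_mem hD k) (hH hgP)] at hk
  rw [lo_inj hk, fg_mul_P (zpow_mem (D_mem_P 3) k) hgP, fg_zpow_P (D_mem_P 3), fg_D le_rfl h3]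

lemma good_or_good_mirror {φ : B n → B n} (hφ : Auto φ) (hn : 7 ≤ n) :
    Good φ ∨ Good fun a => φ (mirror a) := by
  obtain ⟨Y, ⟨h0, h1⟩ | ⟨h0, h1⟩⟩ := exists_conj_tr hφ hn
  · exact .inl (good_of_conj hφ hn h0 h1)
  · have key : ∀ i, i ≠ 2 → (i + 2 ≤ 3) → ∀ M : SL(2, ℤ),
        Sc (tr φ (q i 3) * (Y * M⁻¹ * Y⁻¹)⁻¹) →
        Sc (tr (fun a => φ (mirror a)) (q i 3) * (Y * M * Y⁻¹)⁻¹) := by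
      intro i hi hi' M h
      have e : tr (fun a => φ (mirror a)) (q i 3) = (tr φ (q i 3))⁻¹ := by
        rw [← hφ.tr_inv (q_mem_St hi (by omega) (by omega) (by omega))]
        unfold tr q
        beta_reduce
        rw [map_mul, map_inv, mirror_s (by omega), mirror_s (by omega), mul_inv_rev, inv_inv,
          (commute_s (.inl hi') : Commute (s i : B n) (s 3)).inv_left.eq]
      rw [e]
      have := h.inv_mul
      convert this using 2
      group
    exact .inr (good_of_conj hφ.mirror hn (key 0 (by omega) (by omega) _ h0)
      (key 1 (by omega) (by omega) _ h1))

end Braid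

namespace Braid
variable {n : ℕ}
open Equiv

lemma exists_perm_eq {π : Perm ℕ} (hπ : ∀ x, n ≤ x → π x = x) : ∃ β : B n, perm β = π := by
  suffices ∀ m ≤ n, ∀ π : Perm ℕ, (∀ x, m ≤ x → π x = x) → ∃ β : B n, perm β = π from
    this n le_rfl π hπ
  intro m
  induction m with
  | zero => exact fun _ π h => ⟨1, by ext x; simp [h x (by omega)]⟩
  | succ m ih =>
    intro hm π h
    have hj : π m ≤ m := by
      by_contra hlt
      have := π.injective (h (π m) (by omega))
      omega
    obtain ⟨β, hβ⟩ := ih (by omega) (perm (cs (π m) m : B n) * π) (fun x hx => by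
      rcases hx.eq_or_lt with rfl | hx
      · rw [Perm.mul_apply, perm_cs hj (by omega)]
      · rw [Perm.mul_apply, h x (by omega), perm_Bk (cs_mem_Bk (Nat.lt_succ_self m)) (by omega)])
    exact ⟨(cs (π m) m)⁻¹ * β, by rw [map_mul, map_inv, hβ, inv_mul_cancel_left]⟩

lemma exists_perm_three {i j k : ℕ} (hij : i ≠ j) (hik : i ≠ k) (hjk : j ≠ k) (hi : i < n) (hj : j < n)
    (hk : k < n) (hn : 7 ≤ n) :
    ∃ β : B n, ee β = 0 ∧ perm β 0 = i ∧ perm β 1 = j ∧ perm β 2 = k := by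
  set p := swap 0 i * swap 1 (swap 0 i j) with hp
  have p0 : p 0 = i := by grind [Perm.mul_apply]
  have p1 : p 1 = j := by grind [Perm.mul_apply]
  have hpn : ∀ x, n ≤ x → p x = x := fun x hx => by grind [Perm.mul_apply]
  have hk0 : p⁻¹ k ≠ 0 := fun h => hik (by rw [← p0, ← h]; simp)
  have hk1 : p⁻¹ k ≠ 1 := fun h => hjk (by rw [← p1, ← h]; simp)
  have hkn : p⁻¹ k < n := by
    by_contra h
    have := hpn _ (not_lt.1 h)
    rw [show p (p⁻¹ k) = k by simp] at this
    omega
  obtain ⟨β, hβ⟩ := exists_perm_eq (n := n) (π := p * swap 2 (p⁻¹ k)) (fun x hx => by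
    rw [Perm.mul_apply, swap_apply_of_ne_of_ne (by omega) (by omega), hpn x hx])
  have h3 : ∀ x < 3, perm ((s 3 : B n) ^ (-ee β)) x = x := fun x hx => by
    rw [map_zpow, perm_s (by omega), ← swap_inv]
    exact Perm.zpow_apply_eq_self_of_apply_eq_self
      (swap_apply_of_ne_of_ne (by omega) (by omega)) _
  refine ⟨β * s 3 ^ (-ee β), by rw [ee_mul, ee_zpow, ee_s (by omega)]; ring, ?_, ?_, ?_⟩
  · rw [map_mul, Perm.mul_apply, h3 _ (by omega), hβ, Perm.mul_apply,
      swap_apply_of_ne_of_ne (by omega) hk0.symm, p0]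
  · rw [map_mul, Perm.mul_apply, h3 _ (by omega), hβ, Perm.mul_apply,
      swap_apply_of_ne_of_ne (by omega) hk1.symm, p1]
  · rw [map_mul, Perm.mul_apply, h3 _ (by omega), hβ, Perm.mul_apply, swap_apply_left]
    simp

lemma lk_of_fg {x y : B n} (hx : x ∈ P n) (hy : y ∈ P n) {g : B n} (hg : g ∈ P n) {k : ℤ} (hn : 3 ≤ n)
    (h : fg 3 x = D 3 ^ k * fg 3 (g * y * g⁻¹)) {i j : ℕ} (hij : i < j) (hj : j < 3) :
    lk x i j = lk y i j + 2 * k := by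
  have := congrArg (fun z => lk z i j) h
  beta_reduce at this
  rw [lk_fg hx (by omega) hj, lk_mul_P (zpow_mem (D_mem_P 3) k), lk_zpow_P (D_mem_P 3),
    lk_fg (conj_mem_P g hy) (by omega) hj, lk_conj hy, mem_P.1 hg, lk_D hij hj hn] at this
  rw [this, inv_one, Perm.one_apply, Perm.one_apply]; ring

lemma nice_of_good {φ : B n → B n} (hφ : Auto φ) (hn : 7 ≤ n) (hG : Good φ) : Nice φ := by
  refine ⟨hφ, fun {a} ha => ?_⟩
  obtain ⟨g, hg, H⟩ := hG
  have tri : ∀ {i j k : ℕ}, i ≠ j → i ≠ k → j ≠ k → i < n → j < n → k < n →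
      lk (φ a) i j - lk a i j = lk (φ a) j k - lk a j k := by
    intro i j k hij hik hjk hi hj hk
    obtain ⟨β, hβ, rfl, rfl, rfl⟩ := exists_perm_three hij hik hjk hi hj hk hn
    have hβ' : ee β⁻¹ = 0 := by rw [ee_inv, hβ]; rfl
    have hb : β⁻¹ * a * β⁻¹⁻¹ ∈ J n := conj_mem_J _ ha
    obtain ⟨k, hk⟩ := H _ hb
    have e : ∀ i j, lk (β⁻¹ * a * β⁻¹⁻¹) i j = lk a (perm β i) (perm β j) := fun i j => by
      rw [lk_conj ha.1, map_inv, inv_inv]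
    have e' : ∀ i j, lk (φ (β⁻¹ * a * β⁻¹⁻¹)) i j = lk (φ a) (perm β i) (perm β j) := fun i j => by
      rw [hφ.map_conj hβ' ha.2, lk_conj (hφ.map_mem_P ha), hφ.perm_map hβ', map_inv, inv_inv]
    have key := fun {i j : ℕ} => lk_of_fg (hφ.map_mem_P hb) hb.1 hg (by omega) hk (i := i) (j := j)
    have h1 := key (i := 0) (j := 1) (by omega) (by omega)
    have h2 := key (i := 1) (j := 2) (by omega) (by omega)
    rw [e, e'] at h1 h2
    omega
  have hc : ∀ i < n, ∀ j < n, i ≠ j → lk (φ a) i j - lk a i j = lk (φ a) 0 1 - lk a 0 1 := by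
    intro i hi j hj hij
    have sym : ∀ i j, lk (φ a) i j - lk a i j = lk (φ a) j i - lk a j i := fun i j => by
      rw [lk_comm, lk_comm a]
    obtain ⟨k, hkn, hk⟩ : ∃ k < n, k ∉ ({0, 1, i, j} : Finset ℕ) := by
      by_contra! h
      have h1 := Finset.card_le_card (show Finset.range n ⊆ {0, 1, i, j} from
        fun x hx => h x (Finset.mem_range.1 hx))
      have h2 := Finset.card_le_four (a := 0) (b := 1) (c := i) (d := j)
      rw [Finset.card_range] at h1
      omega
    simp only [Finset.mem_insert, Finset.mem_singleton, not_or] at hk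
    obtain ⟨k0, k1, ki, kj⟩ := hk
    have star : ∀ i j, i < n → j < n → k ≠ i → k ≠ j →
        lk (φ a) i k - lk a i k = lk (φ a) j k - lk a j k := fun i j hi hj h h' => by
      by_cases hij : i = j
      · rw [hij]
      · rw [sym j k]; exact tri (by omega) hij (by omega) hi hkn hj
    rw [tri hij (by omega) (by omega) hi hj hkn, tri (i := 0) (j := 1) (k := k) (by omega) (by omega)
      (by omega) (by omega) (by omega) hkn]
    exact star _ _ hj (by omega) (by omega) (by omega)
  set c := lk (φ a) 0 1 - lk a 0 1 with hcdef
  have hsum : ∑ x ∈ Finset.range n, ∑ y ∈ Finset.range n, (lk (φ a) x y - lk a x y) = 0 := by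
    simp only [Finset.sum_sub_distrib, sum_lk, hφ.ee_map ha.2, (mem_J.1 ha).2, sub_self]
  have hsum' : ∑ x ∈ Finset.range n, ∑ y ∈ Finset.range n, (lk (φ a) x y - lk a x y) =
      n * ((n - 1) * c) := by
    rw [Finset.sum_congr rfl (g := fun _ => (n - 1) * c), Finset.sum_const, Finset.card_range,
      nsmul_eq_mul]
    intro x hx
    rw [← Finset.add_sum_erase _ _ hx, lk_self, lk_self, Finset.sum_congr rfl (g := fun _ => c),
      Finset.sum_const, Finset.card_erase_of_mem hx, Finset.card_range, nsmul_eq_mul,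
      Nat.cast_sub (by omega)]
    · simp
    · intro y hy
      rw [Finset.mem_erase, Finset.mem_range] at hy
      exact hc x (Finset.mem_range.1 hx) y hy.2 (Ne.symm hy.1)
  have hc0 : c = 0 := by
    rw [hsum'] at hsum
    have : ((n : ℤ) - 1) ≠ 0 := by omega
    have h' : (n : ℤ) ≠ 0 := by omega
    exact (mul_eq_zero.1 ((mul_eq_zero.1 hsum).resolve_left h')).resolve_left this
  intro i j
  by_cases hij : i = j
  · rw [hij, lk_self, lk_self]
  by_cases hi : i < n
  · by_cases hj : j < n
    · have := hc i hi j hj hij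
      omega
    · rw [lk_comm, lk_comm a, lk_Bk (mem_Bk _) (not_lt.1 hj), lk_Bk (mem_Bk _) (not_lt.1 hj)]
  · rw [lk_Bk (mem_Bk _) (not_lt.1 hi), lk_Bk (mem_Bk _) (not_lt.1 hi)]

lemma not_nice_mirror {φ : B n → B n} (hφ : Nice φ) (hn : 7 ≤ n) : ¬ Nice fun a => φ (mirror a) := by
  intro h
  have h03 : Commute (s 0 : B n) (s 3) := commute_s (by omega)
  have ha : (A 0 1 * (A 3 4)⁻¹ : B n) ∈ J n := mem_J.2 ⟨mul_mem (A_mem_P _ _)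
    (inv_mem (A_mem_P _ _)), by
    rw [A_self, A_self, ee_mul, ee_inv, ee_pow, ee_pow, ee_s (by omega), ee_s (by omega)]; rfl⟩
  have hm : mirror (A 0 1 * (A 3 4)⁻¹ : B n) = (A 0 1 * (A 3 4)⁻¹)⁻¹ := by
    rw [A_self, A_self, map_mul, map_inv, map_pow, map_pow, mirror_s (by omega), mirror_s (by omega)]
    have := (h03.pow_pow 2 2).inv_left.eq
    rw [mul_inv_rev, inv_inv, inv_pow, inv_pow, inv_inv, this]
  have e1 := h.lk_map ha 0 1
  have e2 := hφ.lk_map (inv_mem ha) 0 1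
  beta_reduce at e1
  rw [hm, e2, lk_inv_P ha.1, lk_mul_P (A_mem_P _ _), lk_inv_P (A_mem_P _ _),
    lk_A (by omega) (by omega), lk_A (by omega) (by omega)] at e1
  simp at e1

lemma Nice.inn_three {φ : B n → B n} (hφ : Nice φ) (hn : 7 ≤ n) : Inn φ 3 := by
  have hG : Good φ := (good_or_good_mirror hφ.toAuto hn).resolve_right fun h =>
    not_nice_mirror hφ hn (nice_of_good hφ.toAuto.mirror hn h)
  obtain ⟨g, hg, H⟩ := hG
  refine ⟨g, hg, fun h hh => ?_⟩
  obtain ⟨k, hk⟩ := H h hh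
  have := lk_of_fg (hφ.map_mem_P hh) hh.1 hg (by omega) hk (i := 0) (j := 1) (by omega) (by omega)
  rw [hφ.lk_map hh] at this
  obtain rfl : k = 0 := by omega
  rw [hk, zpow_zero, one_mul]

/-- An automorphism of the commutator subgroup compatible with permutations is induced by
conjugation, up to the mirror automorphism. -/
theorem Auto.exists_conj {φ : B n → B n} (hφ : Auto φ) (hn : 7 ≤ n) :
    (∃ g, ∀ d, ee d = 0 → φ d = g * d * g⁻¹) ∨ ∃ g, ∀ d, ee d = 0 → φ d = g * Braid.mirror d * g⁻¹ := by
  rcases good_or_good_mirror hφ hn with h | h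
  · exact .inl ((nice_of_good hφ hn h).exists_conj (by omega) fun ψ hψ => hψ.inn_three hn)
  · obtain ⟨g, hg⟩ := (nice_of_good hφ.mirror hn h).exists_conj (by omega) fun ψ hψ => hψ.inn_three hn
    refine .inr ⟨g, fun d hd => ?_⟩
    have := hg (Braid.mirror d) (by rw [ee_mirror, hd]; rfl)
    rwa [mirror_mirror] at this

end Braid

namespace Braid
variable {n : ℕ}

lemma isConj_s_zero {i : ℕ} (hi : i + 1 < n) : IsConj (s 0 : B n) (s i) := by
  induction i with
  | zero => exact IsConj.refl _
  | succ i ih =>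
    refine (ih (by omega)).trans (isConj_iff.2 ⟨s i * s (i + 1), ?_⟩)
    rw [mul_inv_eq_iff_eq_mul, s_braid hi, mul_assoc]

lemma isConj_s {i j : ℕ} (hi : i + 1 < n) (hj : j + 1 < n) : IsConj (s i : B n) (s j) :=
  (isConj_s_zero hi).symm.trans (isConj_s_zero hj)

section target
variable {Q : Type*} [Group Q] (f : B n →* Q)

lemma map_eq_of_commute {i : ℕ} (hi : i + 2 < n) (h : Commute (f (s i)) (f (s (i + 1)))) :
    f (s i) = f (s (i + 1)) := by
  have := congrArg f (s_braid hi)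
  simp only [map_mul] at this
  rw [h.eq, mul_assoc, mul_assoc, mul_right_inj, mul_right_inj] at this
  exact this

lemma map_commute_s {i j : ℕ} (h : i + 2 ≤ j ∨ j + 2 ≤ i) : Commute (f (s i)) (f (s j)) :=
  (commute_s h).map f

lemma map_eq_one_of_eq (h : f (s 0) = f (s 1)) {x : B n} (hx : ee x = 0) : f x = 1 := by
  have key : ∀ i, i + 2 < n → f (s i) = f (s (i + 1)) := by
    intro i
    induction i with
    | zero => exact fun _ => h
    | succ i ih =>
      intro hi
      refine map_eq_of_commute f hi ?_
      rw [← ih (by omega)]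
      exact map_commute_s f (by omega)
  have key' : ∀ i, i + 1 < n → f (s i) = f (s 0) := by
    intro i
    induction i with
    | zero => exact fun _ => rfl
    | succ i ih => exact fun hi => (key i hi).symm.trans (ih (by omega))
  have : f = (zpowersHom Q (f (s 0))).comp expo := hom_ext fun i hi => by
    rw [MonoidHom.comp_apply, expo_s hi, key' i hi]
    simp
  rw [this, MonoidHom.comp_apply, show expo x = 1 from hx, map_one]

lemma commute_map_of_forall {z : Q} (h : ∀ i, i + 1 < n → Commute z (f (s i))) (x : B n) :
    Commute z (f x) := by
  induction x using induct with
  | one => rw [map_one]; exact .one_right z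
  | s_mul i β hi hβ => rw [map_mul]; exact (h i hi).mul_right hβ
  | inv_mul i β hi hβ => rw [map_mul, map_inv]; exact (h i hi).inv_right.mul_right hβ

lemma map_zpow_eq {k : ℕ} {j : ℤ} (hk : k + 1 < n)
    (h : ∀ i, i + 1 < n → Commute (f (s k) ^ j) (f (s i))) {i : ℕ} (hi : i + 1 < n) :
    f (s i) ^ j = f (s k) ^ j := by
  obtain ⟨c, hc⟩ := isConj_iff.1 (isConj_s hk hi)
  rw [← hc, map_mul, map_mul, map_inv, conj_zpow, ← (commute_map_of_forall f h c).eq,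
    mul_inv_cancel_right]

lemma map_J_eq_one (hn : 3 ≤ n) (h : f (s 0) ^ 2 = f (s 1) ^ 2) {x : B n} (hx : x ∈ J n) : f x = 1 := by
  have hc : ∀ i, i + 1 < n → Commute (f (s 0) ^ 2) (f (s i)) := by
    intro i hi
    by_cases h0 : i = 0
    · subst h0; exact (Commute.refl _).pow_left 2
    by_cases h1 : i = 1
    · subst h1; rw [h]; exact (Commute.refl _).pow_left 2
    exact (map_commute_s f (by omega)).pow_left 2
  have hs : ∀ i, i + 1 < n → f (s i) ^ 2 = f (s 0) ^ 2 := fun i hi => by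
    exact_mod_cast map_zpow_eq f (j := 2) (k := 0) (by omega) (by exact_mod_cast hc) hi
  let H : Subgroup (B n) :=
    { carrier := {β | ∃ k : ℤ, f β = (f (s 0) ^ 2) ^ k ∧ ee β = 2 * k}
      one_mem' := ⟨0, by simp, by simp [ee_one]⟩
      mul_mem' := by
        rintro a b ⟨k, h1, h2⟩ ⟨l, h3, h4⟩
        exact ⟨k + l, by rw [map_mul, h1, h3, zpow_add], by rw [ee_mul, h2, h4]; ring⟩
      inv_mem' := by
        rintro a ⟨k, h1, h2⟩
        exact ⟨-k, by rw [map_inv, h1, zpow_neg], by rw [ee_inv, h2]; ring⟩ }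
  have hP : P n ≤ H := P_le_of_A fun j k hjk hk => by
    refine ⟨1, ?_, ?_⟩
    · rw [A_eq_cs hjk, map_mul, map_mul, map_inv, map_pow, hs j (by omega),
        ← (commute_map_of_forall f hc _).eq, mul_inv_cancel_right, zpow_one]
    · rw [A_eq_cs hjk, ee_conj, ee_pow, ee_s (by omega)]; rfl
  obtain ⟨k, h1, h2⟩ := hP hx.1
  have : k = 0 := by
    have := (mem_J.1 hx).2
    omega
  rw [h1, this, zpow_zero]

end target

/-- A map on the braid group that is multiplicative on the commutator subgroup. -/
structure CHom {G : Type*} [Group G] (ψ : B n → G) : Prop where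
  map_mul : ∀ {a b}, ee a = 0 → ee b = 0 → ψ (a * b) = ψ a * ψ b

lemma perfect (hn : 5 ≤ n) {S : Subgroup (B n)}
    (h : ∀ a b : B n, ee a = 0 → ee b = 0 → a * b * a⁻¹ * b⁻¹ ∈ S) {x : B n} (hx : ee x = 0) : x ∈ S := by
  have hle : ⁅commutator (B n), commutator (B n)⁆ ≤ S :=
    Subgroup.commutator_le.2 fun a ha b hb => h a b (mem_comm.1 ha) (mem_comm.1 hb)
  let f := QuotientGroup.mk' ⁅commutator (B n), commutator (B n)⁆
  refine hle ?_
  rw [← QuotientGroup.eq_one_iff]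
  refine map_eq_one_of_eq f (map_eq_of_commute f (by omega) ?_) hx
  have h1 : Commute (f (q 0 3)) (f (q 0 1)) := by
    have hq : ∀ i j, i + 1 < n → j + 1 < n → (q i j : B n) ∈ commutator (B n) := fun i j hi hj =>
      mem_comm.2 (by rw [q, ee_mul, ee_inv, ee_s hi, ee_s hj]; rfl)
    rw [← commutatorElement_eq_one_iff_commute, ← map_commutatorElement]
    exact (QuotientGroup.eq_one_iff _).2 (Subgroup.commutator_mem_commutator
      (hq _ _ (by omega) (by omega)) (hq _ _ (by omega) (by omega)))
  have h2 : Commute (f (s 3)) (f (q 0 1)) :=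
    (commute_s_q (commute_s (by omega)) (commute_s (by omega))).map f
  have h3 := h1.mul_left h2
  rw [← map_mul, q, inv_mul_cancel_right, q, map_mul] at h3
  simpa using ((Commute.refl (f (s 0))).inv_right.mul_right h3).inv_right

namespace CHom
variable {G : Type*} [Group G] {ψ : B n → G} (hψ : CHom ψ)
include hψ

lemma map_one : ψ 1 = 1 := by
  have := hψ.map_mul (a := 1) (b := 1) ee_one ee_one
  rwa [mul_one, left_eq_mul] at this

lemma map_inv {a : B n} (ha : ee a = 0) : ψ a⁻¹ = (ψ a)⁻¹ := by
  rw [eq_inv_iff_mul_eq_one, ← hψ.map_mul (by rw [ee_inv, ha]; rfl) ha, inv_mul_cancel, hψ.map_one]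

lemma map_conj {a b : B n} (ha : ee a = 0) (hb : ee b = 0) :
    ψ (a * b * a⁻¹) = ψ a * ψ b * (ψ a)⁻¹ := by
  rw [hψ.map_mul (by rw [ee_mul, ha, hb]; rfl) (by rw [ee_inv, ha]; rfl), hψ.map_mul ha hb,
    hψ.map_inv ha]

lemma map_commute {a b : B n} (ha : ee a = 0) (hb : ee b = 0) (h : Commute a b) :
    Commute (ψ a) (ψ b) := by
  have := hψ.map_mul ha hb
  rw [h.eq, hψ.map_mul hb ha] at this
  exact this.symm

lemma map_zpow {a : B n} (ha : ee a = 0) (k : ℤ) : ψ (a ^ k) = ψ a ^ k := by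
  have h : ∀ k : ℤ, ee (a ^ k) = 0 := fun k => by rw [ee_zpow, ha, mul_zero]
  induction k with
  | zero => rw [zpow_zero, zpow_zero, hψ.map_one]
  | succ k ih => rw [zpow_add_one, zpow_add_one, hψ.map_mul (h _) ha, ih]
  | pred k ih =>
    rw [zpow_sub_one, zpow_sub_one, hψ.map_mul (h _) (by rw [ee_inv, ha]; rfl), ih, hψ.map_inv ha]

lemma comp {H : Type*} [Group H] (f : G →* H) : CHom fun a => f (ψ a) where
  map_mul ha hb := by rw [hψ.map_mul ha hb, _root_.map_mul]

lemma comp_hom {m : ℕ} (f : B m →* B n) (hf : ∀ a, ee (f a) = ee a) : CHom fun a => ψ (f a) where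
  map_mul {a b} ha hb := by
    rw [_root_.map_mul, hψ.map_mul (by rw [hf, ha]) (by rw [hf, hb])]

/-- The largest normal subgroup of the braid group in the kernel of `ψ`. -/
def core : Subgroup (B n) where
  carrier := {x | ee x = 0 ∧ ∀ β, ψ (β * x * β⁻¹) = 1}
  one_mem' := ⟨ee_one, fun β => by rw [mul_one, mul_inv_cancel, hψ.map_one]⟩
  mul_mem' {a b} ha hb := ⟨by rw [ee_mul, ha.1, hb.1]; rfl, fun β => by
    rw [conj_mul, hψ.map_mul (by rw [ee_conj, ha.1]) (by rw [ee_conj, hb.1]), ha.2, hb.2, mul_one]⟩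
  inv_mem' {a} ha := ⟨by rw [ee_inv, ha.1]; rfl, fun β => by
    rw [← conj_inv, hψ.map_inv (by rw [ee_conj, ha.1]), ha.2, inv_one]⟩

instance : hψ.core.Normal where
  conj_mem x hx g := ⟨by rw [ee_conj, hx.1], fun β => by
    have := hx.2 (β * g)
    rwa [mul_inv_rev, mul_assoc β, mul_assoc β, ← mul_assoc _ g⁻¹, ← mul_assoc β] at this⟩

lemma eq_one_of_mem_core {x : B n} (hx : x ∈ hψ.core) : ψ x = 1 := by
  have := hx.2 1
  rwa [one_mul, inv_one, mul_one] at this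

lemma map_conj_of_commute {x : B n} (hx : ee x = 0) {c : ℕ} (hc : c + 1 < n) (h : Commute (s c) x)
    (β : B n) : ψ (β * x * β⁻¹) = ψ (β * s c ^ (-ee β)) * ψ x * (ψ (β * s c ^ (-ee β)))⁻¹ := by
  have h0 : ee (β * s c ^ (-ee β)) = 0 := by rw [ee_mul, ee_zpow, ee_s hc]; ring
  rw [← hψ.map_conj h0 hx]
  congr 1
  have e : s c ^ (-ee β) * x * (s c ^ (-ee β))⁻¹ = x := by
    rw [(h.zpow_left _).eq, mul_inv_cancel_right]
  rw [mul_inv_rev]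
  nth_rewrite 1 [← e]
  simp only [mul_assoc]

lemma mem_core_of_commute {x : B n} (hx : ee x = 0) {c : ℕ} (hc : c + 1 < n) (h : Commute (s c) x)
    (h1 : ψ x = 1) : x ∈ hψ.core :=
  ⟨hx, fun β => by rw [hψ.map_conj_of_commute hx hc h, h1, mul_one, mul_inv_cancel]⟩

/-- The quotient map by the core. -/
abbrev quo : B n →* B n ⧸ hψ.core := QuotientGroup.mk' hψ.core

lemma quo_eq_one {x : B n} : hψ.quo x = 1 ↔ x ∈ hψ.core := QuotientGroup.eq_one_iff x

lemma eq_one_of_quo {x : B n} (h : hψ.quo x = 1) : ψ x = 1 :=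
  hψ.eq_one_of_mem_core (hψ.quo_eq_one.1 h)

lemma eq_one_of_comm (hn : 5 ≤ n) (h : ∀ a b, ee a = 0 → ee b = 0 → Commute (ψ a) (ψ b)) {x : B n}
    (hx : ee x = 0) : ψ x = 1 := by
  let S : Subgroup (B n) :=
    { carrier := {x | ee x = 0 ∧ ψ x = 1}
      one_mem' := ⟨ee_one, hψ.map_one⟩
      mul_mem' := fun ha hb => ⟨by rw [ee_mul, ha.1, hb.1]; rfl, by
        rw [hψ.map_mul ha.1 hb.1, ha.2, hb.2, mul_one]⟩
      inv_mem' := fun ha => ⟨by rw [ee_inv, ha.1]; rfl, by rw [hψ.map_inv ha.1, ha.2, inv_one]⟩ }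
  refine (perfect hn (S := S) (fun a b ha hb => ?_) hx).2
  have hab : ee (a * b) = 0 := by rw [ee_mul, ha, hb]; rfl
  have hba : ee (b * a)⁻¹ = 0 := by rw [ee_inv, ee_mul, ha, hb]; rfl
  rw [show a * b * a⁻¹ * b⁻¹ = a * b * (b * a)⁻¹ by group]
  refine ⟨by rw [ee_mul, hab, hba]; rfl, ?_⟩
  rw [hψ.map_mul hab hba, hψ.map_inv (by rw [ee_mul, ha, hb]; rfl), hψ.map_mul ha hb,
    hψ.map_mul hb ha, (h a b ha hb).eq, mul_inv_cancel]

end CHom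

lemma CHom.sign_eq_one {X : Type*} [Fintype X] [DecidableEq X] {ψ : B n → Equiv.Perm X} (hψ : CHom ψ)
    (hn : 5 ≤ n) {x : B n} (hx : ee x = 0) : Equiv.Perm.sign (ψ x) = 1 :=
  (hψ.comp Equiv.Perm.sign).eq_one_of_comm hn (fun _ _ _ _ => Commute.all _ _) hx

end Braid

namespace Braid

lemma isSolvable_perm_of_card_le_four {X : Type*} [Finite X] (hX : Nat.card X ≤ 4) :
    Group.IsSolvable (Equiv.Perm X) := by
  have h4 : Nat.card (Fin 4) = 4 := by simp
  have hA : Group.IsSolvable (alternatingGroup (Fin 4)) := by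
    rw [Group.isSolvable_iff_subgroup_quotient (commutator (alternatingGroup (Fin 4)))]
    refine ⟨?_, Group.isSolvable_of_comm (G := Abelianization (alternatingGroup (Fin 4))) mul_comm⟩
    rw [← alternatingGroup.kleinFour_eq_commutator h4]
    have := (alternatingGroup.kleinFour_isKleinFour h4)
    exact Group.isSolvable_of_comm fun a b => mul_comm_of_exponent_two this.exponent_two a b
  have hP : Group.IsSolvable (Equiv.Perm (Fin 4)) :=
    Group.isSolvable_of_ker_le_range (alternatingGroup (Fin 4)).subtype Equiv.Perm.sign (by
      rw [Subgroup.range_subtype]; rfl)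
  have e : X ↪ Fin 4 := by
    have := Fintype.ofFinite X
    exact (Function.Embedding.nonempty_of_card_le (by simpa using hX)).some
  exact Group.isSolvable_of_isSolvable_injective (Equiv.Perm.viaEmbeddingHom_injective e)

namespace CHom
variable {n : ℕ}

lemma eq_one_of_isSolvable {G : Type*} [Group G] {ψ : B n → G} (hψ : CHom ψ) (hn : 5 ≤ n)
    [hG : Group.IsSolvable G] {x : B n} (hx : ee x = 0) : ψ x = 1 := by
  have key : ∀ k x, ee x = 0 → ψ x ∈ derivedSeries G k := by
    intro k
    induction k with
    | zero => exact fun x _ => Subgroup.mem_top _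
    | succ k ih =>
      intro x hx
      let S : Subgroup (B n) :=
        { carrier := {x | ee x = 0 ∧ ψ x ∈ derivedSeries G (k + 1)}
          one_mem' := ⟨ee_one, by rw [hψ.map_one]; exact one_mem _⟩
          mul_mem' := fun ha hb => ⟨by rw [ee_mul, ha.1, hb.1]; rfl, by
            rw [hψ.map_mul ha.1 hb.1]; exact mul_mem ha.2 hb.2⟩
          inv_mem' := fun ha => ⟨by rw [ee_inv, ha.1]; rfl, by
            rw [hψ.map_inv ha.1]; exact inv_mem ha.2⟩ }
      refine (perfect hn (S := S) (fun a b ha hb => ?_) hx).2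
      have h1 : ee (a * b * a⁻¹) = 0 := by rw [ee_conj, hb]
      have h2 : ee b⁻¹ = 0 := by rw [ee_inv, hb]; rfl
      refine ⟨by rw [ee_mul, h1, h2]; rfl, ?_⟩
      rw [hψ.map_mul h1 h2, hψ.map_conj ha hb, hψ.map_inv hb]
      exact Subgroup.commutator_mem_commutator (ih a ha) (ih b hb)
  obtain ⟨k, hk⟩ := hG.solvable
  have := key k x hx
  rwa [hk, Subgroup.mem_bot] at this

lemma eq_one_of_card_le_four {X : Type*} [Finite X] {ψ : B n → Equiv.Perm X} (hψ : CHom ψ)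
    (hn : 5 ≤ n) (hX : Nat.card X ≤ 4) {x : B n} (hx : ee x = 0) : ψ x = 1 :=
  have := isSolvable_perm_of_card_le_four hX
  hψ.eq_one_of_isSolvable hn hx

lemma exists_restrict {G G' : Type*} [Group G] [Group G'] {ψ : B n → G} (hψ : CHom ψ)
    {H : Subgroup G} (hH : ∀ d, ee d = 0 → ψ d ∈ H) (f : H →* G') :
    ∃ ψ' : B n → G', CHom ψ' ∧ ∀ d (hd : ee d = 0), ψ' d = f ⟨ψ d, hH d hd⟩ := by
  classical
  let ψ' : B n → G' := fun d => if hd : ee d = 0 then f ⟨ψ d, hH d hd⟩ else 1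
  have h : ∀ d (hd : ee d = 0), ψ' d = f ⟨ψ d, hH d hd⟩ := fun d hd => dif_pos hd
  refine ⟨ψ', ⟨fun {a b} ha hb => ?_⟩, h⟩
  have hab : ee (a * b) = 0 := by rw [ee_mul, ha, hb]; rfl
  rw [h _ ha, h _ hb, h _ hab, ← _root_.map_mul]
  congr 1
  exact Subtype.ext (hψ.map_mul ha hb)

/-- `Trivial n β` says that the commutator subgroup of `B n` acts trivially on fewer than `β`
points. -/
def Trivial (n β : ℕ) : Prop :=
  ∀ (X : Type) [Finite X] (ψ : B n → Equiv.Perm X), CHom ψ → Nat.card X < β →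
    ∀ d, ee d = 0 → ψ d = 1

lemma trivial_five (hn : 5 ≤ n) : Trivial n 5 :=
  fun _ _ _ hψ hX _ hd => hψ.eq_one_of_card_le_four hn (by omega) hd

end CHom

lemma apply_comm_of_isCycle {X : Type*} {c g h : Equiv.Perm X} (hc : c.IsCycle)
    (hg : Commute g c) (hh : Commute h c) {x : X} (hx : c x ≠ x) : g (h x) = h (g x) := by
  have key : ∀ {g : Equiv.Perm X}, Commute g c → ∃ i : ℤ, (c ^ i) x = g x := fun {g} hg =>
    hc.exists_zpow_eq hx (by
      rw [← Equiv.Perm.mul_apply, ← hg.eq, Equiv.Perm.mul_apply]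
      exact fun e => hx (g.injective e))
  obtain ⟨i, hi⟩ := key hg
  obtain ⟨j, hj⟩ := key hh
  rw [← hi, ← hj, ← Equiv.Perm.mul_apply, ← Equiv.Perm.mul_apply, (hg.zpow_right j).eq,
    (hh.zpow_right i).eq, Equiv.Perm.mul_apply, Equiv.Perm.mul_apply, ← hi, ← hj,
    ← Equiv.Perm.mul_apply, ← Equiv.Perm.mul_apply, ← zpow_add, ← zpow_add, add_comm]

lemma two_mul_card_cycleFactorsFinset_le {X : Type*} [Fintype X] [DecidableEq X]
    (u : Equiv.Perm X) : 2 * u.cycleFactorsFinset.card ≤ Fintype.card X := by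
  have h1 : u.cycleType.card = u.cycleFactorsFinset.card := by
    rw [Equiv.Perm.cycleType_def]; simp
  have h2 : u.cycleType.card • 2 ≤ u.cycleType.sum :=
    Multiset.card_nsmul_le_sum fun _ hx => Equiv.Perm.two_le_of_mem_cycleType hx
  have h3 := Equiv.Perm.sum_cycleType u
  have h4 := Finset.card_le_univ u.support
  rw [smul_eq_mul] at h2
  omega

namespace CHom
variable {n : ℕ}

lemma apply_eq_self_of_commute {X : Type} [Fintype X] [DecidableEq X] {ψ : B n → Equiv.Perm X}
    (hψ : CHom ψ) (hn : 5 ≤ n) {β : ℕ} (hβ : Trivial n β) (hX : Fintype.card X < 2 * β)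
    {u : Equiv.Perm X} (hu : ∀ d, ee d = 0 → Commute (ψ d) u) {x : X} (hx : u x ≠ x)
    {d : B n} (hd : ee d = 0) : ψ d x = x := by
  have hH : ∀ d, ee d = 0 → ψ d ∈ Subgroup.centralizer {u} := fun d hd =>
    Subgroup.mem_centralizer_singleton_iff.2 (hu d hd).eq
  obtain ⟨ψ', h1, h2⟩ := hψ.exists_restrict hH (Equiv.Perm.OnCycleFactors.toPermHom u)
  have hc : ∀ d, ee d = 0 → ∀ c ∈ u.cycleFactorsFinset, Commute (ψ d) c := fun d hd =>
    (Equiv.Perm.OnCycleFactors.mem_ker_toPermHom_iff u (k := ⟨ψ d, hH d hd⟩)).1 <| by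
      rw [MonoidHom.mem_ker, ← h2 d hd]
      refine hβ _ ψ' h1 ?_ d hd
      have := two_mul_card_cycleFactorsFinset_le u
      simp only [Nat.card_eq_fintype_card, Fintype.card_coe]
      omega
  let S : Subgroup (B n) :=
    { carrier := {d | ee d = 0 ∧ ψ d x = x}
      one_mem' := ⟨ee_one, by rw [hψ.map_one]; rfl⟩
      mul_mem' := fun ha hb => ⟨by rw [ee_mul, ha.1, hb.1]; rfl, by
        rw [hψ.map_mul ha.1 hb.1, Equiv.Perm.mul_apply, hb.2, ha.2]⟩
      inv_mem' := fun ha => ⟨by rw [ee_inv, ha.1]; rfl, by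
        rw [hψ.map_inv ha.1, Equiv.Perm.inv_eq_iff_eq, ha.2]⟩ }
  refine (perfect hn (S := S) (fun a b ha hb => ?_) hd).2
  have h1 : ee (a * b * a⁻¹) = 0 := by rw [ee_conj, hb]
  have h2 : ee b⁻¹ = 0 := by rw [ee_inv, hb]; rfl
  refine ⟨by rw [ee_mul, h1, h2]; rfl, ?_⟩
  have hx' : u.cycleOf x x ≠ x := by rwa [Equiv.Perm.cycleOf_apply_self]
  have hm : u.cycleOf x ∈ u.cycleFactorsFinset :=
    Equiv.Perm.cycleOf_mem_cycleFactorsFinset_iff.2 (Equiv.Perm.mem_support.2 hx)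
  have ca := hc a ha _ hm
  have cb := hc b hb _ hm
  have e := apply_comm_of_isCycle (Equiv.Perm.isCycle_cycleOf u hx) ca.inv_left cb.inv_left hx'
  rw [hψ.map_mul h1 h2, hψ.map_conj ha hb, hψ.map_inv hb]
  simp only [Equiv.Perm.mul_apply]
  rw [e]
  simp

end CHom
end Braid

namespace Braid
variable {n : ℕ}

lemma map_zpow_eq_of_commute {Q : Type*} [Group Q] (f : B n →* Q) {k : ℕ} {j : ℤ} (hk : k + 2 < n)
    (h : Commute (f (s k) ^ j) (f (s (k + 1)))) {i : ℕ} (hi : i + 1 < n) :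
    f (s i) ^ j = f (s k) ^ j := by
  have e : f (s (k + 1)) ^ j = f (s k) ^ j := by
    have h1 : (s (k + 1) : B n) = s k * s (k + 1) * s k * (s k * s (k + 1))⁻¹ := by
      rw [eq_mul_inv_iff_mul_eq, ← mul_assoc, s_braid hk]
    have h2 : (s (k + 1) : B n) = (s k * s (k + 1)) * s k * (s k * s (k + 1))⁻¹ := h1
    have h3 : Commute (f (s k) ^ j) (f (s k * s (k + 1))) := by
      rw [map_mul]; exact ((Commute.refl _).zpow_left j).mul_right h
    rw [h2, map_mul _ _ (_⁻¹), map_mul _ (s k * s (k + 1)), map_inv, conj_zpow, ← h3.eq,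
      mul_inv_cancel_right]
  refine map_zpow_eq f (by omega) (fun i hi => ?_) hi
  by_cases h1 : i = k
  · subst h1; exact (Commute.refl _).zpow_left j
  by_cases h2 : i = k + 1
  · subst h2; exact h
  by_cases h3 : i + 1 = k
  · rw [← e]; exact (map_commute_s f (by omega)).zpow_left j
  · exact (map_commute_s f (by omega)).zpow_left j

lemma map_eq_one_of_eq_succ {Q : Type*} [Group Q] (f : B n →* Q) {k : ℕ} (hk : k + 2 < n)
    (h : f (s k) = f (s (k + 1))) {x : B n} (hx : ee x = 0) : f x = 1 := by
  have := fun i hi => map_zpow_eq_of_commute f (j := 1) hk (by rw [zpow_one, h]) (i := i) hi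
  refine map_eq_one_of_eq f ?_ hx
  have h0 := this 0 (by omega)
  have h1 := this 1 (by omega)
  rw [zpow_one, zpow_one] at h0 h1
  rw [h0, h1]

lemma orderOf_mul_orderOf_dvd_card {G : Type*} [Group G] {a b : G} (hab : Commute a b)
    (h : ∀ i j : ℤ, a ^ i * b ^ j = 1 → a ^ i = 1) : orderOf a * orderOf b ∣ Nat.card G := by
  let f := MonoidHom.noncommCoprod (Subgroup.zpowers a).subtype (Subgroup.zpowers b).subtype
    (by
      rintro ⟨_, i, rfl⟩ ⟨_, j, rfl⟩
      exact (hab.zpow_zpow i j))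
  have hf : Function.Injective f := by
    rw [injective_iff_map_eq_one]
    rintro ⟨⟨_, i, rfl⟩, ⟨_, j, rfl⟩⟩ h1
    have h2 : a ^ i * b ^ j = 1 := h1
    have h3 := h i j h2
    rw [h3, one_mul] at h2
    exact Prod.ext (Subtype.ext h3) (Subtype.ext h2)
  have := Subgroup.card_dvd_of_injective f hf
  rwa [Nat.card_prod, Nat.card_zpowers, Nat.card_zpowers] at this

lemma twenty_seven_dvd_card {G : Type*} [Group G] [Finite G] {a b c : G} (hab : Commute a b)
    (h : ∀ i j : ℤ, a ^ i * b ^ j = 1 → a ^ i = 1) (ha : orderOf a = 3)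
    (h1 : c * a * c⁻¹ = b) (h2 : c * b * c⁻¹ = (a * b)⁻¹) : 27 ∣ Nat.card G := by
  have hb : orderOf b = 3 := by
    rw [← ha, ← h1]; exact (MulAut.conj c).orderOf_eq a
  have hne : a ≠ b := by
    rintro rfl
    have := h 1 (-1) (by simp)
    rw [zpow_one] at this
    simp [this] at ha
  have ha3 : a ^ 3 = 1 := by rw [← ha, pow_orderOf_eq_one]
  let E := Subgroup.closure {a, b}
  have haE : a ∈ E := Subgroup.subset_closure (by simp)
  have hbE : b ∈ E := Subgroup.subset_closure (by simp)
  have hcomm : ∀ x ∈ E, Commute a x ∧ Commute b x := by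
    intro x hx
    induction hx using Subgroup.closure_induction with
    | mem x hx =>
      rcases hx with rfl | rfl
      · exact ⟨Commute.refl _, hab.symm⟩
      · exact ⟨hab, Commute.refl _⟩
    | one => exact ⟨.one_right _, .one_right _⟩
    | mul x y _ _ hx hy => exact ⟨hx.1.mul_right hy.1, hx.2.mul_right hy.2⟩
    | inv x _ hx => exact ⟨hx.1.inv_right, hx.2.inv_right⟩
  have hcle : E ≤ Subgroup.comap (MulAut.conj c).toMonoidHom E := by
    rw [Subgroup.closure_le]
    rintro x (rfl | rfl)
    · change c * x * c⁻¹ ∈ E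
      rw [h1]; exact hbE
    · change c * x * c⁻¹ ∈ E
      rw [h2]; exact inv_mem (mul_mem haE hbE)
  have hcN : c ∈ Subgroup.normalizer (E : Set G) := by
    refine Subgroup.mem_normalizer_iff.2 fun x => ⟨fun hx => hcle hx, fun hx => ?_⟩
    have hinj : Function.Injective (fun y : E => (⟨c * y * c⁻¹, hcle y.2⟩ : E)) := by
      intro y z hyz
      have := congrArg Subtype.val hyz
      exact Subtype.ext (by simpa using this)
    obtain ⟨y, hy⟩ := Finite.surjective_of_injective hinj ⟨_, hx⟩
    have : (y : G) = x := by simpa using congrArg Subtype.val hy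
    rw [← this]; exact y.2
  have haN : a ∈ Subgroup.normalizer (E : Set G) := Subgroup.le_normalizer haE
  have hbN : b ∈ Subgroup.normalizer (E : Set G) := Subgroup.le_normalizer hbE
  let φ := E.normalizerMonoidHom
  have hφ : ∀ (g) (x : E), ((φ g x : E) : G) = g * x * (g : G)⁻¹ := fun g x => rfl
  have hak : (⟨a, haN⟩ : Subgroup.normalizer (E : Set G)) ∈ φ.ker := by
    rw [MonoidHom.mem_ker]
    ext x
    rw [hφ]; simp [(hcomm x x.2).1.eq]
  have hbk : (⟨b, hbN⟩ : Subgroup.normalizer (E : Set G)) ∈ φ.ker := by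
    rw [MonoidHom.mem_ker]
    ext x
    rw [hφ]; simp [(hcomm x x.2).2.eq]
  have d9 : 9 ∣ Nat.card φ.ker := by
    have := orderOf_mul_orderOf_dvd_card (a := (⟨⟨a, haN⟩, hak⟩ : φ.ker)) (b := ⟨⟨b, hbN⟩, hbk⟩)
      (Subtype.ext (Subtype.ext hab.eq)) fun i j hij => by
        refine Subtype.ext (Subtype.ext ?_)
        exact h i j (congrArg (fun x : φ.ker => ((x : Subgroup.normalizer (E : Set G)) : G)) hij)
    rwa [Subgroup.orderOf_mk, Subgroup.orderOf_mk, Subgroup.orderOf_mk, Subgroup.orderOf_mk, ha,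
      hb] at this
  have h3 : c * (a * b)⁻¹ * c⁻¹ = a := by
    have : c * (a * b) * c⁻¹ = a⁻¹ := by
      rw [show c * (a * b) * c⁻¹ = c * a * c⁻¹ * (c * b * c⁻¹) by group, h1, h2]; group
    rw [← conj_inv, this, inv_inv]
  have hc3 : ∀ x, c ^ 3 * x * (c ^ 3)⁻¹ = c * (c * (c * x * c⁻¹) * c⁻¹) * c⁻¹ := fun x => by
    simp only [pow_succ, pow_zero, one_mul, mul_inv_rev, mul_assoc]
  have hcx : ∀ x ∈ E, c ^ 3 * x * (c ^ 3)⁻¹ = x := by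
    intro x hx
    rw [mul_inv_eq_iff_eq_mul]
    refine (Subgroup.mem_centralizer_singleton_iff.1 ?_).symm
    revert x hx
    change E ≤ _
    rw [Subgroup.closure_le]
    rintro x (rfl | rfl) <;>
    refine Subgroup.mem_centralizer_singleton_iff.2 (Eq.symm ?_) <;>
    rw [← mul_inv_eq_iff_eq_mul, hc3]
    · rw [h1, h2, h3]
    · rw [h2, h3, h1]
  let C : φ.range := ⟨φ ⟨c, hcN⟩, ⟨_, rfl⟩⟩
  have hC : orderOf C = 3 := by
    have : Fact (Nat.Prime 3) := ⟨by norm_num⟩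
    refine orderOf_eq_prime ?_ ?_
    · refine Subtype.ext ?_
      change φ ⟨c, hcN⟩ ^ 3 = 1
      rw [← map_pow]
      ext x
      rw [hφ]
      exact hcx x x.2
    · intro h
      have h4 : φ ⟨c, hcN⟩ = 1 := congrArg Subtype.val h
      have h5 := hφ ⟨c, hcN⟩ ⟨a, haE⟩
      rw [h4] at h5
      exact hne (h5.trans h1)
  have d3 : 3 ∣ Nat.card φ.range := by
    rw [← hC]; exact orderOf_dvd_natCard C
  have := mul_dvd_mul d9 d3
  rw [← Subgroup.index_ker, Subgroup.card_mul_index] at this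
  exact this.trans (Subgroup.card_subgroup_dvd_card _)
end Braid

namespace Braid
variable {n : ℕ}

lemma ee_q {i j : ℕ} (hi : i + 1 < n) (hj : j + 1 < n) : ee (q i j : B n) = 0 := by
  rw [q, ee_mul, ee_inv, ee_s hi, ee_s hj]; rfl

lemma perm_eq_one_of_lt {β : B n} (h : ∀ x < n, perm β x = x) : perm β = 1 := by
  ext x
  rcases lt_or_ge x n with hx | hx
  · rw [h x hx, Equiv.Perm.one_apply]
  · rw [perm_ge β hx, Equiv.Perm.one_apply]

lemma mem_J_of_lt {β : B n} (h : ∀ x < n, perm β x = x) (hβ : ee β = 0) : β ∈ J n :=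
  mem_J.2 ⟨mem_P.2 (perm_eq_one_of_lt h), hβ⟩

lemma rotate_aux {G : Type*} [Group G] {a b c : G} (h : a * c = c * a) (h1 : a * b * a = b * a * b)
    (h2 : b * c * b = c * b * c) : b * a * c * b * a = c * (b * a * c * b) := by
  calc b * a * c * b * a = b * (a * c) * b * a := by simp only [mul_assoc]
    _ = b * c * (a * b * a) := by rw [h]; simp only [mul_assoc]
    _ = b * c * b * a * b := by rw [h1]; simp only [mul_assoc]
    _ = c * b * (c * a) * b := by rw [h2]; simp only [mul_assoc]
    _ = c * (b * a * c * b) := by rw [← h]; simp only [mul_assoc]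

lemma rotate_aux' {G : Type*} [Group G] {a b c : G} (h : a * c = c * a)
    (h1 : a * b * a = b * a * b) (h2 : b * c * b = c * b * c) :
    b * a * c * b * c = a * (b * a * c * b) := by
  have := rotate_aux h.symm h2.symm h1.symm
  rwa [mul_assoc b c a, ← h, ← mul_assoc] at this

namespace CHom
section
variable {G : Type*} [Group G] {ψ : B n → G} (hψ : CHom ψ)
include hψ

lemma quo_eq_one_of_commute {x : B n} (hx : ee x = 0) {c : ℕ} (hc : c + 1 < n)
    (h : Commute (s c) x) (h1 : ψ x = 1) : hψ.quo x = 1 :=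
  hψ.quo_eq_one.2 (hψ.mem_core_of_commute hx hc h h1)

lemma independent (hn : 7 ≤ n) {i j : ℤ} (h : ψ (q 0 2) ^ i * ψ (q 2 4) ^ j = 1) :
    ψ (q 0 2) ^ i = 1 := by
  have e1 : ee (q 0 2 : B n) = 0 := ee_q (by omega) (by omega)
  have e2 : ee (q 2 4 : B n) = 0 := ee_q (by omega) (by omega)
  have e3 : ∀ k : ℤ, ee (q 0 2 ^ k : B n) = 0 := fun k => by rw [ee_zpow, e1, mul_zero]
  have e4 : ∀ k : ℤ, ee (q 2 4 ^ k : B n) = 0 := fun k => by rw [ee_zpow, e2, mul_zero]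
  have c1 : Commute (s 0 : B n) (q 0 2) := commute_s_q (Commute.refl _) (commute_s (by omega))
  have c2 : Commute (s 0 : B n) (q 2 4) := commute_s_q (commute_s (by omega)) (commute_s (by omega))
  rw [← hψ.map_zpow e1, ← hψ.map_zpow e2, ← hψ.map_mul (e3 i) (e4 j)] at h
  have h1 := hψ.quo_eq_one_of_commute (by rw [ee_mul, e3, e4]; rfl) (by omega)
    ((c1.zpow_right i).mul_right (c2.zpow_right j)) h
  have t02 : Commute (hψ.quo (s 0)) (hψ.quo (s 2)) := map_commute_s _ (by omega)
  have t24 : Commute (hψ.quo (s 2)) (hψ.quo (s 4)) := map_commute_s _ (by omega)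
  rw [_root_.map_mul, _root_.map_zpow, _root_.map_zpow, q, q, _root_.map_mul, _root_.map_mul,
    _root_.map_inv, _root_.map_inv, t02.inv_right.mul_zpow, t24.inv_right.mul_zpow, inv_zpow,
    inv_zpow, ← mul_assoc, mul_inv_eq_one] at h1
  have h2 : Commute (hψ.quo (s 4) ^ j) (hψ.quo (s (4 + 1))) := by
    rw [← h1]
    have a0 : Commute (hψ.quo (s 0)) (hψ.quo (s (4 + 1))) := map_commute_s _ (by omega)
    have a2 : Commute (hψ.quo (s 2)) (hψ.quo (s (4 + 1))) := map_commute_s _ (by omega)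
    exact ((a0.zpow_left i).mul_left (a2.zpow_left i).inv_left).mul_left (a2.zpow_left j)
  have h3 := map_zpow_eq_of_commute hψ.quo (k := 4) (by omega) h2 (i := 2) (by omega)
  rw [← h3, mul_eq_right, ← inv_zpow, ← t02.inv_right.mul_zpow, ← _root_.map_inv,
    ← _root_.map_mul, ← _root_.map_zpow] at h1
  rw [← hψ.map_zpow e1]
  exact hψ.eq_one_of_quo h1

/-- An element rotating `s 0`, `s 2`, `s 4`. -/
lemma exists_rotation (hn : 7 ≤ n) : ∃ g : G, g * ψ (q 0 2) * g⁻¹ = ψ (q 2 4) ∧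
    g * ψ (q 2 4) * g⁻¹ = (ψ (q 0 2) * ψ (q 2 4))⁻¹ := by
  have e1 : ee (q 0 2 : B n) = 0 := ee_q (by omega) (by omega)
  have e2 : ee (q 2 4 : B n) = 0 := ee_q (by omega) (by omega)
  have c1 : Commute (s 0 : B n) (q 0 2) := commute_s_q (Commute.refl _) (commute_s (by omega))
  have c2 : Commute (s 0 : B n) (q 2 4) := commute_s_q (commute_s (by omega)) (commute_s (by omega))
  have key : ∀ i, i + 3 < n → ∀ x : B n, x = s (i + 1) * s i * s (i + 2) * s (i + 1) →
      x * s i = s (i + 2) * x ∧ x * s (i + 2) = s i * x := by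
    rintro i hi x rfl
    have e := (commute_s (n := n) (i := i) (j := i + 2) (by omega)).eq
    have b1 : s i * s (i + 1) * s i = (s (i + 1) * s i * s (i + 1) : B n) := s_braid (by omega)
    have b2 : s (i + 1) * s (i + 2) * s (i + 1) = (s (i + 2) * s (i + 1) * s (i + 2) : B n) :=
      s_braid (by omega)
    exact ⟨rotate_aux e b1 b2, rotate_aux' e b1 b2⟩
  have far : ∀ i j, (i + 4 ≤ j ∨ j + 2 ≤ i) → Commute (s (i + 1) * s i * s (i + 2) * s (i + 1) : B n) (s j) := by
    intro i j h
    exact (((commute_s (by omega)).mul_left (commute_s (by omega))).mul_left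
      (commute_s (by omega))).mul_left (commute_s (by omega))
  let x : B n := s 1 * s 0 * s 2 * s 1
  let y : B n := s 3 * s 2 * s 4 * s 3
  have hx := key 0 (by omega) x rfl
  have hy := key 2 (by omega) y rfl
  have hx4 : Commute x (s 4) := far 0 4 (by omega)
  have hy0 : Commute y (s 0) := far 2 0 (by omega)
  have g0 : x * y * s 0 = s 2 * (x * y) := by
    rw [mul_assoc, hy0.eq, ← mul_assoc, hx.1, mul_assoc]
  have g2 : x * y * s 2 = s 4 * (x * y) := by
    rw [mul_assoc, hy.1, ← mul_assoc, hx4.eq, mul_assoc]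
  have g4 : x * y * s 4 = s 0 * (x * y) := by
    rw [mul_assoc, hy.2, ← mul_assoc, hx.2, mul_assoc]
  have r1 : x * y * q 0 2 * (x * y)⁻¹ = q 2 4 := by
    rw [q, q, conj_mul, ← conj_inv, g0, g2, mul_inv_cancel_right, mul_inv_cancel_right]
  have r2 : x * y * q 2 4 * (x * y)⁻¹ = (q 0 2 * q 2 4)⁻¹ := by
    rw [q, q, conj_mul, ← conj_inv, g2, g4, mul_inv_cancel_right, mul_inv_cancel_right,
      ← mul_assoc, inv_mul_cancel_right, mul_inv_rev, inv_inv]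
  refine ⟨_, (hψ.map_conj_of_commute e1 (by omega) c1 (x * y)).symm.trans (by rw [r1]),
    (hψ.map_conj_of_commute e2 (by omega) c2 (x * y)).symm.trans (by rw [r2, hψ.map_inv (by rw [ee_mul, e1, e2]; rfl), hψ.map_mul e1 e2])⟩

end
end CHom
end Braid

namespace Braid.CHom

lemma sq_eq_one {n : ℕ} (hn : 7 ≤ n) {X : Type} [Fintype X] [DecidableEq X] (hX : Fintype.card X ≤ 7)
    {ψ : B n → Equiv.Perm X} (hψ : CHom ψ) : ψ (q 0 2) ^ 2 = 1 := by
  rcases subsingleton_or_nontrivial X with hs | hs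
  · exact Subsingleton.elim _ _
  have e1 : ee (q 0 2 : B n) = 0 := ee_q (by omega) (by omega)
  have e2 : ee (q 2 4 : B n) = 0 := ee_q (by omega) (by omega)
  have hab : Commute (ψ (q 0 2)) (ψ (q 2 4)) := hψ.map_commute e1 e2
    ((commute_s_q (commute_s (by omega)) (commute_s (by omega))).mul_left
      (commute_s_q (Commute.refl _) (commute_s (by omega))).inv_left)
  have hind := fun i j => hψ.independent (by omega) (i := i) (j := j)
  obtain ⟨c, hc1, hc2⟩ := hψ.exists_rotation (by omega)
  have s1 := Equiv.Perm.mem_alternatingGroup.2 (hψ.sign_eq_one (by omega) e1)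
  have s2 := Equiv.Perm.mem_alternatingGroup.2 (hψ.sign_eq_one (by omega) e2)
  generalize ψ (q 0 2) = a at *
  generalize ψ (q 2 4) = b at *
  have hob : orderOf b = orderOf a := by
    rw [← hc1]; exact (MulAut.conj c).orderOf_eq a
  have h2 : 2 ≤ Fintype.card X := Fintype.one_lt_card
  have hd := orderOf_mul_orderOf_dvd_card (G := alternatingGroup X) (a := ⟨a, s1⟩) (b := ⟨b, s2⟩)
    (Subtype.ext hab.eq) fun i j hij => Subtype.ext (hind i j (congrArg Subtype.val hij))
  rw [Subgroup.orderOf_mk, Subgroup.orderOf_mk, hob, nat_card_alternatingGroup,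
    Nat.card_eq_fintype_card] at hd
  have hd' : orderOf a * orderOf a ∣ 2520 := hd.trans (by
    interval_cases Fintype.card X <;> decide)
  have h6 : orderOf a ∣ 6 := by
    have hle : orderOf a < 51 := by
      have := Nat.le_of_dvd (by norm_num) hd'
      nlinarith
    have key : ∀ o < 51, o * o ∣ 2520 → o ∣ 6 := by decide
    exact key _ hle hd'
  have h3 : ¬ 3 ∣ orderOf a := by
    intro h3
    have ho : 0 < orderOf a := orderOf_pos a
    obtain ⟨k, hk⟩ := h3
    have hk0 : 0 < k := by omega
    have := twenty_seven_dvd_card (a := a ^ k) (b := b ^ k) (c := c) (hab.pow_pow k k)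
      (fun i j hij => by
        rw [← zpow_natCast, ← zpow_natCast, ← zpow_mul, ← zpow_mul] at hij
        rw [← zpow_natCast, ← zpow_mul]
        exact hind _ _ hij)
      (by rw [orderOf_pow_of_dvd hk0.ne' (Dvd.intro_left 3 hk.symm), hk, Nat.mul_div_cancel _ hk0])
      (by rw [← conj_pow, hc1]) (by rw [← conj_pow, hc2, inv_pow, hab.mul_pow])
    rw [Nat.card_eq_fintype_card, Fintype.card_perm] at this
    have : 27 ∣ 5040 := this.trans (Nat.factorial_dvd_factorial (n := 7) hX)
    omega
  have : orderOf a ∣ 2 := by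
    have : (orderOf a).Coprime 3 := ((Nat.Prime.coprime_iff_not_dvd (by norm_num)).2 h3).symm
    exact this.dvd_of_dvd_mul_right (m := 2) h6
  exact orderOf_dvd_iff_pow_eq_one.1 this

lemma quo_sq_eq {n : ℕ} (hn : 7 ≤ n) {G : Type*} [Group G] {ψ : B n → G} (hψ : CHom ψ)
    (h : ψ (q 0 2) ^ 2 = 1) {i : ℕ} (hi : i + 1 < n) :
    hψ.quo (s i) ^ 2 = hψ.quo (s 0) ^ 2 := by
  have e1 : ee (q 0 2 : B n) = 0 := ee_q (by omega) (by omega)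
  have c1 : Commute (s 0 : B n) (q 0 2) := commute_s_q (Commute.refl _) (commute_s (by omega))
  have h1 : ψ (q 0 2 ^ 2) = 1 := by
    rw [pow_two, hψ.map_mul e1 e1, ← pow_two, h]
  have h2 := hψ.quo_eq_one_of_commute (by rw [ee_pow, e1, mul_zero]) (by omega) (c1.pow_right 2) h1
  have t02 : Commute (hψ.quo (s 0)) (hψ.quo (s 2)) := map_commute_s _ (by omega)
  rw [_root_.map_pow, q, _root_.map_mul, _root_.map_inv, t02.inv_right.mul_pow, inv_pow,
    mul_inv_eq_one] at h2
  have := fun i hi => map_zpow_eq_of_commute hψ.quo (j := 2) (k := 2) (by omega) (by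
    have a0 : Commute (hψ.quo (s 0)) (hψ.quo (s (2 + 1))) := map_commute_s _ (by omega)
    rw [show (2 : ℤ) = ((2 : ℕ) : ℤ) from rfl, zpow_natCast, ← h2]
    exact a0.pow_left 2) (i := i) hi
  have h3 := (this i hi).trans (this 0 (by omega)).symm
  exact_mod_cast h3

end Braid.CHom

namespace Braid.CHom
variable {n : ℕ}

/-- Every action of the commutator subgroup of `B n` on at most `n` points is trivial or resembles
the standard one. -/
def Rigid (n : ℕ) : Prop :=
  ∀ (X : Type) [Fintype X] [DecidableEq X] (ψ : B n → Equiv.Perm X) (hψ : CHom ψ),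
    Fintype.card X ≤ n → (∃ d, ee d = 0 ∧ ψ d ≠ 1) →
    Fintype.card X = n ∧ (ψ (q 0 1)).IsThreeCycle ∧ hψ.quo (s 0) ^ 2 = hψ.quo (s 1) ^ 2

lemma Rigid.trivial (h : Rigid n) : Trivial n n := by
  classical
  intro X _ ψ hψ hX d hd
  by_contra hne
  have := Fintype.ofFinite X
  rw [Nat.card_eq_fintype_card] at hX
  exact absurd (h X ψ hψ hX.le ⟨d, hd, hne⟩).1 hX.ne

lemma perm_q_three_five (hn : 7 ≤ n) : ((q 3 5 : B n) * (s 4 * q 3 5 * (s 4)⁻¹) * (q 3 5)⁻¹ *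
    (s 4 * q 3 5 * (s 4)⁻¹)⁻¹) ∈ J n := by
  have e : ee (q 3 5 : B n) = 0 := ee_q (by omega) (by omega)
  refine mem_J_of_lt (fun x _ => ?_) (by simp [ee_mul, ee_inv, e])
  simp only [q, _root_.map_mul, _root_.map_inv, perm_s (n := n) (i := 3) (by omega),
    perm_s (n := n) (i := 4) (by omega), perm_s (n := n) (i := 5) (by omega), Equiv.swap_inv,
    Equiv.Perm.mul_apply, mul_inv_rev]
  rcases lt_or_ge x 7 with h | h
  · interval_cases x <;> decide
  · simp [Equiv.swap_apply_of_ne_of_ne, show x ≠ 3 by omega, show x ≠ 4 by omega,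
      show x ≠ 5 by omega, show x ≠ 6 by omega]

lemma q_zero_one_cube (hn : 7 ≤ n) : (q 0 1 : B n) ^ 3 ∈ J n := by
  have e : ee (q 0 1 : B n) = 0 := ee_q (by omega) (by omega)
  refine mem_J_of_lt (fun x _ => ?_) (by rw [ee_pow, e, mul_zero])
  simp only [q, _root_.map_mul, _root_.map_inv, perm_s (n := n) (i := 0) (by omega), pow_succ, pow_zero, one_mul,
    perm_s (n := n) (i := 1) (by omega), Equiv.swap_inv, Equiv.Perm.mul_apply]
  rcases lt_or_ge x 7 with h | h
  · interval_cases x <;> decide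
  · simp [Equiv.swap_apply_of_ne_of_ne, show x ≠ 0 by omega, show x ≠ 1 by omega,
      show x ≠ 2 by omega]

lemma quo_ne {G : Type*} [Group G] {ψ : B n → G} (hψ : CHom ψ) (hne : ∃ d, ee d = 0 ∧ ψ d ≠ 1)
    {k : ℕ} (hk : k + 2 < n) : hψ.quo (s k) ≠ hψ.quo (s (k + 1)) := fun h => by
  obtain ⟨d, hd, h1⟩ := hne
  exact h1 (hψ.eq_one_of_quo (map_eq_one_of_eq_succ hψ.quo hk h hd))

lemma map_q_zero_one_ne {G : Type*} [Group G] {ψ : B n → G} (hψ : CHom ψ) (hn : 5 ≤ n)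
    (hne : ∃ d, ee d = 0 ∧ ψ d ≠ 1) : ψ (q 0 1) ≠ 1 := fun h => by
  have := hψ.quo_eq_one_of_commute (ee_q (by omega) (by omega)) (c := 3) (by omega)
    (commute_s_q (commute_s (by omega)) (commute_s (by omega))) h
  rw [q, _root_.map_mul, _root_.map_inv, mul_inv_eq_one] at this
  exact hψ.quo_ne hne (by omega) this

lemma quo_of_mem_J {G : Type*} [Group G] {ψ : B n → G} (hψ : CHom ψ) (hn : 3 ≤ n)
    (h : hψ.quo (s 0) ^ 2 = hψ.quo (s 1) ^ 2) {x : B n} (hx : x ∈ J n) : ψ x = 1 :=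
  hψ.eq_one_of_quo (map_J_eq_one hψ.quo hn h hx)

lemma zpow_eq_one_or {G : Type*} [Group G] {a : G} (ha : a ^ 2 = 1) (i : ℤ) :
    a ^ i = 1 ∨ a ^ i = a := by
  have ha : a ^ (2 : ℤ) = 1 := by exact_mod_cast ha
  rcases Int.even_or_odd' i with ⟨k, rfl | rfl⟩
  · left; rw [zpow_mul, ha, one_zpow]
  · right; rw [zpow_add_one, zpow_mul, ha, one_zpow, one_mul]

lemma four_dvd_of_involutions {G : Type*} [Group G] {a b : G} (hab : Commute a b) (ha : a ^ 2 = 1)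
    (hb : b ^ 2 = 1) (ha1 : a ≠ 1) (hb1 : b ≠ 1) (hne : a ≠ b) : 4 ∣ Nat.card G := by
  have := orderOf_mul_orderOf_dvd_card hab fun i j h => by
    rcases zpow_eq_one_or ha i with hi | hi
    · exact hi
    rcases zpow_eq_one_or hb j with hj | hj
    · rwa [hj, mul_one] at h
    · rw [hi, hj] at h
      have hb' : b⁻¹ = b := inv_eq_of_mul_eq_one_left (by rw [← pow_two, hb])
      exact absurd (by rw [← hb']; exact eq_inv_of_mul_eq_one_left h) hne
  rwa [orderOf_eq_prime ha ha1, orderOf_eq_prime hb hb1] at this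

lemma four_dvd_card_centralizer (hn : 7 ≤ n) {G : Type*} [Group G] {ψ : B n → G} (hψ : CHom ψ)
    (h : ∀ i, i + 1 < n → hψ.quo (s i) ^ 2 = hψ.quo (s 0) ^ 2) (hne : ∃ d, ee d = 0 ∧ ψ d ≠ 1) :
    4 ∣ Nat.card (Subgroup.centralizer {ψ (q 0 1)}) := by
  have e1 : ee (q 3 5 : B n) = 0 := ee_q (by omega) (by omega)
  have e2 : ee (s 4 * q 3 5 * (s 4)⁻¹ : B n) = 0 := by rw [ee_conj, e1]
  have e0 : ee (q 0 1 : B n) = 0 := ee_q (by omega) (by omega)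
  have hJ : ∀ {x}, x ∈ J n → hψ.quo x = 1 := fun hx =>
    map_J_eq_one hψ.quo (by omega) (h 1 (by omega)).symm hx
  set t := hψ.quo with ht
  have t35 : Commute (t (s 3)) (t (s 5)) := map_commute_s _ (by omega)
  have hsq : t (q 3 5) ^ 2 = 1 := by
    rw [q, _root_.map_mul, _root_.map_inv, t35.inv_right.mul_pow, inv_pow, h 3 (by omega),
      h 5 (by omega), mul_inv_cancel]
  have f1 : ψ (q 3 5) ^ 2 = 1 := by
    rw [pow_two, ← hψ.map_mul e1 e1]
    exact hψ.eq_one_of_quo (by rw [_root_.map_mul, ← pow_two]; exact hsq)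
  have f2 : ψ (s 4 * q 3 5 * (s 4)⁻¹) ^ 2 = 1 := by
    rw [pow_two, ← hψ.map_mul e2 e2]
    refine hψ.eq_one_of_quo ?_
    rw [← pow_two, conj_pow, _root_.map_mul, _root_.map_mul, _root_.map_pow, ← ht, hsq, mul_one,
      _root_.map_inv, mul_inv_cancel]
  have hw : Commute (ψ (q 3 5)) (ψ (s 4 * q 3 5 * (s 4)⁻¹)) := by
    have := hψ.eq_one_of_quo (hJ (perm_q_three_five hn))
    rw [hψ.map_mul (by simp [ee_mul, ee_inv, e1]) (by simp [ee_mul, ee_inv, e1]),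
      hψ.map_mul (by simp [ee_mul, ee_inv, e1]) (by simp [ee_inv, e1]),
      hψ.map_mul e1 e2, hψ.map_inv e1, hψ.map_inv e2, mul_inv_eq_one, mul_inv_eq_iff_eq_mul] at this
    exact this
  have c1 : Commute (s 0 : B n) (q 3 5) := commute_s_q (commute_s (by omega)) (commute_s (by omega))
  have c2 : Commute (s 1 : B n) (q 3 5) := commute_s_q (commute_s (by omega)) (commute_s (by omega))
  have c3 : Commute (s 0 : B n) (s 4) := commute_s (by omega)
  have c4 : Commute (s 1 : B n) (s 4) := commute_s (by omega)
  have d1 : Commute (s 0 : B n) (s 4 * q 3 5 * (s 4)⁻¹) := (c3.mul_right c1).mul_right c3.inv_right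
  have d2 : Commute (s 1 : B n) (s 4 * q 3 5 * (s 4)⁻¹) := (c4.mul_right c2).mul_right c4.inv_right
  have m1 : ψ (q 3 5) ∈ Subgroup.centralizer {ψ (q 0 1)} :=
    Subgroup.mem_centralizer_singleton_iff.2
      (hψ.map_commute e0 e1 (c1.mul_left c2.inv_left)).symm.eq
  have m2 : ψ (s 4 * q 3 5 * (s 4)⁻¹) ∈ Subgroup.centralizer {ψ (q 0 1)} :=
    Subgroup.mem_centralizer_singleton_iff.2
      (hψ.map_commute e0 e2 (d1.mul_left d2.inv_left)).symm.eq
  have n1 : t (q 3 5) ≠ 1 := by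
    intro hq
    rw [q, _root_.map_mul, _root_.map_inv, mul_inv_eq_one] at hq
    have h23 : t (s 2) = t (s 3) := map_eq_of_commute t (by omega) (by
      rw [hq]; exact map_commute_s t (by omega))
    exact hψ.quo_ne hne (by omega) h23
  have n2 : ψ (q 3 5) ≠ 1 := fun hq => n1 (hψ.quo_eq_one_of_commute e1 (by omega) c1 hq)
  have n3 : ψ (s 4 * q 3 5 * (s 4)⁻¹) ≠ 1 := fun hq => n1 <| by
    have := hψ.quo_eq_one_of_commute e2 (by omega) d1 hq
    rwa [_root_.map_mul, _root_.map_mul, _root_.map_inv, conj_eq_one_iff] at this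
  have n4 : ψ (q 3 5) ≠ ψ (s 4 * q 3 5 * (s 4)⁻¹) := fun hq => by
    have h1 : ψ (q 3 5 * (s 4 * q 3 5 * (s 4)⁻¹)⁻¹) = 1 := by
      rw [hψ.map_mul e1 (by rw [ee_inv, e2]; rfl), hψ.map_inv e2, hq, mul_inv_cancel]
    have h2 := hψ.quo_eq_one_of_commute (by rw [ee_mul, ee_inv, e1, e2]; rfl) (by omega)
      (c1.mul_right d1.inv_right) h1
    rw [_root_.map_mul, _root_.map_inv, mul_inv_eq_one, _root_.map_mul, _root_.map_mul,
      _root_.map_inv, eq_mul_inv_iff_mul_eq] at h2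
    have b34 : t (s 3) * t (s 4) * t (s 3) = t (s 4) * t (s 3) * t (s 4) := by
      simpa only [_root_.map_mul] using congrArg t (s_braid (n := n) (i := 3) (by omega))
    have b45 : t (s 4) * t (s 5) * t (s 4) = t (s 5) * t (s 4) * t (s 5) := by
      simpa only [_root_.map_mul] using congrArg t (s_braid (n := n) (i := 4) (by omega))
    have hr : t (s 3) = t (q 3 5) * t (s 5) := by rw [q, _root_.map_mul, _root_.map_inv]; simp
    have hr5 : Commute (t (q 3 5)) (t (s 5)) := by
      rw [q, _root_.map_mul, _root_.map_inv]
      exact t35.mul_left (Commute.refl _).inv_left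
    have h2 : Commute (t (q 3 5)) (t (s 4)) := h2
    apply n1
    rw [hr] at b34
    generalize t (q 3 5) = r at *
    generalize t (s 4) = b at *
    generalize t (s 5) = c at *
    have : r * r * (c * b * c) = r * (c * b * c) := by
      calc r * r * (c * b * c) = r * c * b * (r * c) := by
            rw [show r * c * b * (r * c) = r * c * (b * r) * c by simp only [mul_assoc], ← h2.eq,
              show r * c * (r * b) * c = r * (c * r) * b * c by simp only [mul_assoc], ← hr5.eq]
            simp only [mul_assoc]
        _ = b * (r * c) * b := b34
        _ = r * (c * b * c) := by rw [← mul_assoc, ← h2.eq, ← b45]; simp only [mul_assoc]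
    rw [mul_left_inj, mul_eq_right] at this
    exact this
  exact four_dvd_of_involutions (a := ⟨_, m1⟩) (b := ⟨_, m2⟩) (Subtype.ext hw.eq) (Subtype.ext f1)
    (Subtype.ext f2) (fun h => n2 (congrArg Subtype.val h)) (fun h => n3 (congrArg Subtype.val h))
    fun h => n4 (congrArg Subtype.val h)

lemma rigid_seven : Rigid 7 := by
  intro X _ _ ψ hψ hX hne
  have hsq := fun i hi => hψ.quo_sq_eq le_rfl (sq_eq_one le_rfl hX hψ) (i := i) hi
  have h4 := four_dvd_card_centralizer le_rfl hψ hsq hne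
  have e0 : ee (q 0 1 : B 7) = 0 := ee_q (by omega) (by omega)
  have e : ∀ k : ℕ, ψ (q 0 1 ^ k) = ψ (q 0 1) ^ k := fun k => by
    rw [← zpow_natCast, hψ.map_zpow e0, zpow_natCast]
  have h3 : ψ (q 0 1) ^ 3 = 1 := by
    rw [← e]
    exact hψ.quo_of_mem_J (by omega) (hsq 1 (by omega)).symm (q_zero_one_cube le_rfl)
  have hp : orderOf (ψ (q 0 1)) = 3 := orderOf_eq_prime h3 (hψ.map_q_zero_one_ne (by omega) hne)
  obtain ⟨k, hk⟩ := Equiv.Perm.cycleType_prime_order (σ := ψ (q 0 1)) (by rw [hp]; norm_num)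
  rw [hp] at hk
  have hs : (ψ (q 0 1)).cycleType.sum ≤ Fintype.card X := by
    rw [Equiv.Perm.sum_cycleType]; exact Finset.card_le_univ _
  rw [Equiv.Perm.nat_card_centralizer, hk] at h4
  rw [hk, Multiset.sum_replicate, smul_eq_mul] at hs
  have hk1 : k < 2 := by omega
  refine ⟨?_, ?_, (hsq 1 (by omega)).symm⟩
  · interval_cases k <;> interval_cases Fintype.card X <;> revert h4 <;> decide
  · interval_cases k
    · exact hk
    · exfalso; interval_cases Fintype.card X <;> revert h4 <;> decide

end Braid.CHom

namespace Braid
variable {n : ℕ}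

lemma three_le_card_support {X : Type*} [Fintype X] [DecidableEq X] {g : Equiv.Perm X}
    (hg : Equiv.Perm.sign g = 1) (h1 : g ≠ 1) : 3 ≤ g.support.card := by
  by_contra! h
  have h2 := Equiv.Perm.two_le_card_support_of_ne_one h1
  have h3 : g.support.card = 2 := by omega
  have := (Equiv.Perm.card_support_eq_two.1 h3).sign_eq
  rw [hg] at this
  exact absurd this (by decide)

lemma eq_one_or_of_support_subset {X : Type*} [Fintype X] [DecidableEq X] {a b : Equiv.Perm X}
    {T : Finset X} (hT : T.card = 3) (ha : Equiv.Perm.sign a = 1) (hb : Equiv.Perm.sign b = 1)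
    (haT : a.support ⊆ T) (hbT : b.support ⊆ T) (h1 : a ≠ 1) : b = 1 ∨ b = a ∨ b = a⁻¹ := by
  have e : Fin 3 ≃ T := (Fintype.equivFinOfCardEq (by simpa using hT)).symm
  let f : Equiv.Perm (Fin 3) →* Equiv.Perm X :=
    (Equiv.Perm.ofSubtype (p := (· ∈ T))).comp e.permCongrHom.toMonoidHom
  have hs : ∀ c, Equiv.Perm.sign (f c) = Equiv.Perm.sign c := fun c => by
    change Equiv.Perm.sign (Equiv.Perm.ofSubtype (e.permCongr c)) = _
    rw [Equiv.Perm.sign_ofSubtype, Equiv.Perm.sign_permCongr]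
  have hf : ∀ c : Equiv.Perm X, c.support ⊆ T → ∃ d, f d = c := by
    intro c hc
    have hm : ∀ x, c x ≠ x → x ∈ T := fun x hx => hc (Equiv.Perm.mem_support.2 hx)
    have hi : ∀ x, c x ∈ T ↔ x ∈ T := fun x => by
      by_cases hx : c x = x
      · rw [hx]
      · exact iff_of_true (hm _ fun h => hx (c.injective h)) (hm _ hx)
    refine ⟨e.permCongr.symm (c.subtypePerm hi), ?_⟩
    change Equiv.Perm.ofSubtype (e.permCongr (e.permCongr.symm _)) = c
    rw [Equiv.apply_symm_apply, Equiv.Perm.ofSubtype_subtypePerm hi hm]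
  obtain ⟨a, rfl⟩ := hf a haT
  obtain ⟨b, rfl⟩ := hf b hbT
  rw [hs] at ha hb
  have key : ∀ a b : Equiv.Perm (Fin 3), Equiv.Perm.sign a = 1 → Equiv.Perm.sign b = 1 → a ≠ 1 →
      b = 1 ∨ b = a ∨ b = a⁻¹ := by decide
  rcases key a b ha hb (fun h => h1 (by rw [h, map_one])) with rfl | rfl | rfl
  · exact Or.inl (map_one f)
  · exact Or.inr (Or.inl rfl)
  · exact Or.inr (Or.inr (map_inv f a))

open Classical Pointwise in
lemma CHom.card_moved_le {X : Type} [Fintype X] {ψ : B n → Equiv.Perm X} (hψ : CHom ψ) {β : ℕ}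
    (hβ : Trivial n β) (hne : ∃ d, ee d = 0 ∧ ψ d ≠ 1) :
    β ≤ (Finset.univ.filter fun x => ∃ d, ee d = 0 ∧ ψ d x ≠ x).card := by
  by_contra! hlt
  set O := Finset.univ.filter fun x => ∃ d, ee d = 0 ∧ ψ d x ≠ x with hO
  have hmem : ∀ x, x ∈ (O : Set X) ↔ ∃ d, ee d = 0 ∧ ψ d x ≠ x := fun x => by simp [hO]
  have hnot : ∀ {x}, x ∉ (O : Set X) → ∀ d, ee d = 0 → ψ d x = x := fun {x} hx d hd => by
    by_contra h
    exact hx ((hmem x).2 ⟨d, hd, h⟩)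
  have hH : ∀ d, ee d = 0 → ψ d ∈ MulAction.stabilizer (Equiv.Perm X) (O : Set X) := fun d hd => by
    rw [MulAction.mem_stabilizer_set]
    intro x
    rw [Equiv.Perm.smul_def]
    refine ⟨fun h => ?_, fun h => ?_⟩
    · by_contra hx
      rw [hnot hx d hd] at h
      exact hx h
    · by_contra hx
      have := hnot hx d⁻¹ (by rw [ee_inv, hd]; rfl)
      rw [hψ.map_inv hd, ← Equiv.Perm.mul_apply, inv_mul_cancel, Equiv.Perm.one_apply] at this
      rw [← this] at hx
      exact hx h
  obtain ⟨ψ', h1, h2⟩ := hψ.exists_restrict hH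
    (MulAction.toPermHom (MulAction.stabilizer (Equiv.Perm X) (O : Set X)) (O : Set X))
  have h3 := hβ _ ψ' h1 (by simpa using hlt)
  obtain ⟨d, hd, hd1⟩ := hne
  obtain ⟨x, hx⟩ : ∃ x, ψ d x ≠ x := by
    by_contra! h
    exact hd1 (Equiv.ext h)
  have hxO := (hmem x).2 ⟨d, hd, hx⟩
  have h4 := DFunLike.congr_fun (h3 d hd) ⟨x, hxO⟩
  rw [h2 d hd] at h4
  exact hx (congrArg Subtype.val h4)

end Braid

namespace Braid
variable {n : ℕ}

/-- The inclusion of `B k` into `B n` sending `s i` to `s (i + c)`. -/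
def shift {k n : ℕ} (c : ℕ) (h : k + c ≤ n) : B k →* B n :=
  lift (fun i => s (i + c)) (fun i j hij _ => s_comm (by omega)) fun i hi => by
    rw [show i + 1 + c = i + c + 1 by omega]
    exact s_braid (by omega)

lemma shift_s {k c : ℕ} (h : k + c ≤ n) {i : ℕ} (hi : i + 1 < k) :
    shift c h (s i) = s (i + c) := lift_s _ _ _ hi

lemma shift_q {k c : ℕ} (h : k + c ≤ n) {i j : ℕ} (hi : i + 1 < k) (hj : j + 1 < k) :
    shift c h (q i j) = q (i + c) (j + c) := by
  rw [q, map_mul, map_inv, shift_s h hi, shift_s h hj, q]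

lemma ee_shift {k c : ℕ} (h : k + c ≤ n) (b : B k) : ee (shift c h b) = ee b := by
  induction b using induct with
  | one => rw [map_one, ee_one, ee_one]
  | s_mul i β hi ih => rw [map_mul, shift_s h hi, ee_mul, ee_mul, ih, ee_s hi, ee_s (by omega)]
  | inv_mul i β hi ih =>
    rw [map_mul, map_inv, shift_s h hi, ee_mul, ee_mul, ih, ee_inv, ee_inv, ee_s hi,
      ee_s (by omega)]

lemma commute_shift {k c i : ℕ} (h : k + c ≤ n) (hi : i + 2 ≤ c ∨ c + k ≤ i) (b : B k) :
    Commute (s i) (shift c h b) := by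
  induction b using induct with
  | one => rw [map_one]; exact Commute.one_right _
  | s_mul j β hj ih =>
    rw [map_mul, shift_s h hj]
    exact (commute_s (by omega)).mul_right ih
  | inv_mul j β hj ih =>
    rw [map_mul, map_inv, shift_s h hj]
    exact (commute_s (by omega)).inv_right.mul_right ih

namespace CHom

open Classical in
lemma rigid_of_trivial (hn : 8 ≤ n) {β : ℕ} (hβ : Trivial (n - 3) β) (h2 : n < 2 * β)
    (h3 : n ≤ β + 3 ∨ n = 9) : Rigid n := by
  intro X _ _ ψ hψ hX hne
  have hk : n - 3 + 3 ≤ n := by omega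
  have hK : CHom fun a => ψ (shift 3 hk a) := hψ.comp_hom _ (ee_shift hk)
  have hq : ∀ i j : ℕ, i + 1 < n → j + 1 < n → ee (q i j : B n) = 0 := fun _ _ => ee_q
  have hKne : ∃ d, ee d = 0 ∧ ψ (shift 3 hk d) ≠ 1 := by
    refine ⟨q 0 1, ee_q (by omega) (by omega), fun h => ?_⟩
    rw [shift_q hk (by omega) (by omega)] at h
    have := hψ.quo_eq_one_of_commute (hq _ _ (by omega) (by omega)) (c := 0) (by omega)
      (commute_s_q (commute_s (by omega)) (commute_s (by omega))) h
    rw [q, _root_.map_mul, _root_.map_inv, mul_inv_eq_one] at this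
    exact hψ.quo_ne hne (k := 3) (by omega) this
  set O := Finset.univ.filter fun x => ∃ d, ee d = 0 ∧ ψ (shift 3 hk d) x ≠ x with hO
  have hcard : n ≤ O.card + 3 := by
    rcases h3 with h3 | rfl
    · have h4 : β ≤ O.card := by convert hK.card_moved_le hβ hKne
      omega
    have hl : 6 + 0 ≤ 9 := by omega
    have hL : CHom fun a => ψ (shift 0 hl a) := hψ.comp_hom _ (ee_shift hl)
    have hdis : Disjoint (ψ (q 3 4)).support (ψ (q 6 7)).support := by
      rw [Finset.disjoint_right]
      intro x hx hx'
      rw [Equiv.Perm.mem_support] at hx hx'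
      have := hL.apply_eq_self_of_commute (by omega) (trivial_five (by omega)) (by omega)
        (u := ψ (q 6 7)) (fun d hd => hψ.map_commute ((ee_shift hl d).trans hd)
          (hq _ _ (by omega) (by omega)) ((commute_shift hl (by omega) d).mul_left
            (commute_shift hl (by omega) d).inv_left).symm) hx
        (d := q 3 4) (ee_q (by omega) (by omega))
      rw [shift_q hl (by omega) (by omega)] at this
      exact hx' this
    have hne' : ∀ k : ℕ, 3 ≤ k → k + 2 < 9 → ψ (q k (k + 1)) ≠ 1 := fun k hk3 hk9 h => by
      have := hψ.quo_eq_one_of_commute (hq _ _ (by omega) (by omega)) (c := 0) (by omega)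
        (commute_s_q (commute_s (by omega)) (commute_s (by omega))) h
      rw [q, _root_.map_mul, _root_.map_inv, mul_inv_eq_one] at this
      exact hψ.quo_ne hne (by omega) this
    have hsub : (ψ (q 3 4)).support ∪ (ψ (q 6 7)).support ⊆ O := by
      intro x hx
      rw [Finset.mem_union, Equiv.Perm.mem_support, Equiv.Perm.mem_support] at hx
      rw [hO, Finset.mem_filter]
      refine ⟨Finset.mem_univ _, ?_⟩
      rcases hx with hx | hx
      · exact ⟨q 0 1, ee_q (by omega) (by omega), by rwa [shift_q hk (by omega) (by omega)]⟩
      · exact ⟨q 3 4, ee_q (by omega) (by omega), by rwa [shift_q hk (by omega) (by omega)]⟩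
    have h4 := Finset.card_le_card hsub
    rw [Finset.card_union_of_disjoint hdis] at h4
    have h5 := three_le_card_support (hψ.sign_eq_one (by omega) (hq 3 4 (by omega) (by omega)))
      (hne' 3 (by omega) (by omega))
    have h6 := three_le_card_support (hψ.sign_eq_one (by omega) (hq 6 7 (by omega) (by omega)))
      (hne' 6 (by omega) (by omega))
    omega
  have hT : ∀ e : B n, ee e = 0 → (∀ d, Commute e (shift 3 hk d)) → (ψ e).support ⊆ Oᶜ := by
    intro e he hc x hx
    rw [Finset.mem_compl, hO, Finset.mem_filter]
    rintro ⟨-, d, hd, hdx⟩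
    exact hdx (hK.apply_eq_self_of_commute (by omega) hβ (by omega) (u := ψ e)
      (fun d hd => hψ.map_commute ((ee_shift hk d).trans hd) he (hc d).symm)
      (Equiv.Perm.mem_support.1 hx) hd)
  have c0 : ∀ d, Commute (s 0) (shift 3 hk d) := commute_shift hk (by omega)
  have c1 : ∀ d, Commute (s 1) (shift 3 hk d) := commute_shift hk (by omega)
  have cq : ∀ d, Commute (q 0 1) (shift 3 hk d) := fun d => (c0 d).mul_left (c1 d).inv_left
  have e0 : ee (q 0 1 : B n) = 0 := hq _ _ (by omega) (by omega)
  have e1 : ee (s 0 * q 0 1 * (s 0)⁻¹ : B n) = 0 := by rw [ee_conj, e0]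
  have hTa := hT _ e0 cq
  have hTb := hT _ e1 fun d => ((c0 d).mul_left (cq d)).mul_left (c0 d).inv_left
  have ha1 := hψ.map_q_zero_one_ne (by omega) hne
  have hsa := hψ.sign_eq_one (by omega) e0
  have hsb := hψ.sign_eq_one (by omega) e1
  have h5 := three_le_card_support hsa ha1
  have h6 := Finset.card_le_card hTa
  have h7 := Finset.card_compl_add_card O
  refine ⟨by omega, card_support_eq_three_iff.1 (by omega), ?_⟩
  have ct : Commute (s 3 : B n) (q 0 1) :=
    commute_s_q (commute_s (by omega)) (commute_s (by omega))
  have ct' : Commute (s 3 : B n) (s 0 * q 0 1 * (s 0)⁻¹) :=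
    ((commute_s (by omega)).mul_right ct).mul_right (commute_s (by omega)).inv_right
  have hab : ∀ {x}, ee x = 0 → Commute (s 3 : B n) x → ψ x = 1 → hψ.quo x = 1 := fun hx hc h =>
    hψ.quo_eq_one_of_commute hx (by omega) hc h
  have h01 := hψ.quo_ne hne (k := 0) (by omega)
  rcases eq_one_or_of_support_subset (T := Oᶜ) (by omega) hsa hsb hTa hTb ha1 with h | h | h
  · have := hab e1 ct' h
    rw [_root_.map_mul, _root_.map_mul, _root_.map_inv, conj_eq_one_iff, q, _root_.map_mul,
      _root_.map_inv, mul_inv_eq_one] at this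
    exact absurd this h01
  · have := hab (by rw [ee_mul, ee_inv, e0, e1]; rfl) (ct'.mul_right ct.inv_right)
      (by rw [hψ.map_mul e1 (by rw [ee_inv, e0]; rfl), hψ.map_inv e0, h, mul_inv_cancel])
    rw [_root_.map_mul, _root_.map_inv, mul_inv_eq_one] at this
    refine absurd (map_eq_of_commute hψ.quo (i := 0) (by omega) ?_) h01
    simp only [q, _root_.map_mul, _root_.map_inv, zero_add] at this ⊢
    generalize hψ.quo (s 0) = a at *
    generalize hψ.quo (s 1) = b at *
    rw [mul_assoc, mul_assoc, mul_right_inj, ← mul_assoc, mul_inv_eq_iff_eq_mul] at this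
    exact Commute.inv_right_iff.1 this
  · have := hab (by rw [ee_mul, e0, e1]; rfl) (ct'.mul_right ct)
      (by rw [hψ.map_mul e1 e0, h, inv_mul_cancel])
    simp only [q, _root_.map_mul, _root_.map_inv] at this
    generalize hψ.quo (s 0) = a at *
    generalize hψ.quo (s 1) = b at *
    rw [← mul_assoc, mul_inv_eq_one, inv_mul_cancel_right, ← mul_assoc, mul_inv_eq_iff_eq_mul] at this
    rw [pow_two, pow_two, this]

lemma rigid (hn : 7 ≤ n) : Rigid n := by
  induction n using Nat.strong_induction_on with
  | _ n ih =>
    rcases (by omega : n = 7 ∨ n = 8 ∨ n = 9 ∨ 10 ≤ n) with rfl | rfl | rfl | h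
    · exact rigid_seven
    · exact rigid_of_trivial (by omega) (trivial_five (by omega)) (by omega) (by omega)
    · exact rigid_of_trivial (by omega) (trivial_five (by omega)) (by omega) (by omega)
    · exact rigid_of_trivial (by omega) (ih (n - 3) (by omega) (by omega)).trivial (by omega)
        (by omega)

end CHom

end Braid

namespace Braid
section
variable {X : Type*} [Fintype X] [DecidableEq X] {c d : Equiv.Perm X}

lemma _root_.Equiv.Perm.IsThreeCycle.apply_cube (hc : c.IsThreeCycle) (x : X) :
    c (c (c x)) = x := by
  have h : c ^ 3 = 1 := by rw [← hc.orderOf]; exact pow_orderOf_eq_one c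
  simpa [pow_succ] using DFunLike.congr_fun h x

lemma _root_.Equiv.Perm.IsThreeCycle.eq_of_apply_ne (hc : c.IsThreeCycle) {x y : X} (hx : c x ≠ x)
    (hy : c y ≠ y) : y = x ∨ y = c x ∨ y = c (c x) := by
  have : y ∈ c.support := Equiv.Perm.mem_support.2 hy
  rw [hc.support_eq_iff_mem_support.2 (Equiv.Perm.mem_support.2 hx)] at this
  simpa using this

lemma exists_common_of_isThreeCycle (hc : c.IsThreeCycle) (hd : d.IsThreeCycle) (h : (c * d) ^ 2 = 1)
    (h1 : c * d ≠ 1) : ∃ z, c z ≠ z ∧ d z = c z := by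
  have h2 : ∀ x, d (c (d (c x))) = x := fun x => by
    have := DFunLike.congr_fun h (c x)
    simp only [pow_two, Equiv.Perm.mul_apply, Equiv.Perm.one_apply] at this
    exact c.injective this
  by_cases hf : ∃ y, c y ≠ y ∧ d y = y
  · obtain ⟨y, hy, hdy⟩ := hf
    have h3 := hc.apply_cube y
    have h4 := h2 (c (c y))
    rw [h3, hdy] at h4
    exact ⟨c y, fun h => hy (c.injective h), h4⟩
  · push Not at hf
    have hs : c.support ⊆ d.support := fun x hx =>
      Equiv.Perm.mem_support.2 (hf x (Equiv.Perm.mem_support.1 hx))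
    have he := Finset.eq_of_subset_of_card_le hs (by rw [hc.card_support, hd.card_support])
    rcases eq_one_or_of_support_subset hc.card_support hc.sign hd.sign subset_rfl he.ge hc.ne_one
      with rfl | rfl | rfl
    · exact absurd rfl hd.ne_one
    · obtain ⟨x, hx⟩ : ∃ x, d x ≠ x := by
        by_contra! h
        exact hd.ne_one (Equiv.ext h)
      exact ⟨x, hx, rfl⟩
    · exact absurd (mul_inv_cancel c) h1

lemma mul_ne_one_of_sq {G : Type*} [Group G] {a b c : G} (ha : a ^ 3 = 1) (ha1 : a ≠ 1)
    (hc : c ^ 3 = 1) (h1 : (a * c) ^ 2 = 1) (h2 : (b * c) ^ 2 = 1) : a * b ≠ 1 := by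
  intro h
  rw [mul_eq_one_iff_inv_eq] at h
  subst h
  rw [pow_two] at h1 h2
  have h3 : c * a * c = a⁻¹ := (inv_eq_of_mul_eq_one_right (by rw [← h1]; simp only [mul_assoc])).symm
  have h4 : c * a⁻¹ * c = a := by
    rw [← inv_inv a]
    exact (inv_eq_of_mul_eq_one_right (by rw [inv_inv, ← h2]; simp only [mul_assoc])).symm
  have h5 : c * a * c = a := by
    rw [← h3] at h4
    calc c * a * c = c * (c * (c * a * c) * c) * c := by rw [h4]
      _ = c ^ 3 * a * c ^ 3 := by simp only [pow_succ, pow_zero, one_mul, mul_assoc]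
      _ = a := by rw [hc, one_mul, mul_one]
  have h6 : a * a = 1 := by rw [mul_eq_one_iff_eq_inv, ← h3, h5]
  refine ha1 ?_
  rw [← ha, pow_succ, pow_two, h6, one_mul]

lemma eq_of_two_apply_eq (hc : c.IsThreeCycle) (hd : d.IsThreeCycle) {a : X} (ha : c a ≠ a)
    (h1 : d a = c a) (h2 : d (c a) = c (c a)) : c = d := by
  ext x
  have e1 := hc.apply_cube a
  have e2 := hd.apply_cube a
  have t1 := hc.eq_of_apply_ne (y := x) ha
  have t2 := hd.eq_of_apply_ne (x := a) (y := x) (by rw [h1]; exact ha)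
  clear hc hd
  rw [h1, h2] at e2 t2
  by_cases h : x = a ∨ x = c a ∨ x = c (c a)
  · rcases h with rfl | rfl | rfl
    · exact h1.symm
    · exact h2.symm
    · rw [e1, e2]
  · rw [not_imp_comm.1 t1 h, not_imp_comm.1 t2 h]

lemma apply_eq_of_common {c d e : Equiv.Perm X} (hc : c.IsThreeCycle) (hd : d.IsThreeCycle)
    (he : e.IsThreeCycle) (hcd : c ≠ d) {a z w : X} (ha : c a ≠ a) (hz : c z ≠ z) (hw : d w ≠ w)
    (hda : d a = c a) (hez : e z = c z) (hew : e w = d w) : e a = c a := by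
  have hp : d (c a) ≠ c (c a) := fun h => hcd (eq_of_two_apply_eq hc hd ha hda h)
  have s2 := hc.eq_of_apply_ne ha hz
  have s3 := hd.eq_of_apply_ne (by rw [hda]; exact ha) hw
  have e2 := hc.apply_cube a
  have e3 := hd.apply_cube a
  have ek := he.apply_cube
  have sk := fun {x y} => he.eq_of_apply_ne (x := x) (y := y)
  have i2 := c.injective
  have i3 := d.injective
  have ik := e.injective
  clear hc hd he hcd
  rw [hda] at s3 e3
  rcases s2 with rfl | rfl | rfl
  · exact hez
  · rcases s3 with rfl | rfl | rfl
    · exact hew.trans hda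
    · exact absurd (hew.symm.trans hez) hp
    · have h5 := @sk (c a) (d (c a))
      grind
  · rcases s3 with rfl | rfl | rfl
    · exact hew.trans hda
    · have h5 := @sk (c a) (c (c a))
      grind
    · grind

lemma exists_common_edge {n : ℕ} {c : ℕ → Equiv.Perm X} (hn : 5 ≤ n)
    (h3 : ∀ k, 2 ≤ k → k < n → (c k).IsThreeCycle)
    (hsq : ∀ i j, 2 ≤ i → i < n → 2 ≤ j → j < n → i ≠ j → (c i * c j) ^ 2 = 1) :
    ∃ a b, a ≠ b ∧ ∀ k, 2 ≤ k → k < n → c k a = b := by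
  have hp : ∀ k, 2 ≤ k → k < n → c k ^ 3 = 1 := fun k h2 hk => by
    rw [← (h3 k h2 hk).orderOf]; exact pow_orderOf_eq_one _
  have hne : ∀ i j, 2 ≤ i → i < n → 2 ≤ j → j < n → i ≠ j → c i ≠ c j := by
    intro i j hi hi' hj hj' hij h
    have := hsq i j hi hi' hj hj' hij
    rw [h] at this
    refine (h3 j hj hj').ne_one ?_
    have h4 := hp j hj hj'
    calc c j = (c j ^ 3)⁻¹ * (c j * c j) ^ 2 := by
          rw [← pow_two, ← pow_mul, pow_succ (c j) 3, inv_mul_cancel_left]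
      _ = 1 := by rw [this, h4, inv_one, one_mul]
  have hz : ∀ i j, 2 ≤ i → i < n → 2 ≤ j → j < n → i ≠ j → ∃ z, c i z ≠ z ∧ c j z = c i z := by
    intro i j hi hi' hj hj' hij
    obtain ⟨k, hk, hk', hki, hkj⟩ : ∃ k, 2 ≤ k ∧ k < n ∧ i ≠ k ∧ j ≠ k := by
      by_contra! h
      have h2 := h 2; have h4 := h 3; have h5 := h 4
      omega
    exact exists_common_of_isThreeCycle (h3 i hi hi') (h3 j hj hj') (hsq i j hi hi' hj hj' hij)
      (mul_ne_one_of_sq (hp i hi hi') (h3 i hi hi').ne_one (hp k hk hk')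
        (hsq i k hi hi' hk hk' hki) (hsq j k hj hj' hk hk' hkj))
  obtain ⟨a, ha, ha'⟩ := hz 2 3 (by omega) (by omega) (by omega) (by omega) (by omega)
  refine ⟨a, c 2 a, ha.symm, fun k hk hk' => ?_⟩
  rcases (by omega : k = 2 ∨ k = 3 ∨ 4 ≤ k) with rfl | rfl | h4
  · rfl
  · exact ha'
  obtain ⟨z, hz2, hzk⟩ := hz 2 k (by omega) (by omega) (by omega) (by omega) (by omega)
  obtain ⟨w, hw3, hwk⟩ := hz 3 k (by omega) (by omega) (by omega) (by omega) (by omega)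
  exact apply_eq_of_common (h3 2 le_rfl (by omega)) (h3 3 (by omega) (by omega)) (h3 k hk hk')
    (hne 2 3 (by omega) (by omega) (by omega) (by omega) (by omega)) ha hz2 hw3 ha' hzk hwk

end
end Braid

namespace Braid
open Equiv
variable {n : ℕ}

lemma perm_lt (β : B n) {x : ℕ} (hx : x < n) : perm β x < n := by
  by_contra! h
  have := perm_ge β h
  rw [(perm β).injective this] at h
  omega

lemma inv_apply_perm (β : B n) (x : ℕ) : perm β⁻¹ (perm β x) = x := by
  rw [map_inv]; exact (perm β).symm_apply_apply x

lemma perm_apply_inv (β : B n) (x : ℕ) : perm β (perm β⁻¹ x) = x := by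
  rw [map_inv]; exact (perm β).apply_symm_apply x

/-- The permutation of the strands of a braid. -/
def permF : B n →* Perm (Fin n) where
  toFun β := ⟨fun x => ⟨perm β x, perm_lt β x.2⟩, fun x => ⟨perm β⁻¹ x, perm_lt β⁻¹ x.2⟩,
    fun x => Fin.ext (inv_apply_perm β x),
    fun x => Fin.ext (perm_apply_inv β x)⟩
  map_one' := by ext x; simp
  map_mul' β γ := by ext x; simp

lemma permF_val (β : B n) (x : Fin n) : (permF β x : ℕ) = perm β x := rfl

lemma permF_s {i : ℕ} (hi : i + 1 < n) :
    permF (s i : B n) = swap ⟨i, by omega⟩ ⟨i + 1, hi⟩ := by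
  ext x
  rw [permF_val, perm_s hi, swap_apply_def, swap_apply_def]
  simp only [Fin.ext_iff]
  split_ifs <;> rfl

lemma permF_eq_one_iff {β : B n} : permF β = 1 ↔ β ∈ P n := by
  rw [mem_P]
  refine ⟨fun h => perm_eq_one_of_lt fun x hx => ?_, fun h => ?_⟩
  · have := congrArg Fin.val (DFunLike.congr_fun h ⟨x, hx⟩)
    rwa [permF_val] at this
  · ext x
    rw [permF_val, h]
    rfl

lemma sign_permF (β : B n) : Perm.sign (permF β) = (-1) ^ ee β := by
  induction β using induct with
  | one => rw [map_one, map_one, ee_one, zpow_zero]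
  | s_mul i β hi ih =>
    rw [map_mul, map_mul, ih, permF_s hi, Perm.sign_swap (by simp), ee_mul, ee_s hi, zpow_add,
      zpow_one]
  | inv_mul i β hi ih =>
    rw [map_mul, map_mul, ih, map_inv, map_inv, permF_s hi, Perm.sign_swap (by simp), ee_mul,
      ee_inv, ee_s hi, zpow_add, zpow_neg, zpow_one]

lemma permF_surjective : Function.Surjective (permF : B n →* Perm (Fin n)) := fun π => by
  obtain ⟨β, hβ⟩ := exists_perm_eq (n := n) (π := π.extendDomain Fin.equivSubtype)
    fun x hx => Perm.extendDomain_apply_not_subtype _ _ (by omega)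
  refine ⟨β, Equiv.ext fun x => Fin.ext ?_⟩
  rw [permF_val, hβ]
  exact (Perm.extendDomain_apply_image π Fin.equivSubtype x)

lemma mem_J_of_two_le {d : B n} (hd : ee d = 0) (h : ∀ x, 2 ≤ x → perm d x = x) : d ∈ J n := by
  refine mem_J.2 ⟨?_, hd⟩
  rcases Nat.lt_or_ge n 2 with hn | hn
  · rw [mem_P]
    refine perm_eq_one_of_lt fun x hx => ?_
    have := perm_lt d hx
    omega
  have hinj := (perm d).injective
  have h0 : perm d 0 < 2 := by
    by_contra! h2
    have := hinj (h _ h2)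
    omega
  have h1 : perm d 1 < 2 := by
    by_contra! h2
    have := hinj (h _ h2)
    omega
  by_cases hd0 : perm d 0 = 0
  · rw [mem_P]
    refine perm_eq_one_of_lt fun x hx => ?_
    rcases (by omega : x = 0 ∨ x = 1 ∨ 2 ≤ x) with rfl | rfl | h2
    · exact hd0
    · have : perm d 1 ≠ perm d 0 := fun e => absurd (hinj e) (by omega)
      omega
    · exact h x h2
  · exfalso
    have hs : d * s 0 ∈ P n := by
      rw [mem_P]
      refine perm_eq_one_of_lt fun x hx => ?_
      rw [map_mul, perm_s (by omega), Perm.mul_apply]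
      rcases (by omega : x = 0 ∨ x = 1 ∨ 2 ≤ x) with rfl | rfl | h2
      · rw [swap_apply_left]
        change perm d 1 = 0
        have : perm d 1 ≠ perm d 0 := fun e => absurd (hinj e) (by omega)
        omega
      · rw [swap_apply_right]; omega
      · rw [swap_apply_of_ne_of_ne (by omega) (by omega)]; exact h x h2
    have := sign_permF (d * s 0)
    rw [permF_eq_one_iff.2 hs, map_one, ee_mul, hd, ee_s (by omega)] at this
    exact absurd this (by decide)

lemma sq_threeCycle {i j : ℕ} (hi : 2 ≤ i) (hj : 2 ≤ j) (hij : i ≠ j) {g : ℕ → ℕ → ℕ}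
    (hg : ∀ k x, 2 ≤ k → g k x = if x = 0 then 1 else if x = 1 then k else if x = k then 0 else x)
    (x : ℕ) : g i (g j (g i (g j x))) = x := by
  have h0 : ∀ k, 2 ≤ k → g k 0 = 1 := fun k hk => by rw [hg k 0 hk, if_pos rfl]
  have h1 : ∀ k, 2 ≤ k → g k 1 = k := fun k hk => by
    rw [hg k 1 hk, if_neg one_ne_zero, if_pos rfl]
  have hk : ∀ k, 2 ≤ k → g k k = 0 := fun k hk => by
    rw [hg k k hk, if_neg (by omega), if_neg (by omega), if_pos rfl]
  have hx : ∀ k y, 2 ≤ k → 2 ≤ y → y ≠ k → g k y = y := fun k y hk hy h => by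
    rw [hg k y hk, if_neg (by omega), if_neg (by omega), if_neg h]
  rcases (by omega : x = 0 ∨ x = 1 ∨ x = i ∨ x = j ∨ (2 ≤ x ∧ x ≠ i ∧ x ≠ j)) with
    rfl | rfl | rfl | rfl | ⟨h2, hi', hj'⟩
  · rw [h0 j hj, h1 i hi, hx j i hj hi hij, hk i hi]
  · rw [h1 j hj, hx i j hi hj hij.symm, hk j hj, h0 i hi]
  · rw [hx j x hj hi hij, hk x hi, h0 j hj, h1 x hi]
  · rw [hk x hj, h0 i hi, h1 x hj, hx i x hi hj hij.symm]
  · rw [hx j x hj h2 hj', hx i x hi h2 hi', hx j x hj h2 hj', hx i x hi h2 hi']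

lemma exists_threeCycle (hn : 7 ≤ n) {k : ℕ} (hk : 2 ≤ k) (hkn : k < n) :
    ∃ β : B n, ee β = 0 ∧ ∀ x, perm (β * q 0 1 * β⁻¹) x =
      if x = 0 then 1 else if x = 1 then k else if x = k then 0 else x := by
  obtain ⟨β, hβ, h0, h1, h2⟩ := exists_perm_three (n := n) (i := 0) (j := 1) (k := k) (by omega)
    (by omega) (by omega) (by omega) (by omega) hkn hn
  refine ⟨β, hβ, fun x => ?_⟩
  obtain ⟨y, rfl⟩ := (perm β).surjective x
  rw [map_mul, map_mul, map_inv, Perm.mul_apply, Perm.mul_apply,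
    show (perm β)⁻¹ (perm β y) = y from (perm β).symm_apply_apply y, q, map_mul, map_inv, perm_s (by omega), perm_s (by omega), swap_inv, Perm.mul_apply]
  have hinj := (perm β).injective
  rcases (by omega : y = 0 ∨ y = 1 ∨ y = 2 ∨ 3 ≤ y) with rfl | rfl | rfl | hy
  · rw [show swap 0 (0 + 1) (swap 1 (1 + 1) 0) = 1 by decide, h0, h1, if_pos rfl]
  · rw [show swap 0 (0 + 1) (swap 1 (1 + 1) 1) = 2 by decide, h1, h2, if_neg one_ne_zero,
      if_pos rfl]
  · rw [show swap 0 (0 + 1) (swap 1 (1 + 1) 2) = 0 by decide, h0, h2, if_neg (by omega),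
      if_neg (by omega), if_pos rfl]
  · have hy1 : swap 1 (1 + 1) y = y := swap_apply_of_ne_of_ne (by omega) (by omega)
    have hy0 : swap 0 (0 + 1) y = y := swap_apply_of_ne_of_ne (by omega) (by omega)
    rw [hy1, hy0, if_neg, if_neg, if_neg]
    · exact fun e => absurd (hinj (e.trans h2.symm)) (by omega)
    · exact fun e => absurd (hinj (e.trans h1.symm)) (by omega)
    · exact fun e => absurd (hinj (e.trans h0.symm)) (by omega)

lemma exists_labels {X : Type*} [Fintype X] [DecidableEq X] {c : ℕ → Perm X} (hn : 5 ≤ n)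
    (hcyc : ∀ k, 2 ≤ k → k < n → (c k).IsThreeCycle)
    (hsqr : ∀ i j, 2 ≤ i → i < n → 2 ≤ j → j < n → i ≠ j → (c i * c j) ^ 2 = 1) :
    ∃ f : ℕ → X, (∀ i j, i < n → j < n → f i = f j → i = j) ∧ ∀ k, 2 ≤ k → k < n → ∀ x, x < n →
      c k (f x) = f (if x = 0 then 1 else if x = 1 then k else if x = k then 0 else x) := by
  obtain ⟨a, b, hab, hc⟩ := exists_common_edge hn hcyc hsqr
  let f : ℕ → X := fun k => if k = 0 then a else if k = 1 then b else c k b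
  have f0 : f 0 = a := rfl
  have f1 : f 1 = b := rfl
  have fk : ∀ k, 2 ≤ k → f k = c k b := fun k hk => by
    simp only [f]; rw [if_neg (by omega), if_neg (by omega)]
  have hca : ∀ k, 2 ≤ k → k < n → c k (f k) = a := fun k hk hkn => by
    rw [fk k hk, ← hc k hk hkn, (hcyc k hk hkn).apply_cube]
  have hfa : ∀ k, 2 ≤ k → k < n → f k ≠ a := fun k hk hkn h => by
    have := hca k hk hkn
    rw [h, hc k hk hkn] at this
    exact hab this.symm
  have hfb : ∀ k, 2 ≤ k → k < n → f k ≠ b := fun k hk hkn h => by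
    rw [fk k hk] at h
    have := hca k hk hkn
    rw [fk k hk, h, h] at this
    exact hab this.symm
  have hinj : ∀ i j, i < n → j < n → f i = f j → i = j := by
    have key : ∀ i j, i < n → j < n → i < j → f i ≠ f j := by
      intro i j hi hj hij
      rcases (by omega : i = 0 ∨ (i = 1 ∧ 2 ≤ j) ∨ 2 ≤ i) with rfl | ⟨rfl, h⟩ | h
      · rcases (by omega : j = 1 ∨ 2 ≤ j) with rfl | h
        · exact hab
        · exact (hfa j h hj).symm
      · exact (hfb j h hj).symm
      · intro h'
        have := DFunLike.congr_fun (hsqr i j h hi (by omega) hj (by omega)) a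
        simp only [pow_two, Perm.mul_apply, Perm.one_apply] at this
        rw [hc j (by omega) hj, ← fk i h, h', hca j (by omega) hj, hc i h hi] at this
        exact hab this.symm
    intro i j hi hj h
    by_contra hij
    rcases lt_or_gt_of_ne hij with h' | h'
    · exact key i j hi hj h' h
    · exact key j i hj hi h' h.symm
  refine ⟨f, hinj, fun k hk hkn x hx => ?_⟩
  split_ifs with h1 h2 h3
  · rw [h1, f0, f1, hc k hk hkn]
  · rw [h2, f1, fk k hk]
  · rw [h3, f0, hca k hk hkn]
  · by_contra hne
    have := (hcyc k hk hkn).eq_of_apply_ne (x := a) (y := f x)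
      (by rw [hc k hk hkn]; exact hab.symm) hne
    rw [hc k hk hkn, ← fk k hk] at this
    rcases this with h | h | h
    · exact h1 (hinj _ _ hx (by omega) (h.trans f0.symm))
    · exact h2 (hinj _ _ hx (by omega) (h.trans f1.symm))
    · exact h3 (hinj _ _ hx hkn h)

lemma CHom.apply_eq {X : Type*} {ψ : B n → Perm X} (hψ : CHom ψ) {T : ℕ → B n} {f : ℕ → X}
    (hT : ∀ k, 2 ≤ k → k < n → ∀ x, perm (T k) x =
      if x = 0 then 1 else if x = 1 then k else if x = k then 0 else x)
    (eT : ∀ k, ee (T k) = 0) (hJ : ∀ {x}, x ∈ J n → ψ x = 1)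
    (hR : ∀ k, 2 ≤ k → k < n → ∀ x, x < n → ψ (T k) (f x) = f (perm (T k) x)) (m : ℕ) (d : B n)
    (hd : ee d = 0) (hdm : ∀ x, m ≤ x → perm d x = x) :
    ∀ x, x < n → ψ d (f x) = f (perm d x) := by
  have hmul : ∀ d e, ee d = 0 → ee e = 0 → (∀ x, x < n → ψ d (f x) = f (perm d x)) →
      (∀ x, x < n → ψ e (f x) = f (perm e x)) →
      ∀ x, x < n → ψ (d * e) (f x) = f (perm (d * e) x) := by
    intro d e hd he h1 h2 x hx
    rw [hψ.map_mul hd he, Perm.mul_apply, h2 x hx, h1 _ (perm_lt e hx), _root_.map_mul,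
      Perm.mul_apply]
  have hinv : ∀ d, ee d = 0 → (∀ x, x < n → ψ d (f x) = f (perm d x)) →
      ∀ x, x < n → ψ d⁻¹ (f x) = f (perm d⁻¹ x) := by
    intro d hd h x hx
    rw [hψ.map_inv hd, Perm.inv_eq_iff_eq, h _ (perm_lt _ hx), ← Perm.mul_apply, ← _root_.map_mul,
      mul_inv_cancel, _root_.map_one, Perm.one_apply]
  induction m generalizing d with
  | zero =>
    intro x _
    have h := hdm
    rw [hJ (mem_J_of_two_le hd fun x _ => h x (by omega)), h x (by omega), Perm.one_apply]
  | succ m ih =>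
    have h := hdm
    by_cases hm : m < 2
    · have h1 := mem_J_of_two_le hd fun x hx => h x (by omega)
      intro x _
      rw [hJ h1, mem_P.1 (mem_J.1 h1).1, Perm.one_apply, Perm.one_apply]
    by_cases hmn : n ≤ m
    · exact ih d hd fun x hx => perm_ge d (by omega)
    have step : ∀ e : B n, ee e = 0 → (∀ x, x < n → ψ e (f x) = f (perm e x)) →
        (∀ x, m + 1 ≤ x → perm e x = x) → perm e (perm d m) = m →
        ∀ x, x < n → ψ d (f x) = f (perm d x) := by
      intro e he h1 h2 h3
      have := hmul e⁻¹ (e * d) (by rw [ee_inv, he]; rfl) (by rw [ee_mul, he, hd]; rfl)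
        (hinv e he h1) (ih (e * d) (by rw [ee_mul, he, hd]; rfl) fun x hx => by
          rw [_root_.map_mul, Perm.mul_apply]
          rcases hx.eq_or_lt with rfl | hx
          · exact h3
          · rw [h x hx, h2 x hx])
      rwa [inv_mul_cancel_left] at this
    have hTm := hT m (by omega) (by omega)
    have hRm := hR m (by omega) (by omega)
    have hTi : ∀ {x y}, perm (T m) x = y → perm (T m)⁻¹ y = x := fun {x y} e => by
      rw [_root_.map_inv, Perm.inv_eq_iff_eq, e]
    have hTi' : ∀ x, m + 1 ≤ x → perm (T m)⁻¹ x = x := fun x hx => hTi (by rw [hTm]; split_ifs <;> omega)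
    have eTi : ee (T m)⁻¹ = 0 := by rw [ee_inv, eT]; rfl
    have hlt : perm d m ≤ m := by
      by_contra! h'
      have := (perm d).injective (h _ h')
      omega
    rcases (by omega : perm d m = m ∨ perm d m = 0 ∨ perm d m = 1 ∨
      (2 ≤ perm d m ∧ perm d m < m)) with hj | hj | hj | ⟨hj, hjm⟩
    · exact ih d hd fun x hx => by
        rcases hx.eq_or_lt with rfl | hx
        · exact hj
        · exact h x hx
    · exact step (T m)⁻¹ eTi (hinv _ (eT m) hRm) hTi' (hTi (by rw [hTm, hj]; split_ifs <;> omega))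
    · exact step (T m) (eT m) hRm (fun x hx => by rw [hTm]; split_ifs <;> omega) (by simp [hTm, hj])
    · have hTj := hT (perm d m) hj (by omega)
      refine step ((T m)⁻¹ * T (perm d m)) (by rw [ee_mul, eTi, eT]; rfl)
        (hmul _ _ eTi (eT _) (hinv _ (eT m) hRm) (hR _ hj (by omega))) (fun x hx => ?_) ?_
      · rw [_root_.map_mul, Perm.mul_apply, hTj]
        convert hTi' x hx using 2
        split_ifs <;> omega
      · rw [_root_.map_mul, Perm.mul_apply, hTj]
        exact hTi (by rw [hTm]; split_ifs <;> omega)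

lemma CHom.exists_perm_conj {ψ : B n → Perm (Fin n)} (hψ : CHom ψ) (hn : 7 ≤ n)
    (hne : ∃ d, ee d = 0 ∧ ψ d ≠ 1) :
    ∃ π : Perm (Fin n), ∀ d, ee d = 0 → ψ d = π * permF d * π⁻¹ := by
  obtain ⟨-, h3c, hsq⟩ := rigid hn (Fin n) ψ hψ (by simp) hne
  have hJ : ∀ {x}, x ∈ J n → ψ x = 1 := hψ.quo_of_mem_J (by omega) hsq
  have e0 : ee (q 0 1 : B n) = 0 := ee_q (by omega) (by omega)
  choose! β hβ hT' using fun k hk hkn => exists_threeCycle (n := n) hn (k := k) hk hkn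
  set T : ℕ → B n := fun k => β k * q 0 1 * (β k)⁻¹ with hTdef
  have hT : ∀ k, 2 ≤ k → k < n → ∀ x, perm (T k) x =
      if x = 0 then 1 else if x = 1 then k else if x = k then 0 else x := hT'
  have eT : ∀ k, ee (T k) = 0 := fun k => by rw [hTdef, ee_conj, e0]
  have hcyc : ∀ k, 2 ≤ k → k < n → (ψ (T k)).IsThreeCycle := fun k hk hkn => by
    rw [Perm.IsThreeCycle, hTdef, hψ.map_conj (hβ k hk hkn) e0, Perm.cycleType_conj]
    exact h3c
  have hsqr : ∀ i j, 2 ≤ i → i < n → 2 ≤ j → j < n → i ≠ j → (ψ (T i) * ψ (T j)) ^ 2 = 1 := by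
    intro i j hi hi' hj hj' hij
    have e : ee (T i * T j) = 0 := by rw [ee_mul, eT, eT]; rfl
    rw [← hψ.map_mul (eT i) (eT j), pow_two, ← hψ.map_mul e e]
    refine hJ (mem_J_of_lt (fun x _ => ?_) (by rw [ee_mul, e]; rfl))
    rw [_root_.map_mul, _root_.map_mul, Perm.mul_apply, Perm.mul_apply, Perm.mul_apply]
    simp only [hT i hi hi', hT j hj hj']
    exact sq_threeCycle hi hj hij
      (g := fun k x => if x = 0 then 1 else if x = 1 then k else if x = k then 0 else x)
      (fun _ _ _ => rfl) x
  obtain ⟨f, hinj, hf⟩ := exists_labels (c := fun k => ψ (T k)) (by omega) hcyc hsqr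
  have hR : ∀ k, 2 ≤ k → k < n → ∀ x, x < n → ψ (T k) (f x) = f (perm (T k) x) :=
    fun k hk hkn x hx => by rw [hT k hk hkn]; exact hf k hk hkn x hx
  have hbij : Function.Bijective fun x : Fin n => f x :=
    Finite.injective_iff_bijective.1 fun x y h => Fin.ext (hinj _ _ x.2 y.2 h)
  refine ⟨Equiv.ofBijective _ hbij, fun d hd => ?_⟩
  rw [eq_mul_inv_iff_mul_eq]
  ext x
  rw [Perm.mul_apply, Perm.mul_apply, ofBijective_apply, ofBijective_apply, permF_val,
    hψ.apply_eq hT eT hJ hR n d hd (fun x hx => perm_ge d hx) x x.2]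

end Braid

namespace Braid

open Equiv

variable {n : ℕ}

lemma mem_P_of_forall_commute (hn : 7 ≤ n) {z : B n} (hz : ∀ d, ee d = 0 → Commute d z) :
    z ∈ P n := by
  refine perm_eq_one_of_lt (n := n) fun x hx => ?_
  by_contra! hxy
  obtain ⟨k, hk, hkx, hky⟩ : ∃ k < 3, k ≠ x ∧ k ≠ perm z x := by
    by_contra! h
    have h0 := h 0
    have h1 := h 1
    have h2 := h 2
    omega
  obtain ⟨β, -, h0, h1, h2⟩ := exists_perm_three hxy.symm hkx.symm hky.symm hx (perm_lt z hx)
    (by omega : k < n) hn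
  have e : ee (β * q 1 2 * β⁻¹) = 0 := by rw [ee_conj, ee_q (by omega) (by omega)]
  have hp : ∀ y, perm (β * q 1 2 * β⁻¹) (perm β y) = perm β (swap 1 2 (swap 2 3 y)) := fun y => by
    rw [map_mul, map_mul, map_inv, Perm.mul_apply, Perm.mul_apply,
      show (perm β)⁻¹ (perm β y) = y from (perm β).symm_apply_apply y, q, map_mul, map_inv,
      perm_s (by omega), perm_s (by omega), swap_inv, Perm.mul_apply]
  have hc : perm (β * q 1 2 * β⁻¹) (perm z x) = perm z (perm (β * q 1 2 * β⁻¹) x) := by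
    rw [← Perm.mul_apply, ← Perm.mul_apply, ← map_mul, ← map_mul, (hz _ e).eq]
  have hpx := hp 0
  have hpy := hp 1
  rw [show swap 1 2 (swap 2 3 0) = 0 by decide, h0] at hpx
  rw [show swap 1 2 (swap 2 3 1) = 2 by decide, h1, h2] at hpy
  rw [hpx, hpy] at hc
  exact hky hc

/-- The centralizer of the commutator subgroup is generated by the full twist. -/
lemma mem_zpowers_D_of_forall_commute (hn : 7 ≤ n) {z : B n}
    (hz : ∀ d, ee d = 0 → Commute d z) : z ∈ Subgroup.zpowers (D n : B n) := by
  have hD := ee_D_ne_zero (n := n) (by omega)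
  refine mem_zpowers_D le_rfl hD (mem_Bk z) (mem_P_of_forall_commute hn hz) fun i j hij hj => ?_
  have e : ee ((A i j : B n) ^ ee (D n : B n) * (D n ^ (2 : ℤ))⁻¹) = 0 := by
    rw [ee_mul, ee_inv, ee_zpow, ee_zpow, ee_A hij hj]; ring
  have := (hz _ e).mul_left ((commute_D_top z).zpow_left 2)
  rwa [inv_mul_cancel_right] at this

/-- Restriction of automorphisms to the commutator subgroup. -/
def res (G : Type*) [Group G] : MulAut G →* MulAut (commutator G) :=
  have mem (α : MulAut G) (d : commutator G) : α d ∈ commutator G :=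
    Subgroup.characteristic_iff_map_le.1 inferInstance α (Subgroup.mem_map_of_mem _ d.2)
  { toFun := fun α =>
      { toFun := fun d => ⟨α d, mem α d⟩
        invFun := fun d => ⟨α⁻¹ d, mem α⁻¹ d⟩
        left_inv := fun d => Subtype.ext (α.symm_apply_apply d)
        right_inv := fun d => Subtype.ext (α.apply_symm_apply d)
        map_mul' := fun _ _ => Subtype.ext (map_mul α _ _) }
    map_one' := rfl
    map_mul' := fun _ _ => rfl }

@[simp] lemma coe_res {G : Type*} [Group G] (α : MulAut G) (d : commutator G) :
    (res G α d : G) = α d := rfl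

lemma res_injective (hn : 7 ≤ n) : Function.Injective (res (B n)) := by
  rw [injective_iff_map_eq_one]
  intro α hα
  have fix : ∀ d, ee d = 0 → α d = d := fun d hd => by
    rw [← coe_res α ⟨d, mem_comm.2 hd⟩, hα, MulAut.one_apply]
  have e0 : ee (s 0 : B n) = 1 := ee_s (by omega)
  have hz : ∀ d, ee d = 0 → Commute d ((s 0)⁻¹ * α (s 0)) := fun d hd => by
    have h := fix (s 0 * d * (s 0)⁻¹) (by rw [ee_conj, hd])
    rw [map_mul, map_mul, map_inv, fix d hd] at h
    have h' : α (s 0) * d = s 0 * d * (s 0)⁻¹ * α (s 0) := by rw [← h]; group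
    change d * _ = _ * d
    rw [mul_assoc _ _ d, h']; group
  obtain ⟨k, hk⟩ := mem_zpowers_D_of_forall_commute hn hz
  have hk : α (s 0) = s 0 * D n ^ k := by rw [show (D n : B n) ^ k = _ from hk]; group
  have ee_map : ∀ x, ee (α x) = ee x * (1 + k * ee (D n : B n)) := fun x => by
    have h := fix (x * (s 0 ^ ee x)⁻¹) (by rw [ee_mul, ee_inv, ee_zpow, e0]; ring)
    rw [map_mul, map_inv, map_zpow, hk] at h
    have h := congrArg ee h
    rw [ee_mul, ee_mul, ee_inv, ee_inv, ee_zpow, ee_zpow, ee_mul, ee_zpow, e0] at h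
    linarith
  obtain ⟨x, hx⟩ := α.surjective (s 0)
  have h1 := ee_map x
  rw [hx, e0, ee_D le_rfl] at h1
  have hk0 : k = 0 := by
    have hn' : (7 : ℤ) ≤ n := by exact_mod_cast hn
    have hN : (42 : ℤ) ≤ n * (n - 1) := by nlinarith
    by_contra hk0
    rcases Int.eq_one_or_neg_one_of_mul_eq_one' h1.symm with ⟨-, h⟩ | ⟨-, h⟩
    · have : k * ((n : ℤ) * (n - 1)) = 0 := by linarith
      rcases mul_eq_zero.1 this with h | h
      · exact hk0 h
      · omega
    · rcases lt_or_gt_of_ne hk0 with h' | h' <;> nlinarith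
  rw [hk0, zpow_zero, mul_one] at hk
  refine MulEquiv.ext fun x => ?_
  refine DFunLike.congr_fun (hom_ext (f := α.toMonoidHom) (g := MonoidHom.id _) fun i hi => ?_) x
  have h := fix (q i 0) (ee_q hi (by omega))
  change α (s i) = s i
  rwa [q, map_mul, map_inv, hk, mul_left_inj] at h

/-- The automorphism of the braid group inverting the standard generators. -/
def mirrorAut : MulAut (B n) where
  __ := Braid.mirror
  invFun := Braid.mirror
  left_inv := mirror_mirror
  right_inv := mirror_mirror

lemma res_surjective (hn : 7 ≤ n) : Function.Surjective (res (B n)) := by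
  classical
  intro φ
  let Φ : B n → B n := fun d => if h : ee d = 0 then φ ⟨d, mem_comm.2 h⟩ else 1
  have hΦ : ∀ d (h : ee d = 0), Φ d = φ ⟨d, mem_comm.2 h⟩ := fun d h => dif_pos h
  have hmul : ∀ {a b}, ee a = 0 → ee b = 0 → Φ (a * b) = Φ a * Φ b := fun {a b} ha hb => by
    rw [hΦ a ha, hΦ b hb, hΦ (a * b) (by rw [ee_mul, ha, hb]; rfl), ← Subgroup.coe_mul, ← map_mul]
    rfl
  have hee : ∀ {a}, ee a = 0 → ee (Φ a) = 0 := fun {a} ha => by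
    rw [hΦ a ha]; exact mem_comm.1 (φ _).2
  have hsurj : ∀ {b}, ee b = 0 → ∃ a, ee a = 0 ∧ Φ a = b := fun {b} hb => by
    obtain ⟨⟨a, ha⟩, h⟩ := φ.surjective ⟨b, mem_comm.2 hb⟩
    exact ⟨a, mem_comm.1 ha, by rw [hΦ a (mem_comm.1 ha), h]⟩
  have hψ : CHom fun d => permF (Φ d) := ⟨fun ha hb => by rw [hmul ha hb, map_mul]⟩
  obtain ⟨π, hπ⟩ := hψ.exists_perm_conj hn <| by
    obtain ⟨a, ha, h⟩ := hsurj (ee_q (n := n) (i := 0) (j := 1) (by omega) (by omega))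
    refine ⟨a, ha, fun h1 => ?_⟩
    rw [h, permF_eq_one_iff, mem_P] at h1
    have := congrArg (fun p => p 0) h1
    simp only [q, map_mul, map_inv] at this
    rw [perm_s (by omega), perm_s (by omega)] at this
    exact absurd this (by decide)
  obtain ⟨c, rfl⟩ := permF_surjective π
  have hA : Auto fun d => c⁻¹ * Φ d * c :=
    { map_mul := fun ha hb => by rw [hmul ha hb]; group
      ee_map := fun ha => by rw [ee_conj_inv, hee ha]
      surj := fun {b} hb => by
        obtain ⟨a, ha, h⟩ := hsurj (b := c * b * c⁻¹) (by rw [ee_conj, hb])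
        exact ⟨a, ha, by rw [h]; group⟩
      perm_map := fun {a} ha => by
        have h : permF (c⁻¹ * Φ a * c) = permF a := by
          have : permF (Φ a) = _ := hπ a ha
          rw [map_mul, map_mul, this, map_inv]; group
        refine Equiv.ext fun x => ?_
        rcases lt_or_ge x n with hx | hx
        · rw [← permF_val _ ⟨x, hx⟩, ← permF_val _ ⟨x, hx⟩, h]
        · rw [perm_ge _ hx, perm_ge _ hx] }
  have key : ∀ (α : MulAut (B n)) (g : B n), (∀ d, ee d = 0 → c⁻¹ * Φ d * c = g * α d * g⁻¹) →
      res (B n) (MulAut.conj (c * g) * α) = φ := fun α g h => by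
    refine MulEquiv.ext fun ⟨d, hd⟩ => Subtype.ext ?_
    have h := h d (mem_comm.1 hd)
    rw [coe_res, ← hΦ d (mem_comm.1 hd), MulAut.mul_apply, MulAut.conj_apply]
    have : Φ d = c * (c⁻¹ * Φ d * c) * c⁻¹ := by group
    rw [this, h]; group
  rcases hA.exists_conj hn with ⟨g, hg⟩ | ⟨g, hg⟩
  · exact ⟨_, key 1 g hg⟩
  · exact ⟨_, key mirrorAut g hg⟩

end Braid

/-- Orevkov / Dyer–Grossman: for `n ≥ 7`, the automorphism group of the commutator
subgroup of the braid group `B n` is isomorphic to the automorphism group of `B n`. -/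
theorem aut_commutator_braid_iso_aut_braid (n : ℕ) (hn : 7 ≤ n) :
    Nonempty (MulAut ↥(commutator (B n)) ≃* MulAut (B n)) :=
  ⟨(MulEquiv.ofBijective (Braid.res (B n))
    ⟨Braid.res_injective hn, Braid.res_surjective hn⟩).symm⟩
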